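/- With G(t) the minimal L² integral defined below and h(t) = ∫_t^∞ c(s)e^{-s}ds, if G(h^{-1}(r)) is linear with respect to r on [0, ∫₀^∞ c(s)e^{-s}ds), then there is a unique holomorphic function F on D with (F − f, z₀) ∈ F_{z₀} and G(t) = ∫_{{ψ<−t}} |F|² e^{-φ}c(−ψ) for every t ≥ 0; furthermore, for every nonnegative measurable function a on (0,∞) and all +∞ ≥ t₁ > t₂ ≥ 0, ∫_{{−t₁ ≤ ψ < −t₂}} |F|² e^{-φ} a(−ψ) = ( G(0) / ∫₀^∞ c(s)e^{-s}ds ) · ∫_{t₂}^{t₁} a(t) e^{-t} dt. -/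

import Mathlib

open MeasureTheory Metric Complex Set Filter

noncomputable section

/-- `u` is harmonic on `s`: locally the real part of a holomorphic function. -/
def HarmonicOnD (u : ℂ → ℝ) (s : Set ℂ) : Prop :=
  ∀ z ∈ s, ∃ r > 0, Metric.ball z r ⊆ s ∧ ∃ f : ℂ → ℂ,
    DifferentiableOn ℂ f (Metric.ball z r) ∧ ∀ w ∈ Metric.ball z r, u w = (f w).re

/-- Upper circle average of an `EReal`-valued function (via decreasing truncations). -/
noncomputable def circleAvgE (u : ℂ → EReal) (z : ℂ) (r : ℝ) : EReal :=
  ⨅ n : ℕ, ((((2 * Real.pi)⁻¹ *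
      ∫ θ in (0:ℝ)..(2 * Real.pi),
        (max (u (circleMap z r θ)) ((-(n : ℝ) : ℝ) : EReal)).toReal) : ℝ) : EReal)

/-- `u` is subharmonic on the open set `s`. -/
def SubharmonicOnE (u : ℂ → EReal) (s : Set ℂ) : Prop :=
  UpperSemicontinuousOn u s ∧ (∀ z ∈ s, u z ≠ ⊤) ∧ (∃ z ∈ s, u z ≠ ⊥) ∧
  ∀ z ∈ s, ∀ r : ℝ, 0 < r → Metric.closedBall z r ⊆ s → u z ≤ circleAvgE u z r

/-- The Lelong number `v(dd^c u, z₀)` of a subharmonic function. -/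
noncomputable def lelongNumber (u : ℂ → EReal) (z₀ : ℂ) : ℝ :=
  sSup {a : ℝ | 0 ≤ a ∧ ∃ C : ℝ, ∃ r > 0, ∀ z : ℂ, z ≠ z₀ → dist z z₀ < r →
    u z ≤ ((a * Real.log (dist z z₀) + C : ℝ) : EReal)}

/-- `G` is the (negative) Green function of `D` with pole at `z₀`. -/
structure IsGreenFunction (D : Set ℂ) (z₀ : ℂ) (G : ℂ → EReal) : Prop where
  neg : ∀ z ∈ D, G z < 0
  pole : G z₀ = ⊥
  logharm : ∃ h : ℂ → ℝ, HarmonicOnD h D ∧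
    ∀ z ∈ D \ {z₀}, G z = ((Real.log (dist z z₀) + h z : ℝ) : EReal)
  bdry : ∀ w ∈ frontier D, Filter.Tendsto (fun z => (G z).toReal) (nhdsWithin w D) (nhds 0)

/-- `Γ` is an analytic Jordan curve. -/
def IsAnalyticJordanCurve (Γ : Set ℂ) : Prop :=
  ∃ γ : ℝ → ℂ, AnalyticOnNhd ℝ γ Set.univ ∧ Function.Periodic γ (2 * Real.pi) ∧
    (∀ t, deriv γ t ≠ 0) ∧ Set.InjOn γ (Set.Ico 0 (2 * Real.pi)) ∧ Γ = Set.range γ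

/-- `D` is a bounded planar regular region whose boundary consists of `n`
analytic Jordan curves. -/
def IsRegularRegion (n : ℕ) (D : Set ℂ) : Prop :=
  IsOpen D ∧ IsConnected D ∧ Bornology.IsBounded D ∧
  ∃ Γ : Fin n → Set ℂ, (∀ i, IsAnalyticJordanCurve (Γ i)) ∧
    (Pairwise fun i j => Disjoint (Γ i) (Γ j)) ∧ frontier D = ⋃ i, Γ i

/-- `ν` is the outward unit normal vector field on `∂D`. -/
def IsOutwardUnitNormal (D : Set ℂ) (ν : ℂ → ℂ) : Prop :=
  ∀ z ∈ frontier D, ‖ν z‖ = 1 ∧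
    (∀ᶠ t in nhdsWithin (0:ℝ) (Set.Ioi (0:ℝ)),
      z + t • ν z ∉ closure D ∧ z - t • ν z ∈ D) ∧
    (∀ γ : ℝ → ℂ, γ 0 = z → (∀ᶠ t in nhds (0:ℝ), γ t ∈ frontier D) →
      DifferentiableAt ℝ γ 0 → ((starRingEnd ℂ) (ν z) * deriv γ 0).re = 0)

/-- Arclength (1-dimensional Hausdorff) measure on the boundary of `D`. -/
noncomputable def bdryArc (D : Set ℂ) : Measure ℂ :=
  (MeasureTheory.Measure.hausdorffMeasure 1).restrict (frontier D)

/-- The analytic Hardy class `H₂^(c)(D)`. -/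
def HardyH2c (D : Set ℂ) (f : ℂ → ℂ) : Prop :=
  DifferentiableOn ℂ f D ∧ ∃ U : ℂ → ℝ, HarmonicOnD U D ∧ ∀ z ∈ D, ‖f z‖ ^ 2 ≤ U z

/-- Nontangential convergence of `f` to `L` at the boundary point `w`. -/
def NTTendsto (D : Set ℂ) (f : ℂ → ℂ) (w L : ℂ) : Prop :=
  ∀ α : ℝ, 1 < α →
    Filter.Tendsto f
      (nhdsWithin w {z | z ∈ D ∧ dist z w ≤ α * Metric.infDist z (frontier D)}) (nhds L)

/-- `g` is the nontangential boundary value function of `f` (a.e. on `∂D`). -/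
def IsNTBoundaryValue (D : Set ℂ) (f g : ℂ → ℂ) : Prop :=
  ∀ᵐ w ∂(bdryArc D), NTTendsto D f w (g w)

/-- `K` is the weighted Szegő kernel of `D` with boundary weight `lam`. -/
structure IsSzegoKernel (D : Set ℂ) (lam : ℂ → ℝ) (K : ℂ → ℂ → ℂ) : Prop where
  holo : ∀ w ∈ D, DifferentiableOn ℂ (fun z => K z w) D
  cont : ∀ w ∈ D, ContinuousOn (fun z => K z w) (closure D)
  hardy : ∀ w ∈ D, HardyH2c D (fun z => K z w)
  hermitian : ∀ z ∈ D, ∀ w ∈ D, K z w = (starRingEnd ℂ) (K w z)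
  sqfin : ∀ w ∈ D, (∫⁻ z, ENNReal.ofReal (‖K z w‖ ^ 2 * lam z) ∂(bdryArc D)) ≠ ⊤
  reproduce : ∀ f fb : ℂ → ℂ, HardyH2c D f → IsNTBoundaryValue D f fb → ∀ w ∈ D,
    f w = ((2 * Real.pi)⁻¹ : ℂ) * ∫ z, fb z * (starRingEnd ℂ) (K z w) * (lam z : ℂ) ∂(bdryArc D)

/-- `B` is the weighted Bergman kernel of `D` with weight `ρ`. -/
structure IsBergmanKernel (D : Set ℂ) (ρ : ℂ → ℝ) (B : ℂ → ℂ → ℂ) : Prop where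
  holo : ∀ w ∈ D, DifferentiableOn ℂ (fun z => B z w) D
  hermitian : ∀ z ∈ D, ∀ w ∈ D, B z w = (starRingEnd ℂ) (B w z)
  sqfin : ∀ w ∈ D, (∫⁻ z in D, ENNReal.ofReal (‖B z w‖ ^ 2 * ρ z)) ≠ ⊤
  reproduce : ∀ f : ℂ → ℂ, DifferentiableOn ℂ f D →
    IntegrableOn (fun z => ‖f z‖ ^ 2) D volume → ∀ w ∈ D,
      f w = ∫ z in D, f z * (starRingEnd ℂ) (B z w) * (ρ z : ℂ)

/-- Extended-real logarithm (with `elog 0 = ⊥`). -/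
noncomputable def elog (x : ℝ) : EReal := if x = 0 then ⊥ else ((Real.log x : ℝ) : EReal)

/-- `χ_{z₀}^m = χ_{-u}`: there is a holomorphic `F` on `D` with `log |F| = m·G + u`. -/
def charEqGreenPow (D : Set ℂ) (z₀ : ℂ) (G : ℂ → EReal) (u : ℂ → ℝ) (m : ℕ) : Prop :=
  ∃ F : ℂ → ℂ, DifferentiableOn ℂ F D ∧ ∀ z ∈ D \ {z₀},
    F z ≠ 0 ∧ Real.log ‖F z‖ = m * (G z).toReal + u z

/-- `χ_{z₀} = χ_{-u}`. -/
def charEqGreen (D : Set ℂ) (z₀ : ℂ) (G : ℂ → EReal) (u : ℂ → ℝ) : Prop :=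
  charEqGreenPow D z₀ G u 1

/-- The weight `ρ = e^{-φ} c(-2ψ)` (realized through `EReal.toReal`). -/
noncomputable def wgt2 (φ ψ : ℂ → EReal) (c : ℝ → ℝ) (z : ℂ) : ℝ :=
  Real.exp (-(φ z).toReal) * c ((-((2 : EReal) * ψ z)).toReal)

/-- The weight `e^{-φ} c(-ψ)` (realized through `EReal.toReal`). -/
noncomputable def wgt1 (φ ψ : ℂ → EReal) (c : ℝ → ℝ) (z : ℂ) : ℝ :=
  Real.exp (-(φ z).toReal) * c ((-(ψ z)).toReal)

/-- Admissible gain function `c` on `[0,∞)`. -/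
structure AdmissibleC (c : ℝ → ℝ) : Prop where
  meas : Measurable c
  pos : ∀ t : ℝ, 0 ≤ t → 0 < c t
  mono : ∀ s t : ℝ, 0 ≤ s → s ≤ t → c t * Real.exp (-t) ≤ c s * Real.exp (-s)
  limz : Filter.Tendsto c (nhdsWithin 0 (Set.Ioi 0)) (nhds 1)
  czero : c 0 = 1
  fin : (∫⁻ t in Set.Ioi (0:ℝ), ENNReal.ofReal (c t * Real.exp (-t))) ≠ ⊤

/-- Admissible gain function `c` on `(0,∞)` (no normalization at `0`). -/
structure AdmissibleC' (c : ℝ → ℝ) : Prop where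
  meas : Measurable c
  pos : ∀ t : ℝ, 0 < t → 0 < c t
  mono : ∀ s t : ℝ, 0 < s → s ≤ t → c t * Real.exp (-t) ≤ c s * Real.exp (-s)
  fin : (∫⁻ t in Set.Ioi (0:ℝ), ENNReal.ofReal (c t * Real.exp (-t))) ≠ ⊤

/-- `Z` is a discrete subset of `D`. -/
def DiscreteIn (Z D : Set ℂ) : Prop :=
  Z ⊆ D ∧ ∀ z ∈ D, ∃ r > 0, Metric.ball z r ∩ Z ⊆ {z}

/-- `w` has a positive lower bound on every compact subset of `D ∖ Z`. -/
def PosLowerBoundOnCompacts (D Z : Set ℂ) (w : ℂ → ℝ) : Prop :=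
  ∀ Kc : Set ℂ, Kc ⊆ D \ Z → IsCompact Kc → ∃ m : ℝ, 0 < m ∧ ∀ z ∈ Kc, m ≤ w z

/-- `∫₀^∞ c(t) e^{-t} dt`. -/
noncomputable def cInt (c : ℝ → ℝ) : ℝ := ∫ t in Set.Ioi (0:ℝ), c t * Real.exp (-t)

/-- `h(t) = ∫_t^∞ c(s) e^{-s} ds`. -/
noncomputable def hFun (c : ℝ → ℝ) (t : ℝ) : ℝ := ∫ s in Set.Ioi t, c s * Real.exp (-s)

end
/-- `Fz` is (the membership predicate of) an ideal of germs of holomorphic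
functions at `z₀`. -/
def IsIdealAt (Fz : (ℂ → ℂ) → Prop) (z₀ : ℂ) : Prop :=
  (∀ g h : ℂ → ℂ, g =ᶠ[nhds z₀] h → Fz g → Fz h) ∧
  (∀ g : ℂ → ℂ, Fz g → AnalyticAt ℂ g z₀) ∧
  Fz (fun _ => 0) ∧
  (∀ g h : ℂ → ℂ, Fz g → Fz h → Fz (g + h)) ∧
  (∀ g h : ℂ → ℂ, AnalyticAt ℂ h z₀ → Fz g → Fz (fun z => h z * g z))

/-- Membership in the multiplier ideal `I(φ+ψ)_{z₀}`: germs `g` with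
`|g|² e^{-φ-ψ}` locally integrable near `z₀`. -/
def InMultIdeal (φ ψ : ℂ → EReal) (z₀ : ℂ) (g : ℂ → ℂ) : Prop :=
  AnalyticAt ℂ g z₀ ∧ ∃ r > 0, MeasureTheory.IntegrableOn
    (fun z => ‖g z‖ ^ 2 * Real.exp (-(φ z + ψ z).toReal)) (Metric.ball z₀ r) volume

/-- `I(φ+ψ)_{z₀} ≠ O_{z₀}`. -/
def MultIdealNontrivial (φ ψ : ℂ → EReal) (z₀ : ℂ) : Prop :=
  ¬ InMultIdeal φ ψ z₀ (fun _ => 1)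

/-- The minimal L² integral
`G(t) = inf { ∫_{{ψ<-t}} |f̃|² e^{-φ} c(-ψ) : f̃ ∈ O({ψ<-t}), (f̃-f,z₀) ∈ F_{z₀} }`. -/
noncomputable def minL2F (D : Set ℂ) (ψ φ : ℂ → EReal) (c : ℝ → ℝ) (f : ℂ → ℂ)
    (Fz : (ℂ → ℂ) → Prop) (t : ℝ) : ENNReal :=
  sInf { I : ENNReal | ∃ g : ℂ → ℂ,
      DifferentiableOn ℂ g {z | z ∈ D ∧ ψ z < ((-t : ℝ) : EReal)} ∧
      Fz (fun z => g z - f z) ∧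
      I = ∫⁻ z in {z | z ∈ D ∧ ψ z < ((-t : ℝ) : EReal)},
            ENNReal.ofReal (‖g z‖ ^ 2 * wgt1 φ ψ c z) }

section
open MeasureTheory Metric Complex Set Filter
open scoped ContDiff Topology

/-- Wirtinger derivative. -/
noncomputable def dz (f : ℂ → ℂ) (z : ℂ) : ℂ := (fderiv ℝ f z 1 - I * fderiv ℝ f z I) / 2
/-- Conjugate Wirtinger derivative. -/
noncomputable def dzb (f : ℂ → ℂ) (z : ℂ) : ℂ := (fderiv ℝ f z 1 + I * fderiv ℝ f z I) / 2

lemma dz_mul {f g : ℂ → ℂ} {z : ℂ} (hf : DifferentiableAt ℝ f z) (hg : DifferentiableAt ℝ g z) :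
    dz (fun w => f w * g w) z = dz f z * g z + f z * dz g z := by
  unfold dz
  rw [fderiv_fun_mul hf hg]
  simp [smul_eq_mul]; ring

lemma dzb_mul {f g : ℂ → ℂ} {z : ℂ} (hf : DifferentiableAt ℝ f z) (hg : DifferentiableAt ℝ g z) :
    dzb (fun w => f w * g w) z = dzb f z * g z + f z * dzb g z := by
  unfold dzb
  rw [fderiv_fun_mul hf hg]
  simp [smul_eq_mul]; ring

lemma dz_add {f g : ℂ → ℂ} {z : ℂ} (hf : DifferentiableAt ℝ f z) (hg : DifferentiableAt ℝ g z) :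
    dz (fun w => f w + g w) z = dz f z + dz g z := by
  unfold dz
  rw [fderiv_fun_add hf hg]
  simp; ring

lemma dzb_add {f g : ℂ → ℂ} {z : ℂ} (hf : DifferentiableAt ℝ f z) (hg : DifferentiableAt ℝ g z) :
    dzb (fun w => f w + g w) z = dzb f z + dzb g z := by
  unfold dzb
  rw [fderiv_fun_add hf hg]
  simp; ring

lemma dz_conj {f : ℂ → ℂ} {z : ℂ} :
    dz (fun w => (starRingEnd ℂ) (f w)) z = (starRingEnd ℂ) (dzb f z) := by
  have : fderiv ℝ (fun w => (starRingEnd ℂ) (f w)) z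
      = (conjCLE : ℂ →L[ℝ] ℂ).comp (fderiv ℝ f z) := conjCLE.comp_fderiv
  unfold dz dzb
  rw [this]
  simp [sub_eq_add_neg, map_ofNat]

lemma dzb_conj {f : ℂ → ℂ} {z : ℂ} :
    dzb (fun w => (starRingEnd ℂ) (f w)) z = (starRingEnd ℂ) (dz f z) := by
  have : fderiv ℝ (fun w => (starRingEnd ℂ) (f w)) z
      = (conjCLE : ℂ →L[ℝ] ℂ).comp (fderiv ℝ f z) := conjCLE.comp_fderiv
  unfold dz dzb
  rw [this]
  simp [sub_eq_add_neg, map_ofNat]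

lemma fderiv_ofReal_comp {g : ℝ → ℝ} {y : ℂ → ℝ} {z : ℂ} (hg : DifferentiableAt ℝ g (y z))
    (hy : DifferentiableAt ℝ y z) (v : ℂ) :
    fderiv ℝ (fun w => ((g (y w) : ℝ) : ℂ)) z v
      = deriv g (y z) * fderiv ℝ (fun w => ((y w : ℝ) : ℂ)) z v := by
  have h1 : HasFDerivAt (fun w => ((y w : ℝ) : ℂ)) (ofRealCLM.comp (fderiv ℝ y z)) z :=
    ofRealCLM.hasFDerivAt.comp z hy.hasFDerivAt
  have h2 : HasFDerivAt (fun w => g (y w)) (deriv g (y z) • fderiv ℝ y z) z :=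
    hg.hasDerivAt.comp_hasFDerivAt z hy.hasFDerivAt
  have h3 : HasFDerivAt (fun w => ((g (y w) : ℝ) : ℂ))
      (ofRealCLM.comp (deriv g (y z) • fderiv ℝ y z)) z :=
    ofRealCLM.hasFDerivAt.comp z h2
  rw [h3.fderiv, h1.fderiv]
  simp

lemma dz_ofReal_comp {g : ℝ → ℝ} {y : ℂ → ℝ} {z : ℂ} (hg : DifferentiableAt ℝ g (y z))
    (hy : DifferentiableAt ℝ y z) :
    dz (fun w => ((g (y w) : ℝ) : ℂ)) z = deriv g (y z) * dz (fun w => ((y w : ℝ) : ℂ)) z := by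
  unfold dz
  rw [fderiv_ofReal_comp hg hy, fderiv_ofReal_comp hg hy]; ring

lemma dzb_ofReal_comp {g : ℝ → ℝ} {y : ℂ → ℝ} {z : ℂ} (hg : DifferentiableAt ℝ g (y z))
    (hy : DifferentiableAt ℝ y z) :
    dzb (fun w => ((g (y w) : ℝ) : ℂ)) z = deriv g (y z) * dzb (fun w => ((y w : ℝ) : ℂ)) z := by
  unfold dzb
  rw [fderiv_ofReal_comp hg hy, fderiv_ofReal_comp hg hy]; ring

lemma dzb_ofReal (y : ℂ → ℝ) (z : ℂ) :
    dzb (fun w => ((y w : ℝ) : ℂ)) z = (starRingEnd ℂ) (dz (fun w => ((y w : ℝ) : ℂ)) z) := by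
  rw [← dzb_conj]; simp

lemma ContDiff.dz' {f : ℂ → ℂ} (hf : ContDiff ℝ ∞ f) : ContDiff ℝ ∞ (dz f) := by
  unfold dz
  have : ContDiff ℝ ∞ (fderiv ℝ f) := hf.fderiv_right (by simp)
  fun_prop

lemma ContDiff.dzb' {f : ℂ → ℂ} (hf : ContDiff ℝ ∞ f) : ContDiff ℝ ∞ (dzb f) := by
  unfold dzb
  have : ContDiff ℝ ∞ (fderiv ℝ f) := hf.fderiv_right (by simp)
  fun_prop

lemma ContDiff.da {E F : Type*} [NormedAddCommGroup E] [NormedSpace ℝ E] [NormedAddCommGroup F]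
    [NormedSpace ℝ F] {f : E → F} (hf : ContDiff ℝ ∞ f) (z : E) : DifferentiableAt ℝ f z :=
  (hf.differentiable (by simp)) z

lemma dz_dzb_comm {f : ℂ → ℂ} (hf : ContDiff ℝ ∞ f) (z : ℂ) : dz (dzb f) z = dzb (dz f) z := by
  have h1 : ContDiff ℝ ∞ (fderiv ℝ f) := hf.fderiv_right (by simp)
  have hs : ∀ v w, fderiv ℝ (fderiv ℝ f) z v w = fderiv ℝ (fderiv ℝ f) z w v := by
    intro v w
    have := (hf.contDiffAt (x := z)).isSymmSndFDerivAt (by simp; exact WithTop.coe_le_coe.2 (le_top (a := (2:ℕ∞))))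
    exact this v w
  have key : ∀ (c : ℂ) (v : ℂ), fderiv ℝ (fun w => (fderiv ℝ f w 1 + c * fderiv ℝ f w I) / 2) z v
      = (fderiv ℝ (fderiv ℝ f) z v 1 + c * fderiv ℝ (fderiv ℝ f) z v I) / 2 := by
    intro c v
    have h2 : ∀ u : ℂ, HasFDerivAt (fun w => fderiv ℝ f w u)
        ((fderiv ℝ (fderiv ℝ f) z).flip u) z := fun u => by
      have := (h1.da z).hasFDerivAt.clm_apply (hasFDerivAt_const u z)
      simpa using this
    have h3 := (((h2 1).add ((h2 I).const_mul c)).mul_const (1/2 : ℂ)).fderiv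
    have : (fun w => (fderiv ℝ f w 1 + c * fderiv ℝ f w I) / 2)
      = fun w => (fderiv ℝ f w 1 + c * fderiv ℝ f w I) * (1/2 : ℂ) := by
      ext w; ring
    rw [this]
    erw [h3]
    simp; ring
  have kb : ∀ v, fderiv ℝ (dzb f) z v
      = (fderiv ℝ (fderiv ℝ f) z v 1 + I * fderiv ℝ (fderiv ℝ f) z v I) / 2 := key I
  have ka : ∀ v, fderiv ℝ (dz f) z v
      = (fderiv ℝ (fderiv ℝ f) z v 1 + (-I) * fderiv ℝ (fderiv ℝ f) z v I) / 2 := by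
    intro v
    rw [← key (-I)]
    congr 2
    ext w; simp [dz]; ring
  rw [dz, dzb, ka, ka, kb, kb, hs 1 I]
  ring

lemma integral_fderiv_zero {f : ℂ → ℂ} (hf : ContDiff ℝ 1 f) (hc : HasCompactSupport f) (v : ℂ) :
    ∫ z, fderiv ℝ f z v = 0 := by
  have hcd : Continuous (fun z => fderiv ℝ f z v) :=
    (hf.continuous_fderiv (by simp)).clm_apply continuous_const
  have hcs : HasCompactSupport (fun z => fderiv ℝ f z v) := hc.fderiv_apply ℝ v
  have := integral_bilinear_fderiv_right_eq_neg_left_of_integrable (μ := volume) (v := v)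
    (f := fun _ : ℂ => (1:ℂ)) (g := f) (B := ContinuousLinearMap.mul ℝ ℂ)
    (by simp) (by simpa using hcd.integrable_of_hasCompactSupport hcs)
    (by simpa using hf.continuous.integrable_of_hasCompactSupport hc)
    (by fun_prop) (fun x _ => hf.differentiable (by simp) x)
  simpa using this

lemma HasCompactSupport.dz' {f : ℂ → ℂ} (hc : HasCompactSupport f) : HasCompactSupport (dz f) := by
  refine (hc.fderiv ℝ).mono ?_
  intro z hz
  simp only [Function.mem_support] at hz ⊢
  intro h; apply hz; simp [dz, h]

lemma HasCompactSupport.dzb' {f : ℂ → ℂ} (hc : HasCompactSupport f) :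
    HasCompactSupport (dzb f) := by
  refine (hc.fderiv ℝ).mono ?_
  intro z hz
  simp only [Function.mem_support] at hz ⊢
  intro h; apply hz; simp [dzb, h]

lemma tsupport_dzb (f : ℂ → ℂ) : tsupport (dzb f) ⊆ tsupport f := by
  refine (closure_minimal ?_ (isClosed_tsupport _))
  intro z hz
  apply support_fderiv_subset ℝ
  simp only [Function.mem_support] at hz ⊢
  intro h; apply hz; simp [dzb, h]

lemma integral_dz_zero {f : ℂ → ℂ} (hf : ContDiff ℝ 1 f) (hc : HasCompactSupport f) :
    ∫ z, dz f z = 0 := by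
  have h : ∀ v, Integrable (fun z => fderiv ℝ f z v) := fun v =>
    ((hf.continuous_fderiv (by simp)).clm_apply continuous_const).integrable_of_hasCompactSupport
      (hc.fderiv_apply ℝ v)
  unfold dz
  rw [integral_div, integral_sub (h 1) ((h I).const_mul I), integral_const_mul,
    integral_fderiv_zero hf hc, integral_fderiv_zero hf hc]
  simp

lemma integral_dzb_zero {f : ℂ → ℂ} (hf : ContDiff ℝ 1 f) (hc : HasCompactSupport f) :
    ∫ z, dzb f z = 0 := by
  have h : ∀ v, Integrable (fun z => fderiv ℝ f z v) := fun v =>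
    ((hf.continuous_fderiv (by simp)).clm_apply continuous_const).integrable_of_hasCompactSupport
      (hc.fderiv_apply ℝ v)
  unfold dzb
  rw [integral_div, integral_add (h 1) ((h I).const_mul I), integral_const_mul,
    integral_fderiv_zero hf hc, integral_fderiv_zero hf hc]
  simp

end

section
open MeasureTheory Metric Complex Set Filter
open scoped ContDiff Topology

/-- Real coercion of a function. -/
noncomputable abbrev rc (y : ℂ → ℝ) : ℂ → ℂ := fun w => ((y w : ℝ) : ℂ)

/-- A quarter of the Laplacian. -/
noncomputable def lap (y : ℂ → ℝ) (z : ℂ) : ℝ := (dz (dzb (rc y)) z).re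

lemma ContDiff.rc' {y : ℂ → ℝ} (hy : ContDiff ℝ ∞ y) : ContDiff ℝ ∞ (rc y) :=
  ofRealCLM.contDiff.comp hy

lemma lap_eq {y : ℂ → ℝ} (hy : ContDiff ℝ ∞ y) (z : ℂ) :
    dz (dzb (rc y)) z = (lap y z : ℂ) := by
  have h1 : (starRingEnd ℂ) (dz (dzb (rc y)) z) = dz (dzb (rc y)) z := by
    rw [← dzb_conj]
    have : (fun w => (starRingEnd ℂ) (dzb (rc y) w)) = dz (rc y) := by
      ext w; rw [dzb_ofReal]; simp
    rw [this, dz_dzb_comm hy.rc']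
  rw [lap]
  exact (conj_eq_iff_re.1 h1).symm

lemma continuous_lap {y : ℂ → ℝ} (hy : ContDiff ℝ ∞ y) : Continuous (lap y) := by
  unfold lap
  exact continuous_re.comp hy.rc'.dzb'.dz'.continuous

lemma lap_comp {g : ℝ → ℝ} {U : Set ℝ} (hU : IsOpen U) (hg : ContDiffOn ℝ ∞ g U) {y : ℂ → ℝ}
    (hy : ContDiff ℝ ∞ y) (hyU : ∀ z, y z ∈ U) (z : ℂ) :
    lap (fun w => g (y w)) z
      = deriv (deriv g) (y z) * ‖dz (rc y) z‖ ^ 2 + deriv g (y z) * lap y z := by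
  have hg' : ContDiffOn ℝ ∞ (deriv g) U := hg.deriv_of_isOpen hU (by simp)
  have hd : ∀ w, DifferentiableAt ℝ g (y w) := fun w =>
    (hg.contDiffAt (hU.mem_nhds (hyU w))).differentiableAt (by simp)
  have hd' : ∀ w, DifferentiableAt ℝ (deriv g) (y w) := fun w =>
    (hg'.contDiffAt (hU.mem_nhds (hyU w))).differentiableAt (by simp)
  have e1 : dzb (rc fun w => g (y w)) = fun w => rc (fun w => deriv g (y w)) w * dzb (rc y) w := by
    ext w
    exact dzb_ofReal_comp (hd w) (hy.da w)
  have hdd : DifferentiableAt ℝ (rc (fun w => deriv g (y w))) z :=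
    ofRealCLM.differentiableAt.comp z ((hd' z).comp z (hy.da z))
  have key : dz (dzb (rc fun w => g (y w))) z
      = ((deriv (deriv g) (y z) * ‖dz (rc y) z‖ ^ 2 + deriv g (y z) * lap y z : ℝ) : ℂ) := by
    rw [e1, dz_mul hdd (hy.rc'.dzb'.da z), dz_ofReal_comp (hd' z) (hy.da z), lap_eq hy, dzb_ofReal,
      mul_assoc, Complex.mul_conj']
    push_cast; rfl
  rw [lap, key, ofReal_re]

lemma lap_add {y v : ℂ → ℝ} (hy : ContDiff ℝ ∞ y) (hv : ContDiff ℝ ∞ v) (z : ℂ) :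
    lap (fun w => y w + v w) z = lap y z + lap v z := by
  have e1 : dzb (rc fun w => y w + v w) = fun w => dzb (rc y) w + dzb (rc v) w := by
    ext w
    rw [← dzb_add (hy.rc'.da w) (hv.rc'.da w)]
    congr 1; ext w; simp [rc]
  rw [lap, e1, dz_add (hy.rc'.dzb'.da z) (hv.rc'.dzb'.da z)]
  simp [lap]

lemma twist_identity {η Ψ : ℂ → ℝ} (hη : ContDiff ℝ ∞ η) (hΨ : ContDiff ℝ ∞ Ψ) {χ : ℂ → ℂ}
    (hχ : ContDiff ℝ ∞ χ) (hc : HasCompactSupport χ) :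
    ∫ z, Real.exp (Ψ z) * (η z * ‖dzb χ z‖ ^ 2
      + 2 * (dz (rc η) z * (starRingEnd ℂ) (χ z) * dzb χ z).re
      - η z * ‖dz χ z + dz (rc Ψ) z * χ z‖ ^ 2
      - (η z * lap Ψ z - lap η z) * ‖χ z‖ ^ 2) = 0 := by
  set E : ℂ → ℝ := fun z => Real.exp (Ψ z) with hE
  have hEs : ContDiff ℝ ∞ E := Real.contDiff_exp.comp hΨ
  have hEz : ∀ z, dz (rc E) z = rc E z * dz (rc Ψ) z := fun z => by
    have := dz_ofReal_comp (g := Real.exp) (y := Ψ) (z := z) Real.differentiableAt_exp (hΨ.da z)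
    rw [Real.deriv_exp] at this
    exact this
  have hEzb : ∀ z, dzb (rc E) z = rc E z * dzb (rc Ψ) z := fun z => by
    have := dzb_ofReal_comp (g := Real.exp) (y := Ψ) (z := z) Real.differentiableAt_exp (hΨ.da z)
    rw [Real.deriv_exp] at this
    exact this
  set X : ℂ → ℂ := fun z => (starRingEnd ℂ) (χ z) with hX
  have hXs : ContDiff ℝ ∞ X := conjCLE.contDiff.comp hχ
  have hXc : HasCompactSupport X := hc.comp_left (g := fun z => (starRingEnd ℂ) z) (by simp)
  set A : ℂ → ℂ := fun z => dz χ z + dz (rc Ψ) z * χ z with hA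
  have hAs : ContDiff ℝ ∞ A := hχ.dz'.add (hΨ.rc'.dz'.mul hχ)
  have ηs := hη.rc'
  have Es := hEs.rc'
  have Bs := hχ.dzb'
  -- the three fields
  set P1 : ℂ → ℂ := fun z => (rc η z * rc E z) * (X z * dzb χ z) with hP1
  set P2 : ℂ → ℂ := fun z => (rc η z * rc E z) * (X z * A z) with hP2
  set P3 : ℂ → ℂ := fun z => (dzb (rc η) z * rc E z) * (X z * χ z) with hP3
  have s1 : ContDiff ℝ ∞ P1 := (ηs.mul Es).mul (hXs.mul Bs)
  have s2 : ContDiff ℝ ∞ P2 := (ηs.mul Es).mul (hXs.mul hAs)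
  have s3 : ContDiff ℝ ∞ P3 := (ηs.dzb'.mul Es).mul (hXs.mul hχ)
  have c1 : HasCompactSupport P1 := (hXc.mul_right (f' := dzb χ)).mul_left
    (f := fun z => rc η z * rc E z)
  have c2 : HasCompactSupport P2 := (hXc.mul_right (f' := A)).mul_left
    (f := fun z => rc η z * rc E z)
  have c3 : HasCompactSupport P3 := (hXc.mul_right (f' := χ)).mul_left
    (f := fun z => dzb (rc η) z * rc E z)
  have le1 : (1 : WithTop ℕ∞) ≤ ∞ := by simp
  have i1 : Integrable (dz P1) := s1.dz'.continuous.integrable_of_hasCompactSupport c1.dz'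
  have i2 : Integrable (dzb P2) := s2.dzb'.continuous.integrable_of_hasCompactSupport c2.dzb'
  have i3 : Integrable (dz P3) := s3.dz'.continuous.integrable_of_hasCompactSupport c3.dz'
  have I0 : ∫ z, (dz P1 z - dzb P2 z + dz P3 z) = 0 := by
    have i12 : Integrable (fun z => dz P1 z - dzb P2 z) := i1.sub i2
    rw [integral_add i12 i3, integral_sub i1 i2, integral_dz_zero (s1.of_le le1) c1,
      integral_dzb_zero (s2.of_le le1) c2, integral_dz_zero (s3.of_le le1) c3]
    simp
  have pt : ∀ z, dz P1 z - dzb P2 z + dz P3 z = ((E z * (η z * ‖dzb χ z‖ ^ 2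
      + 2 * (dz (rc η) z * (starRingEnd ℂ) (χ z) * dzb χ z).re
      - η z * ‖dz χ z + dz (rc Ψ) z * χ z‖ ^ 2
      - (η z * lap Ψ z - lap η z) * ‖χ z‖ ^ 2) : ℝ) : ℂ) := by
    intro z
    have d1 : dz P1 z = _ := dz_mul ((ηs.mul Es).da z) ((hXs.mul Bs).da z)
    have d2 : dzb P2 z = _ := dzb_mul ((ηs.mul Es).da z) ((hXs.mul hAs).da z)
    have d3 : dz P3 z = _ := dz_mul ((ηs.dzb'.mul Es).da z) ((hXs.mul hχ).da z)
    have e1 : dz (fun w => rc η w * rc E w) z = _ := dz_mul (ηs.da z) (Es.da z)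
    have e2 : dz (fun w => X w * dzb χ w) z = _ := dz_mul (hXs.da z) (Bs.da z)
    have e3 : dzb (fun w => rc η w * rc E w) z = _ := dzb_mul (ηs.da z) (Es.da z)
    have e4 : dzb (fun w => X w * A w) z = _ := dzb_mul (hXs.da z) (hAs.da z)
    have e5 : dz (fun w => dzb (rc η) w * rc E w) z = _ := dz_mul (ηs.dzb'.da z) (Es.da z)
    have e6 : dz (fun w => X w * χ w) z = _ := dz_mul (hXs.da z) (hχ.da z)
    have e7 : dzb A z = dzb (dz χ) z + (dzb (dz (rc Ψ)) z * χ z + dz (rc Ψ) z * dzb χ z) := by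
      rw [hA, dzb_add (hχ.dz'.da z) ((hΨ.rc'.dz'.mul hχ).da z),
        dzb_mul (hΨ.rc'.dz'.da z) (hχ.da z)]
    have e8 : dz X z = (starRingEnd ℂ) (dzb χ z) := dz_conj
    have e9 : dzb X z = (starRingEnd ℂ) (dz χ z) := dzb_conj
    erw [d1, d2, d3]
    erw [e1, e2, e3, e4, e5, e6]
    rw [e7, e8, e9, hEz, hEzb, dzb_ofReal η, ← dz_dzb_comm hΨ.rc', ← dz_dzb_comm hχ, lap_eq hΨ,
      lap_eq hη, dzb_ofReal Ψ]
    have n1 : ∀ w : ℂ, ((‖w‖ ^ 2 : ℝ) : ℂ) = w * (starRingEnd ℂ) w := fun w => by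
      rw [Complex.mul_conj']; push_cast; rfl
    have n2 : ∀ w : ℂ, ((2 * w.re : ℝ) : ℂ) = w + (starRingEnd ℂ) w := fun w => by
      rw [Complex.add_conj]
    simp only [ofReal_sub, ofReal_add, ofReal_mul (E z), ofReal_mul (η z), n2, n1,
      ofReal_mul (_ - _), hX, hA, rc]
    simp only [map_add, map_mul, Complex.conj_conj]
    ring
  have : (∫ z, ((E z * (η z * ‖dzb χ z‖ ^ 2
      + 2 * (dz (rc η) z * (starRingEnd ℂ) (χ z) * dzb χ z).re
      - η z * ‖dz χ z + dz (rc Ψ) z * χ z‖ ^ 2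
      - (η z * lap Ψ z - lap η z) * ‖χ z‖ ^ 2) : ℝ) : ℂ)) = 0 := by
    rw [← I0]; congr 1; ext z; rw [pt]
  rw [integral_complex_ofReal] at this
  exact_mod_cast this

end

section
open MeasureTheory Metric Complex Set Filter
open scoped ContDiff Topology

lemma star_ineq {q H S : ℝ → ℝ} (hq : ContDiff ℝ ∞ q) (hqpos : ∀ t, 0 < t → 0 < q t)
    (hqa : ∀ t, 0 < t → deriv q t ≤ 0) (hH : ∀ t, HasDerivAt H (q t) t)
    (hS : ∀ t, HasDerivAt S (H t) t) (H0 : H 0 = 0) (S0 : S 0 = 0)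
    {y Φ : ℂ → ℝ} (hy : ContDiff ℝ ∞ y) (hy0 : ∀ z, 0 < y z) (hΦ : ContDiff ℝ ∞ Φ)
    {χ : ℂ → ℂ} (hχ : ContDiff ℝ ∞ χ) (hc : HasCompactSupport χ)
    (hΦs : ∀ z ∈ tsupport χ, 0 ≤ lap Φ z) :
    ∫ z, ‖χ z‖ ^ 2 * (-lap y z) / H (y z) * Real.exp (Φ z)
      ≤ ∫ z, ‖dzb χ z‖ ^ 2 * Real.exp (Φ z) / q (y z) := by
  have hHs : ContDiff ℝ ∞ H := by
    rw [contDiff_infty_iff_deriv]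
    refine ⟨fun t => (hH t).differentiableAt, ?_⟩
    have : deriv H = q := funext fun t => (hH t).deriv
    rwa [this]
  have hSs : ContDiff ℝ ∞ S := by
    rw [contDiff_infty_iff_deriv]
    refine ⟨fun t => (hS t).differentiableAt, ?_⟩
    have : deriv S = H := funext fun t => (hS t).deriv
    rwa [this]
  have hHpos : ∀ t, 0 < t → 0 < H t := by
    intro t ht
    have : StrictMonoOn H (Ici 0) := by
      apply strictMonoOn_of_deriv_pos (convex_Ici 0) hHs.continuous.continuousOn
      intro x hx
      rw [interior_Ici] at hx
      rw [(hH x).deriv]; exact hqpos x hx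
    have h := this (mem_Ici.2 le_rfl) (mem_Ici.2 ht.le) ht
    rwa [H0] at h
  have hSnn : ∀ t, 0 ≤ t → 0 ≤ S t := by
    intro t ht
    have : MonotoneOn S (Ici 0) := by
      apply monotoneOn_of_deriv_nonneg (convex_Ici 0) hSs.continuous.continuousOn
        (hSs.differentiable (by simp)).differentiableOn
      intro x hx
      rw [interior_Ici] at hx
      rw [(hS x).deriv]; exact (hHpos x hx).le
    have h := this (mem_Ici.2 le_rfl) (mem_Ici.2 ht) ht
    rwa [S0] at h
  have hHS : ∀ t, 0 < t → S t * q t ≤ H t ^ 2 := by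
    intro t ht
    have hd : ∀ x, HasDerivAt (fun x => H x ^ 2 - S x * q x)
        (H x * q x - S x * deriv q x) x := fun x => by
      have := ((hH x).pow 2).sub ((hS x).mul (hq.da x).hasDerivAt)
      refine this.congr_deriv ?_
      simp; ring
    have : MonotoneOn (fun x => H x ^ 2 - S x * q x) (Ici 0) := by
      apply monotoneOn_of_deriv_nonneg (convex_Ici 0)
      · exact fun x _ => (hd x).continuousAt.continuousWithinAt
      · exact fun x _ => (hd x).differentiableAt.differentiableWithinAt
      · intro x hx
        rw [interior_Ici] at hx
        rw [(hd x).deriv]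
        have h1 := mul_pos (hHpos x hx) (hqpos x hx)
        have h2 := mul_nonpos_of_nonneg_of_nonpos (hSnn x (mem_Ioi.1 hx).le) (hqa x hx)
        linarith
    have h := this (mem_Ici.2 le_rfl) (mem_Ici.2 ht.le) ht.le
    simp only [H0, S0] at h
    linarith
  -- the functions s and u
  set s : ℝ → ℝ := fun t => S t / H t with hs
  set u : ℝ → ℝ := fun t => - Real.log (H t) with hu
  have U : IsOpen (Ioi (0:ℝ)) := isOpen_Ioi
  have ss : ContDiffOn ℝ ∞ s (Ioi 0) :=
    hSs.contDiffOn.div hHs.contDiffOn (fun t ht => (hHpos t ht).ne')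
  have us : ContDiffOn ℝ ∞ u (Ioi 0) :=
    (hHs.contDiffOn.log (fun t ht => (hHpos t ht).ne')).neg
  have ds : ∀ t, 0 < t → HasDerivAt s (1 - S t * q t / H t ^ 2) t := fun t ht => by
    have := (hS t).div (hH t) (hHpos t ht).ne'
    refine this.congr_deriv ?_
    have := (hHpos t ht).ne'
    field_simp
  have du : ∀ t, 0 < t → HasDerivAt u (- (q t / H t)) t := fun t ht =>
    ((hH t).log (hHpos t ht).ne').neg
  have dds : ∀ t, 0 < t → deriv (deriv s) t
      = -(H t * q t + S t * deriv q t) / H t ^ 2 + 2 * S t * q t ^ 2 / H t ^ 3 := by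
    intro t ht
    have e : deriv s =ᶠ[𝓝 t] fun t => 1 - S t * q t / H t ^ 2 := by
      filter_upwards [U.mem_nhds ht] with x hx using (ds x hx).deriv
    rw [e.deriv_eq]
    have hn := (hHpos t ht).ne'
    have := (((hS t).mul (hq.da t).hasDerivAt).div ((hH t).pow 2) (pow_ne_zero 2 hn)).const_sub 1
    refine (this.congr_deriv ?_).deriv
    simp
    field_simp
    ring
  have ddu : ∀ t, 0 < t → deriv (deriv u) t = -(deriv q t / H t) + q t ^ 2 / H t ^ 2 := by
    intro t ht
    have e : deriv u =ᶠ[𝓝 t] fun t => - (q t / H t) := by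
      filter_upwards [U.mem_nhds ht] with x hx using (du x hx).deriv
    rw [e.deriv_eq]
    have hn := (hHpos t ht).ne'
    have := ((hq.da t).hasDerivAt.div (hH t) hn).neg
    refine (this.congr_deriv ?_).deriv
    field_simp
    ring
  set η : ℂ → ℝ := fun z => s (y z) with hη
  have cc : ∀ {g : ℝ → ℝ}, ContDiffOn ℝ ∞ g (Ioi 0) → ContDiff ℝ ∞ (fun z => g (y z)) := by
    intro g hg
    rw [← contDiffOn_univ]
    exact hg.comp hy.contDiffOn (fun z _ => hy0 z)
  have hηs : ContDiff ℝ ∞ η := cc ss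
  have hus : ContDiff ℝ ∞ (fun z => u (y z)) := cc us
  set Ψ : ℂ → ℝ := fun z => Φ z + u (y z) with hΨ
  have hΨs : ContDiff ℝ ∞ Ψ := hΦ.add hus
  have key := twist_identity hηs hΨs hχ hc
  set R : ℂ → ℝ := fun z => Real.exp (Ψ z) * (η z * ‖dzb χ z‖ ^ 2
      + 2 * (dz (rc η) z * (starRingEnd ℂ) (χ z) * dzb χ z).re
      - η z * ‖dz χ z + dz (rc Ψ) z * χ z‖ ^ 2
      - (η z * lap Ψ z - lap η z) * ‖χ z‖ ^ 2) with hR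
  have cχ := hχ.continuous
  have cb := hχ.dzb'.continuous
  have cq := hq.continuous
  have cH := hHs.continuous
  have cy := hy.continuous
  have cΦ := hΦ.continuous
  have cl := continuous_lap hy
  have nH : ∀ z, H (y z) ≠ 0 := fun z => (hHpos _ (hy0 z)).ne'
  have nq : ∀ z, q (y z) ≠ 0 := fun z => (hqpos _ (hy0 z)).ne'
  have iL : Integrable (fun z => ‖χ z‖ ^ 2 * (-lap y z) / H (y z) * Real.exp (Φ z)) := by
    apply Continuous.integrable_of_hasCompactSupport
    · fun_prop (disch := assumption)
    · refine hc.mono ?_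
      intro z hz; simp only [Function.mem_support] at hz ⊢; intro h; apply hz; simp [h]
  have iRr : Integrable (fun z => ‖dzb χ z‖ ^ 2 * Real.exp (Φ z) / q (y z)) := by
    apply Continuous.integrable_of_hasCompactSupport
    · fun_prop (disch := assumption)
    · refine hc.dzb'.mono ?_
      intro z hz; simp only [Function.mem_support] at hz ⊢; intro h; apply hz; simp [h]
  have iR : Integrable R := by
    apply Continuous.integrable_of_hasCompactSupport
    · have c1 := hηs.continuous
      have c2 := hηs.rc'.dz'.continuous
      have c3 := hΨs.rc'.dz'.continuous
      have c4 := hχ.dz'.continuous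
      have c5 := continuous_lap hηs
      have c6 := continuous_lap hΨs
      have c7 := hΨs.continuous
      have c8 : Continuous fun z => (starRingEnd ℂ) (χ z) := continuous_conj.comp cχ
      have c9 : Continuous fun z => (dz (rc η) z * (starRingEnd ℂ) (χ z) * dzb χ z).re :=
        continuous_re.comp ((c2.mul c8).mul cb)
      fun_prop
    · have : HasCompactSupport (fun z => (χ z, dz χ z, dzb χ z)) := by
        apply (hc.isCompact.union (hc.dz'.isCompact.union hc.dzb'.isCompact)).of_isClosed_subset
          (isClosed_tsupport _)
        apply closure_minimal _
          ((isClosed_tsupport _).union ((isClosed_tsupport _).union (isClosed_tsupport _)))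
        intro z hz
        by_contra hcon
        simp only [mem_union, not_or] at hcon
        apply hz
        simp [image_eq_zero_of_notMem_tsupport hcon.1,
          image_eq_zero_of_notMem_tsupport hcon.2.1, image_eq_zero_of_notMem_tsupport hcon.2.2]
      refine this.mono ?_
      intro z hz
      simp only [Function.mem_support] at hz ⊢
      intro h
      simp only [Prod.mk_eq_zero] at h
      apply hz
      simp [hR, h.1, h.2.1, h.2.2]
  have pt : ∀ z, ‖χ z‖ ^ 2 * (-lap y z) / H (y z) * Real.exp (Φ z)
      - ‖dzb χ z‖ ^ 2 * Real.exp (Φ z) / q (y z) ≤ - R z := by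
    intro z
    have hyz := hy0 z
    have Hp := hHpos _ hyz
    have qp := hqpos _ hyz
    have eΨ : Real.exp (Ψ z) = Real.exp (Φ z) / H (y z) := by
      rw [hΨ]; simp only [hu]
      rw [Real.exp_add, Real.exp_neg, Real.exp_log Hp]; rfl
    have l1 : lap η z = _ := lap_comp U ss hy hy0 z
    have l2 : lap Ψ z = lap Φ z + _ := lap_add hΦ hus z
    rw [lap_comp U us hy hy0 z, ddu _ hyz, (du _ hyz).deriv] at l2
    rw [dds _ hyz, (ds _ hyz).deriv] at l1
    have l3 : dz (rc η) z = _ := dz_ofReal_comp (ds _ hyz).differentiableAt (hy.da z)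
    rw [(ds _ hyz).deriv] at l3
    set W := dz (rc y) z with hW
    have hre : (dz (rc η) z * (starRingEnd ℂ) (χ z) * dzb χ z).re
        ≤ (1 - S (y z) * q (y z) / H (y z) ^ 2) * (‖W‖ * ‖χ z‖ * ‖dzb χ z‖) := by
      rw [l3]
      have h1 : 0 ≤ 1 - S (y z) * q (y z) / H (y z) ^ 2 := by
        rw [sub_nonneg, div_le_one (by positivity)]; exact hHS _ hyz
      refine (Complex.re_le_norm _).trans ?_
      rw [norm_mul, norm_mul, norm_mul, Complex.norm_real, Real.norm_of_nonneg h1,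
        RCLike.norm_conj]
      apply le_of_eq; ring
    have hnn : 0 ≤ 1 - S (y z) * q (y z) / H (y z) ^ 2 := by
      rw [sub_nonneg, div_le_one (by positivity)]; exact hHS _ hyz
    have hSz := hSnn _ hyz.le
    have hηz : η z = S (y z) / H (y z) := rfl
    have hlΦ : 0 ≤ lap Φ z * ‖χ z‖ ^ 2 := by
      by_cases hz : z ∈ tsupport χ
      · have := hΦs z hz; positivity
      · simp [image_eq_zero_of_notMem_tsupport hz]
    have hA : 0 ≤ η z * ‖dz χ z + dz (rc Ψ) z * χ z‖ ^ 2 := by rw [hηz]; positivity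
    have main : ‖χ z‖ ^ 2 * (-lap y z) - H (y z) / q (y z) * ‖dzb χ z‖ ^ 2
        ≤ -(η z * ‖dzb χ z‖ ^ 2
      + 2 * (dz (rc η) z * (starRingEnd ℂ) (χ z) * dzb χ z).re
      - η z * ‖dz χ z + dz (rc Ψ) z * χ z‖ ^ 2
      - (η z * lap Ψ z - lap η z) * ‖χ z‖ ^ 2) := by
      have e1 : η z * lap Ψ z - lap η z = S (y z) / H (y z) * lap Φ z
          + (1 - S (y z) * q (y z) / H (y z) ^ 2) * (q (y z) / H (y z)) * ‖W‖ ^ 2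
          - lap y z := by
        rw [l1, l2, hηz]; field_simp; ring
      have e2 : 0 ≤ (1 - S (y z) * q (y z) / H (y z) ^ 2) * (q (y z) / H (y z)) *
          (‖W‖ * ‖χ z‖ - H (y z) / q (y z) * ‖dzb χ z‖) ^ 2 := by positivity
      have e3 : (1 - S (y z) * q (y z) / H (y z) ^ 2) * (q (y z) / H (y z)) *
          (‖W‖ * ‖χ z‖ - H (y z) / q (y z) * ‖dzb χ z‖) ^ 2
          = (1 - S (y z) * q (y z) / H (y z) ^ 2) * (q (y z) / H (y z)) * ‖W‖ ^ 2 * ‖χ z‖ ^ 2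
          - 2 * ((1 - S (y z) * q (y z) / H (y z) ^ 2) * (‖W‖ * ‖χ z‖ * ‖dzb χ z‖))
          + (H (y z) / q (y z) - S (y z) / H (y z)) * ‖dzb χ z‖ ^ 2 := by
        field_simp; ring
      have e4 : 0 ≤ S (y z) / H (y z) * (lap Φ z * ‖χ z‖ ^ 2) := by positivity
      rw [e1, hηz]
      rw [hηz] at hA
      nlinarith
    have hm := mul_le_mul_of_nonneg_left main (Real.exp_pos (Ψ z)).le
    have e5 : ‖χ z‖ ^ 2 * (-lap y z) / H (y z) * Real.exp (Φ z)
      - ‖dzb χ z‖ ^ 2 * Real.exp (Φ z) / q (y z) = Real.exp (Ψ z) *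
        (‖χ z‖ ^ 2 * (-lap y z) - H (y z) / q (y z) * ‖dzb χ z‖ ^ 2) := by
      rw [eΨ]; field_simp
    rw [e5, hR]
    calc _ ≤ _ := hm
      _ = _ := by ring
  have h := integral_mono (iL.sub iRr) iR.neg pt
  have h2 : ∫ z, (-R) z = 0 := by
    simp only [Pi.neg_apply]; rw [integral_neg, key]; simp
  rw [h2] at h
  simp only [Pi.sub_apply] at h
  rw [integral_sub iL iRr] at h
  linarith

end

section
open MeasureTheory Metric Complex Set Filter
open scoped ContDiff Topology

lemma cs_w {X : Type*} [MeasurableSpace X] {μ : Measure X} {f g w : X → ℝ}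
    (hf : Integrable f μ) (hg : Integrable g μ) (hw : Integrable w μ) (f0 : ∀ x, 0 ≤ f x)
    (g0 : ∀ x, 0 ≤ g x) (h : ∀ x, w x ^ 2 ≤ f x * g x) :
    (∫ x, w x ∂μ) ^ 2 ≤ (∫ x, f x ∂μ) * ∫ x, g x ∂μ := by
  have key : ∀ s : ℝ, 0 ≤ (∫ x, f x ∂μ) * (s * s) + (-2 * ∫ x, w x ∂μ) * s + ∫ x, g x ∂μ := by
    intro s
    have e : (∫ x, f x ∂μ) * (s * s) + (-2 * ∫ x, w x ∂μ) * s + ∫ x, g x ∂μ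
        = ∫ x, (f x * (s * s) + w x * (-2 * s) + g x) ∂μ := by
      have h1 : Integrable (fun x => f x * (s * s) + w x * (-2 * s)) μ :=
        (hf.mul_const _).add (hw.mul_const _)
      rw [integral_add h1 hg, integral_add (hf.mul_const _) (hw.mul_const _),
        integral_mul_const, integral_mul_const]
      ring
    rw [e]
    apply integral_nonneg
    intro x
    show 0 ≤ f x * (s * s) + w x * (-2 * s) + g x
    rcases (f0 x).eq_or_lt with h0 | h0
    · have := h x
      rw [← h0, zero_mul] at this
      have hw0 : w x = 0 := by nlinarith
      rw [← h0, hw0]; have := g0 x; simpa using this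
    · have h1 : 0 ≤ f x * (f x * (s * s) + w x * (-2 * s) + g x) := by
        nlinarith [h x, sq_nonneg (f x * s - w x)]
      exact nonneg_of_mul_nonneg_right h1 h0
  have := discrim_le_zero key
  rw [discrim] at this
  nlinarith

lemma cutoff_smooth {O : Set ℂ} (hO : IsOpen O) {p : ℂ → ℝ} (hp : ContDiff ℝ ∞ p) {F : ℂ → ℂ}
    {τ τ' : ℝ} (hτ : τ' < τ) (hF : DifferentiableOn ℂ F {z | z ∈ O ∧ p z < τ}) {k : ℝ → ℝ}
    (hk : ContDiff ℝ ∞ k) (hk0 : ∀ x, τ' ≤ x → k x = 0) :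
    ContDiffOn ℝ ∞ (fun z => (k (p z) : ℂ) * F z) O := by
  intro z hz
  apply ContDiffAt.contDiffWithinAt
  by_cases h : p z < τ
  · have hW : IsOpen {z | z ∈ O ∧ p z < τ} := hO.inter (isOpen_lt hp.continuous continuous_const)
    have h1 : ContDiffAt ℝ ∞ F z :=
      ((hF.contDiffOn (n := ∞) hW).restrict_scalars ℝ).contDiffAt (hW.mem_nhds ⟨hz, h⟩)
    have h2 : ContDiffAt ℝ ∞ (fun z => (k (p z) : ℂ)) z :=
      (ofRealCLM.contDiff.comp (hk.comp hp)).contDiffAt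
    exact h2.mul h1
  · have hev : (fun z => (k (p z) : ℂ) * F z) =ᶠ[𝓝 z] fun _ => 0 := by
      have : {w | τ' < p w} ∈ 𝓝 z :=
        (isOpen_lt continuous_const hp.continuous).mem_nhds (by push Not at h; exact hτ.trans_le h)
      filter_upwards [this] with w hw
      rw [hk0 _ (le_of_lt hw)]; simp
    exact contDiffAt_const.congr_of_eventuallyEq hev

lemma mul_smooth {O : Set ℂ} (hO : IsOpen O) {g χ : ℂ → ℂ} (hg : ContDiffOn ℝ ∞ g O)
    (hχ : ContDiff ℝ ∞ χ) (hs : tsupport χ ⊆ O) : ContDiff ℝ ∞ (fun z => g z * χ z) := by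
  rw [contDiff_iff_contDiffAt]
  intro z
  by_cases hz : z ∈ tsupport χ
  · exact (hg.contDiffAt (hO.mem_nhds (hs hz))).mul hχ.contDiffAt
  · have hev : (fun z => g z * χ z) =ᶠ[𝓝 z] fun _ => 0 := by
      filter_upwards [notMem_tsupport_iff_eventuallyEq.1 hz] with w hw
      rw [hw]; simp
    exact contDiffAt_const.congr_of_eventuallyEq hev

lemma mul_cont {O : Set ℂ} (hO : IsOpen O) {g : ℂ → ℂ} {χ : ℂ → ℂ} (hg : ContinuousOn g O)
    (hχ : Continuous χ) (hs : tsupport χ ⊆ O) : Continuous (fun z => g z * χ z) := by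
  rw [continuous_iff_continuousAt]
  intro z
  by_cases hz : z ∈ tsupport χ
  · exact (hg.continuousAt (hO.mem_nhds (hs hz))).mul hχ.continuousAt
  · have hev : (fun z => g z * χ z) =ᶠ[𝓝 z] fun _ => 0 := by
      filter_upwards [notMem_tsupport_iff_eventuallyEq.1 hz] with w hw
      rw [hw]; simp
    exact continuousAt_const.congr hev.symm

lemma dzb_holo {F : ℂ → ℂ} {z : ℂ} (hF : DifferentiableAt ℂ F z) : dzb F z = 0 := by
  unfold dzb
  rw [hF.fderiv_restrictScalars ℝ]
  simp
  rw [← mul_assoc, I_mul_I]; ring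

/-- The smooth dual inequality. -/
lemma DI_smooth {q H S : ℝ → ℝ} (hq : ContDiff ℝ ∞ q) (hqpos : ∀ t, 0 < t → 0 < q t)
    (hqa : ∀ t, 0 < t → deriv q t ≤ 0) (hH : ∀ t, HasDerivAt H (q t) t)
    (hS : ∀ t, HasDerivAt S (H t) t) (H0 : H 0 = 0) (S0 : S 0 = 0)
    {v b ρ : ℝ → ℝ} (hv : ∀ t, HasDerivAt v (b t) t) (hb : ∀ t, HasDerivAt b (ρ t) t)
    (hρ : ContDiff ℝ ∞ ρ) (hρ0 : ∀ t, 0 ≤ ρ t) (hb0 : ∀ t, 0 ≤ b t)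
    {τ τ' T : ℝ} (hτ : τ' < τ) (hb1 : ∀ x, τ' ≤ x → b x = 1) (hρτ : ∀ x, τ' ≤ x → ρ x = 0)
    (hvT : ∀ x, -T ≤ v x)
    {p Φ : ℂ → ℝ} (hp : ContDiff ℝ ∞ p) (hpv : ∀ z, v (p z) < 0) (hΦ : ContDiff ℝ ∞ Φ)
    {O : Set ℂ} (hO : IsOpen O) {F : ℂ → ℂ} (hF : DifferentiableOn ℂ F {z | z ∈ O ∧ p z < τ})
    {χ : ℂ → ℂ} (hχ : ContDiff ℝ ∞ χ) (hc : HasCompactSupport χ) (hsO : tsupport χ ⊆ O)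
    (hps : ∀ z ∈ O, 0 ≤ lap p z) (hΦs : ∀ z ∈ O, 0 ≤ lap Φ z) :
    ‖∫ z, ((1 - b (p z) : ℝ) : ℂ) * F z * dzb χ z‖ ^ 2
      ≤ (H T * ∫ z in tsupport χ, ρ (p z) * ‖F z‖ ^ 2 * Real.exp (-Φ z)) *
        ∫ z, ‖dzb χ z‖ ^ 2 * Real.exp (Φ z) / q (-v (p z)) := by
  have hHs : ContDiff ℝ ∞ H := by
    rw [contDiff_infty_iff_deriv]
    refine ⟨fun t => (hH t).differentiableAt, ?_⟩
    have : deriv H = q := funext fun t => (hH t).deriv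
    rwa [this]
  have hHmono : StrictMonoOn H (Ici 0) := by
    apply strictMonoOn_of_deriv_pos (convex_Ici 0) hHs.continuous.continuousOn
    intro x hx
    rw [interior_Ici] at hx
    rw [(hH x).deriv]; exact hqpos x hx
  have hHpos : ∀ t, 0 < t → 0 < H t := by
    intro t ht
    have h := hHmono (mem_Ici.2 le_rfl) (mem_Ici.2 ht.le) ht
    rwa [H0] at h
  have hbs : ContDiff ℝ ∞ b := by
    rw [contDiff_infty_iff_deriv]
    refine ⟨fun t => (hb t).differentiableAt, ?_⟩
    have : deriv b = ρ := funext fun t => (hb t).deriv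
    rwa [this]
  have dvb : deriv v = b := funext fun t => (hv t).deriv
  have dbρ : deriv b = ρ := funext fun t => (hb t).deriv
  have hvs : ContDiff ℝ ∞ v := by
    rw [contDiff_infty_iff_deriv]
    refine ⟨fun t => (hv t).differentiableAt, ?_⟩
    rwa [dvb]
  set y : ℂ → ℝ := fun z => -v (p z) with hy
  have hys : ContDiff ℝ ∞ y := (hvs.comp hp).neg
  have hy0 : ∀ z, 0 < y z := fun z => by have := hpv z; simp only [hy]; linarith
  have ly : ∀ z, lap y z = -(ρ (p z) * ‖dz (rc p) z‖ ^ 2 + b (p z) * lap p z) := by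
    intro z
    have := lap_comp (g := fun x => -v x) isOpen_univ hvs.neg.contDiffOn hp (fun z => mem_univ _) z
    have d1 : deriv (fun x => -v x) = fun x => - b x := by
      funext x; exact (hv x).neg.deriv
    have d2 : deriv (fun x => - b x) = fun x => - ρ x := by
      funext x; exact (hb x).neg.deriv
    rw [d1, d2] at this
    rw [hy, this]; ring
  have st := star_ineq hq hqpos hqa hH hS H0 S0 hys hy0 hΦ hχ hc (fun z hz => hΦs z (hsO hz))
  have cχ := hχ.continuous
  have cH := hHs.continuous
  have cy := hys.continuous
  have cΦ := hΦ.continuous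
  have cρ := hρ.continuous
  have cp := hp.continuous
  have cl := continuous_lap hys
  have cdp : Continuous (dz (rc p)) := hp.rc'.dz'.continuous
  have nH : ∀ z, H (y z) ≠ 0 := fun z => (hHpos _ (hy0 z)).ne'
  -- smooth products
  have g1 := cutoff_smooth hO hp hτ hF (k := fun x => 1 - b x) (contDiff_const.sub hbs)
    (fun x hx => by rw [hb1 x hx]; simp)
  have g2 := cutoff_smooth hO hp hτ hF hρ hρτ
  have s1 := mul_smooth hO g1 hχ hsO
  have c1 : HasCompactSupport (fun z => ((1 - b (p z) : ℝ) : ℂ) * F z * χ z) := hc.mul_left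
  have c2 : Continuous (fun z => (ρ (p z) : ℂ) * F z * χ z) := mul_cont hO g2.continuousOn cχ hsO
  have c1' : Continuous (fun z => ((1 - b (p z) : ℝ) : ℂ) * F z * dzb χ z) :=
    mul_cont hO g1.continuousOn hχ.dzb'.continuous ((tsupport_dzb χ).trans hsO)
  have dzbp : ∀ z, dzb (rc p) z = (starRingEnd ℂ) (dz (rc p) z) := dzb_ofReal p
  have cdbp : Continuous (dzb (rc p)) := hp.rc'.dzb'.continuous
  have d1 : ∀ z, dzb (fun z => ((1 - b (p z) : ℝ) : ℂ) * F z * χ z) z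
      = ((1 - b (p z) : ℝ) : ℂ) * F z * dzb χ z
        - dzb (rc p) z * ((ρ (p z) : ℂ) * F z * χ z) := by
    intro z
    by_cases hz : z ∈ O
    · rw [dzb_mul ((g1.contDiffAt (hO.mem_nhds hz)).differentiableAt (by simp)) (hχ.da z)]
      by_cases h : p z < τ
      · have hW : IsOpen {z | z ∈ O ∧ p z < τ} :=
          hO.inter (isOpen_lt hp.continuous continuous_const)
        have hFz : DifferentiableAt ℂ F z := hF.differentiableAt (hW.mem_nhds ⟨hz, h⟩)
        have h1 : DifferentiableAt ℝ (rc fun z => 1 - b (p z)) z :=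
          (contDiff_const.sub (hbs.comp hp)).rc'.da z
        rw [dzb_mul h1 (hFz.restrictScalars ℝ), dzb_holo hFz]
        have h3 := dzb_ofReal_comp (g := fun x => 1 - b x) (y := p) (z := z)
          ((contDiff_const.sub hbs).da _) (hp.da z)
        rw [((hb (p z)).const_sub 1).deriv] at h3
        rw [h3]; push_cast; ring
      · have hev : (fun z => ((1 - b (p z) : ℝ) : ℂ) * F z) =ᶠ[𝓝 z] fun _ => 0 := by
          have : {w | τ' < p w} ∈ 𝓝 z :=
            (isOpen_lt continuous_const hp.continuous).mem_nhds
              (by push Not at h; exact hτ.trans_le h)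
          filter_upwards [this] with w hw
          rw [hb1 _ (le_of_lt hw)]; simp
        have h0 : dzb (fun z => ((1 - b (p z) : ℝ) : ℂ) * F z) z = 0 := by
          rw [dzb, hev.fderiv_eq]; simp
        rw [h0, hρτ (p z) (by push Not at h; linarith)]
        push_cast; ring
    · have hz' : z ∉ tsupport χ := fun h => hz (hsO h)
      have hev : (fun z => ((1 - b (p z) : ℝ) : ℂ) * F z * χ z) =ᶠ[𝓝 z] fun _ => 0 := by
        filter_upwards [notMem_tsupport_iff_eventuallyEq.1 hz'] with w hw
        rw [hw]; simp
      rw [dzb, hev.fderiv_eq, image_eq_zero_of_notMem_tsupport hz',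
        image_eq_zero_of_notMem_tsupport (fun h => hz' (tsupport_dzb χ h))]
      simp
  have i1 : Integrable (fun z => ((1 - b (p z) : ℝ) : ℂ) * F z * dzb χ z) :=
    c1'.integrable_of_hasCompactSupport hc.dzb'.mul_left
  have i2 : Integrable (fun z => dzb (rc p) z * ((ρ (p z) : ℂ) * F z * χ z)) :=
    (cdbp.mul c2).integrable_of_hasCompactSupport
      (HasCompactSupport.mul_left (f := dzb (rc p))
        (hc.mul_left (f := fun z => (ρ (p z) : ℂ) * F z)))
  have I1 : ∫ z, ((1 - b (p z) : ℝ) : ℂ) * F z * dzb χ z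
      = ∫ z, dzb (rc p) z * ((ρ (p z) : ℂ) * F z * χ z) := by
    have := integral_dzb_zero (s1.of_le (by simp)) c1
    simp_rw [d1] at this
    rw [integral_sub i1 i2, sub_eq_zero] at this
    exact this
  rw [I1]
  set K := tsupport χ with hK
  have hKc : IsCompact K := hc
  have c3 : ContinuousOn (fun z => ρ (p z) * ‖F z‖ ^ 2 * Real.exp (-Φ z)) K := by
    intro z hz
    have hzO := hO.mem_nhds (hsO hz)
    apply ContinuousAt.continuousWithinAt
    by_cases h : p z < τ
    · have hW : IsOpen {z | z ∈ O ∧ p z < τ} := hO.inter (isOpen_lt cp continuous_const)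
      have hFz : ContinuousAt F z := (hF.differentiableAt (hW.mem_nhds ⟨hsO hz, h⟩)).continuousAt
      have h1 : ContinuousAt (fun z => ρ (p z)) z := (cρ.comp cp).continuousAt
      have h2 : ContinuousAt (fun z => Real.exp (-Φ z)) z :=
        (Real.continuous_exp.comp cΦ.neg).continuousAt
      exact (h1.mul (hFz.norm.pow 2)).mul h2
    · have hev : (fun z => ρ (p z) * ‖F z‖ ^ 2 * Real.exp (-Φ z)) =ᶠ[𝓝 z] fun _ => 0 := by
        have : {w | τ' < p w} ∈ 𝓝 z :=
          (isOpen_lt continuous_const hp.continuous).mem_nhds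
            (by push Not at h; exact hτ.trans_le h)
        filter_upwards [this] with w hw
        rw [hρτ _ (le_of_lt hw)]; simp
      exact continuousAt_const.congr hev.symm
  have i3 : IntegrableOn (fun z => ρ (p z) * ‖F z‖ ^ 2 * Real.exp (-Φ z)) K :=
    c3.integrableOn_compact hKc
  set f : ℂ → ℝ := K.indicator (fun z => H T * (ρ (p z) * ‖F z‖ ^ 2 * Real.exp (-Φ z))) with hf
  set g : ℂ → ℝ := fun z => ρ (p z) * ‖dz (rc p) z‖ ^ 2 * ‖χ z‖ ^ 2 / H (y z) * Real.exp (Φ z)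
    with hg
  have hKm : MeasurableSet K := hKc.isClosed.measurableSet
  have fi : Integrable f := by
    rw [hf, integrable_indicator_iff hKm]; exact i3.const_mul (H T)
  have gi : Integrable g := by
    apply Continuous.integrable_of_hasCompactSupport
    · fun_prop (disch := assumption)
    · refine hc.mono ?_
      intro z hz; simp only [Function.mem_support] at hz ⊢; intro h; apply hz; simp [hg, h]
  have yT : ∀ z, y z ≤ T := fun z => by have := hvT (p z); simp only [hy]; linarith
  have HT : ∀ z, H (y z) ≤ H T := fun z =>
    hHmono.monotoneOn (mem_Ici.2 (hy0 z).le) (mem_Ici.2 ((hy0 z).le.trans (yT z))) (yT z)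
  have HTp : 0 < H T := (hHpos _ (hy0 0)).trans_le (HT 0)
  have cs := cs_w fi gi i2.norm
    (by
      intro z; apply indicator_nonneg
      intro z _
      have := hρ0 (p z)
      positivity)
    (by
      intro z
      have := hρ0 (p z)
      have := hHpos _ (hy0 z)
      simp only [hg]; positivity)
    (by
      intro z
      by_cases hz : z ∈ K
      · rw [hf, indicator_of_mem hz]
        simp only [hg, norm_mul, dzbp, RCLike.norm_conj, Complex.norm_real,
          Real.norm_of_nonneg (hρ0 (p z))]
        have h1 : 0 < H (y z) := hHpos _ (hy0 z)
        have h2 : 1 ≤ H T / H (y z) := (one_le_div h1).2 (HT z)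
        have e : H T * (ρ (p z) * ‖F z‖ ^ 2 * Real.exp (-Φ z)) *
          (ρ (p z) * ‖dz (rc p) z‖ ^ 2 * ‖χ z‖ ^ 2 / H (y z) * Real.exp (Φ z))
          = (H T / H (y z)) * (‖dz (rc p) z‖ * (ρ (p z) * ‖F z‖ * ‖χ z‖)) ^ 2 := by
          rw [Real.exp_neg]; field_simp
        rw [e]
        exact le_mul_of_one_le_left (sq_nonneg _) h2
      · simp [hf, hz, image_eq_zero_of_notMem_tsupport hz])
  have hfI : ∫ z, f z = H T * ∫ z in K, ρ (p z) * ‖F z‖ ^ 2 * Real.exp (-Φ z) := by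
    rw [hf, integral_indicator hKm, integral_const_mul]
  have hgI : ∫ z, g z ≤ ∫ z, ‖dzb χ z‖ ^ 2 * Real.exp (Φ z) / q (-v (p z)) := by
    refine le_trans (integral_mono gi ?_ ?_) st
    · apply Continuous.integrable_of_hasCompactSupport
      · fun_prop (disch := assumption)
      · refine hc.mono ?_
        intro z hz; simp only [Function.mem_support] at hz ⊢; intro h; apply hz; simp [h]
    · intro z
      simp only [hg]
      by_cases hz : z ∈ K
      · rw [ly]
        have h1 : 0 < H (y z) := hHpos _ (hy0 z)
        have h3 := mul_nonneg (hb0 (p z)) (hps z (hsO hz))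
        gcongr ?_ / _ * _
        nlinarith [sq_nonneg ‖χ z‖]
      · simp [image_eq_zero_of_notMem_tsupport hz]
  calc _ ≤ (∫ z, ‖dzb (rc p) z * ((ρ (p z) : ℂ) * F z * χ z)‖) ^ 2 := by
        gcongr; exact norm_integral_le_integral_norm _
    _ ≤ (∫ z, f z) * ∫ z, g z := cs
    _ ≤ _ := by
      rw [hfI]
      gcongr
      apply mul_nonneg HTp.le
      apply integral_nonneg
      intro z
      have := hρ0 (p z)
      show 0 ≤ ρ (p z) * ‖F z‖ ^ 2 * Real.exp (-Φ z)
      positivity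

end

section
open MeasureTheory Metric Complex Set Filter
open scoped ContDiff Topology

/-- unnormalised radial bump -/
noncomputable def mol0 (ε : ℝ) (z : ℂ) : ℝ := expNegInvGlue (ε ^ 2 - ‖z‖ ^ 2)
/-- radial mollifier -/
noncomputable def mol (ε : ℝ) (z : ℂ) : ℝ := (∫ w, mol0 ε w)⁻¹ * mol0 ε z

lemma mol0_smooth (ε : ℝ) : ContDiff ℝ ∞ (mol0 ε) :=
  expNegInvGlue.contDiff.comp (contDiff_const.sub (contDiff_norm_sq ℝ))

lemma mol0_nonneg (ε : ℝ) (z : ℂ) : 0 ≤ mol0 ε z := expNegInvGlue.nonneg _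

lemma mol0_zero {ε : ℝ} (hε : 0 < ε) {z : ℂ} (h : ε ≤ ‖z‖) : mol0 ε z = 0 := by
  apply expNegInvGlue.zero_of_nonpos
  have : ε ^ 2 ≤ ‖z‖ ^ 2 := by gcongr
  linarith

lemma mol0_compact {ε : ℝ} (hε : 0 < ε) : HasCompactSupport (mol0 ε) := by
  apply HasCompactSupport.intro (isCompact_closedBall (0:ℂ) ε)
  intro x hx
  apply mol0_zero hε
  simp at hx; exact hx.le

lemma mol0_int {ε : ℝ} (hε : 0 < ε) : Integrable (mol0 ε) :=
  (mol0_smooth ε).continuous.integrable_of_hasCompactSupport (mol0_compact hε)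

lemma mol0_pos {ε : ℝ} (hε : 0 < ε) : 0 < ∫ w, mol0 ε w := by
  apply (mol0_smooth ε).continuous.integral_pos_of_hasCompactSupport_nonneg_nonzero
    (mol0_compact hε) (mol0_nonneg ε) (x := 0)
  apply (expNegInvGlue.pos_of_pos _).ne'
  simp; positivity

lemma mol_smooth (ε : ℝ) : ContDiff ℝ ∞ (mol ε) := contDiff_const.mul (mol0_smooth ε)

lemma mol_nonneg {ε : ℝ} (hε : 0 < ε) (z : ℂ) : 0 ≤ mol ε z :=
  mul_nonneg (inv_nonneg.2 (mol0_pos hε).le) (mol0_nonneg ε z)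

lemma mol_zero {ε : ℝ} (hε : 0 < ε) {z : ℂ} (h : ε ≤ ‖z‖) : mol ε z = 0 := by
  rw [mol, mol0_zero hε h, mul_zero]

lemma mol_compact {ε : ℝ} (hε : 0 < ε) : HasCompactSupport (mol ε) :=
  (mol0_compact hε).mul_left

lemma mol_int {ε : ℝ} (hε : 0 < ε) : Integrable (mol ε) :=
  (mol_smooth ε).continuous.integrable_of_hasCompactSupport (mol_compact hε)

lemma mol_integral {ε : ℝ} (hε : 0 < ε) : ∫ w, mol ε w = 1 := by
  unfold mol
  rw [integral_const_mul, inv_mul_cancel₀ (mol0_pos hε).ne']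

lemma mol_lintegral {ε : ℝ} (hε : 0 < ε) : ∫⁻ w, ENNReal.ofReal (mol ε w) = 1 := by
  rw [← ofReal_integral_eq_lintegral_ofReal (mol_int hε)
    (Eventually.of_forall (mol_nonneg hε)), mol_integral hε]; simp

lemma mol_radial (ε : ℝ) {z w : ℂ} (h : ‖z‖ = ‖w‖) : mol ε z = mol ε w := by
  simp [mol, mol0, h]

lemma mol_neg (ε : ℝ) (z : ℂ) : mol ε (-z) = mol ε z := mol_radial ε (norm_neg z)

lemma mol_bdd {ε : ℝ} (hε : 0 < ε) : ∃ C : ℝ, 0 < C ∧ ∀ z, mol ε z ≤ C := by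
  obtain ⟨C, hC⟩ := (mol_smooth ε).continuous.bounded_above_of_compact_support (mol_compact hε)
  refine ⟨max C 1, by positivity, fun z => ?_⟩
  exact (Real.le_norm_self _).trans ((hC z).trans (le_max_left _ _))

lemma polar_symm_eq (r θ : ℝ) : Complex.polarCoord.symm (r, θ) = circleMap 0 r θ := by
  rw [Complex.polarCoord_symm_apply, circleMap, Complex.exp_mul_I]
  push_cast; ring

/-- Polar coordinates, lower integral version. -/
lemma lintegral_polar {g : ℂ → ENNReal} (hg : Measurable g) :
    ∫⁻ z, g z = ∫⁻ r in Ioi (0:ℝ), ∫⁻ θ in Ioo (-Real.pi) Real.pi,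
      ENNReal.ofReal r * g (circleMap 0 r θ) := by
  rw [← Complex.lintegral_comp_polarCoord_symm, polarCoord_target, Measure.volume_eq_prod,
    ← Measure.prod_restrict, lintegral_prod]
  · simp_rw [polar_symm_eq]; rfl
  · apply Measurable.aemeasurable
    refine Measurable.smul (ENNReal.measurable_ofReal.comp measurable_fst) (hg.comp ?_)
    have : Continuous (fun p : ℝ × ℝ => Complex.polarCoord.symm p) := by
      simp_rw [Complex.polarCoord_symm_apply]
      fun_prop
    exact this.measurable

/-- Radial weights: comparison. -/
lemma lintegral_radial_le {g : ℂ → ENNReal} (hg : Measurable g) {k : ℂ → ENNReal}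
    (hk : Measurable k) (hkr : ∀ z w : ℂ, ‖z‖ = ‖w‖ → k z = k w) {A : ENNReal} {ε : ℝ}
    (hkε : ∀ z, ε ≤ ‖z‖ → k z = 0)
    (h : ∀ r, 0 < r → r < ε → ∫⁻ θ in Ioo (-Real.pi) Real.pi, g (circleMap 0 r θ)
      ≤ ENNReal.ofReal (2 * Real.pi) * A) :
    ∫⁻ z, k z * g z ≤ (∫⁻ z, k z) * A := by
  have hkg : Measurable (fun z => k z * g z) := hk.mul hg
  rw [lintegral_polar hkg, lintegral_polar hk, ← lintegral_mul_const]
  swap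
  · apply Measurable.lintegral_prod_right' (f := fun p : ℝ × ℝ =>
      ENNReal.ofReal p.1 * k (circleMap 0 p.1 p.2))
    refine Measurable.mul (by fun_prop) (hk.comp ?_)
    unfold circleMap
    fun_prop
  apply setLIntegral_mono' measurableSet_Ioi
  intro r hr
  have hr0 : 0 < r := hr
  have e : ∀ θ, k (circleMap 0 r θ) = k r := fun θ => hkr _ _ (by simp)
  simp_rw [e]
  have m1 : Measurable fun θ => g (circleMap 0 r θ) := hg.comp (by unfold circleMap; fun_prop)
  simp_rw [← mul_assoc]
  rw [lintegral_const_mul _ m1, setLIntegral_const, Real.volume_Ioo]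
  by_cases hre : r < ε
  · calc _ ≤ ENNReal.ofReal r * k r * (ENNReal.ofReal (2 * Real.pi) * A) := by
          gcongr; exact h r hr0 hre
      _ = _ := by
        have : Real.pi - -Real.pi = 2 * Real.pi := by ring
        rw [this]; ring
  · have : k r = 0 := hkε _ (by simp [abs_of_pos hr0]; linarith)
    simp [this]

lemma integral_circle_shift {E : Type*} [NormedAddCommGroup E] [NormedSpace ℝ E]
    (f : ℂ → E) (z : ℂ) (r : ℝ) :
    ∫ θ in Ioo (-Real.pi) Real.pi, f (circleMap z r θ)
      = ∫ θ in (0:ℝ)..(2 * Real.pi), f (circleMap z r θ) := by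
  have hp : Function.Periodic (fun θ => f (circleMap z r θ)) (2 * Real.pi) :=
    (periodic_circleMap z r).comp f
  have := hp.intervalIntegral_add_eq (-Real.pi) 0
  rw [zero_add] at this
  rw [← this, ← integral_Ioc_eq_integral_Ioo, intervalIntegral.integral_of_le]
  · congr 2; ring_nf
  · linarith [Real.pi_pos]

/-- Mean value with radial mollifier. -/
lemma mol_mean {g : ℂ → ℂ} {z : ℂ} {ε R : ℝ} (hε : 0 < ε) (hR : ε < R)
    (hg : DifferentiableOn ℂ g (ball z R)) :
    ∫ ζ, (mol ε ζ : ℂ) * g (z + ζ) = g z := by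
  have key : ∀ f : ℂ → ℂ, ContinuousOn f (ball z R) →
      ∫ ζ, (mol ε ζ : ℂ) * f (z + ζ) = ∫ r in Ioi (0:ℝ), (r * mol ε r : ℂ) *
        ∫ θ in (0:ℝ)..(2 * Real.pi), f (circleMap z r θ) := by
    intro f hf
    set G : ℂ → ℂ := fun ζ => (mol ε ζ : ℂ) * f (z + ζ) with hG
    have hGc : Continuous G := by
      have h1 : ContinuousOn (fun ζ => f (z + ζ)) (ball 0 R) := by
        refine hf.comp (by fun_prop) ?_
        intro ζ hζ; simpa using hζ
      have := mul_cont isOpen_ball h1 (χ := fun ζ => (mol ε ζ : ℂ))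
        (continuous_ofReal.comp (mol_smooth ε).continuous) (by
          have : tsupport (fun ζ => (mol ε ζ : ℂ)) ⊆ closedBall 0 ε := by
            apply closure_minimal _ isClosed_closedBall
            intro ζ hζ
            by_contra hc
            apply hζ
            simp at hc
            simp [mol_zero hε hc.le]
          exact this.trans (closedBall_subset_ball hR))
      simpa [hG, mul_comm] using this
    have hG0 : ∀ ζ, ε ≤ ‖ζ‖ → G ζ = 0 := fun ζ h => by simp [hG, mol_zero hε h]
    rw [← Complex.integral_comp_polarCoord_symm, polarCoord_target, Measure.volume_eq_prod]
    have hpc : Continuous (fun p : ℝ × ℝ => p.1 • G (Complex.polarCoord.symm p)) := by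
      have : Continuous (fun p : ℝ × ℝ => Complex.polarCoord.symm p) := by
        simp_rw [Complex.polarCoord_symm_apply]
        fun_prop
      fun_prop
    have hi1 : IntegrableOn (fun p : ℝ × ℝ => p.1 • G (Complex.polarCoord.symm p))
        (Ioi 0 ×ˢ Ioo (-Real.pi) Real.pi) (volume.prod volume) := by
      have hi2 : IntegrableOn (fun p : ℝ × ℝ => p.1 • G (Complex.polarCoord.symm p))
        (Icc 0 ε ×ˢ Icc (-Real.pi) Real.pi) (volume.prod volume) :=
        hpc.continuousOn.integrableOn_compact (isCompact_Icc.prod isCompact_Icc)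
      refine hi2.of_forall_sdiff_eq_zero (measurableSet_Ioi.prod measurableSet_Ioo) ?_
      rintro ⟨r, θ⟩ ⟨⟨hr, hθ⟩, hn⟩
      have : ε ≤ r := by
        by_contra hc
        push Not at hc
        exact hn ⟨⟨le_of_lt hr, hc.le⟩, ⟨hθ.1.le, hθ.2.le⟩⟩
      simp only
      rw [hG0 _ (by rw [polar_symm_eq]; simp [abs_of_pos (show (0:ℝ) < r from hr), this])]
      simp
    rw [setIntegral_prod _ hi1]
    apply setIntegral_congr_fun measurableSet_Ioi
    intro r hr
    simp only
    rw [← integral_circle_shift, ← integral_const_mul]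
    congr 1
    ext θ
    rw [polar_symm_eq, hG]
    have e1 : mol ε (circleMap 0 r θ) = mol ε r := mol_radial ε (by simp)
    have e2 : z + circleMap 0 r θ = circleMap z r θ := by simp [circleMap]
    simp only [e1, e2, real_smul]; ring
  have h1 : ∫ ζ, (mol ε ζ : ℂ) * g (z + ζ) = ∫ ζ, (mol ε ζ : ℂ) * g z := by
    have k2 := key (fun _ => g z) continuousOn_const
    rw [key g hg.continuousOn, k2]
    apply setIntegral_congr_fun measurableSet_Ioi
    intro r hr
    have hr0 : 0 < r := hr
    simp only
    by_cases hre : r < ε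
    · congr 1
      have hd : DiffContOnCl ℂ g (ball z |r|) := by
        apply DifferentiableOn.diffContOnCl
        rw [abs_of_pos hr0]
        exact hg.mono ((closure_ball_subset_closedBall).trans
          (closedBall_subset_ball (hre.trans hR)))
      have := hd.circleAverage
      rw [Real.circleAverage_def] at this
      rw [← this, intervalIntegral.integral_const, smul_smul]
      rw [sub_zero, mul_inv_cancel₀ (by positivity), one_smul]
    · have : mol ε (r:ℂ) = 0 := mol_zero hε (by simp [abs_of_pos hr0]; linarith)
      simp [this]
  rw [h1, integral_mul_const, integral_complex_ofReal, mol_integral hε]; simp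

end

section
open MeasureTheory Metric Complex Set Filter
open scoped ContDiff Topology

lemma lap_formula {v : ℂ → ℝ} (hv : ContDiff ℝ ∞ v) (z : ℂ) :
    lap v z = (fderiv ℝ (fderiv ℝ v) z 1 1 + fderiv ℝ (fderiv ℝ v) z I I) / 4 := by
  have h1 : ContDiff ℝ ∞ (fderiv ℝ v) := hv.fderiv_right (by simp)
  have e0 : ∀ w u, fderiv ℝ (rc v) w u = ((fderiv ℝ v w u : ℝ) : ℂ) := by
    intro w u
    have : HasFDerivAt (rc v) (ofRealCLM.comp (fderiv ℝ v w)) w :=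
      ofRealCLM.hasFDerivAt.comp w (hv.da w).hasFDerivAt
    rw [this.fderiv]; simp
  have h2 : ∀ u : ℂ, HasFDerivAt (fun w => ((fderiv ℝ v w u : ℝ) : ℂ))
      (ofRealCLM.comp ((fderiv ℝ (fderiv ℝ v) z).flip u)) z := fun u => by
    have := (h1.da z).hasFDerivAt.clm_apply (hasFDerivAt_const u z)
    simp at this
    exact ofRealCLM.hasFDerivAt.comp z this
  have h3 : dzb (rc v) = fun w => (((fderiv ℝ v w 1 : ℝ) : ℂ) + I * ((fderiv ℝ v w I : ℝ) : ℂ))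
      * (1/2 : ℂ) := by
    ext w; rw [dzb, e0, e0]; ring
  have h4 := (((h2 1).add ((h2 I).const_mul I)).mul_const (1/2 : ℂ))
  rw [lap, h3, dz]
  have h5 : fderiv ℝ (fun w => (((fderiv ℝ v w 1 : ℝ) : ℂ) + I * ((fderiv ℝ v w I : ℝ) : ℂ))
      * (1/2 : ℂ)) z = _ := h4.fderiv
  rw [h5]
  simp
  ring

lemma taylor2 {v : ℂ → ℝ} (hv : ContDiff ℝ ∞ v) (z : ℂ) {ε : ℝ} (hε : 0 < ε) :
    ∃ δ > 0, ∀ h : ℂ, ‖h‖ < δ → |v (z + h) - v z - fderiv ℝ v z h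
      - fderiv ℝ (fderiv ℝ v) z h h / 2| ≤ ε * ‖h‖ ^ 2 := by
  have h1 : ContDiff ℝ ∞ (fderiv ℝ v) := hv.fderiv_right (by simp)
  set D2 := fderiv ℝ (fderiv ℝ v) z with hD2
  have hsym : ∀ a b, D2 a b = D2 b a := by
    intro a b
    have := (hv.contDiffAt (x := z)).isSymmSndFDerivAt
      (by simp; exact WithTop.coe_le_coe.2 (le_top (a := (2:ℕ∞))))
    exact this a b
  have h2 : HasFDerivAt (fderiv ℝ v) D2 z := (h1.da z).hasFDerivAt
  rw [hasFDerivAt_iff_isLittleO_nhds_zero] at h2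
  have h3 := h2.def hε
  rw [Metric.eventually_nhds_iff] at h3
  obtain ⟨δ, hδ, h4⟩ := h3
  refine ⟨δ, hδ, fun h hh => ?_⟩
  set k : ℂ → ℝ := fun h => v (z + h) - v z - fderiv ℝ v z h - D2 h h / 2 with hk
  have hkd : ∀ x, HasFDerivAt k (fderiv ℝ v (z + x) - fderiv ℝ v z - D2 x) x := by
    intro x
    have a1 : HasFDerivAt (fun h => v (z + h)) (fderiv ℝ v (z + x)) x := by
      have := (hv.da (z + x)).hasFDerivAt.comp x ((hasFDerivAt_id x).const_add z)
      refine HasFDerivAt.congr_fderiv (f := fun h => v (z + h)) this ?_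
      ext u; simp
    have a2 : HasFDerivAt (fun h => D2 h h / 2) (D2 x) x := by
      have := ((D2.hasFDerivAt (x := x)).clm_apply (hasFDerivAt_id x)).mul_const (1/2 : ℝ)
      have e : (fun h => D2 h h / 2) = fun h => D2 h (id h) * (1/2 : ℝ) := by
        ext h; simp; ring
      rw [e]
      refine this.congr_fderiv ?_
      ext u
      simp [hsym u x]; ring
    have := (((a1.sub_const (v z)).sub (fderiv ℝ v z).hasFDerivAt).sub a2)
    exact this
  have hb : ∀ x ∈ closedBall (0:ℂ) ‖h‖, ‖fderiv ℝ v (z + x) - fderiv ℝ v z - D2 x‖ ≤ ε * ‖h‖ := by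
    intro x hx
    have hx' : ‖x‖ ≤ ‖h‖ := by simpa using hx
    have := @h4 x (by simp; linarith)
    refine this.trans ?_
    gcongr
  have := (convex_closedBall (0:ℂ) ‖h‖).norm_image_sub_le_of_norm_hasFDerivWithin_le
    (fun x _ => (hkd x).hasFDerivWithinAt) hb
    (x := 0) (y := h) (by simp) (by simp)
  have k0 : k 0 = 0 := by simp [hk]
  rw [k0, sub_zero, sub_zero] at this
  rw [Real.norm_eq_abs] at this
  calc _ = |k h| := rfl
    _ ≤ _ := this
    _ = _ := by ring

lemma lap_nonneg_of_submean {v : ℂ → ℝ} (hv : ContDiff ℝ ∞ v) {z : ℂ} {r₀ : ℝ} (hr₀ : 0 < r₀)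
    (h : ∀ r, 0 < r → r < r₀ →
      2 * Real.pi * v z ≤ ∫ θ in (0:ℝ)..(2 * Real.pi), v (circleMap z r θ)) :
    0 ≤ lap v z := by
  rw [lap_formula hv]
  set D2 := fderiv ℝ (fderiv ℝ v) z with hD2
  set a := D2 1 1
  set c := D2 I I
  suffices ∀ ε > 0, -(4 * ε) ≤ a + c by
    have : 0 ≤ a + c := by
      by_contra hc
      push Not at hc
      have := this (-(a + c) / 8) (by linarith)
      linarith
    positivity
  intro ε hε
  obtain ⟨δ, hδ, ht⟩ := taylor2 hv z hε
  set r := min δ r₀ / 2 with hr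
  have hrp : 0 < r := by positivity
  have hrδ : r < δ := by have := min_le_left δ r₀; rw [hr]; linarith
  have hr0 : r < r₀ := by have := min_le_right δ r₀; rw [hr]; linarith
  have hm := h r hrp hr0
  set d1 := fderiv ℝ v z 1
  set d2 := fderiv ℝ v z I
  set b := D2 1 I
  set b' := D2 I 1
  set up : ℝ → ℝ := fun θ => v z + r * (Real.cos θ * d1 + Real.sin θ * d2)
      + r ^ 2 / 2 * (Real.cos θ ^ 2 * a + Real.sin θ * Real.cos θ * (b + b') + Real.sin θ ^ 2 * c)
      + ε * r ^ 2 with hup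
  have hcm : ∀ θ, circleMap z r θ = z + (r * Real.cos θ : ℝ) • (1:ℂ) + (r * Real.sin θ : ℝ) • I := by
    intro θ
    simp [circleMap, Complex.exp_mul_I]; ring
  have hle : ∀ θ, v (circleMap z r θ) ≤ up θ := by
    intro θ
    set k : ℂ := (r * Real.cos θ : ℝ) • (1:ℂ) + (r * Real.sin θ : ℝ) • I with hk
    have e1 : circleMap z r θ = z + k := by rw [hcm, hk, add_assoc]
    have hkn : ‖k‖ = r := by
      have : k = circleMap 0 r θ := by
        have := e1; simp [circleMap] at this ⊢; exact this.symm
      rw [this]; simp [abs_of_pos hrp]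
    have := (abs_le.1 (ht k (by rw [hkn]; exact hrδ))).2
    rw [hkn] at this
    rw [e1]
    have e2 : fderiv ℝ v z k = r * (Real.cos θ * d1 + Real.sin θ * d2) := by
      rw [hk, map_add, map_smul, map_smul]; simp only [smul_eq_mul, d1, d2]; ring
    have e3 : D2 k k = r ^ 2 *
        (Real.cos θ ^ 2 * a + Real.sin θ * Real.cos θ * (b + b') + Real.sin θ ^ 2 * c) := by
      rw [hk]
      simp only [map_add, map_smul, add_apply, smul_apply,
        smul_eq_mul, a, b, b', c]
      ring
    rw [e2, e3] at this
    simp only [hup]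
    linarith
  have cup : Continuous up := by fun_prop
  have cv : Continuous fun θ => v (circleMap z r θ) :=
    hv.continuous.comp (continuous_circleMap z r)
  have hI := intervalIntegral.integral_mono (by positivity : (0:ℝ) ≤ 2 * Real.pi)
    (cv.intervalIntegrable _ _) (cup.intervalIntegrable (μ := volume) _ _) hle
  have hJ : ∫ θ in (0:ℝ)..(2 * Real.pi), up θ
      = 2 * Real.pi * v z + r ^ 2 / 2 * (Real.pi * (a + c)) + 2 * Real.pi * (ε * r ^ 2) := by
    have ii : ∀ f : ℝ → ℝ, Continuous f → IntervalIntegrable f volume 0 (2 * Real.pi) :=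
      fun f hf => hf.intervalIntegrable _ _
    simp only [hup]
    rw [intervalIntegral.integral_add (ii _ (by fun_prop)) (ii _ (by fun_prop)),
      intervalIntegral.integral_add (ii _ (by fun_prop)) (ii _ (by fun_prop)),
      intervalIntegral.integral_add (ii _ (by fun_prop)) (ii _ (by fun_prop)),
      intervalIntegral.integral_const_mul, intervalIntegral.integral_const_mul,
      intervalIntegral.integral_add (ii _ (by fun_prop)) (ii _ (by fun_prop)),
      intervalIntegral.integral_add (ii _ (by fun_prop)) (ii _ (by fun_prop)),
      intervalIntegral.integral_add (ii _ (by fun_prop)) (ii _ (by fun_prop))]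
    simp only [intervalIntegral.integral_mul_const, integral_cos, integral_sin, integral_cos_sq,
      integral_sin_sq, intervalIntegral.integral_const, integral_sin_mul_cos₁]
    simp
    ring
  rw [hJ] at hI
  have h6 := hm.trans hI
  have : 0 ≤ r ^ 2 * Real.pi * ((a + c) / 2 + 2 * ε) := by nlinarith
  have h7 : 0 ≤ (a + c) / 2 + 2 * ε := nonneg_of_mul_nonneg_right this (by positivity)
  linarith

end

section
open MeasureTheory Metric Complex Set Filter
open scoped ContDiff Topology

lemma usc_open {D : Set ℂ} (hD : IsOpen D) {u : ℂ → EReal} (hu : UpperSemicontinuousOn u D)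
    (a : EReal) : IsOpen {z | z ∈ D ∧ u z < a} := by
  rw [isOpen_iff_mem_nhds]
  rintro z ⟨hz, hza⟩
  have := hu z hz a hza
  rw [nhdsWithin_eq_nhds.2 (hD.mem_nhds hz)] at this
  filter_upwards [this, hD.mem_nhds hz] with w h1 h2 using ⟨h2, h1⟩

noncomputable def nn (M : ℝ) (x : EReal) : ENNReal := ((M : EReal) - x).toENNReal

lemma nn_bot (M : ℝ) : nn M ⊥ = ⊤ := by simp [nn]
lemma nn_coe (M x : ℝ) : nn M (x : EReal) = ENNReal.ofReal (M - x) := by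
  rw [nn, ← EReal.coe_sub, EReal.toENNReal_of_ne_top (EReal.coe_ne_top _), EReal.toReal_coe]

lemma nn_top (M : ℝ) : nn M ⊤ = 0 := by simp [nn]

lemma nn_anti (M : ℝ) {x y : EReal} (h : x ≤ y) : nn M y ≤ nn M x :=
  EReal.toENNReal_le_toENNReal (EReal.sub_le_sub le_rfl h)

lemma nn_change (M M' : ℝ) (x : EReal) : nn M x ≤ nn M' x + ENNReal.ofReal (M - M') := by
  induction x with
  | bot => simp [nn_bot]
  | top => simp [nn_top]
  | coe x =>
    rw [nn_coe, nn_coe]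
    refine le_trans ?_ ENNReal.ofReal_add_le
    apply ENNReal.ofReal_le_ofReal; linarith

lemma nn_iSup (M : ℝ) (N : ℕ) (hN : -M ≤ N) {x : EReal} (hx : x ≤ M) :
    nn M x = ⨆ n : ℕ, ENNReal.ofReal (M - (max x ((-((n + N : ℕ) : ℝ) : ℝ) : EReal)).toReal) := by
  apply le_antisymm
  · induction x with
    | bot =>
      rw [nn_bot]
      refine le_of_eq (Eq.symm ?_)
      rw [iSup_eq_top]
      intro b hb
      obtain ⟨k, hk⟩ := ENNReal.exists_nat_gt hb.ne
      refine ⟨k, hk.trans_le ?_⟩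
      rw [max_eq_right bot_le, EReal.toReal_coe, ← ENNReal.ofReal_natCast]
      apply ENNReal.ofReal_le_ofReal; push_cast; linarith
    | top => simp [nn_top]
    | coe x =>
      obtain ⟨k, hk⟩ := exists_nat_gt (-x)
      refine le_iSup_of_le k ?_
      rw [max_eq_left, EReal.toReal_coe, nn_coe]
      rw [EReal.coe_le_coe_iff]; push_cast
      have : (0:ℝ) ≤ N := Nat.cast_nonneg _
      linarith
  · refine iSup_le fun n => ?_
    have h1 : max x ((-((n + N : ℕ) : ℝ) : ℝ) : EReal) ≠ ⊤ := by
      apply ne_top_of_le_ne_top (EReal.coe_ne_top (max M (-((n + N : ℕ) : ℝ))))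
      rw [EReal.coe_strictMono.monotone.map_max]
      exact max_le_max hx le_rfl
    have h2 : max x ((-((n + N : ℕ) : ℝ) : ℝ) : EReal) ≠ ⊥ :=
      ne_bot_of_le_ne_bot (EReal.coe_ne_bot _) (le_max_right _ _)
    rw [← nn_coe, EReal.coe_toReal h1 h2]
    exact nn_anti M (le_max_left _ _)

lemma nn_meas (M : ℝ) : Measurable (nn M) :=
  Antitone.measurable fun _ _ h => nn_anti M h

noncomputable def NN (K : Set ℂ) (M : ℝ) (u : ℂ → EReal) : ℂ → ENNReal :=
  K.indicator (fun z => nn M (u z))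

open Classical in
noncomputable def extU (K : Set ℂ) (u : ℂ → EReal) (z : ℂ) : EReal := if z ∈ K then u z else ⊤

lemma ext_meas {D K : Set ℂ} (hD : IsOpen D) (hK : MeasurableSet K) (hKD : K ⊆ D) {u : ℂ → EReal}
    (hu : UpperSemicontinuousOn u D) : Measurable (extU K u) := by
  apply measurable_of_Iio
  intro a
  have : extU K u ⁻¹' Iio a = K ∩ {z | z ∈ D ∧ u z < a} := by
    ext z
    by_cases hz : z ∈ K
    · simp [extU, hz, hKD hz]
    · simp [extU, hz]
  rw [this]
  exact hK.inter (usc_open hD hu a).measurableSet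

lemma NN_ext (K : Set ℂ) (M : ℝ) (u : ℂ → EReal) : NN K M u = fun z => nn M (extU K u z) := by
  ext z
  by_cases hz : z ∈ K
  · simp [NN, extU, hz]
  · simp [NN, extU, hz, nn_top]

lemma NN_meas {D K : Set ℂ} (hD : IsOpen D) (hK : MeasurableSet K) (hKD : K ⊆ D) {u : ℂ → EReal}
    (hu : UpperSemicontinuousOn u D) (M : ℝ) : Measurable (NN K M u) := by
  rw [NN_ext]; exact (nn_meas M).comp (ext_meas hD hK hKD hu)

lemma NN_circle {D K : Set ℂ} (hD : IsOpen D) (hK : MeasurableSet K) (hKD : K ⊆ D) {u : ℂ → EReal}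
    (hu : SubharmonicOnE u D) {M : ℝ} (hM : ∀ z ∈ K, u z ≤ M) {z : ℂ} {r : ℝ} (hr : 0 < r)
    (hz : closedBall z r ⊆ K) :
    ∫⁻ θ in Ioo (-Real.pi) Real.pi, NN K M u (circleMap z r θ)
      ≤ ENNReal.ofReal (2 * Real.pi) * NN K M u z := by
  have hzK : z ∈ K := hz (mem_closedBall_self hr.le)
  have hcK : ∀ θ, circleMap z r θ ∈ K := fun θ => hz (circleMap_mem_closedBall z hr.le θ)
  have hav := hu.2.2.2 z (hKD hzK) r hr (hz.trans hKD)
  have e1 : NN K M u z = nn M (u z) := by simp [NN, hzK]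
  rw [e1]
  have hpi : ENNReal.ofReal (2 * Real.pi) ≠ 0 := by
    simp [Real.pi_pos]
  induction hx : u z with
  | bot => rw [nn_bot, ENNReal.mul_top hpi]; exact le_top
  | top => exact absurd hx (hu.2.1 z (hKD hzK))
  | coe x =>
    obtain ⟨N, hN⟩ := exists_nat_ge (-M)
    set g : ℕ → ℝ → ℝ := fun n θ =>
      (max (extU K u (circleMap z r θ)) ((-((n + N : ℕ) : ℝ) : ℝ) : EReal)).toReal with hg
    have hext : ∀ θ, extU K u (circleMap z r θ) = u (circleMap z r θ) := fun θ => by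
      simp [extU, hcK θ]
    have hgm : ∀ n, Measurable (g n) := fun n =>
      measurable_ereal_toReal.comp (((ext_meas hD hK hKD hu.1).comp
        (continuous_circleMap z r).measurable).max measurable_const)
    have hgb : ∀ n θ, -((n + N : ℕ) : ℝ) ≤ g n θ ∧ g n θ ≤ M := by
      intro n θ
      have hle : max (extU K u (circleMap z r θ)) ((-((n + N : ℕ) : ℝ) : ℝ) : EReal) ≤ M := by
        rw [hext]
        refine max_le (hM _ (hcK θ)) ?_
        rw [EReal.coe_le_coe_iff]; push_cast
        have : (0:ℝ) ≤ n := Nat.cast_nonneg _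
        linarith
      have h1 : max (extU K u (circleMap z r θ)) ((-((n + N : ℕ) : ℝ) : ℝ) : EReal) ≠ ⊤ :=
        ne_top_of_le_ne_top (EReal.coe_ne_top M) hle
      have h2 : max (extU K u (circleMap z r θ)) ((-((n + N : ℕ) : ℝ) : ℝ) : EReal) ≠ ⊥ :=
        ne_bot_of_le_ne_bot (EReal.coe_ne_bot _) (le_max_right _ _)
      constructor
      · rw [← EReal.coe_le_coe_iff, EReal.coe_toReal h1 h2]; exact le_max_right _ _
      · rw [← EReal.coe_le_coe_iff, EReal.coe_toReal h1 h2]; exact hle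
    have hgmono : ∀ θ, Antitone fun n => g n θ := by
      intro θ n m hnm
      have : ∀ n, max (extU K u (circleMap z r θ)) ((-((n + N : ℕ) : ℝ) : ℝ) : EReal) ≤
          ((max M (-((n + N : ℕ) : ℝ)) : ℝ) : EReal) := fun n => by
        rw [EReal.coe_strictMono.monotone.map_max, hext]; exact max_le_max (hM _ (hcK θ)) le_rfl
      apply EReal.toReal_le_toReal
      · apply max_le_max le_rfl
        rw [EReal.coe_le_coe_iff]; push_cast
        have : (n:ℝ) ≤ m := by exact_mod_cast hnm
        linarith
      · exact ne_bot_of_le_ne_bot (EReal.coe_ne_bot _) (le_max_right _ _)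
      · exact ne_top_of_le_ne_top (EReal.coe_ne_top _) (this n)
    have hLHS : ∫⁻ θ in Ioo (-Real.pi) Real.pi, NN K M u (circleMap z r θ)
        = ⨆ n, ∫⁻ θ in Ioo (-Real.pi) Real.pi, ENNReal.ofReal (M - g n θ) := by
      rw [← lintegral_iSup]
      · apply lintegral_congr
        intro θ
        have : NN K M u (circleMap z r θ) = nn M (extU K u (circleMap z r θ)) := by rw [NN_ext]
        rw [this, nn_iSup M N hN]
        rw [hext]; exact hM _ (hcK θ)
      · intro n
        exact ENNReal.measurable_ofReal.comp (measurable_const.sub (hgm n))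
      · intro n m hnm θ
        apply ENNReal.ofReal_le_ofReal
        have := hgmono θ hnm
        simp only at this; linarith
    rw [hLHS]
    refine iSup_le fun n => ?_
    rw [nn_coe, ← ENNReal.ofReal_mul (by positivity)]
    have hint : IntegrableOn (fun θ => M - g n θ) (Ioo (-Real.pi) Real.pi) := by
      apply Measure.integrableOn_of_bounded (M := M + (n + N : ℕ)) (by simp)
        (measurable_const.sub (hgm n)).aestronglyMeasurable
      refine Eventually.of_forall fun θ => ?_
      have := hgb n θ
      change ‖M - g n θ‖ ≤ _
      rw [Real.norm_eq_abs, abs_le]; constructor <;> linarith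
    rw [← ofReal_integral_eq_lintegral_ofReal hint]
    swap
    · exact Eventually.of_forall fun θ => by have := (hgb n θ).2; simp; linarith
    apply ENNReal.ofReal_le_ofReal
    have hint2 : IntegrableOn (g n) (Ioo (-Real.pi) Real.pi) := by
      apply Measure.integrableOn_of_bounded (M := |M| + (n + N : ℕ)) (by simp)
        (hgm n).aestronglyMeasurable
      refine Eventually.of_forall fun θ => ?_
      have := hgb n θ
      have h3 := le_abs_self M
      have h4 := abs_nonneg M
      have h5 : (0:ℝ) ≤ (n + N : ℕ) := Nat.cast_nonneg _
      rw [Real.norm_eq_abs, abs_le]; constructor <;> linarith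
    rw [integral_sub (by simp) hint2]
    have e2 : ∫ θ in Ioo (-Real.pi) Real.pi, g n θ = ∫ θ in (0:ℝ)..(2 * Real.pi),
        (max (u (circleMap z r θ)) ((-((n + N : ℕ) : ℝ) : ℝ) : EReal)).toReal := by
      have := integral_circle_shift (fun w => (max (extU K u w)
        ((-((n + N : ℕ) : ℝ) : ℝ) : EReal)).toReal) z r
      rw [hg]
      simp only
      rw [this]
      simp_rw [hext]
    rw [e2]
    have h6 : u z ≤ _ := hav.trans (iInf_le _ (n + N))
    rw [hx, EReal.coe_le_coe_iff, ← div_eq_inv_mul, le_div_iff₀ (by positivity)] at h6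
    rw [setIntegral_const, measureReal_def, Real.volume_Ioo, ENNReal.toReal_ofReal (by linarith [Real.pi_pos]), smul_eq_mul]
    linarith

end

section
open MeasureTheory Metric Complex Set Filter
open scoped ContDiff Topology

lemma NN_mol {D K : Set ℂ} (hD : IsOpen D) (hK : MeasurableSet K) (hKD : K ⊆ D) {u : ℂ → EReal}
    (hu : SubharmonicOnE u D) {M : ℝ} (hM : ∀ z ∈ K, u z ≤ M) {z : ℂ} {ε : ℝ} (hε : 0 < ε)
    (hz : closedBall z ε ⊆ K) :
    ∫⁻ ζ, ENNReal.ofReal (mol ε ζ) * NN K M u (z + ζ) ≤ NN K M u z := by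
  have := lintegral_radial_le (g := fun ζ => NN K M u (z + ζ))
    ((NN_meas hD hK hKD hu.1 M).comp (measurable_const_add z))
    (k := fun ζ => ENNReal.ofReal (mol ε ζ))
    (ENNReal.measurable_ofReal.comp (mol_smooth ε).continuous.measurable)
    (fun a b h => by simp only [mol_radial ε h]) (A := NN K M u z) (ε := ε)
    (fun a h => by simp only [mol_zero hε h, ENNReal.ofReal_zero]) ?_
  · rwa [mol_lintegral hε, one_mul] at this
  · intro r hr hrε
    have h := NN_circle hD hK hKD hu hM (z := z) hr ((closedBall_subset_closedBall hrε.le).trans hz)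
    have e : ∀ θ, z + circleMap 0 r θ = circleMap z r θ := fun θ => by simp [circleMap]
    simpa only [e] using h

lemma NN_ball {D K : Set ℂ} (hD : IsOpen D) (hK : MeasurableSet K) (hKD : K ⊆ D) {u : ℂ → EReal}
    (hu : SubharmonicOnE u D) {M : ℝ} (hM : ∀ z ∈ K, u z ≤ M) {z : ℂ} {ε : ℝ} (hε : 0 < ε)
    (hz : closedBall z ε ⊆ K) :
    ∫⁻ w in ball z ε, NN K M u w ≤ volume (ball (0:ℂ) ε) * NN K M u z := by
  have := lintegral_radial_le (g := fun ζ => NN K M u (z + ζ))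
    ((NN_meas hD hK hKD hu.1 M).comp (measurable_const_add z))
    (k := (ball (0:ℂ) ε).indicator 1)
    (measurable_one.indicator measurableSet_ball)
    (fun a b h => by simp [indicator, h]) (A := NN K M u z) (ε := ε)
    (fun a h => by simp [h]) ?_
  · rw [lintegral_indicator_one measurableSet_ball] at this
    refine le_trans (le_of_eq ?_) this
    rw [← lintegral_indicator measurableSet_ball, ← lintegral_add_left_eq_self _ z]
    apply lintegral_congr
    intro w
    by_cases hw : ‖w‖ < ε <;> simp [indicator, hw]
  · intro r hr hrε
    have h := NN_circle hD hK hKD hu hM (z := z) hr ((closedBall_subset_closedBall hrε.le).trans hz)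
    have e : ∀ θ, z + circleMap 0 r θ = circleMap z r θ := fun θ => by simp [circleMap]
    simpa only [e] using h

lemma usc_bound {D K : Set ℂ} (hK : IsCompact K) (hKD : K ⊆ D) {u : ℂ → EReal}
    (hu : SubharmonicOnE u D) :
    ∃ M : ℝ, (∀ z ∈ K, u z ≤ M) ∧ ((∀ z ∈ D, u z < 0) → M < 0) := by
  rcases K.eq_empty_or_nonempty with h | h
  · exact ⟨-1, by simp [h], by norm_num⟩
  obtain ⟨x, hx, hm⟩ := (hu.1.mono hKD).exists_isMaxOn h hK
  induction hux : u x with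
  | bot => exact ⟨-1, fun z hz => by have := hm hz; simp [hux] at this; simp [this], by norm_num⟩
  | top => exact absurd hux (hu.2.1 x (hKD hx))
  | coe y => exact ⟨y, fun z hz => by have := hm hz; rw [← hux]; exact this,
      fun h0 => by have := h0 x (hKD hx); rw [hux] at this; exact_mod_cast this⟩

lemma fin_of_point {D : Set ℂ} (hD : IsOpen D) {u : ℂ → EReal} (hu : SubharmonicOnE u D) {w : ℂ}
    {ρ : ℝ} (hρ : 0 < ρ) (hw : closedBall w ρ ⊆ D) (huw : u w ≠ ⊥) :
    ∫⁻ z in ball w ρ, nn 0 (u z) < ⊤ := by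
  obtain ⟨M, hM, -⟩ := usc_bound (isCompact_closedBall w ρ) hw hu
  have h1 := NN_ball hD measurableSet_closedBall hw hu hM hρ subset_rfl
  have h2 : ∫⁻ z in ball w ρ, nn 0 (u z) ≤ ∫⁻ z in ball w ρ, (NN (closedBall w ρ) M u z
      + ENNReal.ofReal (0 - M)) := by
    apply setLIntegral_mono' measurableSet_ball
    intro z hz
    have : NN (closedBall w ρ) M u z = nn M (u z) := by
      simp [NN, ball_subset_closedBall hz]
    rw [this]; exact nn_change 0 M _
  refine h2.trans_lt ?_
  rw [lintegral_add_right _ measurable_const]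
  refine ENNReal.add_lt_top.2 ⟨h1.trans_lt ?_, ?_⟩
  · apply ENNReal.mul_lt_top measure_ball_lt_top
    have hwm : w ∈ closedBall w ρ := mem_closedBall_self hρ.le
    have : NN (closedBall w ρ) M u w = nn M (u w) := by simp [NN, hρ.le]
    rw [this]
    induction hh : u w with
    | bot => exact absurd hh huw
    | top => exact absurd hh (hu.2.1 w (hw hwm))
    | coe y => rw [nn_coe]; exact ENNReal.ofReal_lt_top
  · rw [lintegral_const]
    apply ENNReal.mul_lt_top ENNReal.ofReal_lt_top
    simpa using measure_ball_lt_top (μ := volume) (x := w) (r := ρ)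

lemma loc_fin {D : Set ℂ} (hD : IsOpen D) (hc : IsPreconnected D) {u : ℂ → EReal}
    (hu : SubharmonicOnE u D) :
    ∀ z ∈ D, ∃ r > 0, ball z r ⊆ D ∧ ∫⁻ w in ball z r, nn 0 (u w) < ⊤ := by
  set A : Set ℂ := {z | ∃ r > 0, ball z r ⊆ D ∧ ∫⁻ w in ball z r, nn 0 (u w) < ⊤} with hA
  have hopen : IsOpen A := by
    rw [Metric.isOpen_iff]
    rintro z ⟨r, hr, h1, h2⟩
    refine ⟨r / 2, by positivity, fun y hy => ?_⟩
    have hs : ball y (r / 2) ⊆ ball z r := by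
      apply ball_subset_ball'
      rw [mem_ball] at hy; linarith
    exact ⟨r / 2, by positivity, hs.trans h1, (lintegral_mono_set hs).trans_lt h2⟩
  have hpt : ∀ w ∈ D, u w ≠ ⊥ → w ∈ A := by
    intro w hw huw
    obtain ⟨ρ, hρ, h⟩ := Metric.nhds_basis_closedBall.mem_iff.1 (hD.mem_nhds hw)
    exact ⟨ρ, hρ, ball_subset_closedBall.trans h, fin_of_point hD hu hρ h huw⟩
  have : D ⊆ A := by
    apply hc.subset_of_closure_inter_subset hopen
    · obtain ⟨w, hw, huw⟩ := hu.2.2.1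
      exact ⟨w, hw, hpt w hw huw⟩
    · rintro z ⟨hz, hzD⟩
      obtain ⟨R, hR, h⟩ := Metric.nhds_basis_closedBall.mem_iff.1 (hD.mem_nhds hzD)
      obtain ⟨a, ⟨r, hr, h1, h2⟩, ha⟩ := Metric.mem_closure_iff.1 hz (R / 4) (by positivity)
      have : ∃ w ∈ ball a (min r (R / 8)), u w ≠ ⊥ := by
        by_contra hcon
        push Not at hcon
        have h3 : ∫⁻ w in ball a (min r (R / 8)), nn 0 (u w)
            = ∫⁻ w in ball a (min r (R / 8)), ⊤ := by
          apply setLIntegral_congr_fun measurableSet_ball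
          intro w hw
          simp only [hcon w hw, nn_bot]
        have h4 := (lintegral_mono_set (μ := volume) (f := fun w => nn 0 (u w))
          (ball_subset_ball (x := a) (min_le_left r (R / 8)))).trans_lt h2
        rw [h3, lintegral_const, ENNReal.top_mul] at h4
        · exact absurd h4 (lt_irrefl _)
        · simpa using (measure_ball_pos volume a (show 0 < min r (R / 8) by positivity)).ne'
      obtain ⟨w, hw, huw⟩ := this
      rw [mem_ball] at hw
      have hw2 : dist w a < R / 8 := hw.trans_le (min_le_right _ _)
      have hwz : dist w z < R / 2 := by
        have := dist_triangle w a z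
        rw [dist_comm z a] at ha; linarith
      have hs : closedBall w (R / 2) ⊆ closedBall z R := by
        apply closedBall_subset_closedBall'; linarith
      have hf := fin_of_point hD hu (show 0 < R / 2 by positivity) (hs.trans h) huw
      have hd : 0 < R / 2 - dist w z := by linarith
      have hs2 : ball z (R / 2 - dist w z) ⊆ ball w (R / 2) := by
        apply ball_subset_ball'; rw [dist_comm z w]; linarith
      exact ⟨_, hd, hs2.trans (ball_subset_closedBall.trans (hs.trans h)),
        (lintegral_mono_set hs2).trans_lt hf⟩
  exact fun z hz => this hz

lemma cpt_fin {D : Set ℂ} (hD : IsOpen D) (hc : IsPreconnected D) {u : ℂ → EReal}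
    (hu : SubharmonicOnE u D) {K : Set ℂ} (hK : IsCompact K) (hKD : K ⊆ D) (M : ℝ) :
    ∫⁻ z in K, nn M (u z) < ⊤ := by
  have h0 : ∫⁻ z in K, nn 0 (u z) < ⊤ := by
    rw [← withDensity_apply _ hK.measurableSet]
    apply hK.measure_lt_top_of_nhdsWithin
    intro x hx
    obtain ⟨r, hr, h1, h2⟩ := loc_fin hD hc hu x (hKD hx)
    refine ⟨ball x r, mem_nhdsWithin_of_mem_nhds (ball_mem_nhds x hr), ?_⟩
    rwa [withDensity_apply _ measurableSet_ball]
  calc _ ≤ ∫⁻ z in K, (nn 0 (u z) + ENNReal.ofReal (M - 0)) :=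
        lintegral_mono fun z => nn_change M 0 _
    _ = (∫⁻ z in K, nn 0 (u z)) + ENNReal.ofReal (M - 0) * volume K := by
        rw [lintegral_add_right _ measurable_const, lintegral_const]; simp
    _ < ⊤ := ENNReal.add_lt_top.2 ⟨h0, ENNReal.mul_lt_top ENNReal.ofReal_lt_top hK.measure_lt_top⟩

lemma subh_ne_bot {D : Set ℂ} (hD : IsOpen D) (hc : IsPreconnected D) {u : ℂ → EReal}
    (hu : SubharmonicOnE u D) : ∀ᵐ z ∂(volume.restrict D), u z ≠ ⊥ := by
  have h1 : MeasurableSet {z | z ∈ D ∧ u z = ⊥} := by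
    have : {z | z ∈ D ∧ u z = ⊥} = ⋂ n : ℕ, {z | z ∈ D ∧ u z < ((-(n:ℝ) : ℝ) : EReal)} := by
      ext z
      simp only [mem_ofPred_eq, mem_iInter]
      constructor
      · rintro ⟨h1, h2⟩ n
        exact ⟨h1, by rw [h2]; exact EReal.bot_lt_coe _⟩
      · intro h
        refine ⟨(h 0).1, ?_⟩
        rw [EReal.eq_bot_iff_forall_lt]
        intro y
        obtain ⟨n, hn⟩ := exists_nat_gt (-y)
        refine (h n).2.trans ?_
        rw [EReal.coe_lt_coe_iff]; linarith
    rw [this]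
    exact MeasurableSet.iInter fun n => (usc_open hD hu.1 _).measurableSet
  rw [ae_iff, Measure.restrict_apply₀']
  swap
  · exact hD.measurableSet.nullMeasurableSet
  have e : {a | ¬ u a ≠ ⊥} ∩ D = {z | z ∈ D ∧ u z = ⊥} := by
    ext z; simp [and_comm]
  rw [e]
  apply measure_null_of_locally_null
  rintro z ⟨hz, -⟩
  obtain ⟨r, hr, h2, h3⟩ := loc_fin hD hc hu z hz
  refine ⟨{z | z ∈ D ∧ u z = ⊥} ∩ ball z r, ?_, ?_⟩
  · exact inter_mem self_mem_nhdsWithin (mem_nhdsWithin_of_mem_nhds (ball_mem_nhds z hr))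
  · by_contra hne
    have h4 : ∫⁻ w in {z | z ∈ D ∧ u z = ⊥} ∩ ball z r, nn 0 (u w) = ⊤ := by
      have : ∫⁻ w in {z | z ∈ D ∧ u z = ⊥} ∩ ball z r, nn 0 (u w) =
          ∫⁻ w in {z | z ∈ D ∧ u z = ⊥} ∩ ball z r, ⊤ := by
        apply setLIntegral_congr_fun (h1.inter measurableSet_ball)
        rintro w ⟨⟨-, hw⟩, -⟩
        simp only [hw, nn_bot]
      rw [this, lintegral_const, ENNReal.top_mul (by simpa using hne)]
    have h5 := (lintegral_mono_set (μ := volume) (f := fun w => nn 0 (u w))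
          (inter_subset_right (s := {z | z ∈ D ∧ u z = ⊥}) (t := ball z r))).trans_lt h3
    rw [h4] at h5
    exact absurd h5 (lt_irrefl _)

end

section
open MeasureTheory Metric Complex Set Filter
open scoped ContDiff Topology Convolution

/-- smoothing by convolution with the radial mollifier -/
noncomputable def smo (n : ℂ → ℝ) (ε : ℝ) (x : ℂ) : ℝ := ∫ t, mol ε t * n (x + t)

lemma smo_eq (n : ℂ → ℝ) (ε : ℝ) : smo n ε = (mol ε) ⋆[ContinuousLinearMap.lsmul ℝ ℝ, volume] n := by
  ext x
  rw [smo, convolution_def, ← integral_neg_eq_self]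
  apply integral_congr_ae
  refine Eventually.of_forall fun t => ?_
  simp [mol_neg, sub_eq_add_neg]

lemma smo_smooth {n : ℂ → ℝ} (hn : Integrable n) {ε : ℝ} (hε : 0 < ε) : ContDiff ℝ ∞ (smo n ε) := by
  rw [smo_eq]
  exact (mol_compact hε).contDiff_convolution_left _ (mol_smooth ε) hn.locallyIntegrable

lemma smo_int {n : ℂ → ℝ} (hn : Integrable n) {ε : ℝ} (hε : 0 < ε) (x : ℂ) :
    Integrable (fun t => mol ε t * n (x + t)) := by
  obtain ⟨C, hC, hb⟩ := mol_bdd hε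
  apply (hn.comp_add_left x).bdd_mul (c := C) (mol_smooth ε).continuous.aestronglyMeasurable
  refine Eventually.of_forall fun t => ?_
  rw [Real.norm_eq_abs, abs_of_nonneg (mol_nonneg hε t)]; exact hb t

lemma smo_lint {N : ℂ → ENNReal} (hN : Measurable N) (hfin : ∫⁻ z, N z < ⊤) {ε : ℝ} (hε : 0 < ε)
    (x : ℂ) : ENNReal.ofReal (smo (fun z => (N z).toReal) ε x)
      = ∫⁻ t, ENNReal.ofReal (mol ε t) * N (x + t) := by
  have hn : Integrable (fun z => (N z).toReal) := integrable_toReal_of_lintegral_ne_top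
    hN.aemeasurable hfin.ne
  rw [smo, ofReal_integral_eq_lintegral_ofReal (smo_int hn hε x)]
  · apply lintegral_congr_ae
    have h1 : ∀ᵐ z, N z < ⊤ := ae_lt_top hN hfin.ne
    have h2 : ∀ᵐ t, N (x + t) < ⊤ := (measurePreserving_add_left volume x).quasiMeasurePreserving.ae h1
    filter_upwards [h2] with t ht
    rw [ENNReal.ofReal_mul (mol_nonneg hε t), ENNReal.ofReal_toReal ht.ne]
  · exact Eventually.of_forall fun t => mul_nonneg (mol_nonneg hε t) ENNReal.toReal_nonneg

lemma smo_nonneg {N : ℂ → ENNReal} {ε : ℝ} (hε : 0 < ε)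
    (x : ℂ) : 0 ≤ smo (fun z => (N z).toReal) ε x :=
  integral_nonneg fun t => mul_nonneg (mol_nonneg hε t) ENNReal.toReal_nonneg

lemma subh_approx {D : Set ℂ} (hD : IsOpen D) (hc : IsPreconnected D) {u : ℂ → EReal}
    (hu : SubharmonicOnE u D) {K : Set ℂ} (hK : IsCompact K) (hKD : K ⊆ D) :
    ∃ O : Set ℂ, IsOpen O ∧ K ⊆ O ∧ O ⊆ D ∧ ∃ M : ℝ, ((∀ z ∈ D, u z < 0) → M < 0) ∧
    ∃ v : ℕ → ℂ → ℝ, (∀ n, ContDiff ℝ ∞ (v n)) ∧ (∀ n z, v n z ≤ M) ∧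
      (∀ n, ∀ z ∈ O, 0 ≤ lap (v n) z) ∧ (∀ n, ∀ z ∈ O, u z ≤ (v n z : EReal)) ∧
      (∀ z ∈ O, u z ≠ ⊥ → Tendsto (fun n => v n z) atTop (𝓝 (u z).toReal)) := by
  obtain ⟨δ, hδ, hsub⟩ := hK.exists_cthickening_subset_open hD hKD
  set K' := cthickening δ K with hK'
  have hK'c : IsCompact K' := hK.cthickening
  obtain ⟨M, hM, hM0⟩ := usc_bound hK'c hsub hu
  set O := thickening (δ / 2) K with hO
  have hOb : ∀ z ∈ O, ∀ s, s ≤ δ / 2 → closedBall z s ⊆ K' := by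
    intro z hz s hs w hw
    obtain ⟨k, hk, hzk⟩ := mem_thickening_iff.1 hz
    apply mem_cthickening_of_dist_le w k δ K hk
    have := dist_triangle w z k
    rw [mem_closedBall] at hw; linarith
  set N := NN K' M u with hN
  have hNm : Measurable N := NN_meas hD hK'c.measurableSet hsub hu.1 M
  have hNf : ∫⁻ z, N z < ⊤ := by
    rw [hN, NN, lintegral_indicator hK'c.measurableSet]
    exact cpt_fin hD hc hu hK'c hsub M
  have hn : Integrable (fun z => (N z).toReal) := integrable_toReal_of_lintegral_ne_top
    hNm.aemeasurable hNf.ne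
  set e : ℕ → ℝ := fun n => δ / 8 / (n + 1) with he
  have hep : ∀ n, 0 < e n := fun n => by simp only [he]; positivity
  have hele : ∀ n, e n ≤ δ / 8 := fun n => by
    simp only [he]; apply div_le_self (by positivity); linarith [(Nat.cast_nonneg n : (0:ℝ) ≤ n)]
  have hOK : O ⊆ K' := fun z hz => hOb z hz 0 (by positivity) (by simp)
  have hNO : ∀ z ∈ K', N z = nn M (u z) := fun z hz => by simp [hN, NN, hz]
  have hle : ∀ n, ∀ z ∈ O, u z ≤ ((M - smo (fun z => (N z).toReal) (e n) z : ℝ) : EReal) := by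
    intro n z hz
    have h1 := NN_mol hD hK'c.measurableSet hsub hu hM (z := z) (hep n) (hOb z hz _ (by linarith [hele n]))
    rw [← hN, ← smo_lint hNm hNf (hep n), hNO z (hOK hz)] at h1
    have h2 := hM z (hOK hz)
    induction hx : u z with
    | bot => exact bot_le
    | top => exact absurd hx (hu.2.1 z (hsub (hOK hz)))
    | coe x =>
      rw [hx] at h1 h2
      rw [nn_coe, ENNReal.ofReal_le_ofReal_iff (by have := EReal.coe_le_coe_iff.1 h2; linarith)] at h1
      rw [EReal.coe_le_coe_iff]; linarith
  refine ⟨O, isOpen_thickening, self_subset_thickening (by positivity) K, hOK.trans hsub, M, hM0,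
    fun n z => M - smo (fun z => (N z).toReal) (e n) z, fun n => contDiff_const.sub (smo_smooth hn (hep n)),
    fun n z => by linarith [smo_nonneg (N := N) (hep n) z], fun n z hz => ?_, hle, ?_⟩
  · apply lap_nonneg_of_submean (contDiff_const.sub (smo_smooth hn (hep n))) (r₀ := δ / 8) (by positivity)
    intro r hr hr8
    have hcs : Continuous fun θ => smo (fun z => (N z).toReal) (e n) (circleMap z r θ) :=
      (smo_smooth hn (hep n)).continuous.comp (continuous_circleMap z r)
    rw [intervalIntegral.integral_sub (by simp) (hcs.intervalIntegrable _ _)]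
    simp only [intervalIntegral.integral_const, sub_zero, smul_eq_mul]
    suffices ∫ θ in (0:ℝ)..2 * Real.pi, smo (fun z => (N z).toReal) (e n) (circleMap z r θ)
        ≤ 2 * Real.pi * smo (fun z => (N z).toReal) (e n) z by linarith
    rw [← integral_circle_shift]
    have hio : IntegrableOn (fun θ => smo (fun z => (N z).toReal) (e n) (circleMap z r θ))
        (Ioo (-Real.pi) Real.pi) :=
      (hcs.continuousOn.integrableOn_compact (isCompact_Icc (a := -Real.pi) (b := Real.pi))).mono_set Ioo_subset_Icc_self
    rw [← ENNReal.ofReal_le_ofReal_iff (mul_nonneg (by positivity) (smo_nonneg (hep n) z)),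
      ofReal_integral_eq_lintegral_ofReal hio (Eventually.of_forall fun θ => smo_nonneg (hep n) _),
      ENNReal.ofReal_mul (by positivity)]
    simp_rw [smo_lint hNm hNf (hep n)]
    have hcm : Continuous fun p : ℝ × ℂ => circleMap z r p.1 + p.2 :=
      ((continuous_circleMap z r).comp continuous_fst).add continuous_snd
    have hmm : Measurable fun t => ENNReal.ofReal (mol (e n) t) :=
      ENNReal.measurable_ofReal.comp (mol_smooth _).continuous.measurable
    rw [lintegral_lintegral_swap]
    swap
    · apply Measurable.aemeasurable
      exact (hmm.comp measurable_snd).mul (hNm.comp hcm.measurable)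
    rw [← lintegral_const_mul]
    swap
    · exact hmm.mul (hNm.comp (measurable_const_add z))
    apply lintegral_mono
    intro t
    simp only
    rw [lintegral_const_mul]
    swap
    · exact hNm.comp ((continuous_circleMap z r).add continuous_const).measurable
    rcases le_or_gt (e n) ‖t‖ with ht | ht
    · rw [mol_zero (hep n) ht]; simp
    have hcb : closedBall (z + t) r ⊆ K' := by
      refine subset_trans ?_ (hOb z hz (δ / 4) (by linarith))
      apply closedBall_subset_closedBall'
      rw [dist_eq_norm, add_sub_cancel_left]; linarith [hele n]
    have h1 := NN_circle hD hK'c.measurableSet hsub hu hM hr hcb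
    have e1 : ∀ θ, circleMap (z + t) r θ = circleMap z r θ + t := fun θ => by
      simp [circleMap]; ring
    simp only [e1] at h1
    calc _ ≤ ENNReal.ofReal (mol (e n) t) * (ENNReal.ofReal (2 * Real.pi) * N (z + t)) :=
          mul_le_mul_right h1 _
      _ = _ := by ring
  · intro z hz hzb
    have hzt := hu.2.1 z (hsub (hOK hz))
    set x := (u z).toReal with hx
    have hux : u z = (x : EReal) := (EReal.coe_toReal hzt hzb).symm
    have hlow : ∀ n, x ≤ M - smo (fun z => (N z).toReal) (e n) z := fun n => by
      have := hle n z hz; rw [hux] at this; exact_mod_cast this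
    have hxM : x ≤ M := by
      have := hM z (hOK hz); rw [hux] at this; exact_mod_cast this
    rw [Metric.tendsto_atTop]
    intro η hη
    set α := x + η / 2 with hα
    have hop := usc_open hD hu.1 (α : EReal)
    obtain ⟨s, hs, hsb⟩ := Metric.isOpen_iff.1 hop z ⟨hsub (hOK hz), by
      rw [hux, EReal.coe_lt_coe_iff]; linarith⟩
    have hlim : Tendsto e atTop (𝓝 0) := by
      have := tendsto_one_div_add_atTop_nhds_zero_nat.const_mul (δ / 8)
      simpa [he, div_eq_mul_inv] using this
    obtain ⟨n0, hn0⟩ := Filter.eventually_atTop.1 (hlim.eventually (gt_mem_nhds hs))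
    refine ⟨n0, fun n hn' => ?_⟩
    have hes := hn0 n hn'
    have hup : M - α ≤ smo (fun z => (N z).toReal) (e n) z := by
      rw [← ENNReal.ofReal_le_ofReal_iff (smo_nonneg (hep n) z), smo_lint hNm hNf (hep n)]
      calc ENNReal.ofReal (M - α) = ∫⁻ t, ENNReal.ofReal (mol (e n) t) * ENNReal.ofReal (M - α) := by
            rw [lintegral_mul_const, mol_lintegral (hep n), one_mul]
            exact ENNReal.measurable_ofReal.comp (mol_smooth _).continuous.measurable
        _ ≤ _ := by
            apply lintegral_mono
            intro t
            simp only
            rcases le_or_gt (e n) ‖t‖ with ht | ht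
            · rw [mol_zero (hep n) ht]; simp
            gcongr
            have hm1 : z + t ∈ ball z s := by rw [mem_ball, dist_eq_norm, add_sub_cancel_left]; linarith
            have hm2 : z + t ∈ K' := hOb z hz (δ / 2) le_rfl (by
              rw [mem_closedBall, dist_eq_norm, add_sub_cancel_left]; linarith [hele n])
            rw [hNO _ hm2, ← nn_coe]
            exact nn_anti M (hsb hm1).2.le
    rw [Real.dist_eq, abs_lt]
    constructor <;> linarith [hlow n]

end

section
open MeasureTheory Metric Complex Set Filter
open scoped ContDiff Topology Convolution

noncomputable def smoC (h : ℂ → ℂ) (ε : ℝ) (x : ℂ) : ℂ := ∫ t, (mol ε t : ℂ) * h (x + t)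

lemma smoC_eq (h : ℂ → ℂ) (ε : ℝ) :
    smoC h ε = (mol ε) ⋆[ContinuousLinearMap.lsmul ℝ ℝ, volume] h := by
  ext x
  rw [smoC, convolution_def, ← integral_neg_eq_self]
  apply integral_congr_ae
  refine Eventually.of_forall fun t => ?_
  simp [mol_neg, sub_eq_add_neg]

lemma dzb_mol_refl (δ : ℝ) (z t : ℂ) :
    dzb (fun w => (mol δ (z - w) : ℂ)) t = -dzb (rc (mol δ)) (z - t) := by
  have h1 : HasFDerivAt (fun w : ℂ => z - w) (-(ContinuousLinearMap.id ℝ ℂ)) t := by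
    simpa using (hasFDerivAt_id t).const_sub z
  have h2 : HasFDerivAt (fun w => rc (mol δ) (z - w))
      ((fderiv ℝ (rc (mol δ)) (z - t)).comp (-(ContinuousLinearMap.id ℝ ℂ))) t :=
    ((mol_smooth δ).rc'.da (z - t)).hasFDerivAt.comp t h1
  have h3 : fderiv ℝ (fun w => (mol δ (z - w) : ℂ)) t = _ := h2.fderiv
  rw [dzb, dzb, h3]
  simp
  ring

lemma smoC_holo {h : ℂ → ℂ} (hi : Integrable h) {U : Set ℂ}
    (hw : ∀ χ : ℂ → ℂ, ContDiff ℝ ∞ χ → HasCompactSupport χ → tsupport χ ⊆ U →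
      ∫ z, h z * dzb χ z = 0) {δ : ℝ} (hδ : 0 < δ) {z : ℂ} (hz : closedBall z δ ⊆ U) :
    DifferentiableAt ℂ (smoC h δ) z := by
  have hms : ContDiff ℝ ∞ (mol δ) := mol_smooth δ
  have hd := (mol_compact hδ).hasFDerivAt_convolution_left (ContinuousLinearMap.lsmul ℝ ℝ)
    (hms.of_le (by simp)) hi.locallyIntegrable z (μ := volume)
  rw [← smoC_eq] at hd
  have hcf : Continuous (fderiv ℝ (mol δ)) := hms.continuous_fderiv (by simp)
  have hcc : HasCompactSupport (fderiv ℝ (mol δ)) := (mol_compact hδ).fderiv ℝ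
  have hce : ConvolutionExists (fderiv ℝ (mol δ)) h
      ((ContinuousLinearMap.lsmul ℝ ℝ : ℝ →L[ℝ] ℂ →L[ℝ] ℂ).precompL ℂ) volume :=
    HasCompactSupport.convolutionExists_left _ hcc hcf hi.locallyIntegrable
  set A := (fderiv ℝ (mol δ) ⋆[(ContinuousLinearMap.lsmul ℝ ℝ).precompL ℂ, volume] h) z with hA
  have hAv : ∀ v : ℂ, A v = ∫ t, ((fderiv ℝ (mol δ) t v : ℝ) : ℂ) * h (z - t) := by
    intro v
    rw [hA, convolution_def, ContinuousLinearMap.integral_apply]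
    · apply integral_congr_ae
      refine Eventually.of_forall fun t => ?_
      simp [ContinuousLinearMap.precompL_apply]
    · exact hce z
  have hint : ∀ v : ℂ, Integrable fun t => ((fderiv ℝ (mol δ) t v : ℝ) : ℂ) * h (z - t) := by
    intro v
    have hcont : Continuous fun t => ((fderiv ℝ (mol δ) t v : ℝ) : ℂ) :=
      continuous_ofReal.comp ((hms.continuous_fderiv (by simp)).clm_apply continuous_const)
    have hcs : HasCompactSupport fun t => ((fderiv ℝ (mol δ) t v : ℝ) : ℂ) :=
      (((mol_compact hδ).fderiv ℝ).comp_left (g := fun L : ℂ →L[ℝ] ℝ => ((L v : ℝ) : ℂ)) (by simp))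
    obtain ⟨C, hC⟩ := hcont.bounded_above_of_compact_support hcs
    exact (hi.comp_sub_left z).bdd_mul (c := C) hcont.aestronglyMeasurable (Eventually.of_forall hC)
  have e0 : ∀ t v, fderiv ℝ (rc (mol δ)) t v = ((fderiv ℝ (mol δ) t v : ℝ) : ℂ) := by
    intro w u
    have : HasFDerivAt (rc (mol δ)) (ofRealCLM.comp (fderiv ℝ (mol δ) w)) w :=
      ofRealCLM.hasFDerivAt.comp w (hms.da w).hasFDerivAt
    rw [this.fderiv]; simp
  have key : A 1 + I * A I = 0 := by
    rw [hAv, hAv, ← integral_const_mul, ← integral_add (hint 1) ((hint I).const_mul I)]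
    have h1 := hw (fun w => (mol δ (z - w) : ℂ)) ?_ ?_ ?_
    · rw [← integral_sub_left_eq_self _ volume z]
      have : ∀ t, (((fderiv ℝ (mol δ) (z - t)) 1 : ℝ) : ℂ) * h (z - (z - t)) +
          I * ((((fderiv ℝ (mol δ) (z - t)) I : ℝ) : ℂ) * h (z - (z - t)))
          = (-2) * (h t * dzb (fun w => (mol δ (z - w) : ℂ)) t) := by
        intro t
        rw [dzb_mol_refl, dzb, e0, e0, sub_sub_cancel]
        ring
      simp_rw [this]
      rw [integral_const_mul, h1, mul_zero]
    · exact hms.rc'.comp (contDiff_const.sub contDiff_id)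
    · apply HasCompactSupport.intro (isCompact_closedBall z δ)
      intro w hw
      rw [mem_closedBall, not_le, dist_comm, dist_eq_norm] at hw
      simp [mol_zero hδ hw.le]
    · refine (closure_minimal ?_ isClosed_closedBall).trans hz
      intro w hw
      by_contra hcon
      rw [mem_closedBall, not_le, dist_comm, dist_eq_norm] at hcon
      exact hw (by simp [mol_zero hδ hcon.le])
  rw [differentiableAt_complex_iff_differentiableAt_real]
  refine ⟨hd.differentiableAt, ?_⟩
  rw [hd.fderiv, smul_eq_mul]
  have : A 1 = - (I * A I) := eq_neg_of_add_eq_zero_left key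
  rw [this]; linear_combination (A I) * I_sq

lemma smoC_comm {h : ℂ → ℂ} (hi : Integrable h) {δ ε : ℝ} (hδ : 0 < δ) (hε : 0 < ε) (z : ℂ) :
    smoC (smoC h δ) ε z = smoC (smoC h ε) δ z := by
  simp only [smoC, ← integral_const_mul]
  rw [integral_integral_swap]
  · congr 1; ext t; congr 1; ext s
    rw [show z + s + t = z + t + s by ring]; ring
  · have h1 : Integrable (fun p : ℂ × ℂ => (mol ε p.1 : ℂ) * h (z + p.2)) (volume.prod volume) :=
      (mol_int hε).ofReal.mul_prod (hi.comp_add_left z)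
    have h2 := (measurePreserving_prod_add (volume : Measure ℂ) (volume : Measure ℂ)).integrable_comp_of_integrable h1
    obtain ⟨C, hC, hb⟩ := mol_bdd hδ
    have h3 := h2.bdd_mul (f := fun p : ℂ × ℂ => (mol δ p.2 : ℂ)) (c := C)
      (continuous_ofReal.comp ((mol_smooth δ).continuous.comp continuous_snd)).aestronglyMeasurable
      (Eventually.of_forall fun p => by
        rw [norm_real, Real.norm_eq_abs, abs_of_nonneg (mol_nonneg hδ _)]; exact hb _)
    refine h3.congr (Eventually.of_forall fun p => ?_)
    simp [Function.uncurry, add_assoc]; ring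

lemma int_prod_shift {k₁ k₂ h : ℂ → ℂ} (h1 : Integrable k₁) (h2 : Continuous k₂)
    (h2c : HasCompactSupport k₂) (hi : Integrable h) :
    Integrable (fun p : ℂ × ℂ => k₁ p.1 * (k₂ p.2 * h (p.1 + p.2))) (volume.prod volume) := by
  have a1 : Integrable (fun p : ℂ × ℂ => k₁ p.1 * h p.2) (volume.prod volume) := h1.mul_prod hi
  have a2 := (measurePreserving_prod_add (volume : Measure ℂ) (volume : Measure ℂ)).integrable_comp_of_integrable a1
  obtain ⟨C, hC⟩ := h2.bounded_above_of_compact_support h2c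
  have h3 := a2.bdd_mul (f := fun p : ℂ × ℂ => k₂ p.2) (c := C)
      (h2.comp continuous_snd).aestronglyMeasurable
      (Eventually.of_forall fun p => hC _)
  refine h3.congr (Eventually.of_forall fun p => ?_)
  simp; ring

lemma mol_tendsto {Ψ : ℂ → ℂ} (hΨ : Continuous Ψ) {η : ℝ} (hη : 0 < η) :
    ∃ δ₀ > 0, ∀ δ, 0 < δ → δ < δ₀ → ‖(∫ ζ, (mol δ ζ : ℂ) * Ψ ζ) - Ψ 0‖ ≤ η := by
  obtain ⟨δ₀, hδ₀, h⟩ := Metric.continuous_iff.1 hΨ 0 η hη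
  refine ⟨δ₀, hδ₀, fun δ hδ hδδ => ?_⟩
  have hmc : Continuous fun ζ => (mol δ ζ : ℂ) := continuous_ofReal.comp (mol_smooth δ).continuous
  have hcs : HasCompactSupport fun ζ => (mol δ ζ : ℂ) := (mol_compact hδ).comp_left (g := ofReal) (by simp)
  have i1 : Integrable fun ζ => (mol δ ζ : ℂ) * Ψ ζ :=
    (hmc.mul hΨ).integrable_of_hasCompactSupport hcs.mul_right
  have i2 : Integrable fun ζ => (mol δ ζ : ℂ) * Ψ 0 :=
    (hmc.mul continuous_const).integrable_of_hasCompactSupport hcs.mul_right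
  have e1 : ∫ ζ, (mol δ ζ : ℂ) * Ψ 0 = Ψ 0 := by
    rw [integral_mul_const, integral_complex_ofReal, mol_integral hδ]; simp
  have : (∫ ζ, (mol δ ζ : ℂ) * Ψ ζ) - Ψ 0 = ∫ ζ, ((mol δ ζ : ℂ) * Ψ ζ - (mol δ ζ : ℂ) * Ψ 0) := by
    rw [integral_sub i1 i2, e1]
  rw [this]
  refine (norm_integral_le_of_norm_le ((mol_int hδ).mul_const η) (Eventually.of_forall fun ζ => ?_)).trans ?_
  · rw [← mul_sub, norm_mul, norm_real, Real.norm_eq_abs, abs_of_nonneg (mol_nonneg hδ ζ)]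
    rcases le_or_gt δ ‖ζ‖ with hz | hz
    · rw [mol_zero hδ hz]; simp
    · have := h ζ (by simp; linarith)
      rw [dist_eq_norm] at this
      exact mul_le_mul_of_nonneg_left this.le (mol_nonneg hδ ζ)
  · rw [integral_mul_const, mol_integral hδ, one_mul]

lemma weyl_local {h : ℂ → ℂ} (hi : Integrable h) {U : Set ℂ}
    (hw : ∀ χ : ℂ → ℂ, ContDiff ℝ ∞ χ → HasCompactSupport χ → tsupport χ ⊆ U →
      ∫ z, h z * dzb χ z = 0) {a : ℂ} {R : ℝ} (hR : 0 < R) (ha : closedBall a (4 * R) ⊆ U) :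
    ∃ g : ℂ → ℂ, DifferentiableOn ℂ g (ball a R) ∧ h =ᵐ[volume.restrict (ball a R)] g := by
  have hol : ∀ δ, 0 < δ → δ < R → DifferentiableOn ℂ (smoC h δ) (ball a (3 * R)) := by
    intro δ hδ hδR z hz
    refine (smoC_holo hi hw hδ (subset_trans ?_ ha)).differentiableWithinAt
    apply closedBall_subset_closedBall'
    rw [mem_ball] at hz; linarith
  have heq : ∀ δ ε, 0 < δ → δ < R → 0 < ε → ε < R → ∀ z ∈ ball a R, smoC h δ z = smoC h ε z := by
    intro δ ε hδ hδR hε hεR z hz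
    have hs : ball z (2 * R) ⊆ ball a (3 * R) := by
      apply ball_subset_ball'; rw [mem_ball] at hz; linarith
    have h1 : smoC (smoC h δ) ε z = smoC h δ z :=
      mol_mean hε (by linarith : ε < 2 * R) ((hol δ hδ hδR).mono hs)
    have h2 : smoC (smoC h ε) δ z = smoC h ε z :=
      mol_mean hδ (by linarith : δ < 2 * R) ((hol ε hε hεR).mono hs)
    rw [← h1, ← h2, smoC_comm hi hδ hε]
  have hR2 : R / 2 < R := by linarith
  have hg := (hol (R / 2) (by positivity) hR2).mono (ball_subset_ball (by linarith : R ≤ 3 * R))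
  refine ⟨smoC h (R / 2), hg, ?_⟩
  have key : ∀ χ : ℂ → ℝ, ContDiff ℝ ∞ χ → HasCompactSupport χ → tsupport χ ⊆ ball a R →
      ∫ z, (χ z : ℂ) * smoC h (R / 2) z = ∫ z, (χ z : ℂ) * h z := by
    intro χ hχ hc hsup
    have hχc : Continuous fun z => (χ z : ℂ) := continuous_ofReal.comp hχ.continuous
    have hχs : HasCompactSupport fun z => (χ z : ℂ) := hc.comp_left (g := ofReal) (by simp)
    set Ψ : ℂ → ℂ := fun ζ => ∫ z, (χ z : ℂ) * h (z + ζ) with hΨ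
    have hΨc : Continuous Ψ := by
      have : Ψ = (fun z => χ (-z)) ⋆[ContinuousLinearMap.lsmul ℝ ℝ, volume] h := by
        ext x
        rw [hΨ, convolution_def, ← integral_neg_eq_self]
        apply integral_congr_ae
        refine Eventually.of_forall fun t => ?_
        simp [sub_eq_add_neg, add_comm]
      rw [this]
      exact HasCompactSupport.continuous_convolution_left _ (hc.comp_homeomorph (Homeomorph.neg ℂ))
        (hχ.continuous.comp continuous_neg) hi.locallyIntegrable
    have h0 : Ψ 0 = ∫ z, (χ z : ℂ) * h z := by simp [hΨ]
    have hδ : ∀ δ, 0 < δ → δ < R → ∫ ζ, (mol δ ζ : ℂ) * Ψ ζ = ∫ z, (χ z : ℂ) * smoC h (R / 2) z := by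
      intro δ hδ hδR
      have e1 : ∫ z, (χ z : ℂ) * smoC h (R / 2) z = ∫ z, (χ z : ℂ) * smoC h δ z := by
        congr 1; ext z
        by_cases hz : z ∈ ball a R
        · rw [heq _ δ (by positivity) hR2 hδ hδR z hz]
        · rw [image_eq_zero_of_notMem_tsupport fun hz' => hz (hsup hz')]; simp
      rw [e1]
      simp only [smoC, hΨ, ← integral_const_mul]
      rw [integral_integral_swap]
      · congr 1; ext t; congr 1; ext s; ring
      · have := (int_prod_shift (hχc.integrable_of_hasCompactSupport hχs)
          (continuous_ofReal.comp (mol_smooth δ).continuous)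
          ((mol_compact hδ).comp_left (g := ofReal) (by simp)) hi).swap
        refine this.congr (Eventually.of_forall fun p => ?_)
        simp [Function.uncurry]; ring
    rw [← h0]
    refine eq_of_forall_dist_le fun η hη => ?_
    obtain ⟨δ₀, hδ₀, hm⟩ := mol_tendsto hΨc hη
    have hmin : 0 < min δ₀ R := lt_min hδ₀ hR
    have h3 := hm (min δ₀ R / 2) (by positivity) (by linarith [min_le_left δ₀ R])
    rw [hδ _ (by positivity) (by linarith [min_le_right δ₀ R])] at h3
    rwa [dist_eq_norm]
  have hgc : ContinuousOn (smoC h (R / 2)) (ball a R) := hg.continuousOn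
  have := isOpen_ball.ae_eq_zero_of_integral_contDiff_smul_eq_zero (U := ball a R) (μ := volume)
    (f := fun z => h z - smoC h (R / 2) z) ?_ ?_
  · rw [EventuallyEq, ae_restrict_iff' measurableSet_ball]
    filter_upwards [this] with z hz hzb
    exact sub_eq_zero.1 (hz hzb)
  · exact hi.locallyIntegrable.locallyIntegrableOn _ |>.sub
      (hgc.locallyIntegrableOn measurableSet_ball)
  · intro χ hχ hc hsup
    have i1 : Integrable fun z => (χ z : ℂ) * h z := by
      obtain ⟨C, hC⟩ := hχ.continuous.bounded_above_of_compact_support hc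
      exact hi.bdd_mul (c := C) (continuous_ofReal.comp hχ.continuous).aestronglyMeasurable
        (Eventually.of_forall fun z => by simpa using hC z)
    have i2 : Integrable fun z => (χ z : ℂ) * smoC h (R / 2) z := by
      have : Continuous fun z => smoC h (R / 2) z * (χ z : ℂ) := by
        refine mul_cont isOpen_ball hgc (continuous_ofReal.comp hχ.continuous) ?_
        refine subset_trans ?_ hsup
        exact closure_mono fun z hz => by
          simp only [Function.mem_support] at hz ⊢; exact fun h => hz (by simp [h])
      have e : (fun z => (χ z : ℂ) * smoC h (R / 2) z) = fun z => smoC h (R / 2) z * (χ z : ℂ) := by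
        ext z; rw [mul_comm]
      rw [e]
      refine this.integrable_of_hasCompactSupport ?_
      exact HasCompactSupport.mul_left (hc.comp_left (g := ofReal) (by simp))
    have := key χ hχ hc hsup
    simp only [real_smul, mul_sub]
    rw [integral_sub i1 i2, this, sub_self]

/-- Weyl's lemma for the Cauchy-Riemann operator. -/
lemma weyl {h : ℂ → ℂ} {D : Set ℂ} (hD : IsOpen D) (hi : LocallyIntegrableOn h D)
    (hw : ∀ χ : ℂ → ℂ, ContDiff ℝ ∞ χ → HasCompactSupport χ → tsupport χ ⊆ D →
      ∫ z in D, h z * dzb χ z = 0) :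
    ∃ g : ℂ → ℂ, DifferentiableOn ℂ g D ∧ h =ᵐ[volume.restrict D] g := by
  have loc : ∀ a : ℂ, ∃ R : ℝ, ∃ g : ℂ → ℂ, a ∈ D → 0 < R ∧ ball a R ⊆ D ∧
      DifferentiableOn ℂ g (ball a R) ∧ h =ᵐ[volume.restrict (ball a R)] g := by
    intro a
    by_cases ha : a ∈ D
    swap
    · exact ⟨1, 0, fun h => absurd h ha⟩
    obtain ⟨r, hr, hrD⟩ := Metric.nhds_basis_closedBall.mem_iff.1 (hD.mem_nhds ha)
    have hint : Integrable ((ball a r).indicator h) := by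
      rw [integrable_indicator_iff measurableSet_ball]
      exact (hi.integrableOn_compact_subset hrD (isCompact_closedBall a r)).mono_set ball_subset_closedBall
    have hw' : ∀ χ : ℂ → ℂ, ContDiff ℝ ∞ χ → HasCompactSupport χ → tsupport χ ⊆ ball a r →
        ∫ z, (ball a r).indicator h z * dzb χ z = 0 := by
      intro χ hχ hc hsup
      rw [← hw χ hχ hc (hsup.trans (ball_subset_closedBall.trans hrD)),
        ← integral_indicator hD.measurableSet]
      congr 1; ext z
      by_cases hz : z ∈ ball a r
      · rw [indicator_of_mem hz, indicator_of_mem (hrD (ball_subset_closedBall hz))]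
      · have : dzb χ z = 0 := image_eq_zero_of_notMem_tsupport fun h' => hz (hsup (tsupport_dzb _ h'))
        simp [indicator, this]
    obtain ⟨g, hg1, hg2⟩ := weyl_local hint hw' (a := a) (R := r / 8) (by positivity)
      (by apply closedBall_subset_ball; linarith)
    have hs : ball a (r / 8) ⊆ ball a r := ball_subset_ball (by linarith)
    refine ⟨r / 8, g, fun _ => ⟨by positivity, hs.trans (ball_subset_closedBall.trans hrD), hg1, ?_⟩⟩
    filter_upwards [hg2, ae_restrict_mem measurableSet_ball] with z hz hzb
    rw [← hz, indicator_of_mem (hs hzb)]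
  choose R g hRg using loc
  have hag : ∀ a ∈ D, ∀ z ∈ ball a (R a), g z z = g a z := by
    intro a ha z hz
    obtain ⟨h1, h2, h3, h4⟩ := hRg a ha
    obtain ⟨k1, k2, k3, k4⟩ := hRg z (h2 hz)
    have e : g z =ᵐ[volume.restrict (ball a (R a) ∩ ball z (R z))] g a := by
      have q1 := ae_restrict_of_ae_restrict_of_subset (inter_subset_left (t := ball z (R z))) h4
      have q2 := ae_restrict_of_ae_restrict_of_subset (inter_subset_right (s := ball a (R a))) k4
      filter_upwards [q1, q2] with w w1 w2
      rw [← w1, w2]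
    exact Measure.eqOn_open_of_ae_eq e (isOpen_ball.inter isOpen_ball)
      (k3.continuousOn.mono inter_subset_right) (h3.continuousOn.mono inter_subset_left)
      ⟨hz, mem_ball_self k1⟩
  refine ⟨fun z => g z z, ?_, ?_⟩
  · intro a ha
    obtain ⟨h1, h2, h3, h4⟩ := hRg a ha
    have : (fun z => g z z) =ᶠ[𝓝 a] g a := by
      filter_upwards [ball_mem_nhds a h1] with z hz using hag a ha z hz
    exact ((h3.differentiableAt (ball_mem_nhds a h1)).congr_of_eventuallyEq this).differentiableWithinAt
  · rw [EventuallyEq, ae_restrict_iff' hD.measurableSet, ae_iff]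
    apply measure_null_of_locally_null
    intro a ha
    have haD : a ∈ D := by
      by_contra hcon; exact ha fun h => absurd h hcon
    obtain ⟨h1, h2, h3, h4⟩ := hRg a haD
    refine ⟨ball a (R a) ∩ {z | ¬ (z ∈ D → h z = g z z)}, ?_, ?_⟩
    · exact inter_mem (mem_nhdsWithin_of_mem_nhds (ball_mem_nhds a h1)) self_mem_nhdsWithin
    · rw [EventuallyEq, ae_restrict_iff' measurableSet_ball, ae_iff] at h4
      refine measure_mono_null ?_ h4
      rintro z ⟨hz1, hz2⟩
      intro hcon
      exact hz2 fun hzD => by rw [hag a haD z hz1]; exact hcon hz1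

end

section
open MeasureTheory Metric Complex Set Filter
open scoped ContDiff Topology InnerProductSpace

lemma riesz_abs {V E : Type*} [AddCommGroup V] [Module ℂ V] [NormedAddCommGroup E]
    [InnerProductSpace ℂ E] [CompleteSpace E] (k : V →ₗ[ℂ] E) (l : V →ₗ[ℂ] ℂ) {C : ℝ} (hC : 0 ≤ C)
    (h : ∀ v, ‖l v‖ ≤ C * ‖k v‖) : ∃ u : E, ‖u‖ ≤ C ∧ ∀ v, l v = ⟪u, k v⟫_ℂ := by
  have hker : LinearMap.ker k ≤ LinearMap.ker l := by
    intro v hv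
    rw [LinearMap.mem_ker] at hv ⊢
    have := h v
    rw [hv, norm_zero, mul_zero] at this
    exact norm_le_zero_iff.1 this
  let φ : LinearMap.range k →ₗ[ℂ] ℂ := ((LinearMap.ker k).liftQ l hker).comp
    (k.quotKerEquivRange.symm : LinearMap.range k →ₗ[ℂ] _)
  have hφ : ∀ v, φ ⟨k v, LinearMap.mem_range_self k v⟩ = l v := by
    intro v
    simp only [φ, LinearMap.comp_apply, LinearEquiv.coe_coe]
    have : k.quotKerEquivRange.symm ⟨k v, LinearMap.mem_range_self k v⟩ = Submodule.Quotient.mk v := by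
      rw [LinearEquiv.symm_apply_eq]; rfl
    rw [this]
    simp
  let φc : LinearMap.range k →L[ℂ] ℂ := φ.mkContinuous C (by
    rintro ⟨x, v, rfl⟩
    have e : φ ⟨k v, ⟨v, rfl⟩⟩ = l v := hφ v
    rw [e]
    exact h v)
  obtain ⟨g, hg, hgn⟩ := exists_extension_norm_eq _ φc
  refine ⟨(InnerProductSpace.toDual ℂ E).symm g, ?_, fun v => ?_⟩
  · rw [LinearIsometryEquiv.norm_map, hgn]
    exact φ.mkContinuous_norm_le hC _
  · rw [InnerProductSpace.toDual_symm_apply]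
    have := hg ⟨k v, LinearMap.mem_range_self k v⟩
    rw [this, ← hφ]; rfl

/-- weighted duality -/
lemma riesz_w {V : Type*} [AddCommGroup V] [Module ℂ V] {D : Set ℂ} (hD : IsOpen D) {W : ℂ → ℝ}
    (hWm : AEMeasurable W (volume.restrict D)) (hWp : ∀ z ∈ D, 0 < W z)
    (hWb : ∀ K ⊆ D, IsCompact K → ∃ C : ℝ, ∀ z ∈ K, (W z)⁻¹ ≤ C)
    (T : V → ℂ → ℂ) (Tadd : ∀ v w z, T (v + w) z = T v z + T w z)
    (Tsmul : ∀ (c : ℂ) v z, T (c • v) z = c * T v z)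
    (Tc : ∀ v, Continuous (T v)) (Ts : ∀ v, HasCompactSupport (T v)) (TD : ∀ v, tsupport (T v) ⊆ D)
    (l : V →ₗ[ℂ] ℂ) {A : ℝ} (hA : 0 ≤ A)
    (h : ∀ v, ‖l v‖ ^ 2 ≤ A * ∫ z in D, ‖T v z‖ ^ 2 * (W z)⁻¹) :
    ∃ U : ℂ → ℂ, LocallyIntegrableOn U D ∧ AEMeasurable U (volume.restrict D) ∧
      ∫⁻ z in D, ENNReal.ofReal (‖U z‖ ^ 2 * W z) ≤ ENNReal.ofReal A ∧
      ∀ v, l v = ∫ z in D, U z * T v z := by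
  set μ := volume.restrict D with hμ
  set s : ℂ → ℝ := fun z => Real.sqrt ((W z)⁻¹) with hs
  have hsm : AEMeasurable s μ := Real.continuous_sqrt.measurable.comp_aemeasurable hWm.inv
  have hs2 : ∀ z ∈ D, s z ^ 2 = (W z)⁻¹ := fun z hz =>
    Real.sq_sqrt (inv_nonneg.2 (hWp z hz).le)
  have hs0 : ∀ z, 0 ≤ s z := fun z => Real.sqrt_nonneg _
  have hmD : ∀ᵐ z ∂μ, z ∈ D := ae_restrict_mem hD.measurableSet
  have haesm : ∀ v, AEStronglyMeasurable (fun z => T v z * (s z : ℂ)) μ := fun v =>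
    ((Tc v).measurable.aemeasurable.mul hsm.complex_ofReal).aestronglyMeasurable
  have hbd : ∀ v, ∃ C : ℝ, ∀ z ∈ D, ‖T v z * (s z : ℂ)‖ ≤ C := by
    intro v
    obtain ⟨C, hC⟩ := hWb _ (TD v) (Ts v)
    obtain ⟨B, hB⟩ := (Tc v).bounded_above_of_compact_support (Ts v)
    refine ⟨B * Real.sqrt (max C 0), fun z hz => ?_⟩
    have hB0 : 0 ≤ B := (norm_nonneg _).trans (hB z)
    by_cases hzs : z ∈ tsupport (T v)
    · rw [norm_mul, norm_real, Real.norm_eq_abs, abs_of_nonneg (hs0 z)]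
      exact mul_le_mul (hB z) (Real.sqrt_le_sqrt ((hC z hzs).trans (le_max_left _ _))) (hs0 z) hB0
    · rw [image_eq_zero_of_notMem_tsupport hzs]; simp; positivity
  have hmem : ∀ v, MemLp (fun z => T v z * (s z : ℂ)) 2 μ := by
    intro v
    obtain ⟨C, hC⟩ := hbd v
    have h1 : MemLp (fun z => T v z * (s z : ℂ)) 2 (μ.restrict (tsupport (T v))) := by
      have : IsFiniteMeasure (μ.restrict (tsupport (T v))) := by
        refine ⟨?_⟩
        rw [Measure.restrict_apply_univ]
        exact (Measure.restrict_apply_le _ _).trans_lt (Ts v).isCompact.measure_lt_top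
      apply MemLp.of_bound (haesm v).restrict C
      filter_upwards [ae_restrict_of_ae hmD] with z hz using hC z hz
    have h2 := (memLp_indicator_iff_restrict (p := 2) (μ := μ) (f := fun z => T v z * (s z : ℂ))
      (isClosed_tsupport (T v)).measurableSet).2 h1
    convert h2 using 1
    ext z
    by_cases hzs : z ∈ tsupport (T v)
    · rw [indicator_of_mem hzs]
    · rw [indicator_of_notMem hzs, image_eq_zero_of_notMem_tsupport hzs]; simp
  let k : V →ₗ[ℂ] Lp ℂ 2 μ :=
    { toFun := fun v => (hmem v).toLp _
      map_add' := fun v w => by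
        rw [← MemLp.toLp_add]
        apply MemLp.toLp_congr
        refine Eventually.of_forall fun z => ?_
        simp [Tadd]; ring
      map_smul' := fun c v => by
        rw [RingHom.id_apply, ← MemLp.toLp_const_smul]
        apply MemLp.toLp_congr
        refine Eventually.of_forall fun z => ?_
        simp [Tsmul]; ring }
  have hk : ∀ v, ‖k v‖ ^ 2 = ∫ z in D, ‖T v z‖ ^ 2 * (W z)⁻¹ := by
    intro v
    have h1 := @inner_self_eq_norm_sq ℂ _ _ _ _ (k v)
    rw [← h1, L2.inner_def]
    have h2 : ∫ a, ⟪k v a, k v a⟫_ℂ ∂μ = ∫ z, ((‖T v z‖ ^ 2 * (W z)⁻¹ : ℝ) : ℂ) ∂μ := by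
      apply integral_congr_ae
      filter_upwards [(hmem v).coeFn_toLp, hmD] with z hz hzD
      have : k v z = T v z * (s z : ℂ) := hz
      rw [this, inner_self_eq_norm_sq_to_K, norm_mul, norm_real, Real.norm_eq_abs,
        abs_of_nonneg (hs0 z), ← hs2 z hzD]
      push_cast; simp [mul_pow]
    rw [h2, integral_complex_ofReal]
    exact Complex.ofReal_re _
  obtain ⟨u, hu, hul⟩ := riesz_abs k l (Real.sqrt_nonneg A) (by
    intro v
    have := h v
    rw [← hk] at this
    have h3 := Real.sqrt_le_sqrt this
    rwa [Real.sqrt_sq (norm_nonneg _), Real.sqrt_mul hA, Real.sqrt_sq (norm_nonneg _)] at h3)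
  refine ⟨fun z => (starRingEnd ℂ) (u z) * (s z : ℂ), ?_, ?_, ?_, ?_⟩
  · rw [locallyIntegrableOn_iff hD.isLocallyClosed]
    intro K hKD hK
    obtain ⟨C, hC⟩ := hWb K hKD hK
    have hle : volume.restrict K ≤ μ := Measure.restrict_mono hKD le_rfl
    have : IsFiniteMeasure (volume.restrict K) := ⟨by simpa using hK.measure_lt_top⟩
    have h1 : MemLp u 1 (volume.restrict K) :=
      ((Lp.memLp u).mono_measure hle).mono_exponent (by norm_num)
    have h2 : Integrable (fun z => (starRingEnd ℂ) (u z)) (volume.restrict K) :=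
      Complex.conjCLE.toContinuousLinearMap.integrable_comp (memLp_one_iff_integrable.1 h1)
    have h3 := h2.mul_bdd (c := Real.sqrt C) (g := fun z => (s z : ℂ))
      (hsm.complex_ofReal.mono_measure hle).aestronglyMeasurable (by
        filter_upwards [ae_restrict_mem hK.measurableSet] with z hz
        rw [norm_real, Real.norm_eq_abs, abs_of_nonneg (hs0 z)]
        exact Real.sqrt_le_sqrt (hC z hz))
    exact h3
  · exact (continuous_star.measurable.comp_aemeasurable (Lp.aestronglyMeasurable u).aemeasurable).mul
      hsm.complex_ofReal
  · have h1 : ∫⁻ z, ENNReal.ofReal (‖u z‖ ^ 2) ∂μ = ENNReal.ofReal (‖u‖ ^ 2) := by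
      rw [← ofReal_integral_eq_lintegral_ofReal]
      · congr 1
        have h1 := @inner_self_eq_norm_sq ℂ _ _ _ _ u
        rw [← h1, L2.inner_def]
        have h2 : ∫ a, ⟪u a, u a⟫_ℂ ∂μ = ∫ z, ((‖u z‖ ^ 2 : ℝ) : ℂ) ∂μ := by
          apply integral_congr_ae
          refine Eventually.of_forall fun z => ?_
          simp
        rw [h2, integral_complex_ofReal]; simp
      · exact (memLp_two_iff_integrable_sq_norm (Lp.aestronglyMeasurable u)).1 (Lp.memLp u)
      · exact Eventually.of_forall fun z => by positivity
    calc _ = ∫⁻ z, ENNReal.ofReal (‖u z‖ ^ 2) ∂μ := by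
          apply lintegral_congr_ae
          filter_upwards [hmD] with z hz
          congr 1
          rw [norm_mul, norm_real, Real.norm_eq_abs, abs_of_nonneg (hs0 z), mul_pow, hs2 z hz,
            RCLike.norm_conj, mul_assoc, inv_mul_cancel₀ (hWp z hz).ne', mul_one]
      _ ≤ _ := by
          rw [h1]
          apply ENNReal.ofReal_le_ofReal
          calc ‖u‖ ^ 2 ≤ Real.sqrt A ^ 2 := by gcongr
            _ = A := Real.sq_sqrt hA
  · intro v
    rw [hul v, L2.inner_def]
    apply integral_congr_ae
    filter_upwards [(hmem v).coeFn_toLp] with z hz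
    have : k v z = T v z * (s z : ℂ) := hz
    rw [this]
    simp [inner]; ring

/-- the space of test functions -/
def TestF (D : Set ℂ) : Submodule ℂ (ℂ → ℂ) where
  carrier := {χ | ContDiff ℝ ∞ χ ∧ HasCompactSupport χ ∧ tsupport χ ⊆ D}
  add_mem' := by
    rintro a b ⟨a1, a2, a3⟩ ⟨b1, b2, b3⟩
    exact ⟨a1.add b1, a2.add b2, (tsupport_add a b).trans (union_subset a3 b3)⟩
  zero_mem' := ⟨contDiff_const, HasCompactSupport.zero, by simp⟩
  smul_mem' := by
    rintro c a ⟨a1, a2, a3⟩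
    refine ⟨contDiff_const.mul a1, HasCompactSupport.mul_left (f := fun _ => c) a2, ?_⟩
    exact subset_trans (closure_mono fun z hz => by
      simp only [Function.mem_support, Pi.smul_apply] at hz ⊢; exact fun h => hz (by simp [h])) a3

lemma dzb_smul (c : ℂ) {χ : ℂ → ℂ} (h : ContDiff ℝ ∞ χ) (z : ℂ) :
    dzb (fun w => c * χ w) z = c * dzb χ z := by
  rw [dzb_mul (differentiableAt_const c) (h.da z)]
  have : dzb (fun _ => c) z = 0 := by simp [dzb]
  rw [this]; ring

lemma loc_int_mul {D : Set ℂ} (hD : IsOpen D) {F χ : ℂ → ℂ} (hF : LocallyIntegrableOn F D)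
    (h : Continuous χ) (hc : HasCompactSupport χ) (hs : tsupport χ ⊆ D) :
    Integrable (fun z => F z * χ z) (volume.restrict D) := by
  obtain ⟨C, hC⟩ := h.bounded_above_of_compact_support hc
  have h1 : IntegrableOn F (tsupport χ) := hF.integrableOn_compact_subset hs hc
  have h2 : IntegrableOn (fun z => F z * χ z) (tsupport χ) :=
    h1.mul_bdd (c := C) h.aestronglyMeasurable (Eventually.of_forall hC)
  have h3 : IntegrableOn (fun z => F z * χ z) univ := by
    refine h2.of_forall_sdiff_eq_zero MeasurableSet.univ ?_
    rintro z ⟨-, hz⟩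
    rw [image_eq_zero_of_notMem_tsupport hz, mul_zero]
  exact h3.mono_set (subset_univ D)

/-- From the dual inequality to a holomorphic function. -/
lemma solve {D : Set ℂ} (hD : IsOpen D) {W : ℂ → ℝ}
    (hWm : AEMeasurable W (volume.restrict D)) (hWp : ∀ z ∈ D, 0 < W z)
    (hWb : ∀ K ⊆ D, IsCompact K → ∃ C : ℝ, ∀ z ∈ K, (W z)⁻¹ ≤ C)
    {F : ℂ → ℂ} (hF : LocallyIntegrableOn F D) {A : ℝ} (hA : 0 ≤ A)
    (h : ∀ χ : ℂ → ℂ, ContDiff ℝ ∞ χ → HasCompactSupport χ → tsupport χ ⊆ D →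
      ‖∫ z in D, F z * dzb χ z‖ ^ 2 ≤ A * ∫ z in D, ‖dzb χ z‖ ^ 2 * (W z)⁻¹) :
    ∃ g : ℂ → ℂ, DifferentiableOn ℂ g D ∧
      ∫⁻ z in D, ENNReal.ofReal (‖g z - F z‖ ^ 2 * W z) ≤ ENNReal.ofReal A := by
  have hint : ∀ χ : TestF D, Integrable (fun z => F z * dzb χ.1 z) (volume.restrict D) := fun χ =>
    loc_int_mul hD hF χ.2.1.dzb'.continuous χ.2.2.1.dzb' ((tsupport_dzb _).trans χ.2.2.2)
  have hadd : ∀ (v w : TestF D) z, dzb (v + w).1 z = dzb v.1 z + dzb w.1 z := fun v w z =>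
    dzb_add (v.2.1.da z) (w.2.1.da z)
  have hsm : ∀ (c : ℂ) (v : TestF D) z, dzb (c • v).1 z = c * dzb v.1 z := fun c v z =>
    dzb_smul c v.2.1 z
  let l : TestF D →ₗ[ℂ] ℂ :=
    { toFun := fun χ => ∫ z in D, F z * dzb χ.1 z
      map_add' := fun v w => by
        rw [← integral_add (hint v) (hint w)]
        congr 1; ext z; rw [hadd]; ring
      map_smul' := fun c v => by
        rw [RingHom.id_apply, smul_eq_mul, ← integral_const_mul]
        congr 1; ext z; rw [hsm]; ring }
  obtain ⟨U, hU1, hU2, hU3, hU4⟩ := riesz_w hD hWm hWp hWb (V := TestF D) (fun χ => dzb χ.1) hadd hsm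
    (fun v => v.2.1.dzb'.continuous) (fun v => v.2.2.1.dzb')
    (fun v => (tsupport_dzb _).trans v.2.2.2) l hA (fun v => h v.1 v.2.1 v.2.2.1 v.2.2.2)
  obtain ⟨g, hg1, hg2⟩ := weyl hD (h := fun z => F z - U z) (hF.sub hU1) (by
    intro χ h1 h2 h3
    have e := hU4 ⟨χ, h1, h2, h3⟩
    have i2 := loc_int_mul hD hU1 h1.dzb'.continuous h2.dzb' ((tsupport_dzb _).trans h3)
    simp only [sub_mul]
    rw [integral_sub (hint ⟨χ, h1, h2, h3⟩) i2]
    exact sub_eq_zero.2 e)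
  refine ⟨g, hg1, le_trans (le_of_eq ?_) hU3⟩
  apply lintegral_congr_ae
  filter_upwards [hg2] with z hz
  rw [← hz]; congr 3
  rw [sub_sub_cancel_left, norm_neg]

end

section
open MeasureTheory Metric Complex Set Filter
open scoped ContDiff Topology

/-- approximability from above by smooth subharmonic functions -/
def Apx (u : ℂ → EReal) (D : Set ℂ) : Prop :=
  (∀ᵐ z ∂(volume.restrict D), u z ≠ ⊥) ∧ (∀ z ∈ D, u z ≠ ⊤) ∧
  ∀ K, IsCompact K → K ⊆ D → ∃ O, IsOpen O ∧ K ⊆ O ∧ O ⊆ D ∧ ∃ M : ℝ, ((∀ z ∈ D, u z < 0) → M < 0) ∧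
    ∃ v : ℕ → ℂ → ℝ, (∀ n, ContDiff ℝ ∞ (v n)) ∧ (∀ n z, v n z ≤ M) ∧
      (∀ n, ∀ z ∈ O, 0 ≤ lap (v n) z) ∧ (∀ n, ∀ z ∈ O, u z ≤ (v n z : EReal)) ∧
      (∀ z ∈ O, u z ≠ ⊥ → Tendsto (fun n => v n z) atTop (𝓝 (u z).toReal))

lemma subh_apx {D : Set ℂ} {u : ℂ → EReal} (hD : IsOpen D) (hc : IsPreconnected D)
    (hu : SubharmonicOnE u D) : Apx u D :=
  ⟨subh_ne_bot hD hc hu, hu.2.1, fun _ hK hKD => subh_approx hD hc hu hK hKD⟩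

/-- twisting data -/
structure Tw (v b ρ : ℝ → ℝ) (τ τ' T : ℝ) : Prop where
  hv : ∀ t, HasDerivAt v (b t) t
  hb : ∀ t, HasDerivAt b (ρ t) t
  hρ : ContDiff ℝ ∞ ρ
  hρ0 : ∀ t, 0 ≤ ρ t
  hρC : ∃ C, ∀ t, ρ t ≤ C
  hb0 : ∀ t, 0 ≤ b t
  hble : ∀ t, b t ≤ 1
  hτ : τ' < τ
  hb1 : ∀ x, τ' ≤ x → b x = 1
  hρτ : ∀ x, τ' ≤ x → ρ x = 0
  hvT : ∀ x, -T ≤ v x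
  hvneg : ∀ x, x < 0 → v x < 0

/-- weights -/
structure Qs (q H S : ℝ → ℝ) : Prop where
  hq : ContDiff ℝ ∞ q
  hpos : ∀ t, 0 < t → 0 < q t
  hder : ∀ t, 0 < t → deriv q t ≤ 0
  hH : ∀ t, HasDerivAt H (q t) t
  hS : ∀ t, HasDerivAt S (H t) t
  H0 : H 0 = 0
  S0 : S 0 = 0

lemma Qs.anti {q H S : ℝ → ℝ} (h : Qs q H S) {s t : ℝ} (hs : 0 < s) (hst : s ≤ t) : q t ≤ q s := by
  have : AntitoneOn q (Ioi 0) := antitoneOn_of_deriv_nonpos (convex_Ioi 0) h.hq.continuous.continuousOn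
    (h.hq.differentiable (by simp)).differentiableOn (fun x hx => h.hder x (by simpa using hx))
  exact this hs (hs.trans_le hst) hst

lemma Tw.mono {v b ρ : ℝ → ℝ} {τ τ' T : ℝ} (h : Tw v b ρ τ τ' T) : Monotone v :=
  monotone_of_deriv_nonneg (fun t => (h.hv t).differentiableAt) fun t => by
    rw [(h.hv t).deriv]; exact h.hb0 t

lemma toReal_lt_of {u : EReal} {a : ℝ} (h0 : u ≠ ⊥) (h : u < (a : EReal)) : u.toReal < a := by
  have h1 : u ≠ ⊤ := ne_top_of_lt h
  rw [← EReal.coe_toReal h1 h0] at h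
  exact_mod_cast h

lemma toReal_le_of {u : EReal} {a : ℝ} (h0 : u ≠ ⊥) (h : u ≤ (a : EReal)) : u.toReal ≤ a := by
  have h1 : u ≠ ⊤ := ne_top_of_le_ne_top (EReal.coe_ne_top a) h
  rw [← EReal.coe_toReal h1 h0] at h
  exact_mod_cast h

lemma DI_1 {q H S : ℝ → ℝ} (hQ : Qs q H S) {v b ρ : ℝ → ℝ} {τ τ' T : ℝ} (hT : Tw v b ρ τ τ' T)
    {D : Set ℂ} {ψ : ℂ → EReal} (hψ : Apx ψ D) (hneg : ∀ z ∈ D, ψ z < 0) {Φ : ℂ → ℝ}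
    (hΦ : ContDiff ℝ ∞ Φ) {χ : ℂ → ℂ} (hχ : ContDiff ℝ ∞ χ) (hc : HasCompactSupport χ)
    (hs : tsupport χ ⊆ D) {O : Set ℂ} (hO : IsOpen O) (hsO : tsupport χ ⊆ O)
    (hΦs : ∀ z ∈ O, 0 ≤ lap Φ z) {F : ℂ → ℂ}
    (hF : DifferentiableOn ℂ F {z | z ∈ D ∧ ψ z < (τ : EReal)})
    (hF2 : MemLp F 2 (volume.restrict (tsupport χ))) :
    ‖∫ z in tsupport χ, ((1 - b (ψ z).toReal : ℝ) : ℂ) * F z * dzb χ z‖ ^ 2 ≤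
      (H T * ∫ z in tsupport χ, ρ (ψ z).toReal * ‖F z‖ ^ 2 * Real.exp (-Φ z)) *
        ∫ z in tsupport χ, ‖dzb χ z‖ ^ 2 * Real.exp (Φ z) / q (-v (ψ z).toReal) := by
  set K := tsupport χ with hK
  have hKc : IsCompact K := hc
  have hap := hψ.2.2 K hKc hs
  obtain ⟨O1, hO1, hKO1, hO1D, M, hM, p, hp, hpM, hpl, hpu, hpt⟩ := hap
  have hM0 := hM hneg
  have hmK : ∀ᵐ z ∂(volume.restrict K), z ∈ K := ae_restrict_mem hKc.measurableSet
  have hnb : ∀ᵐ z ∂(volume.restrict K), ψ z ≠ ⊥ := ae_mono (Measure.restrict_mono hs le_rfl) hψ.1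
  have hlim : ∀ᵐ z ∂(volume.restrict K), Tendsto (fun n => p n z) atTop (𝓝 (ψ z).toReal) := by
    filter_upwards [hmK, hnb] with z hz hz'
    exact hpt z (hKO1 hz) hz'
  have hdz : ∀ z, z ∉ K → dzb χ z = 0 := fun z hz =>
    image_eq_zero_of_notMem_tsupport fun h => hz (tsupport_dzb χ h)
  have hbc : Continuous b := continuous_iff_continuousAt.2 fun t => (hT.hb t).continuousAt
  have hvc : Continuous v := continuous_iff_continuousAt.2 fun t => (hT.hv t).continuousAt
  have hdc : Continuous (dzb χ) := hχ.dzb'.continuous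
  have hfin : IsFiniteMeasure (volume.restrict K) := ⟨by simpa using hKc.measure_lt_top⟩
  have hFi : Integrable F (volume.restrict K) :=
    memLp_one_iff_integrable.1 (hF2.mono_exponent (by norm_num))
  have hFm := hFi.aestronglyMeasurable
  have hF22 : Integrable (fun z => ‖F z‖ ^ 2) (volume.restrict K) := hF2.integrable_norm_pow (by norm_num)
  have key : ∀ n, ‖∫ z in K, ((1 - b (p n z) : ℝ) : ℂ) * F z * dzb χ z‖ ^ 2 ≤
      (H T * ∫ z in K, ρ (p n z) * ‖F z‖ ^ 2 * Real.exp (-Φ z)) *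
        ∫ z in K, ‖dzb χ z‖ ^ 2 * Real.exp (Φ z) / q (-v (p n z)) := by
    intro n
    have := DI_smooth hQ.hq hQ.hpos hQ.hder hQ.hH hQ.hS hQ.H0 hQ.S0 hT.hv hT.hb hT.hρ hT.hρ0 hT.hb0
      hT.hτ hT.hb1 hT.hρτ hT.hvT (hp n) (fun z => hT.hvneg _ ((hpM n z).trans_lt hM0)) hΦ
      (hO.inter hO1) (F := F) (hF.mono (by
        rintro z ⟨hz, hz'⟩
        exact ⟨hO1D hz.2, (hpu n z hz.2).trans_lt (by exact_mod_cast hz')⟩)) hχ hc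
      (subset_inter hsO hKO1) (fun z hz => hpl n z hz.2) (fun z hz => hΦs z hz.1)
    have e1 : ∫ z in K, ((1 - b (p n z) : ℝ) : ℂ) * F z * dzb χ z
        = ∫ z, ((1 - b (p n z) : ℝ) : ℂ) * F z * dzb χ z :=
      setIntegral_eq_integral_of_forall_compl_eq_zero (fun z hz => by rw [hdz z hz]; simp)
    have e2 : ∫ z in K, ‖dzb χ z‖ ^ 2 * Real.exp (Φ z) / q (-v (p n z))
        = ∫ z, ‖dzb χ z‖ ^ 2 * Real.exp (Φ z) / q (-v (p n z)) :=
      setIntegral_eq_integral_of_forall_compl_eq_zero (fun z hz => by rw [hdz z hz]; simp)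
    rw [e1, e2]
    exact this
  obtain ⟨C1, hC1⟩ := hdc.bounded_above_of_compact_support hc.dzb'
  have L1 : Tendsto (fun n => ∫ z in K, ((1 - b (p n z) : ℝ) : ℂ) * F z * dzb χ z) atTop
      (𝓝 (∫ z in K, ((1 - b (ψ z).toReal : ℝ) : ℂ) * F z * dzb χ z)) := by
    apply tendsto_integral_of_dominated_convergence (fun z => ‖F z‖ * C1)
    · intro n
      refine AEStronglyMeasurable.mul (AEStronglyMeasurable.mul ?_ hFm) hdc.aestronglyMeasurable
      exact (continuous_ofReal.comp (continuous_const.sub (hbc.comp (hp n).continuous))).aestronglyMeasurable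
    · exact hFi.norm.mul_const _
    · intro n
      refine Eventually.of_forall fun z => ?_
      rw [norm_mul, norm_mul, norm_real, Real.norm_eq_abs,
        abs_of_nonneg (by linarith [hT.hble (p n z)])]
      have := hT.hb0 (p n z)
      have h1 : (1 - b (p n z)) * ‖F z‖ ≤ ‖F z‖ := by
        nlinarith [norm_nonneg (F z)]
      exact mul_le_mul h1 (hC1 z) (norm_nonneg _) (norm_nonneg _)
    · filter_upwards [hlim] with z hz
      refine Tendsto.mul_const _ (Tendsto.mul_const _ ?_)
      exact (continuous_ofReal.tendsto _).comp (tendsto_const_nhds.sub ((hbc.tendsto _).comp hz))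
  obtain ⟨C3, hC3⟩ := hT.hρC
  obtain ⟨C2, hC2⟩ : ∃ C, ∀ z ∈ K, Real.exp (-Φ z) ≤ C := by
    obtain ⟨C, hC⟩ := hKc.exists_bound_of_continuousOn
      (f := fun z => Real.exp (-Φ z)) (by have := hΦ.continuous; fun_prop)
    exact ⟨C, fun z hz => (le_abs_self _).trans (hC z hz)⟩
  have hΦc := hΦ.continuous
  have L2 : Tendsto (fun n => ∫ z in K, ρ (p n z) * ‖F z‖ ^ 2 * Real.exp (-Φ z)) atTop
      (𝓝 (∫ z in K, ρ (ψ z).toReal * ‖F z‖ ^ 2 * Real.exp (-Φ z))) := by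
    apply tendsto_integral_of_dominated_convergence (fun z => C3 * ‖F z‖ ^ 2 * C2)
    · intro n
      refine AEStronglyMeasurable.mul (AEStronglyMeasurable.mul ?_ (hFm.norm.pow 2))
        (by fun_prop)
      exact (hT.hρ.continuous.comp (hp n).continuous).aestronglyMeasurable
    · exact (hF22.const_mul _).mul_const _
    · intro n
      filter_upwards [hmK] with z hz
      rw [Real.norm_eq_abs, abs_of_nonneg (by have := hT.hρ0 (p n z); positivity)]
      have h0 := (hT.hρ0 (p n z))
      have h1 : 0 ≤ C3 := h0.trans (hC3 _)
      gcongr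
      · exact hC3 _
      · exact hC2 z hz
    · filter_upwards [hlim] with z hz
      refine Tendsto.mul_const _ (Tendsto.mul_const _ ?_)
      exact (hT.hρ.continuous.tendsto _).comp hz
  have hqT : ∀ x, x < 0 → 0 < q T ∧ q T ≤ q (-v x) := by
    intro x hx
    have h1 := hT.hvneg x hx
    have h2 := hT.hvT x
    exact ⟨hQ.hpos _ (by linarith), hQ.anti (by linarith) (by linarith)⟩
  have L3 : Tendsto (fun n => ∫ z in K, ‖dzb χ z‖ ^ 2 * Real.exp (Φ z) / q (-v (p n z))) atTop
      (𝓝 (∫ z in K, ‖dzb χ z‖ ^ 2 * Real.exp (Φ z) / q (-v (ψ z).toReal))) := by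
    apply tendsto_integral_of_dominated_convergence (fun z => ‖dzb χ z‖ ^ 2 * Real.exp (Φ z) / q T)
    · intro n
      refine AEMeasurable.aestronglyMeasurable (AEMeasurable.div ?_ ?_)
      · exact Continuous.aemeasurable (by fun_prop)
      · have := hQ.hq.continuous
        have := (hp n).continuous
        exact Continuous.aemeasurable (by fun_prop)
    · refine Integrable.div_const ?_ _
      exact (Continuous.continuousOn (by fun_prop)).integrableOn_compact hKc
    · intro n
      refine Eventually.of_forall fun z => ?_
      obtain ⟨h1, h2⟩ := hqT (p n z) ((hpM n z).trans_lt hM0)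
      rw [Real.norm_eq_abs, abs_of_nonneg (by have := h1.trans_le h2; positivity)]
      gcongr
    · filter_upwards [hlim, hmK, hnb] with z hz hzK hzb
      have h3 : (ψ z).toReal < 0 := toReal_lt_of hzb (by simpa using hneg z (hs hzK))
      obtain ⟨h1, h2⟩ := hqT _ h3
      refine Tendsto.div tendsto_const_nhds ?_ (h1.trans_le h2).ne'
      exact ((hQ.hq.continuous.comp (hvc.neg)).tendsto _).comp hz
  exact le_of_tendsto_of_tendsto' (L1.norm.pow 2) ((L2.const_mul _).mul L3) key

end

section
open MeasureTheory Metric Complex Set Filter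
open scoped ContDiff Topology

lemma Apx.aem {u : ℂ → EReal} {D K : Set ℂ} (h : Apx u D) (hK : IsCompact K) (hKD : K ⊆ D) :
    AEMeasurable (fun z => (u z).toReal) (volume.restrict K) := by
  have hap := h.2.2 K hK hKD
  obtain ⟨O1, hO1, hKO1, hO1D, M, hM, p, hp, hpM, hpl, hpu, hpt⟩ := hap
  have hmK : ∀ᵐ z ∂(volume.restrict K), z ∈ K := ae_restrict_mem hK.measurableSet
  have hnb : ∀ᵐ z ∂(volume.restrict K), u z ≠ ⊥ := ae_mono (Measure.restrict_mono hKD le_rfl) h.1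
  refine aemeasurable_of_tendsto_metrizable_ae atTop (f := fun n z => p n z)
    (fun n => (hp n).continuous.aemeasurable) ?_
  filter_upwards [hmK, hnb] with z hz hz'
  exact hpt z (hKO1 hz) hz'

lemma Tw.Tpos {v b ρ : ℝ → ℝ} {τ τ' T : ℝ} (h : Tw v b ρ τ τ' T) : 0 < T := by
  have := h.hvneg (-1) (by norm_num)
  have := h.hvT (-1)
  linarith

lemma Qs.Hnn {q H S : ℝ → ℝ} (h : Qs q H S) {T : ℝ} (hT : 0 < T) : 0 ≤ H T := by
  have : MonotoneOn H (Ici 0) := monotoneOn_of_deriv_nonneg (convex_Ici 0)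
    (fun t _ => (h.hH t).continuousAt.continuousWithinAt)
    (fun t _ => (h.hH t).differentiableAt.differentiableWithinAt)
    (fun t ht => by rw [(h.hH t).deriv]; exact (h.hpos t (by simpa using ht)).le)
  have h2 := this self_mem_Ici hT.le hT.le
  rwa [h.H0] at h2

lemma DI_2 {q H S : ℝ → ℝ} (hQ : Qs q H S) {v b ρ : ℝ → ℝ} {τ τ' T : ℝ} (hT : Tw v b ρ τ τ' T)
    {D : Set ℂ} {ψ : ℂ → EReal} (hψ : Apx ψ D) (hneg : ∀ z ∈ D, ψ z < 0) {Φ : ℂ → EReal}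
    (hΦ : Apx Φ D) {χ : ℂ → ℂ} (hχ : ContDiff ℝ ∞ χ) (hc : HasCompactSupport χ)
    (hs : tsupport χ ⊆ D) {F : ℂ → ℂ}
    (hF : DifferentiableOn ℂ F {z | z ∈ D ∧ ψ z < (τ : EReal)})
    (hF2 : MemLp F 2 (volume.restrict (tsupport χ)))
    (hI : IntegrableOn (fun z => ρ (ψ z).toReal * ‖F z‖ ^ 2 * Real.exp (-(Φ z).toReal)) (tsupport χ)) :
    ‖∫ z in tsupport χ, ((1 - b (ψ z).toReal : ℝ) : ℂ) * F z * dzb χ z‖ ^ 2 ≤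
      (H T * ∫ z in tsupport χ, ρ (ψ z).toReal * ‖F z‖ ^ 2 * Real.exp (-(Φ z).toReal)) *
        ∫ z in tsupport χ, ‖dzb χ z‖ ^ 2 * Real.exp (Φ z).toReal / q (-v (ψ z).toReal) := by
  set K := tsupport χ with hK
  have hKc : IsCompact K := hc
  have hap := hΦ.2.2 K hKc hs
  obtain ⟨O1, hO1, hKO1, hO1D, M, hM, p, hp, hpM, hpl, hpu, hpt⟩ := hap
  have hmK : ∀ᵐ z ∂(volume.restrict K), z ∈ K := ae_restrict_mem hKc.measurableSet
  have hnb : ∀ᵐ z ∂(volume.restrict K), ψ z ≠ ⊥ := ae_mono (Measure.restrict_mono hs le_rfl) hψ.1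
  have hnb' : ∀ᵐ z ∂(volume.restrict K), Φ z ≠ ⊥ := ae_mono (Measure.restrict_mono hs le_rfl) hΦ.1
  have hlim : ∀ᵐ z ∂(volume.restrict K), Tendsto (fun n => p n z) atTop (𝓝 (Φ z).toReal) := by
    filter_upwards [hmK, hnb'] with z hz hz'
    exact hpt z (hKO1 hz) hz'
  have hvc : Continuous v := continuous_iff_continuousAt.2 fun t => (hT.hv t).continuousAt
  have hdc : Continuous (dzb χ) := hχ.dzb'.continuous
  have hfin : IsFiniteMeasure (volume.restrict K) := ⟨by simpa using hKc.measure_lt_top⟩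
  have hψm := hψ.aem hKc hs
  have hqT : ∀ x, x < 0 → 0 < q T ∧ q T ≤ q (-v x) := by
    intro x hx
    have h1 := hT.hvneg x hx
    have h2 := hT.hvT x
    exact ⟨hQ.hpos _ (by linarith), hQ.anti (by linarith) (by linarith)⟩
  have hqT' : ∀ᵐ z ∂(volume.restrict K), 0 < q T ∧ q T ≤ q (-v (ψ z).toReal) := by
    filter_upwards [hmK, hnb] with z hzK hzb
    exact hqT _ (toReal_lt_of hzb (by simpa using hneg z (hs hzK)))
  have key : ∀ n, ‖∫ z in K, ((1 - b (ψ z).toReal : ℝ) : ℂ) * F z * dzb χ z‖ ^ 2 ≤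
      (H T * ∫ z in K, ρ (ψ z).toReal * ‖F z‖ ^ 2 * Real.exp (-(Φ z).toReal)) *
        ∫ z in K, ‖dzb χ z‖ ^ 2 * Real.exp (p n z) / q (-v (ψ z).toReal) := by
    intro n
    refine (DI_1 hQ hT hψ hneg (hp n) hχ hc hs hO1 hKO1 (hpl n) hF hF2).trans ?_
    refine mul_le_mul_of_nonneg_right (mul_le_mul_of_nonneg_left ?_ (hQ.Hnn hT.Tpos)) ?_
    · refine integral_mono_of_nonneg (Eventually.of_forall fun z => ?_) hI ?_
      · have := hT.hρ0 (ψ z).toReal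
        simp only [Pi.zero_apply]; positivity
      · filter_upwards [hmK, hnb'] with z hz hz'
        have h1 := toReal_le_of hz' (hpu n z (hKO1 hz))
        have := hT.hρ0 (ψ z).toReal
        gcongr
    · refine integral_nonneg_of_ae ?_
      filter_upwards [hqT'] with z hz
      have := hz.1.trans_le hz.2
      simp only [Pi.zero_apply]; positivity
  have L3 : Tendsto (fun n => ∫ z in K, ‖dzb χ z‖ ^ 2 * Real.exp (p n z) / q (-v (ψ z).toReal)) atTop
      (𝓝 (∫ z in K, ‖dzb χ z‖ ^ 2 * Real.exp (Φ z).toReal / q (-v (ψ z).toReal))) := by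
    apply tendsto_integral_of_dominated_convergence (fun z => ‖dzb χ z‖ ^ 2 * Real.exp M / q T)
    · intro n
      refine AEMeasurable.aestronglyMeasurable (AEMeasurable.div ?_ ?_)
      · have := (hp n).continuous
        exact Continuous.aemeasurable (by fun_prop)
      · have := hQ.hq.continuous
        have h2 : Continuous fun x => q (-v x) := by fun_prop
        exact h2.measurable.comp_aemeasurable hψm
    · refine Integrable.div_const ?_ _
      exact (Continuous.continuousOn (by fun_prop)).integrableOn_compact hKc
    · intro n
      filter_upwards [hqT'] with z hz
      obtain ⟨h1, h2⟩ := hz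
      rw [Real.norm_eq_abs, abs_of_nonneg (by have := h1.trans_le h2; positivity)]
      have := hpM n z
      gcongr
    · filter_upwards [hlim] with z hz
      exact (((Real.continuous_exp.tendsto _).comp hz).const_mul _).div_const _
  exact ge_of_tendsto' (L3.const_mul _) key

/-- smoothing a monotone weight -/
lemma q_smooth {q : ℝ → ℝ} (hqm : Measurable q) (hpos : ∀ t, 0 < t → 0 < q t)
    (hanti : ∀ s t, 0 < s → s ≤ t → q t ≤ q s) {ε T η : ℝ} (hε : 0 < ε) (hη : 0 < η) (hT : 0 < T)
    (hint : IntegrableOn q (Ioc 0 T)) :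
    ∃ q' H S : ℝ → ℝ, Qs q' H S ∧ (∀ t, ε ≤ t → q t ≤ q' t) ∧ H T ≤ (∫ t in Ioc 0 T, q t) + η := by
  set q1 : ℝ → ℝ := fun t => q (max t ε) with hq1
  have hq1m : Measurable q1 := hqm.comp (measurable_id.max measurable_const)
  have hq1a : Antitone q1 := fun s t hst =>
    hanti _ _ (hε.trans_le (le_max_right _ _)) (max_le_max_right _ hst)
  have hq1p : ∀ t, 0 < q1 t := fun t => hpos _ (hε.trans_le (le_max_right _ _))
  have hq1b : ∀ t, q1 t ≤ q ε := fun t => hanti _ _ hε (le_max_right _ _)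
  have hqε := hpos ε hε
  obtain ⟨δ, hδ, hδη⟩ : ∃ δ : ℝ, 0 < δ ∧ δ * q ε ≤ η := ⟨η / q ε, by positivity, by field_simp; rfl⟩
  let bb : ContDiffBump (δ / 2) := ⟨δ / 8, δ / 4, by positivity, by linarith⟩
  set k : ℝ → ℝ := bb.normed volume with hk
  have hkc : ContDiff ℝ ∞ k := bb.contDiff_normed
  have hks : HasCompactSupport k := bb.hasCompactSupport_normed
  have hk0 : ∀ x, 0 ≤ k x := bb.nonneg_normed
  have hki : ∫ x, k x = 1 := bb.integral_normed
  have hksup : ∀ x, k x ≠ 0 → 0 ≤ x ∧ x ≤ δ := by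
    intro x hx
    have : x ∈ Function.support k := hx
    rw [hk, bb.support_normed_eq, Real.ball_eq_Ioo] at this
    simp only [bb, mem_Ioo] at this
    constructor <;> linarith [this.1, this.2]
  have hq1i : ∀ t, Integrable (fun s => k s * q1 (t - s)) := by
    intro t
    refine (hkc.continuous.integrable_of_hasCompactSupport hks).mul_bdd (c := q ε) ?_ ?_
    · exact (hq1m.comp (measurable_const.sub measurable_id)).aestronglyMeasurable
    · refine Eventually.of_forall fun s => ?_
      rw [Real.norm_eq_abs, abs_of_pos (hq1p _)]; exact hq1b _
  set q' : ℝ → ℝ := fun t => ∫ s, k s * q1 (t - s) with hq'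
  have hloc : LocallyIntegrable q1 := by
    refine (locallyIntegrable_const (q ε)).mono hq1m.aestronglyMeasurable ?_
    refine Eventually.of_forall fun s => ?_
    rw [Real.norm_eq_abs, Real.norm_eq_abs, abs_of_pos (hq1p _), abs_of_pos hqε]; exact hq1b _
  have hsm : ContDiff ℝ ∞ q' :=
    hks.contDiff_convolution_left (ContinuousLinearMap.mul ℝ ℝ) hkc hloc
  have hge : ∀ t, q1 t ≤ q' t := by
    intro t
    have : q1 t = ∫ s, k s * q1 t := by rw [integral_mul_const, hki, one_mul]
    rw [this]
    refine integral_mono ((hkc.continuous.integrable_of_hasCompactSupport hks).mul_const _) (hq1i t) ?_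
    intro s
    by_cases hs : k s = 0
    · simp [hs]
    · exact mul_le_mul_of_nonneg_left (hq1a (by linarith [(hksup s hs).1])) (hk0 s)
  have hle : ∀ t, q' t ≤ q1 (t - δ) := by
    intro t
    have : q1 (t - δ) = ∫ s, k s * q1 (t - δ) := by rw [integral_mul_const, hki, one_mul]
    rw [this]
    refine integral_mono (hq1i t) ((hkc.continuous.integrable_of_hasCompactSupport hks).mul_const _) ?_
    intro s
    by_cases hs : k s = 0
    · simp [hs]
    · exact mul_le_mul_of_nonneg_left (hq1a (by linarith [(hksup s hs).2])) (hk0 s)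
  have hqa' : Antitone q' := fun s t hst => integral_mono (hq1i t) (hq1i s) fun x =>
    mul_le_mul_of_nonneg_left (hq1a (by linarith)) (hk0 x)
  have hcont : Continuous q' := hsm.continuous
  set H : ℝ → ℝ := fun t => ∫ s in (0:ℝ)..t, q' s with hH
  have hHd : ∀ t, HasDerivAt H (q' t) t := fun t => hcont.integral_hasStrictDerivAt 0 t |>.hasDerivAt
  have hHc : Continuous H := continuous_iff_continuousAt.2 fun t => (hHd t).continuousAt
  refine ⟨q', H, fun t => ∫ s in (0:ℝ)..t, H s, ⟨hsm, fun t _ => (hq1p t).trans_le (hge t), ?_, hHd,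
    fun t => hHc.integral_hasStrictDerivAt 0 t |>.hasDerivAt, by simp [hH], by simp⟩, ?_, ?_⟩
  · intro t _; exact hqa'.deriv_nonpos
  · intro t ht
    have := hge t
    simpa [hq1, max_eq_left ht] using this
  · have hii : ∀ a b, IntervalIntegrable q1 volume a b := fun a b => hq1a.intervalIntegrable
    have h1 : H T ≤ ∫ s in (0:ℝ)..T, q1 (s - δ) := by
      refine intervalIntegral.integral_mono_on hT.le (hcont.intervalIntegrable _ _) ?_ (fun s _ => hle s)
      exact Antitone.intervalIntegrable fun a b h => hq1a (by linarith)
    rw [intervalIntegral.integral_comp_sub_right] at h1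
    have h2 : ∫ s in (0 - δ)..(T - δ), q1 s = (∫ s in (0-δ)..0, q1 s) + ∫ s in (0:ℝ)..(T-δ), q1 s :=
      (intervalIntegral.integral_add_adjacent_intervals (hii _ _) (hii _ _)).symm
    have h3 : ∫ s in (0-δ)..0, q1 s ≤ δ * q ε := by
      have : ∫ s in (0-δ)..0, q1 s ≤ ∫ s in (0-δ)..0, q ε :=
        intervalIntegral.integral_mono_on (by linarith) (hii _ _) (by simp) (fun s _ => hq1b s)
      simpa using this
    have h4 : ∫ s in (0:ℝ)..T, q1 s = (∫ s in (0:ℝ)..(T-δ), q1 s) + ∫ s in (T-δ)..T, q1 s :=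
      (intervalIntegral.integral_add_adjacent_intervals (hii _ _) (hii _ _)).symm
    have h5 : 0 ≤ ∫ s in (T-δ)..T, q1 s :=
      intervalIntegral.integral_nonneg (by linarith) fun s _ => (hq1p s).le
    have h6 : ∫ s in (0:ℝ)..T, q1 s ≤ ∫ s in (0:ℝ)..T, q s := by
      refine intervalIntegral.integral_mono_on_of_le_Ioo hT.le (hii _ _)
        ((intervalIntegrable_iff_integrableOn_Ioc_of_le hT.le).2 hint) (fun s hs => ?_)
      exact hanti _ _ hs.1 (le_max_left _ _)
    rw [intervalIntegral.integral_of_le hT.le] at h6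
    rw [intervalIntegral.integral_of_le hT.le] at h6
    rw [intervalIntegral.integral_of_le hT.le] at h4
    linarith

lemma Apx.bdd {u : ℂ → EReal} {D K : Set ℂ} (h : Apx u D) (hK : IsCompact K) (hKD : K ⊆ D) :
    ∃ M : ℝ, (∀ z ∈ K, u z ≤ M) ∧ ((∀ z ∈ D, u z < 0) → M < 0) := by
  have hap := h.2.2 K hK hKD
  obtain ⟨O1, hO1, hKO1, hO1D, M, hM, p, hp, hpM, hpl, hpu, hpt⟩ := hap
  exact ⟨M, fun z hz => (hpu 0 z (hKO1 hz)).trans (by exact_mod_cast hpM 0 z), hM⟩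

lemma DI_3 {q : ℝ → ℝ} (hqm : Measurable q) (hpos : ∀ t, 0 < t → 0 < q t)
    (hanti : ∀ s t, 0 < s → s ≤ t → q t ≤ q s)
    {v b ρ : ℝ → ℝ} {τ τ' T : ℝ} (hT : Tw v b ρ τ τ' T) (hint : IntegrableOn q (Ioc 0 T))
    {D : Set ℂ} {ψ : ℂ → EReal} (hψ : Apx ψ D) (hneg : ∀ z ∈ D, ψ z < 0) {Φ : ℂ → EReal}
    (hΦ : Apx Φ D) {χ : ℂ → ℂ} (hχ : ContDiff ℝ ∞ χ) (hc : HasCompactSupport χ)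
    (hs : tsupport χ ⊆ D) {F : ℂ → ℂ}
    (hF : DifferentiableOn ℂ F {z | z ∈ D ∧ ψ z < (τ : EReal)})
    (hF2 : MemLp F 2 (volume.restrict (tsupport χ)))
    (hI : IntegrableOn (fun z => ρ (ψ z).toReal * ‖F z‖ ^ 2 * Real.exp (-(Φ z).toReal)) (tsupport χ)) :
    ‖∫ z in tsupport χ, ((1 - b (ψ z).toReal : ℝ) : ℂ) * F z * dzb χ z‖ ^ 2 ≤
      ((∫ t in Ioc 0 T, q t) * ∫ z in tsupport χ, ρ (ψ z).toReal * ‖F z‖ ^ 2 * Real.exp (-(Φ z).toReal)) *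
        ∫ z in tsupport χ, ‖dzb χ z‖ ^ 2 * Real.exp (Φ z).toReal / q (-v (ψ z).toReal) := by
  set K := tsupport χ with hK
  have hKc : IsCompact K := hc
  have hmK : ∀ᵐ z ∂(volume.restrict K), z ∈ K := ae_restrict_mem hKc.measurableSet
  have hnb : ∀ᵐ z ∂(volume.restrict K), ψ z ≠ ⊥ := ae_mono (Measure.restrict_mono hs le_rfl) hψ.1
  have hnb' : ∀ᵐ z ∂(volume.restrict K), Φ z ≠ ⊥ := ae_mono (Measure.restrict_mono hs le_rfl) hΦ.1
  obtain ⟨M, hM, hM0⟩ := hψ.bdd hKc hs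
  replace hM0 := hM0 hneg
  obtain ⟨M', hM', -⟩ := hΦ.bdd hKc hs
  have hε : 0 < -v M := by linarith [hT.hvneg M hM0]
  have hvc : Continuous v := continuous_iff_continuousAt.2 fun t => (hT.hv t).continuousAt
  have hdc : Continuous (dzb χ) := hχ.dzb'.continuous
  have hqT' : ∀ᵐ z ∂(volume.restrict K), 0 < q T ∧ q T ≤ q (-v (ψ z).toReal) ∧ -v M ≤ -v (ψ z).toReal := by
    filter_upwards [hmK, hnb] with z hzK hzb
    have h1 := toReal_le_of hzb (hM z hzK)
    have h2 := hT.mono h1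
    have h3 := hT.hvT (ψ z).toReal
    exact ⟨hpos _ hT.Tpos, hanti _ _ (by linarith) (by linarith), by linarith⟩
  have hi3 : IntegrableOn (fun z => ‖dzb χ z‖ ^ 2 * Real.exp (Φ z).toReal / q (-v (ψ z).toReal)) K := by
    refine Integrable.mono' (g := fun z => ‖dzb χ z‖ ^ 2 * Real.exp M' / q T) ?_ ?_ ?_
    · refine Integrable.div_const ?_ _
      exact (Continuous.continuousOn (by fun_prop)).integrableOn_compact hKc
    · refine AEMeasurable.aestronglyMeasurable (AEMeasurable.div (AEMeasurable.mul ?_ ?_) ?_)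
      · exact Continuous.aemeasurable (by fun_prop)
      · exact Real.measurable_exp.comp_aemeasurable (hΦ.aem hKc hs)
      · exact (hqm.comp hvc.measurable.neg).comp_aemeasurable (hψ.aem hKc hs)
    · filter_upwards [hqT', hnb', hmK] with z hz hz' hzK
      obtain ⟨h1, h2, -⟩ := hz
      have h3 := toReal_le_of hz' (hM' z hzK)
      rw [Real.norm_eq_abs, abs_of_nonneg (by have := h1.trans_le h2; positivity)]
      gcongr
  have hI0 : 0 ≤ ∫ z in K, ρ (ψ z).toReal * ‖F z‖ ^ 2 * Real.exp (-(Φ z).toReal) := by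
    refine integral_nonneg fun z => ?_
    have := hT.hρ0 (ψ z).toReal
    simp only [Pi.zero_apply]; positivity
  have key : ∀ η > 0, ‖∫ z in K, ((1 - b (ψ z).toReal : ℝ) : ℂ) * F z * dzb χ z‖ ^ 2 ≤
      (((∫ t in Ioc 0 T, q t) + η) * ∫ z in K, ρ (ψ z).toReal * ‖F z‖ ^ 2 * Real.exp (-(Φ z).toReal)) *
        ∫ z in K, ‖dzb χ z‖ ^ 2 * Real.exp (Φ z).toReal / q (-v (ψ z).toReal) := by
    intro η hη
    have hqs := q_smooth hqm hpos hanti hε hη hT.Tpos hint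
    obtain ⟨q', H, S, hQ, hge, hHT⟩ := hqs
    refine (DI_2 hQ hT hψ hneg hΦ hχ hc hs hF hF2 hI).trans ?_
    have hH0 := hQ.Hnn hT.Tpos
    refine mul_le_mul (mul_le_mul_of_nonneg_right hHT hI0) ?_ ?_ ?_
    · refine integral_mono_of_nonneg ?_ hi3 ?_
      · filter_upwards [hqT'] with z hz
        have := hQ.hpos _ (hε.trans_le hz.2.2)
        simp only [Pi.zero_apply]; positivity
      · filter_upwards [hqT'] with z hz
        have := hge _ hz.2.2
        have := hz.1.trans_le hz.2.1
        gcongr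
    · refine integral_nonneg_of_ae ?_
      filter_upwards [hqT'] with z hz
      have := hQ.hpos _ (hε.trans_le hz.2.2)
      simp only [Pi.zero_apply]; positivity
    · exact mul_nonneg (hH0.trans hHT) hI0
  have hlim : Tendsto (fun η : ℝ => (((∫ t in Ioc 0 T, q t) + η) * ∫ z in K, ρ (ψ z).toReal * ‖F z‖ ^ 2 * Real.exp (-(Φ z).toReal)) *
        ∫ z in K, ‖dzb χ z‖ ^ 2 * Real.exp (Φ z).toReal / q (-v (ψ z).toReal)) (𝓝[>] 0)
      (𝓝 ((((∫ t in Ioc 0 T, q t) + 0) * ∫ z in K, ρ (ψ z).toReal * ‖F z‖ ^ 2 * Real.exp (-(Φ z).toReal)) *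
        ∫ z in K, ‖dzb χ z‖ ^ 2 * Real.exp (Φ z).toReal / q (-v (ψ z).toReal))) := by
    refine Tendsto.mono_left (Continuous.tendsto (by fun_prop) 0) nhdsWithin_le_nhds
  rw [add_zero] at hlim
  exact ge_of_tendsto hlim (by filter_upwards [self_mem_nhdsWithin] with η hη using key η hη)

end

section
open MeasureTheory Metric Complex Set Filter
open scoped ContDiff Topology

lemma tw_exists {t0 B δ : ℝ} (ht0 : 0 < t0) (hB : 0 < B) (hδ : 0 < δ) :
    ∃ (v b ρ : ℝ → ℝ) (τ' : ℝ), Tw v b ρ (-t0) τ' (t0 + B) ∧ (∀ x, x ≤ -t0 - B → b x = 0) ∧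
      (∀ x, x ≤ -t0 - B → ρ x = 0) ∧ (∀ x, ρ x ≤ (1 + δ) / B) ∧ (∀ x, -t0 ≤ x → v x = x) := by
  set r1 := B / (2 * (1 + δ)) with hr1
  have hr1p : 0 < r1 := by positivity
  have hr1lt : r1 < B / 2 := by
    rw [hr1]; apply div_lt_div_of_pos_left hB (by norm_num); linarith
  set r2 := (r1 + B / 2) / 2 with hr2
  have h12 : r1 < r2 := by rw [hr2]; linarith
  have h2B : r2 < B / 2 := by rw [hr2]; linarith
  let bb : ContDiffBump (-t0 - B / 2) := ⟨r1, r2, hr1p, h12⟩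
  set ρ : ℝ → ℝ := bb.normed volume with hρ
  have hρc : ContDiff ℝ ∞ ρ := bb.contDiff_normed
  have hρs : HasCompactSupport ρ := bb.hasCompactSupport_normed
  have hρ0 : ∀ x, 0 ≤ ρ x := bb.nonneg_normed
  have hρi : ∫ x, ρ x = 1 := bb.integral_normed
  have hsup : ∀ x, ρ x ≠ 0 → -t0 - B / 2 - r2 < x ∧ x < -t0 - B / 2 + r2 := by
    intro x hx
    have : x ∈ Function.support ρ := hx
    rw [hρ, bb.support_normed_eq, Real.ball_eq_Ioo] at this
    exact this
  have hρle : ∀ x, ρ x ≤ (1 + δ) / B := by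
    intro x
    have h1 : ρ x ≤ 1 / (volume : Measure ℝ).real (closedBall (-t0 - B / 2) r1) := bb.normed_le_div_measure_closedBall_rIn volume x
    rw [Real.volume_real_closedBall hr1p.le] at h1
    refine h1.trans (le_of_eq ?_)
    rw [hr1]; field_simp
  set τ' := -t0 - B / 2 + r2 with hτ'
  have hcont := hρc.continuous
  set a := -t0 - B with ha
  set b : ℝ → ℝ := fun x => ∫ s in a..x, ρ s with hb
  have hbd : ∀ t, HasDerivAt b (ρ t) t := fun t => hcont.integral_hasStrictDerivAt a t |>.hasDerivAt
  have hbc : Continuous b := continuous_iff_continuousAt.2 fun t => (hbd t).continuousAt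
  have hbmono : Monotone b := monotone_of_deriv_nonneg (fun t => (hbd t).differentiableAt) fun t => by
    rw [(hbd t).deriv]; exact hρ0 t
  have hρa : ∀ x, x ≤ a → ρ x = 0 := by
    intro x hx; by_contra h
    have := (hsup x h).1
    rw [ha] at hx; linarith
  have hρτ : ∀ x, τ' ≤ x → ρ x = 0 := by
    intro x hx; by_contra h
    have := (hsup x h).2
    linarith
  have hb00 : ∀ x, x ≤ a → b x = 0 := by
    intro x hx
    rw [hb]
    simp only
    rw [intervalIntegral.integral_symm, intervalIntegral.integral_of_le hx, neg_eq_zero]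
    exact setIntegral_eq_zero_of_forall_eq_zero fun s hs => hρa s hs.2
  have hb1 : ∀ x, τ' ≤ x → b x = 1 := by
    intro x hx
    have hax : a ≤ x := by rw [ha]; rw [hτ'] at hx; linarith
    rw [← hρi, hb]
    simp only
    rw [intervalIntegral.integral_of_le hax]
    refine setIntegral_eq_integral_of_forall_compl_eq_zero fun s hs => ?_
    simp only [mem_Ioc, not_and_or, not_lt, not_le] at hs
    rcases hs with hs | hs
    · exact hρa s hs
    · exact hρτ s (by linarith)
  have hb0 : ∀ x, 0 ≤ b x := by
    intro x
    rcases le_total x a with h | h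
    · rw [hb00 x h]
    · rw [← hb00 a le_rfl]; exact hbmono h
  have hble : ∀ x, b x ≤ 1 := by
    intro x
    rw [← hb1 (max x τ') (le_max_right _ _)]; exact hbmono (le_max_left _ _)
  have hii : ∀ x y, IntervalIntegrable b volume x y := fun x y => hbc.intervalIntegrable _ _
  set v : ℝ → ℝ := fun x => -t0 + ∫ s in (-t0)..x, b s with hv
  have hvd : ∀ t, HasDerivAt v (b t) t := fun t =>
    (hbc.integral_hasStrictDerivAt (-t0) t |>.hasDerivAt).const_add _
  have hvx : ∀ x, -t0 ≤ x → v x = x := by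
    intro x hx
    have : ∫ s in (-t0)..x, b s = ∫ s in (-t0)..x, (1:ℝ) := by
      refine intervalIntegral.integral_congr fun s hs => ?_
      rw [uIcc_of_le hx] at hs
      exact hb1 s (by rw [hτ']; linarith [hs.1])
    rw [hv]; simp only; rw [this]; simp
  have hvmono : Monotone v := monotone_of_deriv_nonneg (fun t => (hvd t).differentiableAt) fun t => by
    rw [(hvd t).deriv]; exact hb0 t
  refine ⟨v, b, ρ, τ', ⟨hvd, hbd, hρc, hρ0, ⟨_, hρle⟩, hb0, hble, by rw [hτ']; linarith, hb1, hρτ, ?_, ?_⟩,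
    hb00, hρa, hρle, hvx⟩
  · have h1 : ∀ x, x ≤ a → v x = v a := by
      intro x hx
      have : (∫ s in (-t0)..x, b s) = (∫ s in (-t0)..a, b s) + ∫ s in a..x, b s :=
        (intervalIntegral.integral_add_adjacent_intervals (hii _ _) (hii _ _)).symm
      have h0 : ∫ s in a..x, b s = 0 := by
        rw [intervalIntegral.integral_symm, intervalIntegral.integral_of_le hx, neg_eq_zero]
        exact setIntegral_eq_zero_of_forall_eq_zero fun s hs => hb00 s hs.2
      simp only [hv]; rw [this, h0, add_zero]
    have h2 : -(t0 + B) ≤ v a := by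
      have : ∫ s in a..(-t0), b s ≤ ∫ s in a..(-t0), (1:ℝ) :=
        intervalIntegral.integral_mono_on (by rw [ha]; linarith) (hii _ _) (by simp) fun s _ => hble s
      rw [intervalIntegral.integral_const, smul_eq_mul, mul_one] at this
      simp only [hv]; rw [intervalIntegral.integral_symm]; rw [ha] at this ⊢; linarith
    intro x
    rcases le_total x a with h | h
    · rw [h1 x h]; exact h2
    · exact h2.trans (hvmono h)
  · intro x hx
    rcases le_total (-t0) x with h | h
    · rwa [hvx x h]
    · have := hvmono h
      rw [hvx (-t0) le_rfl] at this; linarith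

end

section
open MeasureTheory Metric Complex Set Filter
open scoped ContDiff Topology

/-- limit weight -/
noncomputable def qhat (q : ℝ → ℝ) (L t0 : ℝ) (x : ℝ) : ℝ := if x < -t0 then L else q (-x)

lemma DI_4 {q : ℝ → ℝ} (hqm : Measurable q) (hpos : ∀ t, 0 < t → 0 < q t)
    (hanti : ∀ s t, 0 < s → s ≤ t → q t ≤ q s) (hint : IntegrableOn q (Ioi 0))
    {t0 L a : ℝ} (ht0 : 0 < t0) (hL : Tendsto q (𝓝[>] t0) (𝓝 L)) (ha : 0 ≤ a)
    {D : Set ℂ} {ψ : ℂ → EReal} (hψ : Apx ψ D) (hneg : ∀ z ∈ D, ψ z < 0) {Φ : ℂ → EReal}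
    (hΦ : Apx Φ D) {χ : ℂ → ℂ} (hχ : ContDiff ℝ ∞ χ) (hc : HasCompactSupport χ)
    (hs : tsupport χ ⊆ D) {F : ℂ → ℂ}
    (hF : DifferentiableOn ℂ F {z | z ∈ D ∧ ψ z < ((-t0 : ℝ) : EReal)})
    (hF0 : ∀ z ∈ D, ¬ ψ z < ((-t0 : ℝ) : EReal) → F z = 0)
    (hF2 : MemLp F 2 (volume.restrict (tsupport χ)))
    (hI : ∀ B > 0, IntegrableOn (fun z => ‖F z‖ ^ 2 * Real.exp (-(Φ z).toReal))
        {z | z ∈ D ∧ ((-t0 - B : ℝ) : EReal) ≤ ψ z ∧ ψ z < ((-t0 : ℝ) : EReal)} ∧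
      ∫ z in {z | z ∈ D ∧ ((-t0 - B : ℝ) : EReal) ≤ ψ z ∧ ψ z < ((-t0 : ℝ) : EReal)},
        ‖F z‖ ^ 2 * Real.exp (-(Φ z).toReal) ≤ a * B * L / q (t0 + B)) :
    ‖∫ z in tsupport χ, F z * dzb χ z‖ ^ 2 ≤
      (a * ∫ t in Ioc 0 t0, q t) *
        ∫ z in tsupport χ, ‖dzb χ z‖ ^ 2 * Real.exp (Φ z).toReal / qhat q L t0 (ψ z).toReal := by
  set K := tsupport χ with hK
  have hKc : IsCompact K := hc
  have hmK : ∀ᵐ z ∂(volume.restrict K), z ∈ K := ae_restrict_mem hKc.measurableSet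
  have hnb : ∀ᵐ z ∂(volume.restrict K), ψ z ≠ ⊥ := ae_mono (Measure.restrict_mono hs le_rfl) hψ.1
  have hnb' : ∀ᵐ z ∂(volume.restrict K), Φ z ≠ ⊥ := ae_mono (Measure.restrict_mono hs le_rfl) hΦ.1
  have hfin : IsFiniteMeasure (volume.restrict K) := ⟨by simpa using hKc.measure_lt_top⟩
  have hFi : Integrable F (volume.restrict K) :=
    memLp_one_iff_integrable.1 (hF2.mono_exponent (by norm_num))
  have hdc : Continuous (dzb χ) := hχ.dzb'.continuous
  obtain ⟨C1, hC1⟩ := hdc.bounded_above_of_compact_support hc.dzb'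
  have hqL : ∀ s, t0 < s → q s ≤ L := by
    intro s hs
    refine ge_of_tendsto hL ?_
    filter_upwards [Ioo_mem_nhdsGT hs] with t ht
    exact hanti t s (ht0.trans ht.1) ht.2.le
  have hLp : 0 < L := (hpos _ (by linarith)).trans_le (hqL (t0 + 1) (by linarith))
  have hqhp : ∀ x, x < 0 → 0 < qhat q L t0 x := by
    intro x hx; unfold qhat; split_ifs
    · exact hLp
    · exact hpos _ (by linarith)
  have hqh1 : ∀ x, x < 0 → min L (q t0) ≤ qhat q L t0 x := by
    intro x hx; unfold qhat; split_ifs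
    · exact min_le_left _ _
    · exact (min_le_right _ _).trans (hanti _ _ (by linarith) (by linarith))
  have hmin : 0 < min L (q t0) := lt_min hLp (hpos _ ht0)
  have hqhm : Measurable (qhat q L t0) :=
    Measurable.ite measurableSet_Iio measurable_const (hqm.comp measurable_neg)
  have hψ0 : ∀ᵐ z ∂(volume.restrict K), (ψ z).toReal < 0 := by
    filter_upwards [hmK, hnb] with z hzK hzb
    exact toReal_lt_of hzb (by simpa using hneg z (hs hzK))
  obtain ⟨M', hM', -⟩ := hΦ.bdd hKc hs
  have hi3 : IntegrableOn (fun z => ‖dzb χ z‖ ^ 2 * Real.exp (Φ z).toReal / qhat q L t0 (ψ z).toReal) K := by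
    refine Integrable.mono' (g := fun z => ‖dzb χ z‖ ^ 2 * Real.exp M' / min L (q t0)) ?_ ?_ ?_
    · refine Integrable.div_const ?_ _
      exact (Continuous.continuousOn (by fun_prop)).integrableOn_compact hKc
    · refine AEMeasurable.aestronglyMeasurable (AEMeasurable.div (AEMeasurable.mul ?_ ?_) ?_)
      · exact Continuous.aemeasurable (by fun_prop)
      · exact Real.measurable_exp.comp_aemeasurable (hΦ.aem hKc hs)
      · exact hqhm.comp_aemeasurable (hψ.aem hKc hs)
    · filter_upwards [hψ0, hnb', hmK] with z hz hz' hzK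
      have h1 := hqhp _ hz
      have h2 := hqh1 _ hz
      have h3 := toReal_le_of hz' (hM' z hzK)
      rw [Real.norm_eq_abs, abs_of_nonneg (by positivity)]
      gcongr
  set X := ∫ z in K, ‖dzb χ z‖ ^ 2 * Real.exp (Φ z).toReal / qhat q L t0 (ψ z).toReal with hX
  have hX0 : 0 ≤ X := by
    refine integral_nonneg_of_ae ?_
    filter_upwards [hψ0] with z hz
    have := hqhp _ hz
    simp only [Pi.zero_apply]; positivity
  have hHnn : 0 ≤ ∫ t in Ioc 0 t0, q t := setIntegral_nonneg measurableSet_Ioc fun t ht => (hpos t ht.1).le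
  set Bn : ℕ → ℝ := fun n => 1 / ((n : ℝ) + 1) with hBn
  have hBp : ∀ n, 0 < Bn n := fun n => Nat.one_div_pos_of_nat
  have hBlim : Tendsto Bn atTop (𝓝 0) := tendsto_one_div_add_atTop_nhds_zero_nat
  choose v b ρ τ' hT hb0 hρ0 hρle hvx using fun n => tw_exists ht0 (hBp n) (hBp n)
  have hqpn : ∀ n, 0 < q (t0 + Bn n) := fun n => hpos _ (by linarith [hBp n])
  have key : ∀ n, ‖∫ z in K, ((1 - b n (ψ z).toReal : ℝ) : ℂ) * F z * dzb χ z‖ ^ 2 ≤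
      (((∫ t in Ioc 0 t0, q t) + Bn n * L) * ((1 + Bn n) * (a * L / q (t0 + Bn n)))) *
        (L / q (t0 + Bn n) * X) := by
    intro n
    have hB := hBp n
    have hqp := hqpn n
    have hqLn : q (t0 + Bn n) ≤ L := hqL _ (by linarith)
    have hi := hint.mono_set (Ioc_subset_Ioi_self : Ioc 0 (t0 + Bn n) ⊆ Ioi 0)
    obtain ⟨hi1, hi2⟩ := hI (Bn n) hB
    set S := {z | z ∈ D ∧ ((-t0 - Bn n : ℝ) : EReal) ≤ ψ z ∧ ψ z < ((-t0 : ℝ) : EReal)} with hS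
    have hρS : ∀ᵐ z ∂(volume.restrict K), ρ n (ψ z).toReal * ‖F z‖ ^ 2 * Real.exp (-(Φ z).toReal)
        ≤ S.indicator (fun z => (1 + Bn n) / Bn n * (‖F z‖ ^ 2 * Real.exp (-(Φ z).toReal))) z := by
      filter_upwards [hmK, hnb] with z hzK hzb
      by_cases hzS : z ∈ S
      · rw [indicator_of_mem hzS, mul_assoc]
        exact mul_le_mul_of_nonneg_right (hρle n _) (by positivity)
      · rw [indicator_of_notMem hzS]
        have hzt := hψ.2.1 z (hs hzK)
        have : ρ n (ψ z).toReal = 0 := by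
          by_contra hne
          apply hzS
          refine ⟨hs hzK, ?_, ?_⟩
          · rw [← EReal.coe_toReal hzt hzb]
            by_contra hlt
            rw [not_le] at hlt
            exact hne (hρ0 n _ (by exact_mod_cast hlt.le))
          · rw [← EReal.coe_toReal hzt hzb]
            by_contra hlt
            rw [not_lt] at hlt
            exact hne ((hT n).hρτ _ ((hT n).hτ.le.trans (by exact_mod_cast hlt)))
        rw [this]; simp
    have hSn : NullMeasurableSet S (volume.restrict K) := by
      have h1 : NullMeasurableSet ((fun z => (ψ z).toReal) ⁻¹' (Ico (-t0 - Bn n) (-t0))) (volume.restrict K) :=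
        (hψ.aem hKc hs).nullMeasurableSet_preimage measurableSet_Ico
      refine h1.congr ?_
      filter_upwards [hmK, hnb] with z hzK hzb
      have hzt := hψ.2.1 z (hs hzK)
      have hx : ψ z = ((ψ z).toReal : EReal) := (EReal.coe_toReal hzt hzb).symm
      apply propext
      change ((ψ z).toReal ∈ Ico _ _) ↔ (z ∈ D ∧ _ ≤ ψ z ∧ ψ z < _)
      rw [hx]
      simp only [EReal.toReal_coe, mem_Ico, hs hzK, true_and]
      norm_cast
    have hi1' : Integrable (fun z => (1 + Bn n) / Bn n * (‖F z‖ ^ 2 * Real.exp (-(Φ z).toReal)))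
        ((volume.restrict K).restrict S) := by
      refine Integrable.const_mul ?_ _
      refine Integrable.mono_measure hi1 ?_
      exact Measure.restrict_mono_measure Measure.restrict_le_self S
    have hind : Integrable (S.indicator (fun z => (1 + Bn n) / Bn n * (‖F z‖ ^ 2 * Real.exp (-(Φ z).toReal))))
        (volume.restrict K) := IntegrableOn.integrable_indicator₀ hi1' hSn
    have hgm : AEStronglyMeasurable (fun z => ρ n (ψ z).toReal * ‖F z‖ ^ 2 * Real.exp (-(Φ z).toReal))
        (volume.restrict K) := by
      refine AEStronglyMeasurable.mul (AEStronglyMeasurable.mul ?_ ?_) ?_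
      · exact ((hT n).hρ.continuous.measurable.comp_aemeasurable (hψ.aem hKc hs)).aestronglyMeasurable
      · exact hFi.aestronglyMeasurable.norm.pow 2
      · exact (Real.measurable_exp.comp_aemeasurable (hΦ.aem hKc hs).neg).aestronglyMeasurable
    have hg0 : ∀ z, 0 ≤ ρ n (ψ z).toReal * ‖F z‖ ^ 2 * Real.exp (-(Φ z).toReal) := fun z => by
      have := (hT n).hρ0 (ψ z).toReal; positivity
    have hgi : IntegrableOn (fun z => ρ n (ψ z).toReal * ‖F z‖ ^ 2 * Real.exp (-(Φ z).toReal)) K := by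
      refine Integrable.mono' hind hgm ?_
      filter_upwards [hρS] with z hz
      rwa [Real.norm_eq_abs, abs_of_nonneg (hg0 z)]
    refine (DI_3 hqm hpos hanti (hT n) hi hψ hneg hΦ hχ hc hs hF hF2 hgi).trans ?_
    have hgint : ∫ z in K, ρ n (ψ z).toReal * ‖F z‖ ^ 2 * Real.exp (-(Φ z).toReal)
        ≤ (1 + Bn n) * (a * L / q (t0 + Bn n)) := by
      refine (integral_mono_ae hgi hind hρS).trans ?_
      rw [integral_indicator₀ hSn, integral_const_mul]
      have h5 : ∫ z in S, ‖F z‖ ^ 2 * Real.exp (-(Φ z).toReal) ∂(volume.restrict K)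
          ≤ ∫ z in S, ‖F z‖ ^ 2 * Real.exp (-(Φ z).toReal) :=
        integral_mono_measure (Measure.restrict_mono_measure Measure.restrict_le_self S)
          (Eventually.of_forall fun z => by simp only [Pi.zero_apply]; positivity) hi1
      calc _ ≤ (1 + Bn n) / Bn n * (a * Bn n * L / q (t0 + Bn n)) :=
            mul_le_mul_of_nonneg_left (h5.trans hi2) (by positivity)
        _ = _ := by field_simp
    have hqint : ∫ t in Ioc 0 (t0 + Bn n), q t ≤ (∫ t in Ioc 0 t0, q t) + Bn n * L := by
      rw [← Ioc_union_Ioc_eq_Ioc ht0.le (by linarith : t0 ≤ t0 + Bn n),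
        setIntegral_union (Ioc_disjoint_Ioc_of_le le_rfl) measurableSet_Ioc
          (hint.mono_set Ioc_subset_Ioi_self)
          (hint.mono_set (fun t ht => ht0.trans ht.1))]
      gcongr
      have : ∫ t in Ioc t0 (t0 + Bn n), q t ≤ ∫ t in Ioc t0 (t0 + Bn n), L :=
        setIntegral_mono_on (hint.mono_set (fun t ht => ht0.trans ht.1)) (by simp)
          measurableSet_Ioc fun t ht => hqL t ht.1
      simpa [hB.le] using this
    have hthird : ∫ z in K, ‖dzb χ z‖ ^ 2 * Real.exp (Φ z).toReal / q (-v n (ψ z).toReal)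
        ≤ L / q (t0 + Bn n) * X := by
      rw [hX, ← integral_const_mul]
      refine integral_mono_of_nonneg ?_ (hi3.const_mul _) ?_
      · filter_upwards [hψ0] with z hz
        have := hpos _ (neg_pos.2 ((hT n).hvneg _ hz))
        simp only [Pi.zero_apply]; positivity
      · filter_upwards [hψ0] with z hz
        have h6 := hpos _ (neg_pos.2 ((hT n).hvneg _ hz))
        have h7 := hqhp _ hz
        have h8 : 1 / q (-v n (ψ z).toReal) ≤ L / q (t0 + Bn n) * (1 / qhat q L t0 (ψ z).toReal) := by
          by_cases hlt : (ψ z).toReal < -t0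
          · rw [qhat, if_pos hlt]
            have h9 : q (t0 + Bn n) ≤ q (-v n (ψ z).toReal) :=
              hanti _ _ (neg_pos.2 ((hT n).hvneg _ hz)) (by linarith [(hT n).hvT (ψ z).toReal])
            calc 1 / q (-v n (ψ z).toReal) ≤ 1 / q (t0 + Bn n) := one_div_le_one_div_of_le hqp h9
              _ = _ := by field_simp
          · rw [qhat, if_neg hlt, hvx n _ (not_lt.1 hlt)]
            rw [hvx n _ (not_lt.1 hlt)] at h6
            have : 1 ≤ L / q (t0 + Bn n) := (one_le_div hqp).2 hqLn
            have h10 : 0 ≤ 1 / q (-(ψ z).toReal) := by positivity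
            nlinarith
        calc ‖dzb χ z‖ ^ 2 * Real.exp (Φ z).toReal / q (-v n (ψ z).toReal)
            = ‖dzb χ z‖ ^ 2 * Real.exp (Φ z).toReal * (1 / q (-v n (ψ z).toReal)) := by ring
          _ ≤ ‖dzb χ z‖ ^ 2 * Real.exp (Φ z).toReal * (L / q (t0 + Bn n) * (1 / qhat q L t0 (ψ z).toReal)) :=
            mul_le_mul_of_nonneg_left h8 (by positivity)
          _ = _ := by ring
    refine mul_le_mul (mul_le_mul hqint hgint (integral_nonneg hg0) ?_) hthird ?_ ?_
    · positivity
    · refine integral_nonneg_of_ae ?_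
      filter_upwards [hψ0] with z hz
      have := hpos _ (neg_pos.2 ((hT n).hvneg _ hz))
      simp only [Pi.zero_apply]; positivity
    · positivity
  have L1 : Tendsto (fun n => ∫ z in K, ((1 - b n (ψ z).toReal : ℝ) : ℂ) * F z * dzb χ z) atTop
      (𝓝 (∫ z in K, F z * dzb χ z)) := by
    apply tendsto_integral_of_dominated_convergence (fun z => ‖F z‖ * C1)
    · intro n
      have hbc : Continuous (b n) := continuous_iff_continuousAt.2 fun t => ((hT n).hb t).continuousAt
      refine AEStronglyMeasurable.mul (AEStronglyMeasurable.mul ?_ hFi.aestronglyMeasurable) hdc.aestronglyMeasurable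
      exact ((continuous_ofReal.comp (continuous_const.sub hbc)).measurable.comp_aemeasurable
        (hψ.aem hKc hs)).aestronglyMeasurable
    · exact hFi.norm.mul_const _
    · intro n
      refine Eventually.of_forall fun z => ?_
      rw [norm_mul, norm_mul, norm_real, Real.norm_eq_abs,
        abs_of_nonneg (by linarith [(hT n).hble (ψ z).toReal])]
      have := (hT n).hb0 (ψ z).toReal
      have h1 : (1 - b n (ψ z).toReal) * ‖F z‖ ≤ ‖F z‖ := by
        nlinarith [norm_nonneg (F z)]
      exact mul_le_mul h1 (hC1 z) (norm_nonneg _) (norm_nonneg _)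
    · filter_upwards [hmK, hnb] with z hz hzb
      by_cases hlt : ψ z < ((-t0 : ℝ) : EReal)
      · have h1 := toReal_lt_of hzb hlt
        apply tendsto_const_nhds.congr'
        have h2 : ∀ᶠ n in atTop, Bn n < -t0 - (ψ z).toReal := hBlim.eventually_lt_const (by linarith)
        filter_upwards [h2] with n hn
        rw [hb0 n _ (by linarith)]; simp
      · rw [hF0 z (hs hz) hlt]; simp
  have hq0 : Tendsto (fun n => q (t0 + Bn n)) atTop (𝓝 L) := by
    refine hL.comp (tendsto_nhdsWithin_iff.2 ⟨?_, Eventually.of_forall fun n => ?_⟩)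
    · simpa using hBlim.const_add t0
    · simp [hBp n]
  have L2 : Tendsto (fun n => (((∫ t in Ioc 0 t0, q t) + Bn n * L) * ((1 + Bn n) * (a * L / q (t0 + Bn n)))) *
        (L / q (t0 + Bn n) * X)) atTop (𝓝 ((((∫ t in Ioc 0 t0, q t) + 0 * L) * ((1 + 0) * (a * L / L))) *
        (L / L * X))) := by
    refine Tendsto.mul (Tendsto.mul ?_ ?_) ?_
    · exact (hBlim.mul_const _).const_add _
    · exact (hBlim.const_add _).mul (tendsto_const_nhds.div hq0 hLp.ne')
    · exact (tendsto_const_nhds.div hq0 hLp.ne').mul_const _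
  have hfinal := le_of_tendsto_of_tendsto' (L1.norm.pow 2) L2 key
  refine hfinal.trans (le_of_eq ?_)
  field_simp
  ring

end

section
open MeasureTheory Metric Complex Set Filter
open scoped ContDiff Topology

lemma cpt_cover {D : Set ℂ} (hD : IsOpen D) : ∃ K : ℕ → Set ℂ, (∀ n, IsCompact (K n)) ∧
    (∀ n, K n ⊆ D) ∧ D = ⋃ n, K n := by
  rcases D.eq_empty_or_nonempty with rfl | hne
  · exact ⟨fun _ => ∅, fun _ => isCompact_empty, fun _ => by simp, by simp⟩
  have h1 : ∀ x ∈ D, ∃ r > 0, closedBall x r ⊆ D := fun x hx =>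
    nhds_basis_closedBall.mem_iff.1 (hD.mem_nhds hx)
  choose! r hr hrD using h1
  have h2 := TopologicalSpace.countable_cover_nhdsWithin (s := D) (f := fun x => closedBall x (r x))
    (fun x hx => mem_nhdsWithin_of_mem_nhds (closedBall_mem_nhds x (hr x hx)))
  obtain ⟨t, htD, htc, hcov⟩ := h2
  have htne : t.Nonempty := by
    by_contra h
    rw [not_nonempty_iff_eq_empty] at h
    subst h
    simp at hcov
    exact hne.ne_empty (by simpa using hcov)
  obtain ⟨e, he⟩ := htc.exists_eq_range htne
  refine ⟨fun n => closedBall (e n) (r (e n)), fun n => isCompact_closedBall _ _, fun n =>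
    hrD _ (htD (he ▸ mem_range_self n)), subset_antisymm ?_ (iUnion_subset fun n =>
    hrD _ (htD (he ▸ mem_range_self n)))⟩
  rw [he] at hcov
  simpa using hcov

lemma Apx.aemD {u : ℂ → EReal} {D : Set ℂ} (h : Apx u D) (hD : IsOpen D) :
    AEMeasurable (fun z => (u z).toReal) (volume.restrict D) := by
  obtain ⟨K, hK, hKD, hDK⟩ := cpt_cover hD
  rw [hDK]
  exact aemeasurable_iUnion_iff.2 fun n => h.aem (hK n) (hKD n)

lemma extend {q : ℝ → ℝ} (hqm : Measurable q) (hpos : ∀ t, 0 < t → 0 < q t)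
    (hanti : ∀ s t, 0 < s → s ≤ t → q t ≤ q s) (hint : IntegrableOn q (Ioi 0))
    {t0 L a : ℝ} (ht0 : 0 < t0) (hL : Tendsto q (𝓝[>] t0) (𝓝 L)) (ha : 0 ≤ a)
    {D : Set ℂ} (hD : IsOpen D) {ψ : ℂ → EReal} (hψ : Apx ψ D) (hneg : ∀ z ∈ D, ψ z < 0) {Φ : ℂ → EReal}
    (hΦ : Apx Φ D) {F : ℂ → ℂ}
    (hF : DifferentiableOn ℂ F {z | z ∈ D ∧ ψ z < ((-t0 : ℝ) : EReal)})
    (hF0 : ∀ z ∈ D, ¬ ψ z < ((-t0 : ℝ) : EReal) → F z = 0)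
    (hF2 : ∀ K ⊆ D, IsCompact K → MemLp F 2 (volume.restrict K))
    (hI : ∀ B > 0, IntegrableOn (fun z => ‖F z‖ ^ 2 * Real.exp (-(Φ z).toReal))
        {z | z ∈ D ∧ ((-t0 - B : ℝ) : EReal) ≤ ψ z ∧ ψ z < ((-t0 : ℝ) : EReal)} ∧
      ∫ z in {z | z ∈ D ∧ ((-t0 - B : ℝ) : EReal) ≤ ψ z ∧ ψ z < ((-t0 : ℝ) : EReal)},
        ‖F z‖ ^ 2 * Real.exp (-(Φ z).toReal) ≤ a * B * L / q (t0 + B)) :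
    ∃ g : ℂ → ℂ, DifferentiableOn ℂ g D ∧
      ∫⁻ z in D, ENNReal.ofReal (‖g z - F z‖ ^ 2 * (Real.exp (-(Φ z).toReal) * qhat q L t0 (ψ z).toReal))
        ≤ ENNReal.ofReal (a * ∫ t in Ioc 0 t0, q t) := by
  have hqL : ∀ s, t0 < s → q s ≤ L := by
    intro s hs
    refine ge_of_tendsto hL ?_
    filter_upwards [Ioo_mem_nhdsGT hs] with t ht
    exact hanti t s (ht0.trans ht.1) ht.2.le
  have hLp : 0 < L := (hpos _ (by linarith)).trans_le (hqL (t0 + 1) (by linarith))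
  have hqh1 : ∀ x, x < 0 → min L (q t0) ≤ qhat q L t0 x := by
    intro x hx; unfold qhat; split_ifs
    · exact min_le_left _ _
    · exact (min_le_right _ _).trans (hanti _ _ (by linarith) (by linarith))
  have hmin : 0 < min L (q t0) := lt_min hLp (hpos _ ht0)
  have hqhm : Measurable (qhat q L t0) :=
    Measurable.ite measurableSet_Iio measurable_const (hqm.comp measurable_neg)
  set W : ℂ → ℝ := fun z => Real.exp (-(Φ z).toReal) * max (qhat q L t0 (ψ z).toReal) (min L (q t0)) with hW
  have hmD : ∀ᵐ z ∂(volume.restrict D), z ∈ D := ae_restrict_mem hD.measurableSet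
  have hWe : ∀ᵐ z ∂(volume.restrict D), W z = Real.exp (-(Φ z).toReal) * qhat q L t0 (ψ z).toReal := by
    filter_upwards [hmD, hψ.1] with z hz hzb
    have : (ψ z).toReal < 0 := toReal_lt_of hzb (by simpa using hneg z hz)
    rw [hW]; simp only; rw [max_eq_left (hqh1 _ this)]
  have hWp : ∀ z, 0 < W z := fun z => mul_pos (Real.exp_pos _) (hmin.trans_le (le_max_right _ _))
  have hsol := solve hD (W := W) ?_ (fun z _ => hWp z) ?_ (F := F) ?_ (A := a * ∫ t in Ioc 0 t0, q t) ?_ ?_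
  · obtain ⟨g, hg, hgi⟩ := hsol
    refine ⟨g, hg, le_trans (le_of_eq ?_) hgi⟩
    refine lintegral_congr_ae ?_
    filter_upwards [hWe] with z hz
    rw [hz]
  · exact (Real.measurable_exp.comp_aemeasurable (hΦ.aemD hD).neg).mul
      ((hqhm.comp_aemeasurable (hψ.aemD hD)).max aemeasurable_const)
  · intro K hKD hK
    obtain ⟨M, hM, -⟩ := hΦ.bdd hK hKD
    refine ⟨Real.exp (max M 0) * (min L (q t0))⁻¹, fun z hz => ?_⟩
    rw [hW]; simp only
    rw [mul_inv, Real.exp_neg, inv_inv]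
    refine mul_le_mul ?_ (inv_anti₀ hmin (le_max_right _ _)) (by positivity) (by positivity)
    apply Real.exp_le_exp.2
    by_cases hb : Φ z = ⊥
    · simp [hb]
    · exact (toReal_le_of hb (hM z hz)).trans (le_max_left _ _)
  · rw [locallyIntegrableOn_iff hD.isLocallyClosed]
    intro K hKD hK
    have : IsFiniteMeasure (volume.restrict K) := ⟨by simpa using hK.measure_lt_top⟩
    exact memLp_one_iff_integrable.1 ((hF2 K hKD hK).mono_exponent (by norm_num))
  · exact mul_nonneg ha (setIntegral_nonneg measurableSet_Ioc fun t ht => (hpos t ht.1).le)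
  · intro χ hχ hc hs
    have h1 := DI_4 hqm hpos hanti hint ht0 hL ha hψ hneg hΦ hχ hc hs hF hF0 (hF2 _ hs hc) hI
    have hdz : ∀ z, z ∉ tsupport χ → dzb χ z = 0 := fun z hz =>
      image_eq_zero_of_notMem_tsupport fun h => hz (tsupport_dzb χ h)
    have e1 : ∫ z in D, F z * dzb χ z = ∫ z in tsupport χ, F z * dzb χ z := by
      refine setIntegral_eq_of_subset_of_forall_sdiff_eq_zero hD.measurableSet hs ?_
      intro z hz; rw [hdz z hz.2, mul_zero]
    have e2 : ∫ z in D, ‖dzb χ z‖ ^ 2 * (W z)⁻¹ = ∫ z in tsupport χ, ‖dzb χ z‖ ^ 2 * Real.exp (Φ z).toReal / qhat q L t0 (ψ z).toReal := by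
      rw [setIntegral_eq_of_subset_of_forall_sdiff_eq_zero hD.measurableSet hs
        (by intro z hz; rw [hdz z hz.2]; simp)]
      refine integral_congr_ae ?_
      filter_upwards [ae_mono (Measure.restrict_mono hs le_rfl) hWe] with z hz
      rw [hz, mul_inv, Real.exp_neg, inv_inv]; ring
    rw [e1, e2]; exact h1

end

section
open MeasureTheory Metric Complex Set Filter
open scoped ContDiff Topology

lemma sup_bd {r : ℝ} (hr : 0 < r) : ∃ C : ℝ, 0 < C ∧ ∀ (z : ℂ) (g : ℂ → ℂ),
    DifferentiableOn ℂ g (ball z r) →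
    ENNReal.ofReal (‖g z‖ ^ 2) ≤ ENNReal.ofReal C * ∫⁻ x in ball z r, ENNReal.ofReal (‖g x‖ ^ 2) := by
  obtain ⟨C, hC, hb⟩ := mol_bdd (half_pos hr)
  refine ⟨C, hC, fun z g hg => ?_⟩
  have h1 := mol_mean (half_pos hr) (half_lt_self hr) (hg.pow 2)
  have h2 : ENNReal.ofReal (‖g z‖ ^ 2) = ‖(g ^ 2) z‖ₑ := by
    rw [← ofReal_norm_eq_enorm]; simp
  rw [h2, ← h1]
  refine (enorm_integral_le_lintegral_enorm _).trans ?_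
  calc ∫⁻ ζ, ‖(mol (r/2) ζ : ℂ) * (g ^ 2) (z + ζ)‖ₑ
      ≤ ∫⁻ ζ, (fun x => (ball z r).indicator (fun x => ENNReal.ofReal C * ENNReal.ofReal (‖g x‖ ^ 2)) x) (z + ζ) := by
        refine lintegral_mono fun ζ => ?_
        by_cases h : z + ζ ∈ ball z r
        · simp only [indicator_of_mem h]
          rw [enorm_mul, ← ofReal_norm_eq_enorm, ← ofReal_norm_eq_enorm]
          gcongr
          · simp only [norm_real, Real.norm_eq_abs, abs_of_nonneg (mol_nonneg (half_pos hr) ζ)]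
            exact hb ζ
          · simp
        · have : mol (r/2) ζ = 0 := mol_zero (half_pos hr) (by
            have : r ≤ ‖ζ‖ := by simpa using h
            linarith)
          simp [this]
    _ = ∫⁻ x, (ball z r).indicator (fun x => ENNReal.ofReal C * ENNReal.ofReal (‖g x‖ ^ 2)) x :=
        lintegral_add_left_eq_self _ z
    _ = _ := by
        rw [lintegral_indicator measurableSet_ball, lintegral_const_mul' _ _ ENNReal.ofReal_ne_top]

/-- weighted energy -/
noncomputable def En (Ω : Set ℂ) (w : ℂ → ℝ) (g : ℂ → ℂ) : ENNReal :=
  ∫⁻ z in Ω, ENNReal.ofReal (‖g z‖ ^ 2 * w z)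

/-- local sup bounds -/
def LBd (Ω : Set ℂ) (w : ℂ → ℝ) : Prop :=
  ∀ K, IsCompact K → K ⊆ Ω → ∃ C : ℝ, 0 < C ∧ ∀ g, DifferentiableOn ℂ g Ω → ∀ x ∈ K,
    ENNReal.ofReal (‖g x‖ ^ 2) ≤ ENNReal.ofReal C * En Ω w g

lemma En_mono {Ω Ω' : Set ℂ} (h : Ω ⊆ Ω') (w : ℂ → ℝ) (g : ℂ → ℂ) : En Ω w g ≤ En Ω' w g :=
  lintegral_mono_set h

lemma lbd_ball {Ω : Set ℂ} {w : ℂ → ℝ} {z : ℂ} {r m : ℝ} (hr : 0 < r) (hm : 0 < m)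
    (hΩ : closedBall z (4 * r) ⊆ Ω) (hw : ∀ x ∈ closedBall z (4 * r) \ ball z r, m ≤ w x) :
    ∃ C : ℝ, 0 < C ∧ ∀ g, DifferentiableOn ℂ g Ω → ∀ x ∈ ball z (2 * r),
    ENNReal.ofReal (‖g x‖ ^ 2) ≤ ENNReal.ofReal C * En Ω w g := by
  obtain ⟨C, hC, hb⟩ := sup_bd hr
  refine ⟨C * m⁻¹, by positivity, fun g hg x hx => ?_⟩
  have h1 : ∀ y ∈ sphere z (2 * r), ENNReal.ofReal (‖g y‖ ^ 2) ≤ ENNReal.ofReal (C * m⁻¹) * En Ω w g := by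
    intro y hy
    have hy' : dist y z = 2 * r := hy
    have hsub : ball y r ⊆ closedBall z (4 * r) \ ball z r := by
      intro u hu
      have hu' : dist u y < r := hu
      have h1 := dist_triangle u y z
      have h2 := dist_triangle y u z
      rw [dist_comm y u] at h2
      refine ⟨by simp only [mem_closedBall]; linarith, by simp only [mem_ball, not_lt]; linarith⟩
    refine (hb y g (hg.mono ((hsub.trans sdiff_subset).trans hΩ))).trans ?_
    rw [ENNReal.ofReal_mul hC.le, mul_assoc]
    gcongr
    calc ∫⁻ x in ball y r, ENNReal.ofReal (‖g x‖ ^ 2)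
        ≤ ∫⁻ x in ball y r, ENNReal.ofReal m⁻¹ * ENNReal.ofReal (‖g x‖ ^ 2 * w x) := by
          refine setLIntegral_mono' measurableSet_ball fun u hu => ?_
          rw [← ENNReal.ofReal_mul (by positivity)]
          refine ENNReal.ofReal_le_ofReal ?_
          have := hw u (hsub hu)
          rw [inv_mul_eq_div, le_div_iff₀ hm]
          gcongr
      _ = ENNReal.ofReal m⁻¹ * ∫⁻ x in ball y r, ENNReal.ofReal (‖g x‖ ^ 2 * w x) :=
          lintegral_const_mul' _ _ ENNReal.ofReal_ne_top
      _ ≤ _ := by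
          gcongr
          exact lintegral_mono_set ((hsub.trans sdiff_subset).trans hΩ)
  by_cases hE : En Ω w g = ⊤
  · rw [hE, ENNReal.mul_top (by simpa using (by positivity : 0 < C * m⁻¹))]; exact le_top
  set A := ENNReal.ofReal (C * m⁻¹) * En Ω w g
  have hA : A ≠ ⊤ := ENNReal.mul_ne_top ENNReal.ofReal_ne_top hE
  have h2 : ‖g x‖ ≤ Real.sqrt A.toReal := by
    refine norm_le_of_forall_mem_frontier_norm_le (U := ball z (2 * r)) isBounded_ball ?_ ?_ (subset_closure hx)
    · refine DifferentiableOn.diffContOnCl (hg.mono ?_)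
      rw [closure_ball z (by positivity)]
      exact (closedBall_subset_closedBall (by linarith)).trans hΩ
    · intro y hy
      rw [frontier_ball z (by positivity)] at hy
      refine Real.le_sqrt_of_sq_le ?_
      exact (ENNReal.ofReal_le_iff_le_toReal hA).1 (h1 y hy)
  rw [ENNReal.ofReal_le_iff_le_toReal hA]
  calc ‖g x‖ ^ 2 ≤ (Real.sqrt A.toReal) ^ 2 := by gcongr
    _ = _ := Real.sq_sqrt ENNReal.toReal_nonneg

lemma lbd_of {D Z Ω : Set ℂ} {w : ℂ → ℝ} (hZ : DiscreteIn Z D) (hlb : PosLowerBoundOnCompacts D Z w)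
    (hΩ : IsOpen Ω) (hΩD : Ω ⊆ D) : LBd Ω w := by
  intro K hK hKΩ
  refine hK.induction_on (p := fun K => ∃ C : ℝ, 0 < C ∧ ∀ g, DifferentiableOn ℂ g Ω → ∀ x ∈ K,
    ENNReal.ofReal (‖g x‖ ^ 2) ≤ ENNReal.ofReal C * En Ω w g) ⟨1, one_pos, by simp⟩ ?_ ?_ ?_
  · rintro s t hst ⟨C, hC, h⟩
    exact ⟨C, hC, fun g hg x hx => h g hg x (hst hx)⟩
  · rintro s t ⟨C, hC, h⟩ ⟨C', hC', h'⟩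
    refine ⟨max C C', lt_max_of_lt_left hC, fun g hg x hx => ?_⟩
    rcases hx with hx | hx
    · exact (h g hg x hx).trans (by gcongr; exact le_max_left _ _)
    · exact (h' g hg x hx).trans (by gcongr; exact le_max_right _ _)
  · intro z hz
    obtain ⟨r1, hr1, h1⟩ := hZ.2 z (hΩD (hKΩ hz))
    obtain ⟨r2, hr2, h2⟩ := Metric.isOpen_iff.1 hΩ z (hKΩ hz)
    set r := min r1 r2 / 5
    have hr : 0 < r := by positivity
    have hr1' : 5 * r ≤ r1 := by have := min_le_left r1 r2; simp only [r]; linarith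
    have hr2' : 5 * r ≤ r2 := by have := min_le_right r1 r2; simp only [r]; linarith
    have hsub : closedBall z (4 * r) ⊆ Ω := (closedBall_subset_ball (by linarith)).trans h2
    obtain ⟨m, hm, hmw⟩ := hlb (closedBall z (4 * r) \ ball z r) (fun x hx => ⟨hΩD (hsub hx.1), fun hxZ => by
      have : x = z := h1 ⟨closedBall_subset_ball (by linarith) hx.1, hxZ⟩
      exact hx.2 (by rw [this]; exact mem_ball_self hr)⟩) ((isCompact_closedBall _ _).diff isOpen_ball)
    obtain ⟨C, hC, h⟩ := lbd_ball hr hm hsub hmw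
    exact ⟨ball z (2 * r), mem_nhdsWithin_of_mem_nhds (ball_mem_nhds z (by positivity)), C, hC, h⟩

lemma LBd.eq_zero {Ω : Set ℂ} {w : ℂ → ℝ} (h : LBd Ω w) {g : ℂ → ℂ} (hg : DifferentiableOn ℂ g Ω)
    (h0 : En Ω w g = 0) : ∀ z ∈ Ω, g z = 0 := by
  intro z hz
  obtain ⟨C, hC, hb⟩ := h {z} isCompact_singleton (singleton_subset_iff.2 hz)
  have := hb g hg z rfl
  rw [h0, mul_zero] at this
  have h2 : ‖g z‖ ^ 2 ≤ 0 := by simpa using this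
  have : ‖g z‖ = 0 := by nlinarith [norm_nonneg (g z)]
  simpa using this

lemma En_meas {Ω : Set ℂ} {w : ℂ → ℝ} (hΩ : IsOpen Ω) (hw : AEMeasurable w (volume.restrict Ω)) {g : ℂ → ℂ}
    (hg : DifferentiableOn ℂ g Ω) :
    AEMeasurable (fun z => ENNReal.ofReal (‖g z‖ ^ 2 * w z)) (volume.restrict Ω) := by
  have : AEMeasurable g (volume.restrict Ω) := hg.continuousOn.aemeasurable hΩ.measurableSet
  exact ((this.norm.pow_const 2).mul hw).ennreal_ofReal

lemma En_lim {Ω : Set ℂ} {w : ℂ → ℝ} (hΩ : IsOpen Ω) (hw : AEMeasurable w (volume.restrict Ω))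
    {g : ℕ → ℂ → ℂ} {G : ℂ → ℂ} (hg : ∀ n, DifferentiableOn ℂ (g n) Ω)
    (hl : ∀ z ∈ Ω, Tendsto (fun n => g n z) atTop (𝓝 (G z))) {A : ENNReal} {e : ℕ → ENNReal}
    (he : ∀ n, En Ω w (g n) ≤ e n) (hA : Tendsto e atTop (𝓝 A)) :
    En Ω w G ≤ A := by
  calc En Ω w G ≤ ∫⁻ z in Ω, liminf (fun n => ENNReal.ofReal (‖g n z‖ ^ 2 * w z)) atTop := by
        refine setLIntegral_mono_ae' hΩ.measurableSet (Eventually.of_forall fun z hz => ?_)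
        refine le_of_eq (Tendsto.liminf_eq ?_).symm
        exact (ENNReal.continuous_ofReal.tendsto _).comp ((((hl z hz).norm).pow 2).mul_const _)
    _ ≤ liminf (fun n => En Ω w (g n)) atTop := lintegral_liminf_le' fun n => En_meas hΩ hw (hg n)
    _ ≤ liminf e atTop := liminf_le_liminf (Eventually.of_forall he)
    _ = A := hA.liminf_eq

lemma cauchy_lim {Ω : Set ℂ} {w : ℂ → ℝ} (hΩ : IsOpen Ω) (hL : LBd Ω w)
    {g : ℕ → ℂ → ℂ} (hg : ∀ n, DifferentiableOn ℂ (g n) Ω)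
    (hC : ∀ ε : ℝ, 0 < ε → ∃ N, ∀ n ≥ N, ∀ m ≥ N, En Ω w (fun z => g n z - g m z) ≤ ENNReal.ofReal ε) :
    ∃ G, DifferentiableOn ℂ G Ω ∧ TendstoLocallyUniformlyOn g G atTop Ω := by
  have key : ∀ K, IsCompact K → K ⊆ Ω → UniformCauchySeqOn g atTop K := by
    intro K hK hKΩ
    obtain ⟨C, hC0, hb⟩ := hL K hK hKΩ
    rw [Metric.uniformCauchySeqOn_iff]
    intro ε hε
    obtain ⟨N, hN⟩ := hC ((ε/2)^2/C) (by positivity)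
    refine ⟨N, fun m hm n hn x hx => ?_⟩
    have h1 := (hb _ ((hg m).sub (hg n)) x hx).trans (mul_le_mul_right (hN m hm n hn) _)
    rw [← ENNReal.ofReal_mul hC0.le, ENNReal.ofReal_le_ofReal_iff (by positivity),
      mul_div_cancel₀ _ hC0.ne'] at h1
    have h2 := abs_le_of_sq_le_sq h1 (by positivity)
    rw [abs_norm] at h2
    rw [dist_eq_norm]
    simp only [Pi.sub_apply] at h2
    linarith
  have hpt : ∀ z ∈ Ω, ∃ l, Tendsto (fun n => g n z) atTop (𝓝 l) := fun z hz =>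
    cauchySeq_tendsto_of_complete ((key {z} isCompact_singleton (singleton_subset_iff.2 hz)).cauchySeq rfl)
  choose! G hG using hpt
  have hloc : TendstoLocallyUniformlyOn g G atTop Ω := by
    rw [tendstoLocallyUniformlyOn_iff_forall_isCompact hΩ]
    intro K hKΩ hK
    exact (key K hK hKΩ).tendstoUniformlyOn_of_tendsto fun x hx => hG x (hKΩ hx)
  exact ⟨G, hloc.differentiableOn (Eventually.of_forall hg) hΩ, hloc⟩

lemma ideal_cases {Fz : (ℂ → ℂ) → Prop} {z₀ : ℂ} (hI : IsIdealAt Fz z₀) :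
    (∀ g, Fz g → g =ᶠ[𝓝 z₀] 0) ∨
    ∃ l : ℕ, ∀ g, AnalyticAt ℂ g z₀ → (Fz g ↔ (l : ℕ∞) ≤ analyticOrderAt g z₀) := by
  obtain ⟨hcongr, han, h0, hadd, hmul⟩ := hI
  by_cases h : ∀ g, Fz g → g =ᶠ[𝓝 z₀] 0
  · exact Or.inl h
  right
  push Not at h
  classical
  have hex : ∃ l : ℕ, ∃ g, Fz g ∧ analyticOrderAt g z₀ = l := by
    obtain ⟨g, hg, hne⟩ := h
    have : analyticOrderAt g z₀ ≠ ⊤ := by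
      rw [Ne, analyticOrderAt_eq_top]; exact hne
    exact ⟨(analyticOrderAt g z₀).toNat, g, hg, (ENat.coe_toNat this).symm⟩
  refine ⟨Nat.find hex, fun g hg => ⟨fun hFg => ?_, fun hle => ?_⟩⟩
  · by_cases ht : analyticOrderAt g z₀ = ⊤
    · rw [ht]; exact le_top
    · rw [← ENat.coe_toNat ht]
      exact_mod_cast Nat.find_min' hex ⟨g, hFg, (ENat.coe_toNat ht).symm⟩
  · obtain ⟨k, hk, hord⟩ := Nat.find_spec hex
    obtain ⟨u, hu, hu0, hku⟩ := ((han k hk).analyticOrderAt_eq_natCast).1 hord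
    obtain ⟨v, hv, hgv⟩ := (natCast_le_analyticOrderAt hg).1 hle
    refine hcongr (fun z => (v z * (u z)⁻¹) * k z) g ?_ (hmul k (fun z => v z * (u z)⁻¹) (hv.mul (hu.inv hu0)) hk)
    filter_upwards [hku, hgv, hu.continuousAt.eventually_ne hu0] with z h1 h2 h3
    rw [h1, h2, smul_eq_mul, smul_eq_mul]
    field_simp

lemma ideal_closed {Fz : (ℂ → ℂ) → Prop} {z₀ : ℂ} (hI : IsIdealAt Fz z₀) {Ω : Set ℂ} (hΩ : IsOpen Ω)
    (hz : z₀ ∈ Ω) {g : ℕ → ℂ → ℂ} {G : ℂ → ℂ} (hg : ∀ n, DifferentiableOn ℂ (g n) Ω)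
    (hl : TendstoLocallyUniformlyOn g G atTop Ω) (hF : ∀ n, Fz (g n)) : Fz G := by
  have hG := hl.differentiableOn (Eventually.of_forall hg) hΩ
  have hGa : AnalyticAt ℂ G z₀ := hG.analyticAt (hΩ.mem_nhds hz)
  rcases ideal_cases hI with h | ⟨l, h⟩
  · obtain ⟨r, hr, hrΩ⟩ := Metric.isOpen_iff.1 hΩ z₀ hz
    have hz0 : ∀ n, EqOn (g n) 0 (ball z₀ r) := fun n =>
      AnalyticOnNhd.eqOn_zero_of_preconnected_of_eventuallyEq_zero
        ((hg n).mono hrΩ |>.analyticOnNhd isOpen_ball) (convex_ball z₀ r).isPreconnected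
        (mem_ball_self hr) (h _ (hF n))
    refine hI.1 (fun _ => 0) G ?_ hI.2.2.1
    filter_upwards [ball_mem_nhds z₀ hr] with z hzr
    have h1 := hl.tendsto_at (hrΩ hzr)
    have h2 : (fun n => g n z) = fun _ => 0 := funext fun n => hz0 n hzr
    rw [h2] at h1
    exact tendsto_nhds_unique tendsto_const_nhds h1
  · rw [h G hGa, natCast_le_analyticOrderAt_iff_iteratedDeriv_eq_zero hGa]
    intro i hi
    have hit : ∀ i, TendstoLocallyUniformlyOn (fun n => iteratedDeriv i (g n)) (iteratedDeriv i G) atTop Ω ∧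
        ∀ n, DifferentiableOn ℂ (iteratedDeriv i (g n)) Ω := by
      intro i
      induction i with
      | zero => simpa [iteratedDeriv_zero] using ⟨hl, hg⟩
      | succ k ih =>
        simp only [iteratedDeriv_succ]
        exact ⟨ih.1.deriv (Eventually.of_forall ih.2) hΩ, fun n => (ih.2 n).deriv hΩ⟩
    have h1 := (hit i).1.tendsto_at hz
    have h2 : (fun n => iteratedDeriv i (g n) z₀) = fun _ => 0 := funext fun n =>
      (natCast_le_analyticOrderAt_iff_iteratedDeriv_eq_zero ((hg n).analyticAt (hΩ.mem_nhds hz))).1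
        ((h _ ((hg n).analyticAt (hΩ.mem_nhds hz))).1 (hF n)) i hi
    rw [h2] at h1
    exact tendsto_nhds_unique h1 tendsto_const_nhds

end

section
open MeasureTheory Metric Complex Set Filter
open scoped ContDiff Topology

lemma Fz_mulc {Fz : (ℂ → ℂ) → Prop} {z₀ : ℂ} (hI : IsIdealAt Fz z₀) {g : ℂ → ℂ} (h : Fz g) (a : ℂ) :
    Fz (fun z => a * g z) := hI.2.2.2.2 g (fun _ => a) analyticAt_const h

lemma Fz_add {Fz : (ℂ → ℂ) → Prop} {z₀ : ℂ} (hI : IsIdealAt Fz z₀) {g k : ℂ → ℂ} (h : Fz g) (h' : Fz k) :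
    Fz (fun z => g z + k z) := hI.2.2.2.1 g k h h'

lemma Fz_sub {Fz : (ℂ → ℂ) → Prop} {z₀ : ℂ} (hI : IsIdealAt Fz z₀) {g k : ℂ → ℂ} (h : Fz g) (h' : Fz k) :
    Fz (fun z => g z - k z) := by
  have := Fz_add hI h (Fz_mulc hI h' (-1))
  simpa [sub_eq_add_neg] using this

lemma Fz_congr {Fz : (ℂ → ℂ) → Prop} {z₀ : ℂ} (_ : IsIdealAt Fz z₀) {g k : ℂ → ℂ} (h : Fz g)
    (e : ∀ z, g z = k z) : Fz k := by
  rwa [← (funext e : g = k)]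

/-- admissible competitor -/
def Adm (Ω : Set ℂ) (f : ℂ → ℂ) (Fz : (ℂ → ℂ) → Prop) (g : ℂ → ℂ) : Prop :=
  DifferentiableOn ℂ g Ω ∧ Fz (fun z => g z - f z)

section
variable {Ω : Set ℂ} {w : ℂ → ℝ}

lemma En_fin (hΩ : IsOpen Ω) (hw : AEMeasurable w (volume.restrict Ω))
    (hw0 : ∀ᵐ z ∂(volume.restrict Ω), 0 < w z) {g : ℂ → ℂ} (hg : DifferentiableOn ℂ g Ω)
    (h : En Ω w g ≠ ⊤) : IntegrableOn (fun z => ‖g z‖ ^ 2 * w z) Ω ∧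
      En Ω w g = ENNReal.ofReal (∫ z in Ω, ‖g z‖ ^ 2 * w z) := by
  have h0 : 0 ≤ᵐ[volume.restrict Ω] fun z => ‖g z‖ ^ 2 * w z := by
    filter_upwards [hw0] with z hz; exact mul_nonneg (by positivity) hz.le
  have hm : AEStronglyMeasurable (fun z => ‖g z‖ ^ 2 * w z) (volume.restrict Ω) := by
    have : AEMeasurable g (volume.restrict Ω) := hg.continuousOn.aemeasurable hΩ.measurableSet
    exact ((this.norm.pow_const 2).mul hw).aestronglyMeasurable
  have hi : IntegrableOn (fun z => ‖g z‖ ^ 2 * w z) Ω :=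
    (lintegral_ofReal_ne_top_iff_integrable hm h0).1 h
  exact ⟨hi, (ofReal_integral_eq_lintegral_ofReal hi h0).symm⟩

lemma En_par (hΩ : IsOpen Ω) (hw : AEMeasurable w (volume.restrict Ω))
    (hw0 : ∀ᵐ z ∂(volume.restrict Ω), 0 < w z) {g k : ℂ → ℂ} (hg : DifferentiableOn ℂ g Ω)
    (hk : DifferentiableOn ℂ k Ω) :
    En Ω w (fun z => g z + k z) + En Ω w (fun z => g z - k z) = 2 * En Ω w g + 2 * En Ω w k := by
  unfold En
  rw [← lintegral_const_mul' _ _ (by simp), ← lintegral_const_mul' _ _ (by simp),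
    ← lintegral_add_left' (En_meas hΩ hw (hg.fun_add hk)),
    ← lintegral_add_left' ((En_meas hΩ hw hg).const_mul _)]
  refine lintegral_congr_ae ?_
  filter_upwards [hw0] with z hz
  rw [show (2:ENNReal) = ENNReal.ofReal 2 by simp, ← ENNReal.ofReal_mul (by simp), ← ENNReal.ofReal_mul (by simp),
    ← ENNReal.ofReal_add (by positivity) (by positivity), ← ENNReal.ofReal_add (by positivity) (by positivity)]
  congr 1
  have := parallelogram_law_with_norm ℝ (g z) (k z)
  linear_combination (w z) * this

lemma En_smul {g : ℂ → ℂ} (a : ℂ) :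
    En Ω w (fun z => a * g z) = ENNReal.ofReal (‖a‖ ^ 2) * En Ω w g := by
  unfold En
  rw [← lintegral_const_mul' _ _ (by simp)]
  refine lintegral_congr fun z => ?_
  rw [← ENNReal.ofReal_mul (by positivity), norm_mul]
  congr 1; ring

lemma En_congr (hΩ : IsOpen Ω) {g k : ℂ → ℂ} (h : ∀ z ∈ Ω, g z = k z) : En Ω w g = En Ω w k :=
  setLIntegral_congr_fun hΩ.measurableSet fun z hz => by rw [h z hz]

lemma min_exists (hΩ : IsOpen Ω) (hw : AEMeasurable w (volume.restrict Ω))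
    (hw0 : ∀ᵐ z ∂(volume.restrict Ω), 0 < w z) (hL : LBd Ω w) {Fz : (ℂ → ℂ) → Prop} {z₀ : ℂ}
    (hI : IsIdealAt Fz z₀) (hz : z₀ ∈ Ω) {f : ℂ → ℂ} {G : ENNReal} (hG : G ≠ ⊤)
    (h1 : ∀ g, Adm Ω f Fz g → G ≤ En Ω w g)
    (h2 : ∀ ε : ℝ, 0 < ε → ∃ g, Adm Ω f Fz g ∧ En Ω w g ≤ G + ENNReal.ofReal ε) :
    ∃ F, Adm Ω f Fz F ∧ En Ω w F = G := by
  choose g hg hgE using fun n : ℕ => h2 (1/((n:ℝ)+1)) (by positivity)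
  have hpar : ∀ n m, En Ω w (fun z => g n z - g m z) ≤ ENNReal.ofReal (2*(1/((n:ℝ)+1)) + 2*(1/((m:ℝ)+1))) := by
    intro n m
    have e1 := En_par hΩ hw hw0 (hg n).1 (hg m).1
    have e2 : Adm Ω f Fz (fun z => (1/2:ℂ) * (g n z + g m z)) := by
      refine ⟨((hg n).1.fun_add (hg m).1).const_mul _, ?_⟩
      refine Fz_congr hI (Fz_mulc hI (Fz_add hI (hg n).2 (hg m).2) (1/2)) fun z => by ring
    have e3 := h1 _ e2
    rw [En_smul] at e3
    have e4 : 4 * G ≤ En Ω w (fun z => g n z + g m z) := by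
      calc 4 * G ≤ 4 * (ENNReal.ofReal (‖(1/2:ℂ)‖^2) * En Ω w (fun z => g n z + g m z)) := by gcongr
        _ = _ := by
          rw [← mul_assoc, show (4:ENNReal) = ENNReal.ofReal 4 by simp, ← ENNReal.ofReal_mul (by simp)]
          norm_num
    have e5 : 4 * G + En Ω w (fun z => g n z - g m z) ≤
        4 * G + ENNReal.ofReal (2*(1/((n:ℝ)+1)) + 2*(1/((m:ℝ)+1))) := by
      calc _ ≤ En Ω w (fun z => g n z + g m z) + En Ω w (fun z => g n z - g m z) := by gcongr
        _ = _ := e1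
        _ ≤ 2 * (G + ENNReal.ofReal (1/((n:ℝ)+1))) + 2 * (G + ENNReal.ofReal (1/((m:ℝ)+1))) := by
          gcongr
          · exact hgE n
          · exact hgE m
        _ = _ := by
          rw [ENNReal.ofReal_add (by positivity) (by positivity), ENNReal.ofReal_mul (by simp),
            ENNReal.ofReal_mul (by simp), show ENNReal.ofReal 2 = 2 by simp]
          ring
    exact (ENNReal.add_le_add_iff_left (ENNReal.mul_ne_top (by simp) hG)).1 e5
  obtain ⟨F, hF, hl⟩ := cauchy_lim hΩ hL (fun n => (hg n).1) (fun ε hε => by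
    obtain ⟨N, hN⟩ := exists_nat_one_div_lt (show 0 < ε/4 by positivity)
    refine ⟨N, fun n hn m hm => (hpar n m).trans (ENNReal.ofReal_le_ofReal ?_)⟩
    have a1 : 1/((n:ℝ)+1) ≤ 1/((N:ℝ)+1) := by gcongr
    have a2 : 1/((m:ℝ)+1) ≤ 1/((N:ℝ)+1) := by gcongr
    linarith)
  have hadm : Adm Ω f Fz F := by
    refine ⟨hF, ?_⟩
    have hl' : TendstoLocallyUniformlyOn (fun n z => g n z - g 0 z) (fun z => F z - g 0 z) atTop Ω := by
      rw [tendstoLocallyUniformlyOn_iff_forall_isCompact hΩ] at hl ⊢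
      intro K hKΩ hK
      have := hl K hKΩ hK
      rw [Metric.tendstoUniformlyOn_iff] at this ⊢
      simpa using this
    have := ideal_closed hI hΩ hz (fun n => (hg n).1.fun_sub (hg 0).1) hl' (fun n =>
      Fz_congr hI (Fz_sub hI (hg n).2 (hg 0).2) fun z => by ring)
    exact Fz_congr hI (Fz_add hI this (hg 0).2) fun z => by ring
  refine ⟨F, hadm, le_antisymm ?_ (h1 F hadm)⟩
  refine En_lim hΩ hw (fun n => (hg n).1) (fun z hz => hl.tendsto_at hz) hgE ?_
  have : Tendsto (fun n : ℕ => G + ENNReal.ofReal (1/((n:ℝ)+1))) atTop (𝓝 (G + ENNReal.ofReal 0)) :=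
    tendsto_const_nhds.add ((ENNReal.continuous_ofReal.tendsto _).comp tendsto_one_div_add_atTop_nhds_zero_nat)
  simpa using this

lemma min_orth (hΩ : IsOpen Ω) (hw : AEMeasurable w (volume.restrict Ω))
    (hw0 : ∀ᵐ z ∂(volume.restrict Ω), 0 < w z) {F h : ℂ → ℂ} (hF : DifferentiableOn ℂ F Ω)
    (hh : DifferentiableOn ℂ h Ω) (hfin : En Ω w F ≠ ⊤)
    (hmin : ∀ s : ℝ, En Ω w F ≤ En Ω w (fun z => F z + s * h z)) :
    En Ω w (fun z => F z + h z) = En Ω w F + En Ω w h := by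
  have hpar := En_par hΩ hw hw0 hF hh
  by_cases hht : En Ω w h = ⊤
  · have e := En_par hΩ hw hw0 (hF.fun_add hh) hF
    simp only [add_sub_cancel_left] at e
    rw [hht, add_top] at e ⊢
    by_contra hne
    exact (ENNReal.add_ne_top.2 ⟨ENNReal.mul_ne_top (by simp) hne, ENNReal.mul_ne_top (by simp) hfin⟩) e.symm
  obtain ⟨iF, eF⟩ := En_fin hΩ hw hw0 hF hfin
  obtain ⟨ih, eh⟩ := En_fin hΩ hw hw0 hh hht
  set X : ℂ → ℝ := fun z => inner ℝ (F z) (h z) * w z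
  have iX : IntegrableOn X Ω := by
    refine (iF.add ih).mono' ?_ ?_
    · have m1 : AEStronglyMeasurable F (volume.restrict Ω) := hF.continuousOn.aestronglyMeasurable hΩ.measurableSet
      have m2 : AEStronglyMeasurable h (volume.restrict Ω) := hh.continuousOn.aestronglyMeasurable hΩ.measurableSet
      exact (m1.inner m2).mul hw.aestronglyMeasurable
    · filter_upwards [hw0] with z hz
      simp only [X, norm_mul, Real.norm_eq_abs, abs_of_pos hz, Pi.add_apply]
      rw [← add_mul]
      gcongr
      have := abs_real_inner_le_norm (F z) (h z)
      nlinarith [sq_nonneg (‖F z‖ - ‖h z‖), sq_nonneg (‖F z‖ + ‖h z‖)]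
  have expand : ∀ s : ℝ, En Ω w (fun z => F z + s * h z) =
      ENNReal.ofReal ((∫ z in Ω, ‖F z‖ ^ 2 * w z) + (2 * s * (∫ z in Ω, X z) + s^2 * ∫ z in Ω, ‖h z‖ ^ 2 * w z)) := by
    intro s
    have iall := (iF.add ((iX.const_mul (2*s)).add (ih.const_mul (s^2))))
    have epw : ∀ z, ‖F z + s * h z‖ ^ 2 * w z = ‖F z‖ ^ 2 * w z + (2 * s * X z + s ^ 2 * (‖h z‖ ^ 2 * w z)) := by
      intro z
      have e : (s : ℂ) * h z = s • h z := by simp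
      rw [e, norm_add_sq_real, inner_smul_right, norm_smul, mul_pow, Real.norm_eq_abs, sq_abs]
      simp only [X]; ring
    unfold En
    simp_rw [epw]
    have r1 := integral_add iF ((iX.const_mul (2*s)).add (ih.const_mul (s^2)))
    have r2 := integral_add (iX.const_mul (2*s)) (ih.const_mul (s^2))
    simp only [Pi.add_apply, integral_const_mul] at r1 r2
    rw [← r2, ← r1]
    refine (ofReal_integral_eq_lintegral_ofReal iall ?_).symm
    · filter_upwards [hw0] with z hz
      have := epw z
      simp only [Pi.zero_apply, Pi.add_apply]
      rw [← this]; positivity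
  have hF0 : 0 ≤ ∫ z in Ω, ‖F z‖ ^ 2 * w z := integral_nonneg_of_ae (by
    filter_upwards [hw0] with z hz; simp only [Pi.zero_apply]; positivity)
  have hh0 : 0 ≤ ∫ z in Ω, ‖h z‖ ^ 2 * w z := integral_nonneg_of_ae (by
    filter_upwards [hw0] with z hz; simp only [Pi.zero_apply]; positivity)
  set A := ∫ z in Ω, ‖F z‖ ^ 2 * w z
  set C := ∫ z in Ω, ‖h z‖ ^ 2 * w z
  set Y := ∫ z in Ω, X z
  have hq : ∀ s : ℝ, 0 ≤ A + (2 * s * Y + s^2 * C) → 0 ≤ 2 * s * Y + s^2 * C := by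
    intro s hs
    have := hmin s
    rw [expand s, eF, ENNReal.ofReal_le_ofReal_iff hs] at this
    linarith
  have hnn : ∀ s : ℝ, 0 ≤ A + (2 * s * Y + s^2 * C) := by
    intro s
    have : A + (2 * s * Y + s^2 * C) = ∫ z in Ω, (‖F z‖ ^ 2 * w z + (2 * s * X z + s ^ 2 * (‖h z‖ ^ 2 * w z))) := by
      have r1 := integral_add iF ((iX.const_mul (2*s)).add (ih.const_mul (s^2)))
      have r2 := integral_add (iX.const_mul (2*s)) (ih.const_mul (s^2))
      simp only [Pi.add_apply, integral_const_mul] at r1 r2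
      rw [r1, r2]
    rw [this]
    refine integral_nonneg_of_ae ?_
    filter_upwards [hw0] with z hz
    have e : ‖F z‖ ^ 2 * w z + (2 * s * X z + s ^ 2 * (‖h z‖ ^ 2 * w z)) = ‖F z + s * h z‖ ^ 2 * w z := by
      have e : (s : ℂ) * h z = s • h z := by simp
      rw [e, norm_add_sq_real, inner_smul_right, norm_smul, mul_pow, Real.norm_eq_abs, sq_abs]
      simp only [X]; ring
    simp only [Pi.zero_apply]
    rw [e]; positivity
  have hY : Y = 0 := by
    by_contra hne
    have h1 := hq (-Y/(C+1)) (hnn _)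
    have h2 : 2 * (-Y/(C+1)) * Y + (-Y/(C+1))^2 * C = -(Y^2 * (C+2))/(C+1)^2 := by
      field_simp; ring
    rw [h2] at h1
    have : -(Y^2 * (C+2))/(C+1)^2 < 0 := by
      apply div_neg_of_neg_of_pos
      · have : 0 < Y^2 := by positivity
        nlinarith
      · positivity
    linarith
  have := expand 1
  simp only [ofReal_one, one_mul, hY] at this
  rw [this, eF, eh, ← ENNReal.ofReal_add hF0 hh0]
  congr 1; ring

lemma min_pyth (hΩ : IsOpen Ω) (hw : AEMeasurable w (volume.restrict Ω))
    (hw0 : ∀ᵐ z ∂(volume.restrict Ω), 0 < w z) {Fz : (ℂ → ℂ) → Prop} {z₀ : ℂ}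
    (hI : IsIdealAt Fz z₀) {f F g : ℂ → ℂ} (hF : Adm Ω f Fz F) (hfin : En Ω w F ≠ ⊤)
    (hmin : ∀ g, Adm Ω f Fz g → En Ω w F ≤ En Ω w g) (hg : Adm Ω f Fz g) :
    En Ω w g = En Ω w F + En Ω w (fun z => g z - F z) := by
  have := min_orth hΩ hw hw0 hF.1 (hg.1.fun_sub hF.1) hfin (fun s => hmin _ ⟨hF.1.fun_add
    ((hg.1.fun_sub hF.1).const_mul _), ?_⟩)
  · rw [← this]; congr 1; ext z; ring
  · exact Fz_congr hI (Fz_add hI hF.2 (Fz_mulc hI (Fz_sub hI hg.2 hF.2) s)) fun z => by ring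
end

lemma minL2F_le {D : Set ℂ} {ψ φ : ℂ → EReal} {c : ℝ → ℝ} {f : ℂ → ℂ} {Fz : (ℂ → ℂ) → Prop} {t : ℝ}
    {g : ℂ → ℂ} (hg : Adm {z | z ∈ D ∧ ψ z < ((-t : ℝ) : EReal)} f Fz g) :
    minL2F D ψ φ c f Fz t ≤ En {z | z ∈ D ∧ ψ z < ((-t : ℝ) : EReal)} (wgt1 φ ψ c) g :=
  sInf_le ⟨g, hg.1, hg.2, rfl⟩

lemma minL2F_approx {D : Set ℂ} {ψ φ : ℂ → EReal} {c : ℝ → ℝ} {f : ℂ → ℂ} {Fz : (ℂ → ℂ) → Prop} {t : ℝ}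
    (h : minL2F D ψ φ c f Fz t ≠ ⊤) {ε : ℝ} (hε : 0 < ε) :
    ∃ g, Adm {z | z ∈ D ∧ ψ z < ((-t : ℝ) : EReal)} f Fz g ∧
      En {z | z ∈ D ∧ ψ z < ((-t : ℝ) : EReal)} (wgt1 φ ψ c) g ≤ minL2F D ψ φ c f Fz t + ENNReal.ofReal ε := by
  have h1 : minL2F D ψ φ c f Fz t < minL2F D ψ φ c f Fz t + ENNReal.ofReal ε :=
    ENNReal.lt_add_right h (by simpa using hε)
  obtain ⟨I, ⟨g, hg, hg2, rfl⟩, hlt⟩ := sInf_lt_iff.1 h1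
  exact ⟨g, ⟨hg, hg2⟩, hlt.le⟩

end

section
open MeasureTheory Metric Complex Set Filter
open scoped ContDiff Topology

lemma ann_int {δ r : ℝ} (h0 : 0 < δ) (h : δ ≤ r) :
    ∫⁻ ζ : ℂ, {ζ : ℂ | δ ≤ ‖ζ‖ ∧ ‖ζ‖ < r}.indicator (fun ζ => ENNReal.ofReal ((‖ζ‖ ^ 2)⁻¹)) ζ
      = ENNReal.ofReal (2 * Real.pi * Real.log (r / δ)) := by
  have hms : MeasurableSet {ζ : ℂ | δ ≤ ‖ζ‖ ∧ ‖ζ‖ < r} :=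
    (measurableSet_le measurable_const measurable_norm).inter (measurableSet_lt measurable_norm measurable_const)
  rw [lintegral_polar (Measurable.indicator (by fun_prop) hms)]
  have e1 : ∀ ρ ∈ Ioi (0:ℝ), (∫⁻ θ in Ioo (-Real.pi) Real.pi, ENNReal.ofReal ρ *
      {ζ : ℂ | δ ≤ ‖ζ‖ ∧ ‖ζ‖ < r}.indicator (fun ζ => ENNReal.ofReal ((‖ζ‖ ^ 2)⁻¹)) (circleMap 0 ρ θ))
      = (Ico δ r).indicator (fun ρ => ENNReal.ofReal (2 * Real.pi * ρ⁻¹)) ρ := by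
    intro ρ hρ
    have hρ : 0 < ρ := hρ
    have : ∀ θ, ENNReal.ofReal ρ *
      {ζ : ℂ | δ ≤ ‖ζ‖ ∧ ‖ζ‖ < r}.indicator (fun ζ => ENNReal.ofReal ((‖ζ‖ ^ 2)⁻¹)) (circleMap 0 ρ θ)
      = (Ico δ r).indicator (fun ρ => ENNReal.ofReal (ρ⁻¹)) ρ := by
      intro θ
      by_cases hm : ρ ∈ Ico δ r
      · rw [indicator_of_mem hm, indicator_of_mem (by simpa [abs_of_pos hρ] using hm),
          ← ENNReal.ofReal_mul hρ.le]
        congr 1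
        simp [abs_of_pos hρ]; field_simp
      · rw [indicator_of_notMem hm, indicator_of_notMem (by simpa [abs_of_pos hρ] using hm), mul_zero]
    simp_rw [this]
    rw [setLIntegral_const, Real.volume_Ioo]
    by_cases hm : ρ ∈ Ico δ r
    · rw [indicator_of_mem hm, indicator_of_mem hm, ← ENNReal.ofReal_mul (by positivity)]
      congr 1; ring
    · rw [indicator_of_notMem hm, indicator_of_notMem hm, zero_mul]
  rw [setLIntegral_congr_fun measurableSet_Ioi e1, setLIntegral_indicator measurableSet_Ico]
  have e2 : Ico δ r ∩ Ioi 0 = Ico δ r := inter_eq_left.2 fun x hx => h0.trans_le hx.1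
  rw [e2]
  have hint : IntegrableOn (fun ρ : ℝ => 2 * Real.pi * ρ⁻¹) (Ico δ r) := by
    refine (ContinuousOn.integrableOn_Icc ?_).mono_set Ico_subset_Icc_self
    exact continuousOn_const.mul (continuousOn_inv₀.mono fun x hx => (h0.trans_le hx.1).ne')
  rw [← ofReal_integral_eq_lintegral_ofReal hint]
  · congr 1
    rw [integral_const_mul, integral_Ico_eq_integral_Ioo, ← integral_Ioc_eq_integral_Ioo,
      ← intervalIntegral.integral_of_le h, integral_inv_of_pos h0 (h0.trans_le h)]
  · filter_upwards [ae_restrict_mem measurableSet_Ico] with x hx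
    have := h0.trans_le hx.1
    have := Real.pi_pos
    simp only [Pi.zero_apply]; positivity

lemma contDiff_nq (p : ℂ) (ε : ℝ) : ContDiff ℝ ∞ (fun z : ℂ => ‖z - p‖ ^ 2 + ε) :=
  ((contDiff_id.sub contDiff_const).norm_sq ℝ).add contDiff_const

lemma dzb_nq (p : ℂ) (ε : ℝ) (z : ℂ) : dzb (rc (fun z : ℂ => ‖z - p‖ ^ 2 + ε)) z = z - p := by
  have h1 : HasFDerivAt (fun z : ℂ => ‖z - p‖ ^ 2 + ε) (2 • (innerSL ℝ (z - p))) z := by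
    have h0 : HasFDerivAt (fun z : ℂ => z - p) (ContinuousLinearMap.id ℝ ℂ) z := (hasFDerivAt_id z).sub_const p
    have := (h0.norm_sq).add_const ε
    simpa using this
  have h2 : HasFDerivAt (rc (fun z : ℂ => ‖z - p‖ ^ 2 + ε)) (ofRealCLM.comp (2 • (innerSL ℝ (z - p)))) z :=
    ofRealCLM.hasFDerivAt.comp z h1
  rw [dzb, h2.fderiv]
  apply Complex.ext <;> simp [Complex.inner]

lemma dz_nq (p : ℂ) (ε : ℝ) (z : ℂ) : ‖dz (rc (fun z : ℂ => ‖z - p‖ ^ 2 + ε)) z‖ ^ 2 = ‖z - p‖ ^ 2 := by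
  have := dzb_ofReal (fun z : ℂ => ‖z - p‖ ^ 2 + ε) z
  have h2 := dzb_nq p ε z
  unfold rc at h2 ⊢
  rw [this] at h2
  rw [← h2]; simp

lemma lap_nq (p : ℂ) (ε : ℝ) (z : ℂ) : lap (fun z : ℂ => ‖z - p‖ ^ 2 + ε) z = 1 := by
  have : dzb (rc (fun z : ℂ => ‖z - p‖ ^ 2 + ε)) = fun z => z - p := funext (dzb_nq p ε)
  have h0 : HasFDerivAt (fun z : ℂ => z - p) (ContinuousLinearMap.id ℝ ℂ) z := (hasFDerivAt_id z).sub_const p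
  rw [lap, this, dz, h0.fderiv]
  simp

lemma lap_logq (p : ℂ) {ε : ℝ} (hε : 0 < ε) (z : ℂ) : 0 ≤ lap (fun z : ℂ => Real.log (‖z - p‖ ^ 2 + ε)) z := by
  have hy : ∀ z : ℂ, ‖z - p‖ ^ 2 + ε ∈ Ioi (0:ℝ) := fun z => by
    have : 0 ≤ ‖z - p‖ ^ 2 := by positivity
    simp only [mem_Ioi]; positivity
  have hg : ContDiffOn ℝ ∞ Real.log (Ioi 0) := fun x hx =>
    (Real.contDiffAt_log.2 (ne_of_gt hx)).contDiffWithinAt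
  rw [lap_comp isOpen_Ioi hg (contDiff_nq p ε) hy, dz_nq, lap_nq]
  simp only [Real.deriv_log', deriv_inv]
  have := hy z
  have h3 : 0 < ‖z - p‖ ^ 2 + ε := this
  have : -((‖z - p‖ ^ 2 + ε) ^ 2)⁻¹ * ‖z - p‖ ^ 2 + (‖z - p‖ ^ 2 + ε)⁻¹ * 1 = ε / (‖z - p‖ ^ 2 + ε) ^ 2 := by
    field_simp; ring
  rw [this]; positivity

lemma lap_congr {u v : ℂ → ℝ} {O : Set ℂ} (hO : IsOpen O) (h : ∀ z ∈ O, u z = v z) {z : ℂ} (hz : z ∈ O) :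
    lap u z = lap v z := by
  have h1 : ∀ x ∈ O, dzb (rc u) x = dzb (rc v) x := fun x hx => by
    have : rc u =ᶠ[𝓝 x] rc v := by
      filter_upwards [hO.mem_nhds hx] with y hy; simp only [rc, h y hy]
    simp only [dzb, this.fderiv_eq]
  have : dzb (rc u) =ᶠ[𝓝 z] dzb (rc v) := by
    filter_upwards [hO.mem_nhds hz] with y hy; exact h1 y hy
  simp only [lap, dz, this.fderiv_eq]

lemma contDiff_logq (p : ℂ) {ε : ℝ} (hε : 0 < ε) : ContDiff ℝ ∞ (fun z : ℂ => Real.log (‖z - p‖ ^ 2 + ε)) :=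
  (contDiff_nq p ε).log fun z => by positivity

/-- function with a logarithmic pole at `p` -/
noncomputable def polU (p : ℂ) (Φ : ℂ → ℝ) (z : ℂ) : EReal :=
  open Classical in if z = p then ⊥ else ((Φ z + Real.log (‖z - p‖ ^ 2) : ℝ) : EReal)

lemma polU_apx {p z₀ : ℂ} {R : ℝ} (hp : p ∈ ball z₀ R) {Φ : ℂ → ℝ} (hΦ : ContDiff ℝ ∞ Φ)
    (hlap : ∀ z ∈ ball z₀ R, 0 ≤ lap Φ z) {M : ℝ}
    (hM : ∀ z ∈ ball z₀ (2 * R), Φ z + Real.log (‖z - p‖ ^ 2 + 1) ≤ M)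
    (hM' : (∀ z ∈ ball z₀ R, polU p Φ z < 0) → M < 0) : Apx (polU p Φ) (ball z₀ R) := by
  have hR : 0 < R := pos_of_mem_ball hp
  refine ⟨?_, ?_, ?_⟩
  · refine ae_restrict_of_ae ?_
    have : ∀ᵐ z : ℂ, z ≠ p := by simp [ae_iff]
    filter_upwards [this] with z hz
    simp only [polU, hz, if_false]; exact EReal.coe_ne_bot _
  · intro z _
    unfold polU; split_ifs
    · exact bot_ne_top
    · exact EReal.coe_ne_top _
  intro K hK hKB
  let b : ContDiffBump z₀ := ⟨R, 2 * R, hR, by linarith⟩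
  refine ⟨ball z₀ R, isOpen_ball, hKB, subset_rfl, M, hM',
    fun n z => b z * (Φ z + Real.log (‖z - p‖ ^ 2 + 1/((n:ℝ)+1)) - M) + M, ?_, ?_, ?_, ?_, ?_⟩
  · intro n
    exact (b.contDiff.mul ((hΦ.add (contDiff_logq p (by positivity))).sub contDiff_const)).add contDiff_const
  · intro n z
    by_cases hz : z ∈ ball z₀ (2 * R)
    · have h1 := hM z hz
      have h2 : Real.log (‖z - p‖ ^ 2 + 1/((n:ℝ)+1)) ≤ Real.log (‖z - p‖ ^ 2 + 1) := by
        apply Real.log_le_log (by positivity)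
        have : 1/((n:ℝ)+1) ≤ 1 := by rw [div_le_one (by positivity)]; linarith [Nat.cast_nonneg (α := ℝ) n]
        linarith
      nlinarith [b.nonneg (x := z)]
    · have : b z = 0 := b.zero_of_le_dist (by simpa using hz)
      simp [this]
  · intro n z hz
    have e : ∀ x ∈ ball z₀ R, b x * (Φ x + Real.log (‖x - p‖ ^ 2 + 1/((n:ℝ)+1)) - M) + M
        = Φ x + Real.log (‖x - p‖ ^ 2 + 1/((n:ℝ)+1)) := fun x hx => by
      rw [b.one_of_mem_closedBall (ball_subset_closedBall hx)]; ring
    rw [lap_congr isOpen_ball e hz, lap_add hΦ (contDiff_logq p (by positivity))]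
    exact add_nonneg (hlap z hz) (lap_logq p (by positivity) z)
  · intro n z hz
    beta_reduce
    rw [b.one_of_mem_closedBall (ball_subset_closedBall hz)]
    unfold polU; split_ifs with h
    · exact bot_le
    · rw [EReal.coe_le_coe_iff]
      have : 0 < ‖z - p‖ := norm_pos_iff.2 (sub_ne_zero.2 h)
      have : Real.log (‖z - p‖ ^ 2) ≤ Real.log (‖z - p‖ ^ 2 + 1/((n:ℝ)+1)) :=
        Real.log_le_log (by positivity) (by have : 0 < 1/((n:ℝ)+1) := by positivity
                                            linarith)
      linarith
  · intro z hz hne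
    have h : z ≠ p := fun h => hne (by simp [polU, h])
    have hpos : 0 < ‖z - p‖ := norm_pos_iff.2 (sub_ne_zero.2 h)
    simp only [b.one_of_mem_closedBall (ball_subset_closedBall hz)]
    have : (polU p Φ z).toReal = 1 * (Φ z + Real.log (‖z - p‖ ^ 2 + 0) - M) + M := by
      rw [polU, if_neg h, EReal.toReal_coe, add_zero]; ring
    rw [this]
    refine ((((Tendsto.log ?_ (by positivity)).const_add _).sub_const M).const_mul 1).add_const M
    exact tendsto_const_nhds.add tendsto_one_div_add_atTop_nhds_zero_nat

end

section
open MeasureTheory Metric Complex Set Filter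
open scoped ContDiff Topology

lemma ann_meas (p : ℂ) (δ r : ℝ) : MeasurableSet {z : ℂ | δ ≤ ‖z - p‖ ∧ ‖z - p‖ < r} :=
  (measurableSet_le (f := fun _ => δ) (g := fun z : ℂ => ‖z - p‖) measurable_const (by fun_prop)).inter
    (measurableSet_lt (f := fun z : ℂ => ‖z - p‖) (g := fun _ => r) (by fun_prop) measurable_const)

lemma ann_int' (p : ℂ) {δ r : ℝ} (h0 : 0 < δ) (h : δ ≤ r) :
    ∫⁻ z in {z : ℂ | δ ≤ ‖z - p‖ ∧ ‖z - p‖ < r}, ENNReal.ofReal ((‖z - p‖ ^ 2)⁻¹)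
      = ENNReal.ofReal (2 * Real.pi * Real.log (r / δ)) := by
  rw [← ann_int h0 h, ← lintegral_indicator (ann_meas p δ r)]
  exact lintegral_sub_right_eq_self (μ := (volume : Measure ℂ))
    ({z : ℂ | δ ≤ ‖z‖ ∧ ‖z‖ < r}.indicator fun z => ENNReal.ofReal ((‖z‖ ^ 2)⁻¹)) p

lemma ann_bochner (p : ℂ) {δ r : ℝ} (h0 : 0 < δ) (h : δ ≤ r) :
    IntegrableOn (fun z => (‖z - p‖ ^ 2)⁻¹) {z : ℂ | δ ≤ ‖z - p‖ ∧ ‖z - p‖ < r} ∧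
    ∫ z in {z : ℂ | δ ≤ ‖z - p‖ ∧ ‖z - p‖ < r}, (‖z - p‖ ^ 2)⁻¹ = 2 * Real.pi * Real.log (r / δ) := by
  have hl := ann_int' p h0 h
  have hm : AEStronglyMeasurable (fun z => (‖z - p‖ ^ 2)⁻¹) (volume.restrict {z : ℂ | δ ≤ ‖z - p‖ ∧ ‖z - p‖ < r}) :=
    Measurable.aestronglyMeasurable (by fun_prop)
  have hnn : 0 ≤ᵐ[volume.restrict {z : ℂ | δ ≤ ‖z - p‖ ∧ ‖z - p‖ < r}] fun z => (‖z - p‖ ^ 2)⁻¹ :=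
    Eventually.of_forall fun z => by simp only [Pi.zero_apply]; positivity
  constructor
  · refine (lintegral_ofReal_ne_top_iff_integrable hm hnn).1 ?_
    rw [hl]; exact ENNReal.ofReal_ne_top
  · rw [integral_eq_lintegral_of_nonneg_ae hnn hm, hl, ENNReal.toReal_ofReal]
    have : 0 ≤ Real.log (r / δ) := Real.log_nonneg (by rw [le_div_iff₀ h0]; linarith)
    have := Real.pi_pos
    positivity

lemma log_blow (p : ℂ) {δ κ : ℝ} (hδ : 0 < δ) (hκ : 0 < κ) :
    ∫⁻ z in ball p δ, ENNReal.ofReal (κ * (‖z - p‖ ^ 2)⁻¹) = ⊤ := by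
  have h1 : ∀ N : ℕ, ENNReal.ofReal (κ * (2 * Real.pi * N)) ≤ ∫⁻ z in ball p δ, ENNReal.ofReal (κ * (‖z - p‖ ^ 2)⁻¹) := by
    intro N
    have hp : 0 < δ * Real.exp (-N) := by positivity
    have := ann_int' p (δ := δ * Real.exp (-N)) (r := δ) hp (by
      have : Real.exp (-N) ≤ 1 := Real.exp_le_one_iff.2 (by simp)
      nlinarith)
    have e : δ / (δ * Real.exp (-N)) = Real.exp N := by
      rw [Real.exp_neg]; field_simp
    rw [e, Real.log_exp] at this
    rw [ENNReal.ofReal_mul hκ.le, ← this, ← lintegral_const_mul' _ _ ENNReal.ofReal_ne_top]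
    simp_rw [← ENNReal.ofReal_mul hκ.le]
    refine lintegral_mono_set fun z hz => ?_
    simpa [dist_eq_norm] using hz.2
  by_contra hne
  have h2 : Tendsto (fun N : ℕ => κ * (2 * Real.pi * N)) atTop atTop :=
    ((tendsto_natCast_atTop_atTop).const_mul_atTop (by positivity)).const_mul_atTop hκ
  obtain ⟨N, hN⟩ := (h2.eventually_gt_atTop (∫⁻ z in ball p δ, ENNReal.ofReal (κ * (‖z - p‖ ^ 2)⁻¹)).toReal).exists
  have := (ENNReal.ofReal_le_iff_le_toReal hne).1 (h1 N)
  linarith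

lemma polU_toReal {p z : ℂ} (h : z ≠ p) (Φ : ℂ → ℝ) : (polU p Φ z).toReal = Φ z + Real.log (‖z - p‖ ^ 2) := by
  rw [polU, if_neg h, EReal.toReal_coe]

lemma ot_smooth0 {z₀ p : ℂ} {R : ℝ} (hp : p ∈ ball z₀ R) {Φ : ℂ → ℝ} (hΦ : ContDiff ℝ ∞ Φ)
    (hlap : ∀ z ∈ ball z₀ R, 0 ≤ lap Φ z)
    (hsh : ∃ p₁ ∈ ball z₀ R, p₁ ≠ p ∧ 0 ≤ Φ p₁ + Real.log (‖p₁ - p‖ ^ 2)) :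
    ∃ g : ℂ → ℂ, DifferentiableOn ℂ g (ball z₀ R) ∧ g p = 1 ∧
      ∫⁻ z in ball z₀ R, ENNReal.ofReal (‖g z‖ ^ 2 * Real.exp (-Φ z)) ≤
        ENNReal.ofReal (8 * Real.pi * ((9 * R ^ 2 + 1) * Real.exp 1) * Real.exp (-Φ p)) := by
  have hR : 0 < R := pos_of_mem_ball hp
  have hpi := Real.pi_pos
  set C0 := Real.log (9 * R ^ 2 + 1) + 1 with hC0
  have eC0 : Real.exp C0 = (9 * R ^ 2 + 1) * Real.exp 1 := by
    rw [hC0, Real.exp_add, Real.exp_log (by positivity)]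
  have hne : ∀ᵐ z : ℂ, z ≠ p := by simp [ae_iff]
  have hdist : ∀ z ∈ ball z₀ (2 * R), ‖z - p‖ ^ 2 ≤ 9 * R ^ 2 := by
    intro z hz
    have h1 : ‖z - p‖ < 3 * R := by
      rw [← dist_eq_norm]
      have := dist_triangle z z₀ p
      rw [dist_comm z₀ p] at this
      have h2 : dist p z₀ < R := hp
      have h3 : dist z z₀ < 2 * R := hz
      linarith
    nlinarith [norm_nonneg (z - p)]
  have hB2 : ball z₀ R ⊆ ball z₀ (2 * R) := ball_subset_ball (by linarith)
  have hle : ∀ z ∈ ball z₀ (2 * R), -C0 + Real.log (‖z - p‖ ^ 2 + 1) ≤ -1 := by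
    intro z hz
    have := Real.log_le_log (by positivity) (add_le_add_left (hdist z hz) 1)
    simp only [hC0]; linarith
  have hψ : Apx (polU p (fun _ => -C0)) (ball z₀ R) := polU_apx hp contDiff_const
    (fun z _ => by
      have e : dzb (rc fun _ => -C0) = fun _ => 0 := by funext w; simp [dzb, rc]
      simp [lap, e, dz]) hle (fun _ => by norm_num)
  have hneg : ∀ z ∈ ball z₀ R, polU p (fun _ => -C0) z < 0 := by
    intro z hz
    unfold polU; split_ifs with h
    · exact EReal.bot_lt_zero
    · have h0 : 0 < ‖z - p‖ := norm_pos_iff.2 (sub_ne_zero.2 h)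
      have h1 := hle z (hB2 hz)
      have h2 : Real.log (‖z - p‖ ^ 2) ≤ Real.log (‖z - p‖ ^ 2 + 1) := Real.log_le_log (by positivity) (by linarith)
      exact_mod_cast (by linarith : -C0 + Real.log (‖z - p‖ ^ 2) < 0)
  have hΦA : Apx (polU p Φ) (ball z₀ R) := by
    have hc : ContinuousOn (fun z => Φ z + Real.log (‖z - p‖ ^ 2 + 1)) (closedBall z₀ (2 * R)) :=
      (hΦ.add (contDiff_logq p one_pos)).continuous.continuousOn
    obtain ⟨M, hM⟩ := (isCompact_closedBall z₀ (2 * R)).bddAbove_image hc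
    refine polU_apx hp hΦ hlap (M := M) (fun z hz => hM ⟨z, ball_subset_closedBall hz, rfl⟩) ?_
    intro hall
    obtain ⟨p₁, h1, h2, h3⟩ := hsh
    have := hall p₁ h1
    rw [polU, if_neg h2] at this
    have h4 : Φ p₁ + Real.log (‖p₁ - p‖ ^ 2) < 0 := by exact_mod_cast this
    linarith
  -- radius
  obtain ⟨ρ, hρ, hρR, hρB, hρΦ⟩ : ∃ ρ > 0, ρ ≤ R ∧ ball p ρ ⊆ ball z₀ R ∧
      ∀ z ∈ ball p ρ, Real.exp (-Φ z) ≤ 2 * Real.exp (-Φ p) := by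
    have h1 : ∀ᶠ z in 𝓝 p, Real.exp (-Φ z) < 2 * Real.exp (-Φ p) := by
      have : Continuous fun z => Real.exp (-Φ z) := Real.continuous_exp.comp hΦ.continuous.neg
      exact this.continuousAt.eventually_lt_const (by have := Real.exp_pos (-Φ p); linarith)
    obtain ⟨r, hr, h⟩ := Metric.eventually_nhds_iff_ball.1 (h1.and (isOpen_ball.mem_nhds hp))
    refine ⟨min r R, by positivity, min_le_right _ _, fun z hz => (h z (ball_subset_ball (min_le_left _ _) hz)).2,
      fun z hz => (h z (ball_subset_ball (min_le_left _ _) hz)).1.le⟩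
  set t0 := C0 - Real.log (ρ ^ 2) with ht0
  have et0 : Real.exp (-t0) = ρ ^ 2 * Real.exp (-C0) := by
    rw [ht0, show -(C0 - Real.log (ρ^2)) = Real.log (ρ^2) + -C0 by ring, Real.exp_add, Real.exp_log (by positivity)]
  have ht0p : 0 < t0 := by
    have : Real.log (ρ ^ 2) ≤ Real.log (9 * R ^ 2 + 1) := Real.log_le_log (by positivity) (by nlinarith)
    simp only [ht0, hC0]; linarith
  have hlt : ∀ z, z ≠ p → ∀ s : ℝ, (polU p (fun _ => -C0) z < ((-t0 - s : ℝ) : EReal) ↔ ‖z - p‖ < ρ * Real.exp (-s/2)) := by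
    intro z hz s
    have h0 : 0 < ‖z - p‖ := norm_pos_iff.2 (sub_ne_zero.2 hz)
    rw [polU, if_neg hz, EReal.coe_lt_coe_iff]
    have e1 : -C0 + Real.log (‖z - p‖ ^ 2) < -t0 - s ↔ Real.log (‖z - p‖) < Real.log (ρ * Real.exp (-s/2)) := by
      rw [Real.log_mul hρ.ne' (Real.exp_ne_zero _), Real.log_exp, Real.log_pow, ht0, Real.log_pow]
      push_cast
      constructor <;> intro h <;> linarith
    rw [e1, Real.log_lt_log_iff h0 (by positivity)]
  have hS : {z | z ∈ ball z₀ R ∧ polU p (fun _ => -C0) z < ((-t0 : ℝ) : EReal)} = ball p ρ := by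
    ext z
    simp only [mem_ofPred_eq, mem_ball, dist_eq_norm z p]
    by_cases hz : z = p
    · subst hz
      simp only [polU, if_true, EReal.bot_lt_coe, and_true, sub_self, norm_zero, hρ, iff_true]; exact hp
    · have := hlt z hz 0
      simp only [sub_zero, neg_zero, zero_div, Real.exp_zero, mul_one] at this
      rw [this]
      exact ⟨fun h => h.2, fun h => ⟨hρB (by simpa [dist_eq_norm] using h), h⟩⟩
  set a := 2 * Real.pi * Real.exp (-Φ p) with ha
  set F : ℂ → ℂ := (ball p ρ).indicator 1 with hF
  have hF1 : ∀ z ∈ ball p ρ, F z = 1 := fun z hz => by simp [hF, hz]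
  have hFle : ∀ z, ‖F z‖ ≤ 1 := fun z => by
    by_cases h : z ∈ ball p ρ
    · rw [hF1 z h]; simp
    · simp [hF, h]
  obtain ⟨g, hg, hgE⟩ := extend (q := fun t => Real.exp (-t)) (t0 := t0) (L := Real.exp (-t0)) (a := a)
    (D := ball z₀ R) (ψ := polU p (fun _ => -C0)) (Φ := polU p Φ) (F := F)
    (by fun_prop) (fun t _ => Real.exp_pos _) (fun s t _ h => Real.exp_le_exp.2 (by linarith))
    (integrableOn_exp_neg_Ioi 0) ht0p
    ((Real.continuous_exp.comp continuous_neg).continuousAt.tendsto.mono_left nhdsWithin_le_nhds)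
    (by positivity) isOpen_ball hψ hneg hΦA
    (by rw [hS]; exact (differentiableOn_const 1).congr hF1)
    (fun z hz hn => by
      have : z ∉ ball p ρ := by rw [← hS]; exact fun h => hn h.2
      simp [hF, this])
    (fun K hKB hK => by
      haveI : IsFiniteMeasure (volume.restrict K) := ⟨by simpa using hK.measure_lt_top⟩
      refine MemLp.of_bound ?_ 1 (Eventually.of_forall hFle)
      exact (measurable_one.indicator measurableSet_ball).aestronglyMeasurable)
    (fun s hs => by
      have hset : {z | z ∈ ball z₀ R ∧ ((-t0 - s : ℝ) : EReal) ≤ polU p (fun _ => -C0) z ∧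
          polU p (fun _ => -C0) z < ((-t0 : ℝ) : EReal)} = {z | ρ * Real.exp (-s/2) ≤ ‖z - p‖ ∧ ‖z - p‖ < ρ} := by
        ext z
        have hS' := Set.ext_iff.1 hS z
        simp only [mem_ofPred_eq, mem_ball, dist_eq_norm z p] at hS' ⊢
        by_cases hz : z = p
        · subst hz
          simp only [polU, if_true, sub_self, norm_zero, le_bot_iff, EReal.coe_ne_bot, false_and, and_false, false_iff, not_and]
          intro h; exact absurd h (not_le.2 (by positivity))
        · have := hlt z hz s
          rw [← not_lt, this, not_lt, ← hS']
          tauto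
      obtain ⟨i1, i2⟩ := ann_bochner p (δ := ρ * Real.exp (-s/2)) (r := ρ) (by positivity) (by
        have : Real.exp (-s/2) ≤ 1 := Real.exp_le_one_iff.2 (by linarith)
        nlinarith)
      have e : ρ / (ρ * Real.exp (-s/2)) = Real.exp (s/2) := by
        rw [neg_div, Real.exp_neg]; field_simp
      rw [e, Real.log_exp] at i2
      rw [hset]
      have hdom : ∀ z ∈ {z | ρ * Real.exp (-s/2) ≤ ‖z - p‖ ∧ ‖z - p‖ < ρ},
          ‖F z‖ ^ 2 * Real.exp (-(polU p Φ z).toReal) ≤ 2 * Real.exp (-Φ p) * (‖z - p‖ ^ 2)⁻¹ := by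
        intro z hz
        have hz0 : 0 < ‖z - p‖ := lt_of_lt_of_le (by positivity) hz.1
        have hzp : z ≠ p := fun h => by simp [h] at hz0
        have hzb : z ∈ ball p ρ := by simpa [dist_eq_norm] using hz.2
        rw [hF1 z hzb, polU_toReal hzp, neg_add, Real.exp_add, Real.exp_neg (Real.log _), Real.exp_log (by positivity)]
        have := hρΦ z hzb
        simp only [norm_one, one_pow, one_mul]
        gcongr
      have hint : IntegrableOn (fun z => ‖F z‖ ^ 2 * Real.exp (-(polU p Φ z).toReal))
          {z | ρ * Real.exp (-s/2) ≤ ‖z - p‖ ∧ ‖z - p‖ < ρ} := by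
        refine (i1.const_mul (2 * Real.exp (-Φ p))).mono' ?_ ?_
        · have m1 : Measurable F := measurable_one.indicator measurableSet_ball
          have m2 : Measurable fun z => Φ z + Real.log (‖z - p‖ ^ 2) :=
            hΦ.continuous.measurable.add (by fun_prop)
          have m3 : AEStronglyMeasurable (fun z => ‖F z‖ ^ 2 * Real.exp (-(Φ z + Real.log (‖z - p‖ ^ 2))))
              (volume.restrict {z | ρ * Real.exp (-s/2) ≤ ‖z - p‖ ∧ ‖z - p‖ < ρ}) :=
            ((m1.norm.pow_const 2).mul (Real.measurable_exp.comp m2.neg)).aestronglyMeasurable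
          refine m3.congr (ae_restrict_of_ae ?_)
          filter_upwards [hne] with z hz
          rw [polU_toReal hz]
        · filter_upwards [ae_restrict_mem (ann_meas p _ _)] with z hz
          rw [Real.norm_of_nonneg (by positivity)]
          exact hdom z hz
      refine ⟨hint, ?_⟩
      calc _ ≤ ∫ z in {z | ρ * Real.exp (-s/2) ≤ ‖z - p‖ ∧ ‖z - p‖ < ρ}, 2 * Real.exp (-Φ p) * (‖z - p‖ ^ 2)⁻¹ :=
            setIntegral_mono_on hint (i1.const_mul _) (ann_meas p _ _) hdom
        _ = a * s := by rw [integral_const_mul, i2, ha]; ring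
        _ ≤ a * s * Real.exp (-t0) / Real.exp (-(t0 + s)) := by
            rw [mul_div_assoc, ← Real.exp_sub]
            have : 1 ≤ Real.exp (-t0 - -(t0 + s)) := Real.one_le_exp (by linarith)
            have : 0 ≤ a * s := by positivity
            nlinarith)
  have hgE' : ∫⁻ z in ball z₀ R, ENNReal.ofReal (‖g z - F z‖ ^ 2 *
      (Real.exp (-(polU p Φ z).toReal) * qhat (fun t => Real.exp (-t)) (Real.exp (-t0)) t0 (polU p (fun _ => -C0) z).toReal))
      ≤ ENNReal.ofReal a := by
    refine hgE.trans (ENNReal.ofReal_le_ofReal ?_)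
    have h1 : ∫ t in Ioc 0 t0, Real.exp (-t) ≤ 1 := by
      rw [← integral_exp_neg_Ioi_zero]
      exact setIntegral_mono_set (integrableOn_exp_neg_Ioi 0) (Eventually.of_forall fun t => (Real.exp_pos _).le)
        (Eventually.of_forall fun t ht => ht.1)
    have : 0 ≤ a := by positivity
    nlinarith
  have hin : ∀ z ∈ ball p ρ, z ≠ p → Real.exp (-(polU p Φ z).toReal) *
      qhat (fun t => Real.exp (-t)) (Real.exp (-t0)) t0 (polU p (fun _ => -C0) z).toReal
      = Real.exp (-Φ z) * Real.exp (-t0) * (‖z - p‖ ^ 2)⁻¹ := by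
    intro z hz hzp
    have h0 : 0 < ‖z - p‖ := norm_pos_iff.2 (sub_ne_zero.2 hzp)
    have : (polU p (fun _ => -C0) z).toReal < -t0 := by
      refine toReal_lt_of ?_ (hS.symm ▸ hz : z ∈ {z | z ∈ ball z₀ R ∧ polU p (fun _ => -C0) z < ((-t0 : ℝ) : EReal)}).2
      rw [polU, if_neg hzp]; exact EReal.coe_ne_bot _
    rw [qhat, if_pos this, polU_toReal hzp, neg_add, Real.exp_add, Real.exp_neg (Real.log _), Real.exp_log (by positivity)]
    ring
  refine ⟨g, hg, ?_, ?_⟩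
  · by_contra hgp
    have hgc : ContinuousAt g p := (hg.differentiableAt (isOpen_ball.mem_nhds hp)).continuousAt
    have hkc : ContinuousAt (fun z => ‖g z - 1‖ ^ 2 * (Real.exp (-Φ z) * Real.exp (-t0))) p :=
      ((hgc.sub continuousAt_const).norm.pow 2).mul
        (((Real.continuous_exp.comp hΦ.continuous.neg).continuousAt).mul continuousAt_const)
    have hk0 : 0 < ‖g p - 1‖ ^ 2 * (Real.exp (-Φ p) * Real.exp (-t0)) := by
      have : 0 < ‖g p - 1‖ := norm_pos_iff.2 (sub_ne_zero.2 hgp)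
      positivity
    set κ := ‖g p - 1‖ ^ 2 * (Real.exp (-Φ p) * Real.exp (-t0)) / 2 with hκ
    have hκ0 : 0 < κ := by positivity
    obtain ⟨δ, hδ, hδk⟩ := Metric.eventually_nhds_iff_ball.1 ((hkc.eventually_const_lt (u := κ) (by simp only [hκ]; linarith)).and
      (ball_mem_nhds p hρ))
    have : ∫⁻ z in ball p δ, ENNReal.ofReal (κ * (‖z - p‖ ^ 2)⁻¹) ≤ ENNReal.ofReal a := by
      refine le_trans ?_ hgE'
      refine le_trans ?_ (lintegral_mono_set (fun z hz => hρB (hδk z hz).2))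
      refine setLIntegral_mono_ae' measurableSet_ball ?_
      filter_upwards [hne] with z hzp hz
      refine ENNReal.ofReal_le_ofReal ?_
      rw [hin z (hδk z hz).2 hzp, hF1 z (hδk z hz).2]
      have := (hδk z hz).1
      rw [← mul_assoc]
      gcongr
    rw [log_blow p hδ hκ0] at this
    simp at this
  · have h1 : ∫⁻ z in ball z₀ R, ENNReal.ofReal (‖g z - F z‖ ^ 2 * Real.exp (-Φ z)) ≤
        ENNReal.ofReal (Real.exp C0 * a) := by
      rw [ENNReal.ofReal_mul (by positivity)]
      refine le_trans ?_ (mul_le_mul_right hgE' _)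
      rw [← lintegral_const_mul' _ _ ENNReal.ofReal_ne_top]
      refine setLIntegral_mono_ae' measurableSet_ball ?_
      filter_upwards [hne] with z hzp hz
      have h0 : 0 < ‖z - p‖ := norm_pos_iff.2 (sub_ne_zero.2 hzp)
      rw [← ENNReal.ofReal_mul (by positivity)]
      refine ENNReal.ofReal_le_ofReal ?_
      have key : Real.exp (-Φ z) ≤ Real.exp C0 * (Real.exp (-(polU p Φ z).toReal) *
          qhat (fun t => Real.exp (-t)) (Real.exp (-t0)) t0 (polU p (fun _ => -C0) z).toReal) := by
        by_cases hzb : z ∈ ball p ρ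
        · rw [hin z hzb hzp, et0, Real.exp_neg C0]
          have h1 : ‖z - p‖ < ρ := by simpa [dist_eq_norm] using hzb
          have : Real.exp C0 * (Real.exp (-Φ z) * (ρ ^ 2 * (Real.exp C0)⁻¹) * (‖z - p‖ ^ 2)⁻¹)
              = Real.exp (-Φ z) * (ρ ^ 2 / ‖z - p‖ ^ 2) := by
            field_simp
          rw [this]
          have h2 : 1 ≤ ρ ^ 2 / ‖z - p‖ ^ 2 := by
            rw [one_le_div (by positivity)]; gcongr
          have := Real.exp_pos (-Φ z)
          nlinarith
        · have : ¬ (polU p (fun _ => -C0) z).toReal < -t0 := by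
            intro h
            apply hzb
            rw [← hS]
            refine ⟨hz, ?_⟩
            rw [polU_toReal hzp] at h
            rw [polU, if_neg hzp]
            exact_mod_cast h
          rw [qhat, if_neg this, polU_toReal hzp, polU_toReal hzp, ← Real.exp_add, ← Real.exp_add]
          refine Real.exp_le_exp.2 ?_
          linarith
      calc _ ≤ ‖g z - F z‖ ^ 2 * (Real.exp C0 * (Real.exp (-(polU p Φ z).toReal) *
          qhat (fun t => Real.exp (-t)) (Real.exp (-t0)) t0 (polU p (fun _ => -C0) z).toReal)) := by gcongr
        _ = _ := by ring
    have h2 : ∫⁻ z in ball z₀ R, ENNReal.ofReal (‖F z‖ ^ 2 * Real.exp (-Φ z)) ≤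
        ENNReal.ofReal (Real.exp C0 * a) := by
      calc _ ≤ ∫⁻ z, (ball p ρ).indicator (fun _ => ENNReal.ofReal (2 * Real.exp (-Φ p))) z := by
            refine le_trans ?_ (setLIntegral_le_lintegral (ball z₀ R) _)
            refine lintegral_mono fun z => ?_
            by_cases h : z ∈ ball p ρ
            · rw [indicator_of_mem h, hF1 z h]
              refine ENNReal.ofReal_le_ofReal ?_
              simpa using hρΦ z h
            · simp [hF, h]
        _ = ENNReal.ofReal (2 * Real.exp (-Φ p)) * volume (ball p ρ) := by
            rw [lintegral_indicator measurableSet_ball, setLIntegral_const]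
        _ = ENNReal.ofReal (2 * Real.exp (-Φ p) * (ρ ^ 2 * Real.pi)) := by
            rw [Complex.volume_ball, ENNReal.ofReal_mul (p := 2 * Real.exp (-Φ p)) (by positivity),
              ENNReal.ofReal_mul (p := ρ ^ 2) (by positivity), ENNReal.ofReal_pow hρ.le]
            congr 2
            rw [← ENNReal.ofReal_coe_nnreal]; rfl
        _ ≤ _ := by
            refine ENNReal.ofReal_le_ofReal ?_
            rw [eC0, ha]
            have h1 : ρ ^ 2 ≤ (9 * R ^ 2 + 1) * Real.exp 1 := by
              have : (1:ℝ) ≤ Real.exp 1 := Real.one_le_exp zero_le_one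
              nlinarith
            have : 0 < Real.exp (-Φ p) * Real.pi := by positivity
            nlinarith
    have hm1 : AEMeasurable (fun z => ENNReal.ofReal (‖g z - F z‖ ^ 2 * Real.exp (-Φ z))) (volume.restrict (ball z₀ R)) := by
      have m0 : AEMeasurable g (volume.restrict (ball z₀ R)) := hg.continuousOn.aemeasurable measurableSet_ball
      have m1 : Measurable F := measurable_one.indicator measurableSet_ball
      have m2 : Measurable fun z => Real.exp (-Φ z) := (Real.continuous_exp.comp hΦ.continuous.neg).measurable
      exact (((m0.sub m1.aemeasurable).norm.pow_const 2).mul m2.aemeasurable).ennreal_ofReal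
    calc _ ≤ ∫⁻ z in ball z₀ R, (2 * ENNReal.ofReal (‖g z - F z‖ ^ 2 * Real.exp (-Φ z)) +
          2 * ENNReal.ofReal (‖F z‖ ^ 2 * Real.exp (-Φ z))) := by
          refine lintegral_mono fun z => ?_
          rw [show (2:ENNReal) = ENNReal.ofReal 2 by simp, ← ENNReal.ofReal_mul (by simp), ← ENNReal.ofReal_mul (by simp),
            ← ENNReal.ofReal_add (by positivity) (by positivity)]
          refine ENNReal.ofReal_le_ofReal ?_
          have h3 : ‖g z‖ ≤ ‖g z - F z‖ + ‖F z‖ := by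
            have := norm_add_le (g z - F z) (F z); simpa using this
          have h4 : ‖g z‖ ^ 2 ≤ 2 * ‖g z - F z‖ ^ 2 + 2 * ‖F z‖ ^ 2 := by
            have : ‖g z‖ ^ 2 ≤ (‖g z - F z‖ + ‖F z‖) ^ 2 := by gcongr
            nlinarith [sq_nonneg (‖g z - F z‖ - ‖F z‖)]
          have := mul_le_mul_of_nonneg_right h4 (Real.exp_pos (-Φ z)).le
          linarith
      _ ≤ 2 * ENNReal.ofReal (Real.exp C0 * a) + 2 * ENNReal.ofReal (Real.exp C0 * a) := by
          rw [lintegral_add_left' (hm1.const_mul _), lintegral_const_mul' _ _ (by simp), lintegral_const_mul' _ _ (by simp)]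
          gcongr
      _ = _ := by
          rw [show (2:ENNReal) = ENNReal.ofReal 2 by simp, ← ENNReal.ofReal_mul (by simp),
            ← ENNReal.ofReal_add (by positivity) (by positivity), eC0, ha]
          congr 1; ring

end

section
open MeasureTheory Metric Complex Set Filter
open scoped ContDiff Topology

lemma ot_smooth {z₀ p : ℂ} {R : ℝ} (hp : p ∈ ball z₀ R) {Φ : ℂ → ℝ} (hΦ : ContDiff ℝ ∞ Φ)
    (hlap : ∀ z ∈ ball z₀ R, 0 ≤ lap Φ z) :
    ∃ g : ℂ → ℂ, DifferentiableOn ℂ g (ball z₀ R) ∧ g p = 1 ∧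
      ∫⁻ z in ball z₀ R, ENNReal.ofReal (‖g z‖ ^ 2 * Real.exp (-Φ z)) ≤
        ENNReal.ofReal (8 * Real.pi * ((9 * R ^ 2 + 1) * Real.exp 1) * Real.exp (-Φ p)) := by
  have hpi := Real.pi_pos
  obtain ⟨p₁, hp₁, hne⟩ : ∃ p₁ ∈ ball z₀ R, p₁ ≠ p := by
    have h1 : ∀ᶠ z in 𝓝[≠] p, z ∈ ball z₀ R := nhdsWithin_le_nhds (isOpen_ball.mem_nhds hp)
    obtain ⟨q, hq⟩ := (h1.and self_mem_nhdsWithin).exists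
    exact ⟨q, hq.1, hq.2⟩
  set K := -(Φ p₁ + Real.log (‖p₁ - p‖ ^ 2)) with hK
  obtain ⟨g, h1, h2, h3⟩ := ot_smooth0 (Φ := fun z => Φ z + K) hp (hΦ.add contDiff_const) (fun z hz => by
      have e : dzb (rc fun _ => K) = fun _ => 0 := by funext w; simp [dzb]
      have e2 : lap (fun _ => K) z = 0 := by simp [lap, e, dz]
      have := lap_add hΦ (contDiff_const (c := K)) z
      rw [this, e2, add_zero]; exact hlap z hz) ⟨p₁, hp₁, hne, by rw [hK]; linarith⟩
  refine ⟨g, h1, h2, ?_⟩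
  have e : ∀ x, Real.exp (-(Φ x + K)) = Real.exp (-Φ x) * Real.exp (-K) := fun x => by
    rw [← Real.exp_add]; ring_nf
  simp only [e, ← mul_assoc] at h3
  have e2 : ∀ x : ℝ, 0 ≤ x → ENNReal.ofReal (x * Real.exp (-K)) = ENNReal.ofReal (Real.exp (-K)) * ENNReal.ofReal x :=
    fun x hx => by rw [mul_comm, ENNReal.ofReal_mul (Real.exp_pos _).le]
  rw [e2 _ (by positivity), lintegral_congr (fun z => e2 _ (by positivity)), lintegral_const_mul' _ _ ENNReal.ofReal_ne_top] at h3
  rw [ENNReal.mul_le_mul_iff_right (by simpa using Real.exp_pos _) ENNReal.ofReal_ne_top] at h3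
  simpa [mul_assoc] using h3

lemma En_mono_w {Ω : Set ℂ} {w w' : ℂ → ℝ} (h : ∀ z, w z ≤ w' z) (g : ℂ → ℂ) : En Ω w g ≤ En Ω w' g :=
  lintegral_mono fun z => ENNReal.ofReal_le_ofReal (mul_le_mul_of_nonneg_left (h z) (by positivity))

lemma komlos {B : Set ℂ} (hB : IsOpen B) {p : ℂ} (hp : p ∈ B) {w : ℕ → ℂ → ℝ} {W : ℂ → ℝ} {κ A : ℝ} (hκ : 0 < κ)
    (hwm : ∀ n, Measurable (w n)) (hwκ : ∀ n z, κ ≤ w n z) (hmono : ∀ m n, m ≤ n → ∀ z, w m z ≤ w n z)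
    (hlim : ∀ᵐ z ∂(volume.restrict B), Tendsto (fun n => w n z) atTop (𝓝 (W z)))
    (hx : ∀ n, ∃ x : ℂ → ℂ, DifferentiableOn ℂ x B ∧ x p = 1 ∧ En B (w n) x ≤ ENNReal.ofReal A) :
    ∃ x : ℂ → ℂ, DifferentiableOn ℂ x B ∧ x p = 1 ∧ En B W x ≤ ENNReal.ofReal A := by
  set S : ℕ → Set (ℂ → ℂ) := fun n => {x | DifferentiableOn ℂ x B ∧ x p = 1 ∧ En B (w n) x ≤ ENNReal.ofReal A} with hS
  set N1 : (ℂ → ℂ) → ENNReal := En B (fun _ => 1) with hN1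
  have hanti : ∀ m n, m ≤ n → S n ⊆ S m := fun m n h x hx => ⟨hx.1, hx.2.1, (En_mono_w (hmono m n h) x).trans hx.2.2⟩
  have hbd : ∀ n, ∀ x ∈ S n, N1 x ≤ ENNReal.ofReal (κ⁻¹ * A) := by
    intro n x hx
    have h1 : En B (fun _ => κ) x ≤ ENNReal.ofReal A := (En_mono_w (hwκ n) x).trans hx.2.2
    have h2 : En B (fun _ => κ) x = ENNReal.ofReal κ * N1 x := by
      rw [hN1, En, En, ← lintegral_const_mul' _ _ ENNReal.ofReal_ne_top]
      refine lintegral_congr fun z => ?_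
      rw [← ENNReal.ofReal_mul hκ.le]; congr 1; ring
    rw [← ENNReal.mul_le_mul_iff_right (a := ENNReal.ofReal κ) (by simpa using hκ) ENNReal.ofReal_ne_top,
      ← ENNReal.ofReal_mul hκ.le, mul_inv_cancel_left₀ hκ.ne', ← h2]
    exact h1
  set e : ℕ → ENNReal := fun n => ⨅ x ∈ S n, N1 x with he
  have hele : ∀ n, ∀ x ∈ S n, e n ≤ N1 x := fun n x hx => iInf₂_le x hx
  have hefin : ∀ n, e n ≤ ENNReal.ofReal (κ⁻¹ * A) := fun n => by
    obtain ⟨x, hx⟩ := hx n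
    exact (hele n x hx).trans (hbd n x hx)
  have heft : ∀ n, e n ≠ ⊤ := fun n => ne_top_of_le_ne_top ENNReal.ofReal_ne_top (hefin n)
  have hemono : Monotone e := fun m n h => biInf_mono (fun x hx => hanti m n h hx)
  have hch : ∀ n, ∃ x ∈ S n, N1 x < e n + ENNReal.ofReal (1 / (n + 1 : ℝ)) := by
    intro n
    have : e n < e n + ENNReal.ofReal (1 / (n + 1 : ℝ)) :=
      ENNReal.lt_add_right (heft n) (by simp; positivity)
    conv_lhs at this => rw [he]
    simp only [iInf_lt_iff] at this
    obtain ⟨x, hx, h⟩ := this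
    exact ⟨x, hx, h⟩
  choose x hxS hxe using hch
  have hone : AEMeasurable (fun _ : ℂ => (1:ℝ)) (volume.restrict B) := aemeasurable_const
  have hone0 : ∀ᵐ z ∂(volume.restrict B), (0:ℝ) < (fun _ : ℂ => (1:ℝ)) z := Eventually.of_forall fun _ => one_pos
  -- Cauchy
  have hE : ∃ l, Tendsto (fun n => (e n).toReal) atTop (𝓝 l) :=
    ⟨_, tendsto_atTop_ciSup (fun m n h => (ENNReal.toReal_le_toReal (heft m) (heft n)).2 (hemono h))
      ⟨(ENNReal.ofReal (κ⁻¹ * A)).toReal, by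
        rintro _ ⟨n, rfl⟩
        exact (ENNReal.toReal_le_toReal (heft n) ENNReal.ofReal_ne_top).2 (hefin n)⟩⟩
  obtain ⟨l, hl⟩ := hE
  have hhalf : ∀ n, ∀ y ∈ S n, ∀ y' ∈ S n, (fun z => (1/2 : ℂ) * (y z + y' z)) ∈ S n := by
    intro n y hy y' hy'
    refine ⟨(hy.1.fun_add hy'.1).const_mul _, by simp [hy.2.1, hy'.2.1]; norm_num, ?_⟩
    rw [En_smul]
    have hp := En_par hB (hwm n).aemeasurable (Eventually.of_forall fun z => hκ.trans_le (hwκ n z)) hy.1 hy'.1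
    have h1 : En B (w n) (fun z => y z + y' z) ≤ 4 * ENNReal.ofReal A := by
      calc _ ≤ _ := le_self_add
        _ = _ := hp
        _ ≤ 2 * ENNReal.ofReal A + 2 * ENNReal.ofReal A := by gcongr; exacts [hy.2.2, hy'.2.2]
        _ = _ := by ring
    calc _ ≤ ENNReal.ofReal (‖(1/2:ℂ)‖ ^ 2) * (4 * ENNReal.ofReal A) := by gcongr
      _ = ENNReal.ofReal A := by
        rw [← mul_assoc, show (4:ENNReal) = ENNReal.ofReal 4 by simp, ← ENNReal.ofReal_mul (by positivity)]
        norm_num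
  have hdiff : ∀ n m, n ≤ m → N1 (fun z => x n z - x m z) ≤ ENNReal.ofReal
      (2 * ((e m).toReal - (e n).toReal) + 4 * (1 / (n + 1 : ℝ))) := by
    intro n m h
    have hp := En_par hB hone hone0 (hxS n).1 (hxS m).1
    have ha := hele n _ (hhalf n _ (hxS n) _ (hanti n m h (hxS m)))
    rw [hN1, En_smul] at ha
    rw [← hN1] at hp ha
    have b1 := hxe n
    have b2 := hxe m
    have f1 : N1 (x n) ≠ ⊤ := b1.ne_top
    have f2 : N1 (x m) ≠ ⊤ := b2.ne_top
    have f3 : N1 (fun z => x n z + x m z) ≠ ⊤ := by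
      have : N1 (fun z => x n z + x m z) + N1 (fun z => x n z - x m z) ≠ ⊤ := by
        rw [hp]; exact ENNReal.add_ne_top.2 ⟨ENNReal.mul_ne_top (by simp) f1, ENNReal.mul_ne_top (by simp) f2⟩
      exact (ENNReal.add_ne_top.1 this).1
    have f4 : N1 (fun z => x n z - x m z) ≠ ⊤ := by
      have : N1 (fun z => x n z + x m z) + N1 (fun z => x n z - x m z) ≠ ⊤ := by
        rw [hp]; exact ENNReal.add_ne_top.2 ⟨ENNReal.mul_ne_top (by simp) f1, ENNReal.mul_ne_top (by simp) f2⟩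
      exact (ENNReal.add_ne_top.1 this).2
    have r1 := congrArg ENNReal.toReal hp
    rw [ENNReal.toReal_add f3 f4, ENNReal.toReal_add (ENNReal.mul_ne_top (by simp) f1) (ENNReal.mul_ne_top (by simp) f2),
      ENNReal.toReal_mul, ENNReal.toReal_mul] at r1
    have r2 := (ENNReal.toReal_le_toReal (heft n) (ENNReal.mul_ne_top ENNReal.ofReal_ne_top f3)).2 ha
    rw [ENNReal.toReal_mul, ENNReal.toReal_ofReal (by positivity)] at r2
    have s1 := (ENNReal.toReal_le_toReal f1 (ENNReal.add_ne_top.2 ⟨heft n, ENNReal.ofReal_ne_top⟩)).2 b1.le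
    have s2 := (ENNReal.toReal_le_toReal f2 (ENNReal.add_ne_top.2 ⟨heft m, ENNReal.ofReal_ne_top⟩)).2 b2.le
    rw [ENNReal.toReal_add (heft _) ENNReal.ofReal_ne_top, ENNReal.toReal_ofReal (by positivity)] at s1 s2
    rw [← ENNReal.ofReal_toReal f4]
    refine ENNReal.ofReal_le_ofReal ?_
    have s3 : (1:ℝ) / (m + 1) ≤ 1 / (n + 1) := by
      have : (n:ℝ) ≤ m := by exact_mod_cast h
      gcongr
    norm_num at r1 r2 s1 s2 s3 ⊢
    linarith
  obtain ⟨G, hG, hGl⟩ := cauchy_lim (w := fun _ => 1) hB (lbd_of (Z := ∅) (D := B) ⟨empty_subset _, fun z _ => ⟨1, one_pos, by simp⟩⟩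
    (fun _ _ _ => ⟨1, one_pos, fun _ _ => le_rfl⟩) hB subset_rfl) (g := x) (fun n => (hxS n).1) (by
      intro ε hε
      have h1 : Tendsto (fun n : ℕ => 4 * (1 / (n + 1 : ℝ))) atTop (𝓝 0) := by
        simpa using tendsto_one_div_add_atTop_nhds_zero_nat.const_mul (4:ℝ)
      obtain ⟨N1', hN1'⟩ := Metric.cauchySeq_iff.1 hl.cauchySeq (ε/4) (by positivity)
      obtain ⟨N2, hN2⟩ := eventually_atTop.1 (h1.eventually_lt_const (u := ε/2) (by positivity))
      have main : ∀ n m, n ≤ m → max N1' N2 ≤ n → N1 (fun z => x n z - x m z) ≤ ENNReal.ofReal ε := by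
        intro n m hnm hn
        refine (hdiff n m hnm).trans (ENNReal.ofReal_le_ofReal ?_)
        have a1 := hN1' m (((le_max_left _ _).trans hn).trans hnm) n ((le_max_left _ _).trans hn)
        have a2 := hN2 n ((le_max_right _ _).trans hn)
        rw [Real.dist_eq] at a1
        have := (abs_lt.1 a1).2
        linarith
      refine ⟨max N1' N2, fun n hn m hm => ?_⟩
      rcases le_total n m with h | h
      · exact main n m h hn
      · have := main m n h hm
        refine le_trans (le_of_eq ?_) this
        simp only [hN1, En]
        refine lintegral_congr fun z => ?_
        rw [norm_sub_rev])
  have hpt : ∀ z ∈ B, Tendsto (fun n => x n z) atTop (𝓝 (G z)) := fun z hz => hGl.tendsto_at hz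
  refine ⟨G, hG, ?_, ?_⟩
  · have := hpt p hp
    simp only [fun n => (hxS n).2.1] at this
    exact tendsto_nhds_unique this tendsto_const_nhds
  · have hk : ∀ k, En B (w k) G ≤ ENNReal.ofReal A := by
      intro k
      refine En_lim hB (hwm k).aemeasurable (g := fun n => x (n + k)) (fun n => (hxS _).1)
        (fun z hz => (hpt z hz).comp (tendsto_add_atTop_nat k)) (e := fun _ => ENNReal.ofReal A) (fun n => ?_) tendsto_const_nhds
      exact (hanti k (n + k) (Nat.le_add_left _ _) (hxS _)).2.2
    calc En B W G = ∫⁻ z in B, liminf (fun n => ENNReal.ofReal (‖G z‖ ^ 2 * w n z)) atTop := by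
          refine lintegral_congr_ae ?_
          filter_upwards [hlim] with z hz
          exact (Tendsto.liminf_eq (ENNReal.tendsto_ofReal (hz.const_mul _))).symm
      _ ≤ liminf (fun n => En B (w n) G) atTop := lintegral_liminf_le' (fun n => En_meas hB (hwm n).aemeasurable hG)
      _ ≤ ENNReal.ofReal A := by
          refine (liminf_le_liminf (v := fun _ => ENNReal.ofReal A) (Eventually.of_forall hk)).trans ?_
          simp

lemma ot_lim {D : Set ℂ} {Φ : ℂ → EReal} (hΦ : Apx Φ D) {z₀ : ℂ} {R : ℝ} (hR : closedBall z₀ R ⊆ D) {p : ℂ}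
    (hp : p ∈ ball z₀ R) (hpb : Φ p ≠ ⊥) :
    ∃ x : ℂ → ℂ, DifferentiableOn ℂ x (ball z₀ R) ∧ x p = 1 ∧ En (ball z₀ R) (fun z => Real.exp (-(Φ z).toReal)) x ≤
      ENNReal.ofReal (8 * Real.pi * ((9 * R ^ 2 + 1) * Real.exp 1) * Real.exp (-(Φ p).toReal)) := by
  have hpi := Real.pi_pos
  obtain ⟨O, hO, hKO, hOD, M, -, v, hv, hvM, hlap, hle, hlim⟩ := hΦ.2.2 _ (isCompact_closedBall z₀ R) hR
  have hBO : ball z₀ R ⊆ O := ball_subset_closedBall.trans hKO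
  have hbb : ∀ m z, BddBelow (range fun k => Real.exp (-v (m + k) z)) := fun m z => ⟨0, by
    rintro _ ⟨k, rfl⟩; exact (Real.exp_pos _).le⟩
  refine komlos (w := fun m z => ⨅ k, Real.exp (-v (m + k) z)) (κ := Real.exp (-M)) isOpen_ball hp (Real.exp_pos _) ?_ ?_ ?_ ?_ ?_
  · exact fun m => Measurable.iInf fun k => (Real.continuous_exp.comp (hv _).continuous.neg).measurable
  · exact fun m z => le_ciInf fun k => Real.exp_le_exp.2 (by have := hvM (m + k) z; linarith)
  · intro m n h z
    refine le_ciInf fun k => ?_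
    refine (ciInf_le (hbb m z) (n - m + k)).trans (le_of_eq ?_)
    rw [show m + (n - m + k) = n + k by omega]
  · have h1 : ∀ᵐ z ∂(volume.restrict (ball z₀ R)), Φ z ≠ ⊥ := ae_restrict_of_ae_restrict_of_subset (hBO.trans hOD) hΦ.1
    filter_upwards [h1, ae_restrict_mem measurableSet_ball] with z hz hzB
    have hl : Tendsto (fun n => Real.exp (-v n z)) atTop (𝓝 (Real.exp (-(Φ z).toReal))) :=
      (Real.continuous_exp.tendsto _).comp (hlim z (hBO hzB) hz).neg
    rw [Metric.tendsto_atTop]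
    intro ε hε
    obtain ⟨N, hN⟩ := Metric.tendsto_atTop.1 hl (ε/2) (by positivity)
    refine ⟨N, fun n hn => ?_⟩
    rw [Real.dist_eq, abs_lt]
    constructor
    · have : Real.exp (-(Φ z).toReal) - ε/2 ≤ ⨅ k, Real.exp (-v (n + k) z) := le_ciInf fun k => by
        have := hN (n + k) (by omega)
        rw [Real.dist_eq, abs_lt] at this
        linarith [this.1]
      linarith
    · have := ciInf_le (hbb n z) 0
      have h2 := hN n hn
      rw [Real.dist_eq, abs_lt] at h2
      simp only [add_zero] at this
      linarith [h2.2]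
  · intro n
    obtain ⟨g, h1, h2, h3⟩ := ot_smooth hp (hv n) (fun z hz => hlap n z (hBO hz))
    refine ⟨g, h1, h2, ?_⟩
    refine (En_mono_w (w' := fun z => Real.exp (-v n z)) (fun z => ?_) g).trans (h3.trans (ENNReal.ofReal_le_ofReal ?_))
    · have := ciInf_le (hbb n z) 0
      simpa using this
    · have : (Φ p).toReal ≤ v n p := toReal_le_of hpb (hle n p (hBO hp))
      gcongr

end

section
open MeasureTheory Metric Complex Set Filter
open scoped ContDiff Topology

lemma log_q {D : Set ℂ} (hD : IsOpen D) {ψ : ℂ → EReal} (hψ : SubharmonicOnE ψ D) (hneg : ∀ z ∈ D, ψ z < 0)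
    {z₀ : ℂ} {r : ℝ} (hr : 0 < r) (hrD : closedBall z₀ r ⊆ D) (hz : ψ z₀ ≠ ⊥) {q : ℝ → ℝ}
    (hpos : ∀ t, 0 < t → 0 < q t) (hanti : ∀ s t, 0 < s → s ≤ t → q t ≤ q s) :
    ∫⁻ z in ball z₀ r, ENNReal.ofReal ((‖z - z₀‖ ^ 2)⁻¹ * q (-(ψ z).toReal)) = ⊤ := by
  by_contra hne
  set X := ∫⁻ z in ball z₀ r, ENNReal.ofReal ((‖z - z₀‖ ^ 2)⁻¹ * q (-(ψ z).toReal)) with hX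
  have hz0 : z₀ ∈ D := hrD (mem_closedBall_self hr.le)
  set T := -(ψ z₀).toReal with hT
  have eψ : ψ z₀ = (((ψ z₀).toReal : ℝ) : EReal) := (EReal.coe_toReal (hψ.2.1 z₀ hz0) hz).symm
  have hT0 : 0 < T := by
    have := hneg z₀ hz0
    rw [eψ] at this
    have h2 : (ψ z₀).toReal < 0 := by exact_mod_cast this
    simp only [hT]; linarith
  set K := closedBall z₀ r with hK
  have hKm : MeasurableSet K := measurableSet_closedBall
  have hM : ∀ z ∈ K, ψ z ≤ ((0:ℝ) : EReal) := fun z hz => (hneg z (hrD hz)).le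
  have hNN0 : NN K 0 ψ z₀ = ENNReal.ofReal T := by
    rw [NN, indicator_of_mem (mem_closedBall_self hr.le), eψ, nn_coe, hT]; simp
  set Q := q (2 * T) with hQ
  have hQ0 : 0 < Q := hpos _ (by positivity)
  have key : ∀ δ, 0 < δ → δ ≤ r → Q * (2 * Real.pi * Real.log (r / δ)) ≤ 2 * X.toReal := by
    intro δ hδ hδr
    have hAm : MeasurableSet {ζ : ℂ | δ ≤ ‖ζ‖ ∧ ‖ζ‖ < r} := by simpa using ann_meas 0 δ r
    set k : ℂ → ENNReal := {ζ : ℂ | δ ≤ ‖ζ‖ ∧ ‖ζ‖ < r}.indicator (fun ζ => ENNReal.ofReal ((‖ζ‖ ^ 2)⁻¹)) with hk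
    have hkm : Measurable k := Measurable.indicator (by fun_prop) hAm
    have hkint : ∫⁻ ζ, k ζ = ENNReal.ofReal (2 * Real.pi * Real.log (r / δ)) := by
      have := ann_int' 0 hδ hδr
      simp only [sub_zero] at this
      rw [hk, lintegral_indicator hAm, this]
    have hgm : Measurable (fun ζ => NN K 0 ψ (z₀ + ζ)) := (NN_meas hD hKm hrD hψ.1 0).comp (measurable_const_add z₀)
    have h1 := lintegral_radial_le (g := fun ζ => NN K 0 ψ (z₀ + ζ)) hgm hkm (fun z w h => by
        simp only [hk, indicator, mem_ofPred_eq, h]; congr) (A := ENNReal.ofReal T) (ε := r) (fun z hz => by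
        rw [hk, indicator_of_notMem]; intro h; exact absurd h.2 (not_lt.2 hz)) (fun s hs hsr => by
        have := NN_circle hD hKm hrD hψ hM (z := z₀) hs (closedBall_subset_closedBall hsr.le)
        rw [hNN0] at this
        simpa [circleMap] using this)
    have h2 : ∀ ζ, ENNReal.ofReal Q * k ζ ≤ (ball z₀ r).indicator (fun z => ENNReal.ofReal ((‖z - z₀‖ ^ 2)⁻¹ * q (-(ψ z).toReal))) (z₀ + ζ)
        + ENNReal.ofReal (Q / (2 * T)) * (k ζ * NN K 0 ψ (z₀ + ζ)) := by
      intro ζ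
      by_cases hζ : ζ ∈ {ζ : ℂ | δ ≤ ‖ζ‖ ∧ ‖ζ‖ < r}
      swap
      · rw [hk, indicator_of_notMem hζ]; simp
      have hzb : z₀ + ζ ∈ ball z₀ r := by simpa [dist_eq_norm] using hζ.2
      have hzK : z₀ + ζ ∈ K := ball_subset_closedBall hzb
      have hzD := hrD hzK
      have hNN : NN K 0 ψ (z₀ + ζ) = nn 0 (ψ (z₀ + ζ)) := by rw [NN, indicator_of_mem hzK]
      have hke : k ζ = ENNReal.ofReal ((‖ζ‖ ^ 2)⁻¹) := by rw [hk, indicator_of_mem hζ]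
      have hζ0 : 0 < ‖ζ‖ := hδ.trans_le hζ.1
      rw [indicator_of_mem hzb, hNN, hke]
      by_cases hb : ψ (z₀ + ζ) = ⊥
      · rw [hb, nn_bot, ENNReal.mul_top, ENNReal.mul_top]
        · simp
        · exact (ENNReal.ofReal_pos.2 (by positivity)).ne'
        · exact (ENNReal.ofReal_pos.2 (by positivity)).ne'
      have eψ' : ψ (z₀ + ζ) = (((ψ (z₀ + ζ)).toReal : ℝ) : EReal) := (EReal.coe_toReal (hψ.2.1 _ hzD) hb).symm
      set s := (ψ (z₀ + ζ)).toReal with hs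
      have hs0 : s < 0 := by
        have := hneg _ hzD
        rw [eψ'] at this; exact_mod_cast this
      rw [eψ', nn_coe, add_sub_cancel_left, zero_sub]
      by_cases hsT : -s ≤ 2 * T
      · refine le_trans ?_ le_self_add
        rw [← ENNReal.ofReal_mul hQ0.le]
        refine ENNReal.ofReal_le_ofReal ?_
        rw [mul_comm]
        gcongr
        exact hanti _ _ (by linarith) hsT
      · refine le_trans ?_ le_add_self
        rw [← ENNReal.ofReal_mul hQ0.le, ← ENNReal.ofReal_mul (by positivity), ← ENNReal.ofReal_mul (by positivity)]
        refine ENNReal.ofReal_le_ofReal ?_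
        push Not at hsT
        rw [mul_comm ((‖ζ‖ ^ 2)⁻¹) (-s), ← mul_assoc]
        gcongr
        rw [div_mul_eq_mul_div, le_div_iff₀ (by positivity)]
        gcongr
    have h3 := lintegral_mono (μ := (volume : Measure ℂ)) h2
    have hL : 0 ≤ Real.log (r / δ) := Real.log_nonneg (by rw [le_div_iff₀ hδ]; linarith)
    have hpi := Real.pi_pos
    have hkg : Measurable fun ζ => ENNReal.ofReal (Q / (2 * T)) * (k ζ * NN K 0 ψ (z₀ + ζ)) := (hkm.mul hgm).const_mul _
    rw [lintegral_const_mul' _ _ ENNReal.ofReal_ne_top, lintegral_add_right _ hkg,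
      lintegral_const_mul' _ _ ENNReal.ofReal_ne_top, hkint,
      lintegral_add_left_eq_self (μ := (volume : Measure ℂ)) ((ball z₀ r).indicator (fun z => ENNReal.ofReal ((‖z - z₀‖ ^ 2)⁻¹ * q (-(ψ z).toReal)))) z₀,
      lintegral_indicator measurableSet_ball, ← hX] at h3
    rw [hkint] at h1
    have h4 := h3.trans (add_le_add_right (mul_le_mul_right h1 (ENNReal.ofReal (Q / (2 * T)))) X)
    rw [← ENNReal.ofReal_mul hQ0.le, ← ENNReal.ofReal_mul (by positivity), ← ENNReal.ofReal_mul (by positivity),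
      ← ENNReal.ofReal_toReal hne, ← ENNReal.ofReal_add ENNReal.toReal_nonneg (by positivity),
      ENNReal.ofReal_le_ofReal_iff (by positivity)] at h4
    have e : Q / (2 * T) * (2 * Real.pi * Real.log (r / δ) * T) = Q * (2 * Real.pi * Real.log (r / δ)) / 2 := by
      field_simp
    linarith
  have h2 : Tendsto (fun N : ℕ => Q * (2 * Real.pi * N)) atTop atTop :=
    ((tendsto_natCast_atTop_atTop).const_mul_atTop (by positivity)).const_mul_atTop hQ0
  obtain ⟨N, hN⟩ := (h2.eventually_gt_atTop (2 * X.toReal)).exists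
  have := key (r * Real.exp (-N)) (by positivity) (by
    have : Real.exp (-N) ≤ 1 := Real.exp_le_one_iff.2 (by simp)
    nlinarith)
  have e : r / (r * Real.exp (-N)) = Real.exp N := by
    rw [Real.exp_neg]; field_simp
  rw [e, Real.log_exp] at this
  linarith

lemma factor_pow {U : Set ℂ} (hU : IsOpen U) {z₀ : ℂ} (hz : z₀ ∈ U) {h : ℂ → ℂ} (hh : DifferentiableOn ℂ h U) {l : ℕ}
    (hl : (l : ℕ∞) ≤ analyticOrderAt h z₀) : ∃ k : ℂ → ℂ, DifferentiableOn ℂ k U ∧ ∀ z ∈ U, h z = (z - z₀) ^ l * k z := by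
  classical
  have ha : AnalyticAt ℂ h z₀ := hh.analyticAt (hU.mem_nhds hz)
  obtain ⟨g, hg, he⟩ := (natCast_le_analyticOrderAt ha).1 hl
  set k : ℂ → ℂ := fun z => if z = z₀ then g z₀ else h z / (z - z₀) ^ l with hk
  have heq : ∀ᶠ z in 𝓝 z₀, k z = g z := by
    filter_upwards [he] with z hz
    by_cases hc : z = z₀
    · simp [hk, hc]
    · have : z - z₀ ≠ 0 := sub_ne_zero.2 hc
      simp only [hk, if_neg hc, hz, smul_eq_mul]; field_simp
  refine ⟨k, fun z hzU => ?_, fun z hzU => ?_⟩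
  · by_cases hc : z = z₀
    · subst hc
      exact (hg.differentiableAt.congr_of_eventuallyEq heq).differentiableWithinAt
    · have h1 : ∀ᶠ w in 𝓝 z, k w = h w / (w - z₀) ^ l := by
        filter_upwards [isOpen_ne.mem_nhds hc] with w hw
        simp only [hk, if_neg hw]
      have h2 : DifferentiableAt ℂ (fun w => h w / (w - z₀) ^ l) z :=
        (hh.differentiableAt (hU.mem_nhds hzU)).div (by fun_prop) (pow_ne_zero _ (sub_ne_zero.2 hc))
      exact (h2.congr_of_eventuallyEq h1).differentiableWithinAt
  · by_cases hc : z = z₀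
    · subst hc
      rw [he.self_of_nhds, heq.self_of_nhds, smul_eq_mul]
    · have : z - z₀ ≠ 0 := sub_ne_zero.2 hc
      simp only [hk, if_neg hc]; field_simp

end

section
open MeasureTheory Metric Complex Set Filter
open scoped ContDiff Topology

/-- If a holomorphic germ `h` with finite weighted norm has order at most that of `g`, then `g` is in the ideal. -/
lemma dom_int {D : Set ℂ} (hD : IsOpen D) {Φ : ℂ → EReal} (hΦ : Apx Φ D) {z₀ : ℂ} (hz : z₀ ∈ D) {g h : ℂ → ℂ}
    (hg : AnalyticAt ℂ g z₀) (hh : AnalyticAt ℂ h z₀) {R : ℝ} (hR : 0 < R)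
    (hE : En (ball z₀ R) (fun z => Real.exp (-(Φ z).toReal)) h ≠ ⊤)
    (hord : analyticOrderAt h z₀ ≤ analyticOrderAt g z₀) :
    ∃ r > 0, IntegrableOn (fun z => ‖g z‖ ^ 2 * Real.exp (-(Φ z).toReal)) (ball z₀ r) := by
  -- g is bounded by a multiple of h near the point
  obtain ⟨C, hC, hb⟩ : ∃ C : ℝ, 0 ≤ C ∧ ∀ᶠ z in 𝓝 z₀, ‖g z‖ ≤ C * ‖h z‖ := by
    by_cases ht : analyticOrderAt h z₀ = ⊤
    · rw [ht, top_le_iff, analyticOrderAt_eq_top] at hord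
      refine ⟨0, le_rfl, ?_⟩
      filter_upwards [hord] with z hz
      simp [hz]
    · obtain ⟨n, hn⟩ := ENat.ne_top_iff_exists.1 ht
      rw [← hn] at hord
      obtain ⟨k, hk, hke⟩ := (natCast_le_analyticOrderAt hg).1 hord
      obtain ⟨k', hk', hk0, hke'⟩ := (hh.analyticOrderAt_eq_natCast).1 hn.symm
      have h0 : 0 < ‖k' z₀‖ := norm_pos_iff.2 hk0
      have b1 := hk.continuousAt.norm.eventually_lt_const (u := ‖k z₀‖ + 1) (by linarith)
      have b2 := hk'.continuousAt.norm.eventually_const_lt (u := ‖k' z₀‖ / 2) (by linarith)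
      refine ⟨(‖k z₀‖ + 1) / (‖k' z₀‖ / 2), by positivity, ?_⟩
      filter_upwards [hke, hke', b1, b2] with z e1 e2 l1 l2
      rw [e1, e2, norm_smul, norm_smul, mul_left_comm]
      gcongr
      rw [div_mul_eq_mul_div, le_div_iff₀ (by positivity)]
      gcongr
  have hga : ∀ᶠ z in 𝓝 z₀, AnalyticAt ℂ g z := hg.eventually_analyticAt
  obtain ⟨r, hr, hall⟩ := Metric.eventually_nhds_iff_ball.1 ((hb.and hga).and ((hD.mem_nhds hz) : ∀ᶠ z in 𝓝 z₀, z ∈ D))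
  refine ⟨min r R, by positivity, ?_⟩
  set B := ball z₀ (min r R) with hB
  have hBr : B ⊆ ball z₀ r := ball_subset_ball (min_le_left _ _)
  have hBR : B ⊆ ball z₀ R := ball_subset_ball (min_le_right _ _)
  have hgm : AEMeasurable g (volume.restrict B) :=
    ContinuousOn.aemeasurable (fun z hz => (hall z (hBr hz)).1.2.continuousAt.continuousWithinAt) measurableSet_ball
  have hΦm : AEMeasurable (fun z => (Φ z).toReal) (volume.restrict B) :=
    (hΦ.aemD hD).mono_measure (Measure.restrict_mono (fun z hz => (hall z (hBr hz)).2) le_rfl)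
  have hm : AEMeasurable (fun z => ‖g z‖ ^ 2 * Real.exp (-(Φ z).toReal)) (volume.restrict B) :=
    (hgm.norm.pow_const 2).mul (Real.measurable_exp.comp_aemeasurable hΦm.neg)
  refine (lintegral_ofReal_ne_top_iff_integrable hm.aestronglyMeasurable (Eventually.of_forall fun z => by
    simp only [Pi.zero_apply]; positivity)).1 ?_
  have : ∫⁻ z in B, ENNReal.ofReal (‖g z‖ ^ 2 * Real.exp (-(Φ z).toReal)) ≤
      ENNReal.ofReal (C ^ 2) * En (ball z₀ R) (fun z => Real.exp (-(Φ z).toReal)) h := by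
    refine le_trans ?_ (mul_le_mul_right (En_mono hBR _ _) _)
    rw [En, ← lintegral_const_mul' _ _ ENNReal.ofReal_ne_top]
    refine setLIntegral_mono_ae' measurableSet_ball (Eventually.of_forall fun z hz => ?_)
    rw [← ENNReal.ofReal_mul (by positivity)]
    refine ENNReal.ofReal_le_ofReal ?_
    rw [← mul_assoc, ← mul_pow]
    have := (hall z (hBr hz)).1.1
    gcongr
  exact ne_top_of_le_ne_top (ENNReal.mul_ne_top ENNReal.ofReal_ne_top hE) this

lemma patho {D : Set ℂ} (hD : IsOpen D) {ψ : ℂ → EReal} (hψ : SubharmonicOnE ψ D) (hneg : ∀ z ∈ D, ψ z < 0)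
    (hψb : ∀ᵐ z ∂(volume.restrict D), ψ z ≠ ⊥) {Φ : ℂ → EReal} (hΦ : Apx Φ D) {z₀ : ℂ} (hz0 : z₀ ∈ D) (hz : ψ z₀ ≠ ⊥) {q : ℝ → ℝ}
    (hpos : ∀ t, 0 < t → 0 < q t) (hanti : ∀ s t, 0 < s → s ≤ t → q t ≤ q s) {g : ℂ → ℂ} (hg : AnalyticAt ℂ g z₀)
    {r₀ : ℝ} (hr₀ : 0 < r₀)
    (hE : ∫⁻ z in ball z₀ r₀, ENNReal.ofReal (‖g z‖ ^ 2 * (Real.exp (-(Φ z).toReal) * q (-(ψ z).toReal))) ≠ ⊤) :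
    ∃ r > 0, IntegrableOn (fun z => ‖g z‖ ^ 2 * Real.exp (-(Φ z).toReal)) (ball z₀ r) := by
  by_contra hno
  have hpi := Real.pi_pos
  obtain ⟨R, hR, hRD⟩ : ∃ R > 0, closedBall z₀ R ⊆ D := Metric.nhds_basis_closedBall.mem_iff.1 (hD.mem_nhds hz0)
  set Ω := ball z₀ R with hΩ
  set w : ℂ → ℝ := fun z => Real.exp (-(Φ z).toReal) with hw
  have hgt : ∀ h : ℂ → ℂ, DifferentiableOn ℂ h Ω → En Ω w h ≠ ⊤ → analyticOrderAt g z₀ < analyticOrderAt h z₀ := by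
    intro h hh hE
    by_contra hlt
    push Not at hlt
    exact hno (dom_int hD hΦ hz0 hg (hh.analyticAt (isOpen_ball.mem_nhds (mem_ball_self hR))) hR hE hlt)
  -- order of g is finite
  have hgo : analyticOrderAt g z₀ ≠ ⊤ := by
    intro h
    have := hgt (fun _ => 0) (differentiableOn_const 0) (by simp [En])
    rw [h] at this
    exact not_top_lt this
  obtain ⟨j, hj⟩ := ENat.ne_top_iff_exists.1 hgo
  obtain ⟨k, hk, hk0, hke⟩ := (hg.analyticOrderAt_eq_natCast).1 hj.symm
  -- the bound of the weight from below
  obtain ⟨O, hO, hKO, hOD, M, -, v, hv, hvM, hlap, hle, hlim⟩ := hΦ.2.2 _ (isCompact_closedBall z₀ R) hRD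
  set r := R / 5 with hr
  have hr0 : 0 < r := by positivity
  have hw0 : ∀ z ∈ Ω, Real.exp (-(max M 0)) ≤ w z := by
    intro z hz
    refine Real.exp_le_exp.2 (neg_le_neg ?_)
    by_cases hb : Φ z = ⊥
    · rw [hb]; simp
    · exact (toReal_le_of hb ((hle 0 z (hKO (ball_subset_closedBall hz))).trans (EReal.coe_le_coe_iff.2 (hvM 0 z)))).trans (le_max_left _ _)
  have h4 : closedBall z₀ (4 * r) ⊆ Ω := fun z hz => by
    rw [hΩ, mem_ball]; rw [mem_closedBall] at hz; rw [hr] at hz; linarith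
  obtain ⟨C, hC, hCb⟩ := lbd_ball (Ω := Ω) (w := fun z => ‖z - z₀‖ ^ (2 * (j + 1)) * w z) (z := z₀) (r := r)
    (m := r ^ (2 * (j + 1)) * Real.exp (-(max M 0))) hr0 (by positivity) h4 (fun x hx => by
      have h1 : r ≤ ‖x - z₀‖ := by
        have := hx.2
        rw [mem_ball, not_lt, dist_eq_norm] at this; exact this
      have := hw0 x (h4 hx.1)
      gcongr)
  set C1 := 8 * Real.pi * ((9 * R ^ 2 + 1) * Real.exp 1) with hC1
  have hC1p : 0 < C1 := by positivity
  have hlow : ∀ p ∈ ball z₀ (2 * r), p ≠ z₀ → Φ p ≠ ⊥ → (C * C1)⁻¹ * (‖p - z₀‖ ^ (2 * (j + 1)))⁻¹ ≤ w p := by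
    intro p hp hpz hpb
    have hpΩ : p ∈ Ω := ball_subset_ball (by rw [hr]; linarith) hp
    obtain ⟨x, hx, hx1, hxE⟩ := ot_lim hΦ hRD hpΩ hpb
    have ho := hgt x hx (ne_top_of_le_ne_top ENNReal.ofReal_ne_top hxE)
    rw [← hj] at ho
    have ho' : ((j + 1 : ℕ) : ℕ∞) ≤ analyticOrderAt x z₀ := by
      push_cast; exact Order.add_one_le_of_lt ho
    obtain ⟨y, hy, hxy⟩ := factor_pow isOpen_ball (mem_ball_self hR) hx ho'
    have e1 : En Ω (fun z => ‖z - z₀‖ ^ (2 * (j + 1)) * w z) y = En Ω w x := by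
      refine lintegral_congr_ae ?_
      filter_upwards [ae_restrict_mem measurableSet_ball] with z hz
      rw [hxy z hz, norm_mul, norm_pow]
      congr 1; ring
    have h1 := hCb y hy p hp
    rw [e1] at h1
    have h2 := h1.trans (mul_le_mul_right hxE _)
    rw [← ENNReal.ofReal_mul hC.le, ENNReal.ofReal_le_ofReal_iff (by positivity)] at h2
    have hn : 0 < ‖p - z₀‖ := norm_pos_iff.2 (sub_ne_zero.2 hpz)
    have h3 : ‖y p‖ ^ 2 = (‖p - z₀‖ ^ (2 * (j + 1)))⁻¹ := by
      have := hxy p hpΩ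
      rw [hx1] at this
      have h5 := congrArg norm this
      rw [norm_mul, norm_pow, norm_one] at h5
      rw [eq_comm, inv_eq_iff_eq_inv, eq_comm, inv_eq_of_mul_eq_one_right]
      calc _ = (‖p - z₀‖ ^ (j + 1) * ‖y p‖) ^ 2 := by ring
        _ = 1 := by rw [← h5]; norm_num
    rw [h3] at h2
    rw [inv_mul_le_iff₀ (by positivity)]
    calc _ ≤ _ := h2
      _ = _ := by ring
  have h0 : 0 < ‖k z₀‖ := norm_pos_iff.2 hk0
  have b2 := hk.continuousAt.norm.eventually_const_lt (u := ‖k z₀‖ / 2) (by linarith)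
  obtain ⟨s, hs, hsb⟩ := Metric.eventually_nhds_iff_ball.1 (hke.and b2)
  set ρ := min (min s (2 * r)) r₀ with hρ
  have hρ0 : 0 < ρ := by positivity
  have hρs : ball z₀ ρ ⊆ ball z₀ s := ball_subset_ball ((min_le_left _ _).trans (min_le_left _ _))
  have hρr : ball z₀ ρ ⊆ ball z₀ (2 * r) := ball_subset_ball ((min_le_left _ _).trans (min_le_right _ _))
  have hρr₀ : ball z₀ ρ ⊆ ball z₀ r₀ := ball_subset_ball (min_le_right _ _)
  have hρR : ρ ≤ R := ((min_le_left _ _).trans (min_le_right _ _)).trans (by rw [hr]; linarith)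
  have hρD : closedBall z₀ ρ ⊆ D := (closedBall_subset_closedBall hρR).trans hRD
  have hfin := log_q hD hψ hneg hρ0 hρD hz hpos hanti
  set c3 := (‖k z₀‖ / 2) ^ 2 * (C * C1)⁻¹ with hc3
  have hc3p : 0 < c3 := by positivity
  have hcmp : ENNReal.ofReal c3 * ∫⁻ z in ball z₀ ρ, ENNReal.ofReal ((‖z - z₀‖ ^ 2)⁻¹ * q (-(ψ z).toReal)) ≤
      ∫⁻ z in ball z₀ r₀, ENNReal.ofReal (‖g z‖ ^ 2 * (Real.exp (-(Φ z).toReal) * q (-(ψ z).toReal))) := by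
    refine le_trans ?_ (lintegral_mono_set hρr₀)
    rw [← lintegral_const_mul' _ _ ENNReal.ofReal_ne_top]
    have hne : ∀ᵐ z ∂(volume.restrict (ball z₀ ρ)), z ≠ z₀ := ae_restrict_of_ae (by simp [ae_iff])
    have hb : ∀ᵐ z ∂(volume.restrict (ball z₀ ρ)), Φ z ≠ ⊥ :=
      ae_restrict_of_ae_restrict_of_subset (ball_subset_closedBall.trans hρD) hΦ.1
    have hb' : ∀ᵐ z ∂(volume.restrict (ball z₀ ρ)), ψ z ≠ ⊥ :=
      ae_restrict_of_ae_restrict_of_subset (ball_subset_closedBall.trans hρD) hψb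
    refine lintegral_mono_ae ?_
    filter_upwards [hne, hb, hb', ae_restrict_mem measurableSet_ball] with z hz1 hz2 hz3 hz4
    rw [← ENNReal.ofReal_mul hc3p.le]
    refine ENNReal.ofReal_le_ofReal ?_
    have hzD : z ∈ D := hρD (ball_subset_closedBall hz4)
    have hq : 0 < q (-(ψ z).toReal) := by
      refine hpos _ ?_
      have := toReal_lt_of hz3 (a := 0) (hneg z hzD)
      linarith
    have hn : 0 < ‖z - z₀‖ := norm_pos_iff.2 (sub_ne_zero.2 hz1)
    have l1 := hlow z (hρr hz4) hz1 hz2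
    obtain ⟨e, l2⟩ := hsb z (hρs hz4)
    rw [e, norm_smul, norm_pow, ← mul_assoc, ← mul_assoc]
    refine mul_le_mul_of_nonneg_right ?_ hq.le
    calc c3 * (‖z - z₀‖ ^ 2)⁻¹ = (‖z - z₀‖ ^ j * (‖k z₀‖ / 2)) ^ 2 * ((C * C1)⁻¹ * (‖z - z₀‖ ^ (2 * (j + 1)))⁻¹) := by
          rw [hc3]; field_simp; ring
      _ ≤ _ := by gcongr
  rw [hfin, ENNReal.mul_top (ENNReal.ofReal_pos.2 hc3p).ne'] at hcmp
  exact hE (top_le_iff.1 hcmp)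

end

section
open MeasureTheory Metric Complex Set Filter
open scoped ContDiff Topology

/-- sublevel set -/
def Dt (D : Set ℂ) (ψ : ℂ → EReal) (t : ℝ) : Set ℂ := {z | z ∈ D ∧ ψ z < ((-t : ℝ) : EReal)}

/-- standing assumptions in the main case -/
structure Ctx (D : Set ℂ) (ψ Φ : ℂ → EReal) (q : ℝ → ℝ) (w : ℂ → ℝ) (z₀ : ℂ) (f : ℂ → ℂ)
    (Fz : (ℂ → ℂ) → Prop) (Gm : ℝ → ENNReal) (a b : ℝ) : Prop where
  hD : IsOpen D
  hc : IsConnected D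
  hψ : SubharmonicOnE ψ D
  hψA : Apx ψ D
  hneg : ∀ z ∈ D, ψ z < 0
  hΦ : Apx Φ D
  hz0 : z₀ ∈ D
  hzb : ψ z₀ = ⊥
  hqm : Measurable q
  hpos : ∀ t, 0 < t → 0 < q t
  hanti : ∀ s t, 0 < s → s ≤ t → q t ≤ q s
  hint : IntegrableOn q (Ioi 0)
  hwq : ∀ᵐ z ∂(volume.restrict D), w z = Real.exp (-(Φ z).toReal) * q (-(ψ z).toReal)
  hwm : AEMeasurable w (volume.restrict D)
  hL : ∀ Ω, IsOpen Ω → Ω ⊆ D → LBd Ω w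
  hI : IsIdealAt Fz z₀
  hInt : ∀ g, AnalyticAt ℂ g z₀ → (∃ r > 0, IntegrableOn
    (fun z => ‖g z‖ ^ 2 * Real.exp (-(Φ z).toReal)) (ball z₀ r)) → Fz g
  hloc : ∀ z ∈ D, ψ z = ⊥ ∨ ∃ r > 0, ∃ m > 0, ball z r ⊆ D ∧ ∀ x ∈ ball z r, m ≤ w x
  hf : ¬ Fz f
  hlow : ∀ t, 0 ≤ t → ∀ g, Adm (Dt D ψ t) f Fz g → Gm t ≤ En (Dt D ψ t) w g
  happ : ∀ t, 0 ≤ t → Gm t ≠ ⊤ → ∀ ε : ℝ, 0 < ε → ∃ g, Adm (Dt D ψ t) f Fz g ∧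
    En (Dt D ψ t) w g ≤ Gm t + ENNReal.ofReal ε
  hlin : ∀ t, 0 < t → Gm t = ENNReal.ofReal (a * (∫ s in Ioi t, q s) + b)

namespace Ctx
variable {D : Set ℂ} {ψ Φ : ℂ → EReal} {q : ℝ → ℝ} {w : ℂ → ℝ} {z₀ : ℂ} {f : ℂ → ℂ}
    {Fz : (ℂ → ℂ) → Prop} {Gm : ℝ → ENNReal} {a b : ℝ}

lemma dt_sub (t : ℝ) : Dt D ψ t ⊆ D := fun _ h => h.1

lemma dt_mono {s t : ℝ} (h : s ≤ t) : Dt D ψ t ⊆ Dt D ψ s := fun _ hz =>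
  ⟨hz.1, hz.2.trans_le (by exact_mod_cast neg_le_neg h)⟩

lemma dt_zero (C : Ctx D ψ Φ q w z₀ f Fz Gm a b) : Dt D ψ 0 = D := by
  ext z; exact ⟨fun h => h.1, fun h => ⟨h, by simpa using C.hneg z h⟩⟩

lemma dt_open (C : Ctx D ψ Φ q w z₀ f Fz Gm a b) (t : ℝ) : IsOpen (Dt D ψ t) :=
  usc_open C.hD C.hψ.1 _

lemma z0_mem (C : Ctx D ψ Φ q w z₀ f Fz Gm a b) (t : ℝ) : z₀ ∈ Dt D ψ t :=
  ⟨C.hz0, by rw [C.hzb]; exact EReal.bot_lt_coe _⟩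

lemma res {P : ℂ → Prop} {Ω : Set ℂ} (h : ∀ᵐ z ∂(volume.restrict D), P z) (hs : Ω ⊆ D) :
    ∀ᵐ z ∂(volume.restrict Ω), P z := ae_restrict_of_ae_restrict_of_subset hs h

lemma wm (C : Ctx D ψ Φ q w z₀ f Fz Gm a b) {Ω : Set ℂ} (hs : Ω ⊆ D) :
    AEMeasurable w (volume.restrict Ω) := C.hwm.mono_measure (Measure.restrict_mono hs le_rfl)

lemma tpos (C : Ctx D ψ Φ q w z₀ f Fz Gm a b) :
    ∀ᵐ z ∂(volume.restrict D), 0 < -(ψ z).toReal := by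
  filter_upwards [C.hψA.1, ae_restrict_mem C.hD.measurableSet] with z hz hzD
  have := toReal_lt_of hz (a := 0) (by simpa using C.hneg z hzD)
  linarith

lemma w0 (C : Ctx D ψ Φ q w z₀ f Fz Gm a b) {Ω : Set ℂ} (hs : Ω ⊆ D) :
    ∀ᵐ z ∂(volume.restrict Ω), 0 < w z := by
  refine res ?_ hs
  filter_upwards [C.hwq, C.tpos] with z h1 h2
  rw [h1]; exact mul_pos (Real.exp_pos _) (C.hpos _ h2)

lemma minimizer (C : Ctx D ψ Φ q w z₀ f Fz Gm a b) {t : ℝ} (ht : 0 ≤ t) (hG : Gm t ≠ ⊤) :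
    ∃ F, Adm (Dt D ψ t) f Fz F ∧ En (Dt D ψ t) w F = Gm t :=
  min_exists (C.dt_open t) (C.wm (dt_sub t)) (C.w0 (dt_sub t)) (C.hL _ (C.dt_open t) (dt_sub t)) C.hI
    (C.z0_mem t) hG (C.hlow t ht) (C.happ t ht hG)

lemma nz (C : Ctx D ψ Φ q w z₀ f Fz Gm a b) {Ω : Set ℂ} {F : ℂ → ℂ} (h : Adm Ω f Fz F) :
    ¬ (F =ᶠ[𝓝 z₀] fun _ => 0) := by
  intro h0
  apply C.hf
  refine C.hI.1 _ _ ?_ (Fz_mulc C.hI h.2 (-1))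
  filter_upwards [h0] with z hz
  rw [hz]; ring

lemma Gm_pos (C : Ctx D ψ Φ q w z₀ f Fz Gm a b) {t : ℝ} (ht : 0 ≤ t) : 0 < Gm t := by
  rw [pos_iff_ne_zero]
  intro h0
  obtain ⟨F, hF, hE⟩ := C.minimizer ht (by rw [h0]; simp)
  refine C.nz hF ?_
  have := (C.hL _ (C.dt_open t) (dt_sub t)).eq_zero hF.1 (hE.trans h0)
  filter_upwards [(C.dt_open t).mem_nhds (C.z0_mem t)] with z hz using this z hz

lemma Gm_anti (C : Ctx D ψ Φ q w z₀ f Fz Gm a b) {s t : ℝ} (hs : 0 ≤ s) (h : s ≤ t) : Gm t ≤ Gm s := by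
  by_cases ht : Gm s = ⊤
  · rw [ht]; exact le_top
  obtain ⟨F, hF, hE⟩ := C.minimizer hs ht
  rw [← hE]
  exact (C.hlow t (hs.trans h) F ⟨hF.1.mono (dt_mono h), hF.2⟩).trans (En_mono (dt_mono h) _ _)

lemma hint' (C : Ctx D ψ Φ q w z₀ f Fz Gm a b) {s : ℝ} (hs : 0 ≤ s) : IntegrableOn q (Ioi s) :=
  C.hint.mono_set (Ioi_subset_Ioi hs)

lemma hsplit (C : Ctx D ψ Φ q w z₀ f Fz Gm a b) {s t : ℝ} (hs : 0 ≤ s) (h : s ≤ t) :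
    ∫ x in Ioi s, q x = (∫ x in Ioc s t, q x) + ∫ x in Ioi t, q x := by
  rw [← setIntegral_union (Ioc_disjoint_Ioi le_rfl) measurableSet_Ioi
    ((C.hint' hs).mono_set Ioc_subset_Ioi_self) (C.hint' (hs.trans h)), Ioc_union_Ioi_eq_Ioi h]

lemma gpos (C : Ctx D ψ Φ q w z₀ f Fz Gm a b) {t : ℝ} (ht : 0 < t) : 0 < a * (∫ s in Ioi t, q s) + b := by
  have := C.Gm_pos ht.le
  rw [C.hlin t ht] at this
  exact ENNReal.ofReal_pos.1 this

lemma ioc_le (C : Ctx D ψ Φ q w z₀ f Fz Gm a b) {s t M : ℝ} (hs : 0 ≤ s) (h : s ≤ t)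
    (hM : ∀ x, s < x → q x ≤ M) : ∫ x in Ioc s t, q x ≤ M * (t - s) := by
  have := setIntegral_mono_on ((C.hint' hs).mono_set Ioc_subset_Ioi_self)
    (integrableOn_const (C := M) (s := Ioc s t) (μ := volume) (by simp)) measurableSet_Ioc (fun x hx => hM x hx.1)
  refine this.trans (le_of_eq ?_)
  simp [h]; ring

lemma le_ioc (C : Ctx D ψ Φ q w z₀ f Fz Gm a b) {s t : ℝ} (hs : 0 ≤ s) (h : s ≤ t) :
    q t * (t - s) ≤ ∫ x in Ioc s t, q x := by
  have := setIntegral_mono_on (integrableOn_const (C := q t) (s := Ioc s t) (μ := volume) (by simp))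
    ((C.hint' hs).mono_set Ioc_subset_Ioi_self) measurableSet_Ioc
    (fun x hx => C.hanti x t (hs.trans_lt hx.1) hx.2)
  refine le_trans (le_of_eq ?_) this
  simp [h]; ring

lemma ha (C : Ctx D ψ Φ q w z₀ f Fz Gm a b) : 0 ≤ a := by
  have h1 := C.Gm_anti (s := 1) (t := 2) (by norm_num) (by norm_num)
  rw [C.hlin 1 one_pos, C.hlin 2 two_pos, ENNReal.ofReal_le_ofReal_iff (C.gpos one_pos).le,
    C.hsplit (s := 1) (t := 2) (by norm_num) (by norm_num)] at h1
  have h2 := C.le_ioc (s := 1) (t := 2) (by norm_num) (by norm_num)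
  have h3 := C.hpos 2 two_pos
  by_contra hn
  push Not at hn
  nlinarith

lemma Gm_fin (C : Ctx D ψ Φ q w z₀ f Fz Gm a b) {t : ℝ} (ht : 0 < t) : Gm t ≠ ⊤ := by
  rw [C.hlin t ht]; simp

lemma gsplit (C : Ctx D ψ Φ q w z₀ f Fz Gm a b) {s t : ℝ} (hs : 0 < s) (h : s ≤ t) :
    Gm s = ENNReal.ofReal (a * ∫ x in Ioc s t, q x) + Gm t := by
  have h0 : 0 ≤ ∫ x in Ioc s t, q x := setIntegral_nonneg measurableSet_Ioc
    fun x hx => (C.hpos x (hs.trans hx.1)).le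
  rw [C.hlin s hs, C.hlin t (hs.trans_le h), C.hsplit hs.le h,
    ← ENNReal.ofReal_add (mul_nonneg C.ha h0) (C.gpos (hs.trans_le h)).le]
  congr 1; ring

end Ctx

end

section
open MeasureTheory Metric Complex Set Filter
open scoped ContDiff Topology

namespace Ctx
variable {D : Set ℂ} {ψ Φ : ℂ → EReal} {q : ℝ → ℝ} {w : ℂ → ℝ} {z₀ : ℂ} {f : ℂ → ℂ}
    {Fz : (ℂ → ℂ) → Prop} {Gm : ℝ → ENNReal} {a b : ℝ}

lemma rlim (C : Ctx D ψ Φ q w z₀ f Fz Gm a b) {t0 : ℝ} (ht : 0 < t0) :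
    ∃ L : ℝ, 0 < L ∧ Tendsto q (𝓝[>] t0) (𝓝 L) ∧ ∀ s, t0 < s → q s ≤ L := by
  have hbd : BddAbove (q '' Ioi t0) := ⟨q t0, by
    rintro _ ⟨s, hs, rfl⟩; exact C.hanti t0 s ht (le_of_lt hs)⟩
  have han : AntitoneOn q (Ioi t0) := fun s hs t _ h => C.hanti s t (ht.trans hs) h
  have hle : ∀ s, t0 < s → q s ≤ sSup (q '' Ioi t0) := fun s hs => le_csSup hbd ⟨s, hs, rfl⟩
  exact ⟨_, (C.hpos (t0+1) (by linarith)).trans_le (hle (t0+1) (by linarith)),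
    han.tendsto_nhdsGT hbd, hle⟩

lemma minimizer' (C : Ctx D ψ Φ q w z₀ f Fz Gm a b) {t : ℝ} (ht : 0 ≤ t) (hG : Gm t ≠ ⊤) :
    ∃ F, Adm (Dt D ψ t) f Fz F ∧ En (Dt D ψ t) w F = Gm t ∧ ∀ z ∉ Dt D ψ t, F z = 0 := by
  obtain ⟨F, hF, hE⟩ := C.minimizer ht hG
  have e : ∀ z ∈ Dt D ψ t, (Dt D ψ t).indicator F z = F z := fun z hz => indicator_of_mem hz _
  refine ⟨(Dt D ψ t).indicator F, ⟨hF.1.congr e, ?_⟩, ?_, fun z hz => indicator_of_notMem hz _⟩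
  · refine C.hI.1 _ _ ?_ hF.2
    filter_upwards [(C.dt_open t).mem_nhds (C.z0_mem t)] with z hz
    rw [e z hz]
  · rw [← hE]; exact En_congr (C.dt_open t) e

lemma fphim (C : Ctx D ψ Φ q w z₀ f Fz Gm a b) {Ω A : Set ℂ} (hΩ : IsOpen Ω) (hs : Ω ⊆ D) {F : ℂ → ℂ}
    (hF : DifferentiableOn ℂ F Ω) (hA : A ⊆ Ω) :
    AEStronglyMeasurable (fun z => ‖F z‖ ^ 2 * Real.exp (-(Φ z).toReal)) (volume.restrict A) := by
  have h1 : AEMeasurable F (volume.restrict Ω) := hF.continuousOn.aemeasurable hΩ.measurableSet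
  have h2 : AEMeasurable (fun z => (Φ z).toReal) (volume.restrict Ω) :=
    (C.hΦ.aemD C.hD).mono_measure (Measure.restrict_mono hs le_rfl)
  exact ((((h1.norm.pow_const 2).mul (Real.measurable_exp.comp_aemeasurable h2.neg))).mono_measure
    (Measure.restrict_mono hA le_rfl)).aestronglyMeasurable

lemma ann (C : Ctx D ψ Φ q w z₀ f Fz Gm a b) {t0 L : ℝ} (ht : 0 < t0) (hL : ∀ s, t0 < s → q s ≤ L)
    {F : ℂ → ℂ} (hF : Adm (Dt D ψ t0) f Fz F) (hE : En (Dt D ψ t0) w F = Gm t0) {B : ℝ} (hB : 0 < B) :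
    IntegrableOn (fun z => ‖F z‖ ^ 2 * Real.exp (-(Φ z).toReal))
      {z | z ∈ D ∧ ((-t0-B:ℝ):EReal) ≤ ψ z ∧ ψ z < ((-t0:ℝ):EReal)} ∧
    ∫ z in {z | z ∈ D ∧ ((-t0-B:ℝ):EReal) ≤ ψ z ∧ ψ z < ((-t0:ℝ):EReal)},
      ‖F z‖ ^ 2 * Real.exp (-(Φ z).toReal) ≤ a * B * L / q (t0 + B) := by
  set A := {z | z ∈ D ∧ ((-t0-B:ℝ):EReal) ≤ ψ z ∧ ψ z < ((-t0:ℝ):EReal)} with hA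
  have hsub : A ⊆ Dt D ψ t0 := fun z hz => ⟨hz.1, hz.2.2⟩
  have hAeq : A = Dt D ψ t0 \ Dt D ψ (t0 + B) := by
    ext z
    simp only [hA, Dt, mem_ofPred_eq, Set.mem_sdiff, not_and, not_lt]
    rw [show (-(t0+B)) = -t0 - B by ring]
    exact ⟨fun h => ⟨⟨h.1, h.2.2⟩, fun _ => h.2.1⟩, fun h => ⟨h.1.1, h.2 h.1.1, h.1.2⟩⟩
  have hAm : MeasurableSet A := by
    rw [hAeq]; exact (C.dt_open _).measurableSet.diff (C.dt_open _).measurableSet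
  have hq := C.hpos (t0 + B) (by linarith)
  have h1 : En A w F ≤ ENNReal.ofReal (a * ∫ x in Ioc t0 (t0+B), q x) := by
    have e : En (Dt D ψ t0) w F = En A w F + En (Dt D ψ (t0+B)) w F := by
      rw [En, ← lintegral_inter_add_sdiff _ _ (C.dt_open (t0+B)).measurableSet, ← hAeq, add_comm,
        inter_eq_self_of_subset_right (dt_mono (by linarith))]; rfl
    have l := C.hlow (t0+B) (by linarith) F ⟨hF.1.mono (dt_mono (by linarith)), hF.2⟩
    have g := C.gsplit (t := t0 + B) ht (by linarith)
    rw [← hE, e] at g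
    have := (add_le_add_right l (En A w F)).trans_eq g
    exact (ENNReal.add_le_add_iff_right (C.Gm_fin (by linarith))).1 this
  have h2 : a * ∫ x in Ioc t0 (t0+B), q x ≤ a * B * L := by
    have := mul_le_mul_of_nonneg_left (C.ioc_le (t := t0 + B) ht.le (by linarith) hL) C.ha
    nlinarith
  have h3 : ∫⁻ z in A, ENNReal.ofReal (‖F z‖ ^ 2 * Real.exp (-(Φ z).toReal)) ≤
      ENNReal.ofReal (a * B * L / q (t0 + B)) := by
    rw [div_eq_inv_mul, ENNReal.ofReal_mul (by positivity)]
    refine le_trans ?_ (mul_le_mul_right (h1.trans (ENNReal.ofReal_le_ofReal h2)) _)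
    unfold En
    rw [← lintegral_const_mul' _ _ (by simp)]
    refine lintegral_mono_ae ?_
    filter_upwards [res C.hwq (hsub.trans (dt_sub t0)), res C.tpos (hsub.trans (dt_sub t0)),
      res C.hψA.1 (hsub.trans (dt_sub t0)), ae_restrict_mem hAm] with z e1 e2 e3 e4
    rw [← ENNReal.ofReal_mul (by positivity), e1]
    refine ENNReal.ofReal_le_ofReal ?_
    have e5 : -t0 - B ≤ (ψ z).toReal := by
      have hlt := e4.2.1
      have ht' : ψ z ≠ ⊤ := (e4.2.2.trans (EReal.coe_lt_top _)).ne
      rw [← EReal.coe_toReal ht' e3] at hlt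
      exact_mod_cast hlt
    have e6 := C.hanti _ (t0+B) e2 (by linarith)
    have e7 : 1 ≤ (q (t0+B))⁻¹ * q (-(ψ z).toReal) := by
      rw [← div_eq_inv_mul, one_le_div hq]; exact e6
    calc ‖F z‖ ^ 2 * Real.exp (-(Φ z).toReal) ≤ ‖F z‖ ^ 2 * Real.exp (-(Φ z).toReal) *
          ((q (t0+B))⁻¹ * q (-(ψ z).toReal)) := le_mul_of_one_le_right (by positivity) e7
      _ = _ := by ring
  have hnn : 0 ≤ᵐ[volume.restrict A] fun z => ‖F z‖ ^ 2 * Real.exp (-(Φ z).toReal) :=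
    Eventually.of_forall fun z => by positivity
  have hm := C.fphim (C.dt_open t0) (dt_sub t0) hF.1 hsub
  refine ⟨(lintegral_ofReal_ne_top_iff_integrable hm hnn).1 (h3.trans_lt (by simp)).ne, ?_⟩
  rw [integral_eq_lintegral_of_nonneg_ae hnn hm]
  have hL0 : 0 < L := (C.hpos (t0+1) (by linarith)).trans_le (hL (t0+1) (by linarith))
  have := C.ha
  exact ENNReal.toReal_le_of_le_ofReal (by positivity) h3

lemma l2loc (C : Ctx D ψ Φ q w z₀ f Fz Gm a b) {t0 : ℝ} 
    {F : ℂ → ℂ} (hF : DifferentiableOn ℂ F (Dt D ψ t0)) (hE : En (Dt D ψ t0) w F ≠ ⊤)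
    (h0 : ∀ z ∉ Dt D ψ t0, F z = 0) {K : Set ℂ} (hK : K ⊆ D) (hKc : IsCompact K) :
    MemLp F 2 (volume.restrict K) := by
  have hind : (Dt D ψ t0).indicator F = F := by
    ext z; by_cases hz : z ∈ Dt D ψ t0
    · rw [indicator_of_mem hz]
    · rw [indicator_of_notMem hz, h0 z hz]
  have hm : AEStronglyMeasurable F volume := by
    rw [← hind, aestronglyMeasurable_indicator_iff (C.dt_open t0).measurableSet]
    exact hF.continuousOn.aestronglyMeasurable (C.dt_open t0).measurableSet
  have htot : ∫⁻ z, ENNReal.ofReal (‖F z‖ ^ 2 * w z) ≠ ⊤ := by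
    convert hE using 1
    unfold En
    rw [← lintegral_indicator (C.dt_open t0).measurableSet]
    refine lintegral_congr fun z => ?_
    by_cases hz : z ∈ Dt D ψ t0
    · rw [indicator_of_mem hz]
    · rw [indicator_of_notMem hz, h0 z hz]; simp
  rw [memLp_two_iff_integrable_sq_norm hm.restrict]
  have hli : LocallyIntegrableOn (fun z => ‖F z‖ ^ 2) D := by
    intro z hz
    refine IntegrableAtFilter.filter_mono nhdsWithin_le_nhds ?_
    rcases C.hloc z hz with hb | ⟨r, hr, m, hm0, hrD, hmw⟩
    · have hzt : z ∈ Dt D ψ t0 := ⟨hz, by rw [hb]; exact EReal.bot_lt_coe _⟩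
      obtain ⟨r, hr, hrs⟩ := nhds_basis_closedBall.mem_iff.1 ((C.dt_open t0).mem_nhds hzt)
      exact ⟨closedBall z r, closedBall_mem_nhds z hr,
        (((hF.continuousOn.mono hrs).norm).pow 2).integrableOn_compact (isCompact_closedBall z r)⟩
    · refine ⟨ball z r, ball_mem_nhds z hr, ?_⟩
      refine (lintegral_ofReal_ne_top_iff_integrable (hm.restrict.norm.pow 2)
        (Eventually.of_forall fun z => sq_nonneg ‖F z‖)).1 ?_
      refine ne_top_of_le_ne_top (ENNReal.mul_ne_top (ENNReal.ofReal_ne_top (r := m⁻¹)) htot) ?_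
      refine le_trans ?_ (mul_le_mul_right (setLIntegral_le_lintegral (ball z r) _) _)
      rw [← lintegral_const_mul' _ _ (by simp)]
      refine setLIntegral_mono' measurableSet_ball fun x hx => ?_
      rw [← ENNReal.ofReal_mul (by positivity)]
      refine ENNReal.ofReal_le_ofReal ?_
      have e7 : 1 ≤ m⁻¹ * w x := by
        rw [← div_eq_inv_mul, one_le_div hm0]; exact hmw x hx
      calc ‖F x‖ ^ 2 ≤ ‖F x‖ ^ 2 * (m⁻¹ * w x) := le_mul_of_one_le_right (by positivity) e7
        _ = _ := by ring
  exact hli.integrableOn_compact_subset hK hKc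

end Ctx

end

section
open MeasureTheory Metric Complex Set Filter
open scoped ContDiff Topology

namespace Ctx
variable {D : Set ℂ} {ψ Φ : ℂ → EReal} {q : ℝ → ℝ} {w : ℂ → ℝ} {z₀ : ℂ} {f : ℂ → ℂ}
    {Fz : (ℂ → ℂ) → Prop} {Gm : ℝ → ENNReal} {a b : ℝ}

/-- the weight produced by the extension theorem -/
noncomputable def hatw (Φ ψ : ℂ → EReal) (q : ℝ → ℝ) (L t0 : ℝ) (z : ℂ) : ℝ :=
  Real.exp (-(Φ z).toReal) * qhat q L t0 (ψ z).toReal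

lemma hat_in (C : Ctx D ψ Φ q w z₀ f Fz Gm a b) (t0 L : ℝ) :
    ∀ᵐ z ∂(volume.restrict (Dt D ψ t0)), hatw Φ ψ q L t0 z = Real.exp (-(Φ z).toReal) * L := by
  filter_upwards [res C.hψA.1 (dt_sub t0), ae_restrict_mem (C.dt_open t0).measurableSet] with z h1 h2
  rw [hatw, qhat, if_pos (toReal_lt_of h1 h2.2)]

lemma ext0 (C : Ctx D ψ Φ q w z₀ f Fz Gm a b) {t0 : ℝ} (ht : 0 < t0) :
    ∃ F0 g : ℂ → ℂ, ∃ L : ℝ, Adm (Dt D ψ t0) f Fz F0 ∧ En (Dt D ψ t0) w F0 = Gm t0 ∧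
      (∀ z ∉ Dt D ψ t0, F0 z = 0) ∧ Adm D f Fz g ∧ 0 < L ∧ (∀ s, t0 < s → q s ≤ L) ∧
      En D (hatw Φ ψ q L t0) (fun z => g z - F0 z) ≤ ENNReal.ofReal (a * ∫ t in Ioc 0 t0, q t) := by
  obtain ⟨L, hL0, hLt, hL⟩ := C.rlim ht
  obtain ⟨F0, hF, hE, h0⟩ := C.minimizer' ht.le (C.Gm_fin ht)
  have hfin : En (Dt D ψ t0) w F0 ≠ ⊤ := by rw [hE]; exact C.Gm_fin ht
  obtain ⟨g, hg, hgE⟩ := extend C.hqm C.hpos C.hanti C.hint ht hLt C.ha C.hD C.hψA C.hneg C.hΦ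
    (F := F0) hF.1 (fun z hz hn => h0 z (fun h => hn h.2)) (fun K hK hKc => C.l2loc hF.1 hfin h0 hK hKc)
    (fun B hB => C.ann ht hL hF hE hB)
  refine ⟨F0, g, L, hF, hE, h0, ⟨hg, ?_⟩, hL0, hL, hgE⟩
  have hU : Fz (fun z => g z - F0 z) := by
    have hd : DifferentiableOn ℂ (fun z => g z - F0 z) (Dt D ψ t0) := (hg.mono (dt_sub t0)).fun_sub hF.1
    have hn := (C.dt_open t0).mem_nhds (C.z0_mem t0)
    refine C.hInt _ (hd.analyticAt hn) ?_
    obtain ⟨r, hr, hrs⟩ := nhds_basis_ball.mem_iff.1 hn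
    refine ⟨r, hr, (lintegral_ofReal_ne_top_iff_integrable (C.fphim (C.dt_open t0) (dt_sub t0) hd hrs)
      (Eventually.of_forall fun z => mul_nonneg (sq_nonneg _) (Real.exp_pos _).le)).1 ?_⟩
    refine ne_top_of_le_ne_top (ENNReal.mul_ne_top (ENNReal.ofReal_ne_top (r := L⁻¹))
      (hgE.trans_lt ENNReal.ofReal_lt_top).ne) ?_
    refine le_trans ?_ (mul_le_mul_right (lintegral_mono_set (hrs.trans (dt_sub t0))) _)
    rw [← lintegral_const_mul' _ _ (by simp)]
    refine lintegral_mono_ae ?_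
    filter_upwards [ae_restrict_of_ae_restrict_of_subset hrs (C.hat_in t0 L)] with z hz
    rw [hatw] at hz
    rw [← ENNReal.ofReal_mul (by positivity), hz]
    refine ENNReal.ofReal_le_ofReal (le_of_eq ?_)
    field_simp
  exact Fz_congr C.hI (Fz_add C.hI hU hF.2) fun z => by ring

end Ctx

end

section
open MeasureTheory Metric Complex Set Filter
open scoped ContDiff Topology

namespace Ctx
variable {D : Set ℂ} {ψ Φ : ℂ → EReal} {q : ℝ → ℝ} {w : ℂ → ℝ} {z₀ : ℂ} {f : ℂ → ℂ}
    {Fz : (ℂ → ℂ) → Prop} {Gm : ℝ → ENNReal} {a b : ℝ}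

lemma G0_ge (C : Ctx D ψ Φ q w z₀ f Fz Gm a b) :
    ENNReal.ofReal (a * (∫ s in Ioi 0, q s) + b) ≤ Gm 0 := by
  have hU : ⋃ n : ℕ, Ioi (1/((n:ℝ)+1)) = Ioi 0 := by
    ext x
    simp only [mem_iUnion, mem_Ioi]
    refine ⟨fun ⟨n, hn⟩ => lt_trans (by positivity) hn, fun hx => exists_nat_one_div_lt hx⟩
  have hmono : Monotone fun n : ℕ => Ioi (1/((n:ℝ)+1)) := by
    intro n m hnm
    exact Ioi_subset_Ioi (one_div_le_one_div_of_le (by positivity) (by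
      have : (n:ℝ) ≤ m := by exact_mod_cast hnm
      linarith))
  have h := tendsto_setIntegral_of_monotone (f := q) (μ := volume) (fun n => measurableSet_Ioi) hmono
    (by rw [hU]; exact C.hint)
  rw [hU] at h
  have h2 := (ENNReal.continuous_ofReal.tendsto _).comp ((h.const_mul a).add_const b)
  refine le_of_tendsto' h2 fun n => ?_
  have hn : (0:ℝ) < 1/((n:ℝ)+1) := by positivity
  have := C.Gm_anti le_rfl hn.le
  rwa [C.hlin _ hn] at this

lemma qsmall (C : Ctx D ψ Φ q w z₀ f Fz Gm a b) {t0 L : ℝ} (ht : 0 < t0) (hL : 0 < L) :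
    ∃ s, t0 < s ∧ q s < L := by
  set h0 := ∫ x in Ioi t0, q x with hh
  have hnn : 0 ≤ h0 := setIntegral_nonneg measurableSet_Ioi fun x hx => (C.hpos x (ht.trans hx)).le
  have hp : 0 < 2 * h0 / L + 1 := by positivity
  refine ⟨t0 + (2 * h0 / L + 1), by linarith, ?_⟩
  have h1 := C.le_ioc (s := t0) (t := t0 + (2 * h0 / L + 1)) ht.le (by linarith)
  have h2 := C.hsplit (s := t0) (t := t0 + (2 * h0 / L + 1)) ht.le (by linarith)
  have h3 : 0 ≤ ∫ x in Ioi (t0 + (2 * h0 / L + 1)), q x :=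
    setIntegral_nonneg measurableSet_Ioi fun x hx => (C.hpos x (by
      have : t0 + (2 * h0 / L + 1) < x := hx
      linarith)).le
  rw [add_sub_cancel_left] at h1
  by_contra hn
  push Not at hn
  have h4 : L * (2 * h0 / L + 1) ≤ h0 := (mul_le_mul_of_nonneg_right hn hp.le).trans (by linarith)
  have h5 : L * (2 * h0 / L + 1) = 2 * h0 + L := by field_simp
  linarith

lemma ext1 (C : Ctx D ψ Φ q w z₀ f Fz Gm a b) {t0 : ℝ} (ht : 0 < t0) :
    ∃ F0 g : ℂ → ℂ, Adm (Dt D ψ t0) f Fz F0 ∧ En (Dt D ψ t0) w F0 = Gm t0 ∧ Adm D f Fz g ∧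
      En D w g = Gm 0 ∧ Gm 0 = ENNReal.ofReal (a * (∫ s in Ioi 0, q s) + b) ∧
      ∀ z ∈ connectedComponentIn (Dt D ψ t0) z₀, g z = F0 z := by
  obtain ⟨F0, g, L, hF, hE, h0, hg, hL0, hL, hgE⟩ := C.ext0 ht
  have hO := C.dt_open t0
  have hfin : En (Dt D ψ t0) w F0 ≠ ⊤ := by rw [hE]; exact C.Gm_fin ht
  have hdU : DifferentiableOn ℂ (fun z => g z - F0 z) (Dt D ψ t0) := (hg.1.mono (dt_sub t0)).fun_sub hF.1
  have hpy := min_pyth hO (C.wm (dt_sub t0)) (C.w0 (dt_sub t0)) C.hI hF hfin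
    (by rw [hE]; exact C.hlow t0 ht.le) (g := g) ⟨hg.1.mono (dt_sub t0), hg.2⟩
  set S := ∫⁻ z in Dt D ψ t0, ENNReal.ofReal (‖g z - F0 z‖ ^ 2 * (hatw Φ ψ q L t0 z - w z)) with hS
  have hle : ∀ᵐ z ∂(volume.restrict (Dt D ψ t0)), hatw Φ ψ q L t0 z =
      Real.exp (-(Φ z).toReal) * L ∧ w z = Real.exp (-(Φ z).toReal) * q (-(ψ z).toReal) ∧
      q (-(ψ z).toReal) ≤ L := by
    filter_upwards [C.hat_in t0 L, res C.hwq (dt_sub t0), res C.hψA.1 (dt_sub t0),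
      ae_restrict_mem hO.measurableSet] with z h1 h2 h3 h4
    refine ⟨h1, h2, hL _ ?_⟩
    have := toReal_lt_of h3 h4.2
    linarith
  have e1 : En (Dt D ψ t0) (hatw Φ ψ q L t0) (fun z => g z - F0 z) =
      En (Dt D ψ t0) w (fun z => g z - F0 z) + S := by
    rw [hS, En, En, ← lintegral_add_left' (En_meas hO (C.wm (dt_sub t0)) hdU)]
    refine lintegral_congr_ae ?_
    filter_upwards [hle, C.w0 (dt_sub t0)] with z hz hw
    rw [← ENNReal.ofReal_add (by positivity)]
    · congr 1; ring
    · refine mul_nonneg (by positivity) (sub_nonneg.2 ?_)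
      rw [hz.1, hz.2.1]; exact mul_le_mul_of_nonneg_left hz.2.2 (Real.exp_pos _).le
  have e2 : En (D \ Dt D ψ t0) (hatw Φ ψ q L t0) (fun z => g z - F0 z) = En (D \ Dt D ψ t0) w g := by
    refine lintegral_congr_ae ?_
    filter_upwards [res C.hwq (sdiff_subset), res C.hψA.1 sdiff_subset,
      ae_restrict_mem (C.hD.measurableSet.diff hO.measurableSet)] with z h1 h2 h3
    rw [h0 z h3.2, sub_zero, h1, hatw, qhat, if_neg]
    intro hlt
    refine h3.2 ⟨h3.1, ?_⟩
    rw [← EReal.coe_toReal (C.hψA.2.1 z h3.1) h2]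
    exact_mod_cast hlt
  have split : ∀ v k, En D v k = En (Dt D ψ t0) v k + En (D \ Dt D ψ t0) v k := by
    intro v k
    rw [En, ← lintegral_inter_add_sdiff _ _ hO.measurableSet,
        inter_eq_self_of_subset_right (dt_sub t0)]; rfl
  have tot : En D w g + S ≤ ENNReal.ofReal (a * (∫ s in Ioi 0, q s) + b) := by
    have hnn : 0 ≤ ∫ x in Ioc 0 t0, q x := setIntegral_nonneg measurableSet_Ioc
      fun x hx => (C.hpos x hx.1).le
    have e3 : ENNReal.ofReal (a * (∫ s in Ioi 0, q s) + b) =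
        Gm t0 + ENNReal.ofReal (a * ∫ t in Ioc 0 t0, q t) := by
      rw [C.hlin t0 ht, C.hsplit le_rfl ht.le, ← ENNReal.ofReal_add (C.gpos ht).le (mul_nonneg C.ha hnn)]
      congr 1; ring
    rw [e3, split, hpy, hE]
    rw [split, e1, e2] at hgE
    refine le_trans (le_of_eq ?_) (add_le_add_right hgE (Gm t0))
    ring
  have hge : ENNReal.ofReal (a * (∫ s in Ioi 0, q s) + b) ≤ En D w g := by
    have := C.hlow 0 le_rfl g (by rw [C.dt_zero]; exact hg)
    rw [C.dt_zero] at this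
    exact C.G0_ge.trans this
  have hEg : En D w g = ENNReal.ofReal (a * (∫ s in Ioi 0, q s) + b) :=
    le_antisymm (le_trans le_self_add tot) hge
  have hG : Gm 0 = ENNReal.ofReal (a * (∫ s in Ioi 0, q s) + b) := by
    refine le_antisymm ?_ C.G0_ge
    have := C.hlow 0 le_rfl g (by rw [C.dt_zero]; exact hg)
    rwa [C.dt_zero, hEg] at this
  have hS0 : S = 0 := by
    rw [hEg] at tot
    have := (ENNReal.add_le_add_iff_left (a := ENNReal.ofReal (a * (∫ s in Ioi 0, q s) + b)) (b := S)
      (c := 0) ENNReal.ofReal_ne_top).1 (by rwa [add_zero])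
    simpa using this
  refine ⟨F0, g, hF, hE, hg, hEg.trans hG.symm, hG, ?_⟩
  obtain ⟨s, hs, hqs⟩ := C.qsmall ht hL0
  have hss : Dt D ψ s ⊆ Dt D ψ t0 := dt_mono hs.le
  have hz : En (Dt D ψ s) w (fun z => g z - F0 z) = 0 := by
    have hmz : AEMeasurable (fun z => ENNReal.ofReal (‖g z - F0 z‖ ^ 2 * (hatw Φ ψ q L t0 z - w z)))
        (volume.restrict (Dt D ψ t0)) := by
      have m1 : AEMeasurable (hatw Φ ψ q L t0) (volume.restrict (Dt D ψ t0)) := by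
        have h2 : AEMeasurable (fun z => (Φ z).toReal) (volume.restrict (Dt D ψ t0)) :=
          (C.hΦ.aemD C.hD).mono_measure (Measure.restrict_mono (dt_sub t0) le_rfl)
        exact ((Real.measurable_exp.comp_aemeasurable h2.neg).mul_const L).congr
          (by filter_upwards [hle] with z hz using hz.1.symm)
      exact En_meas hO (m1.sub (C.wm (dt_sub t0))) hdU
    have hae := (lintegral_eq_zero_iff' hmz).1 hS0
    rw [En]
    refine (lintegral_congr_ae (g := fun _ => 0) ?_).trans (by simp)
    filter_upwards [ae_restrict_of_ae_restrict_of_subset hss hae,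
      ae_restrict_of_ae_restrict_of_subset hss hle, res C.hψA.1 (dt_sub s),
      ae_restrict_mem (C.dt_open s).measurableSet] with z h1 h2 h3 h4
    have h5 : q (-(ψ z).toReal) < L := by
      refine (C.hanti s _ (ht.trans hs) ?_).trans_lt hqs
      have := toReal_lt_of h3 h4.2
      linarith
    have h6 : 0 < hatw Φ ψ q L t0 z - w z := by
      rw [h2.1, h2.2.1, ← mul_sub]; exact mul_pos (Real.exp_pos _) (by linarith)
    have h7 : ‖g z - F0 z‖ ^ 2 * (hatw Φ ψ q L t0 z - w z) ≤ 0 := ENNReal.ofReal_eq_zero.1 h1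
    have h8 : ‖g z - F0 z‖ ^ 2 = 0 := by
      by_contra hne
      have := mul_pos (lt_of_le_of_ne (sq_nonneg ‖g z - F0 z‖) (Ne.symm hne)) h6
      linarith
    rw [h8]; simp
  have hUs := (C.hL _ (C.dt_open s) (dt_sub s)).eq_zero (hdU.mono hss) hz
  have hcc : connectedComponentIn (Dt D ψ t0) z₀ ⊆ Dt D ψ t0 := connectedComponentIn_subset _ _
  have han : AnalyticOnNhd ℂ (fun z => g z - F0 z) (connectedComponentIn (Dt D ψ t0) z₀) :=
    fun z hz => hdU.analyticAt (hO.mem_nhds (hcc hz))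
  have := han.eqOn_zero_of_preconnected_of_eventuallyEq_zero isPreconnected_connectedComponentIn
    (mem_connectedComponentIn (C.z0_mem t0)) (by
      filter_upwards [(C.dt_open s).mem_nhds (C.z0_mem s)] with z hz using hUs z hz)
  intro z hz
  exact sub_eq_zero.1 (this hz)

lemma G0_fin (C : Ctx D ψ Φ q w z₀ f Fz Gm a b) : Gm 0 ≠ ⊤ := by
  obtain ⟨_, _, _, _, _, _, h, _⟩ := C.ext1 one_pos
  rw [h]; simp

lemma uniq (C : Ctx D ψ Φ q w z₀ f Fz Gm a b) {g k : ℂ → ℂ} (hg : Adm D f Fz g) (hk : Adm D f Fz k)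
    (eg : En D w g = Gm 0) (ek : En D w k = Gm 0) : ∀ z ∈ D, k z = g z := by
  have hpy := min_pyth C.hD C.hwm (C.w0 subset_rfl) C.hI hg (by rw [eg]; exact C.G0_fin)
    (fun h hh => by
      have := C.hlow 0 le_rfl h (by rw [C.dt_zero]; exact hh)
      rwa [C.dt_zero, ← eg] at this) hk
  rw [eg, ek] at hpy
  have h0 : En D w (fun z => k z - g z) = 0 := by
    have := (ENNReal.add_le_add_iff_left (a := Gm 0) (b := En D w (fun z => k z - g z)) (c := 0) C.G0_fin).1
      (by rw [← hpy, add_zero])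
    simpa using this
  intro z hz
  exact sub_eq_zero.1 ((C.hL D C.hD subset_rfl).eq_zero (hk.1.fun_sub hg.1) h0 z hz)

end Ctx

end

section
open MeasureTheory Metric Complex Set Filter
open scoped ContDiff Topology

namespace Ctx
variable {D : Set ℂ} {ψ Φ : ℂ → EReal} {q : ℝ → ℝ} {w : ℂ → ℝ} {z₀ : ℂ} {f : ℂ → ℂ}
    {Fz : (ℂ → ℂ) → Prop} {Gm : ℝ → ENNReal} {a b : ℝ}

lemma ind_diff {Ω : Set ℂ} (hΩ : IsOpen Ω) {p : ℂ} {F : ℂ → ℂ} (hF : DifferentiableOn ℂ F Ω) :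
    DifferentiableOn ℂ ((connectedComponentIn Ω p).indicator F) Ω := by
  intro z hz
  refine DifferentiableAt.differentiableWithinAt ?_
  by_cases hzc : z ∈ connectedComponentIn Ω p
  · refine (hF.differentiableAt (hΩ.mem_nhds hz)).congr_of_eventuallyEq ?_
    filter_upwards [hΩ.connectedComponentIn.mem_nhds hzc] with y hy
    rw [indicator_of_mem hy]
  · refine (differentiableAt_const (0:ℂ)).congr_of_eventuallyEq ?_
    filter_upwards [hΩ.connectedComponentIn.mem_nhds (mem_connectedComponentIn hz)] with y hy
    rw [indicator_of_notMem]
    intro hy2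
    apply hzc
    rw [connectedComponentIn_eq hy2, ← connectedComponentIn_eq hy]
    exact mem_connectedComponentIn hz

lemma main1 (C : Ctx D ψ Φ q w z₀ f Fz Gm a b) : ∃ F, Adm D f Fz F ∧ En D w F = Gm 0 ∧
    ∀ t, 0 < t → Gm t = En (connectedComponentIn (Dt D ψ t) z₀) w F := by
  obtain ⟨_, F, _, _, hF, hE, _, _⟩ := C.ext1 one_pos
  refine ⟨F, hF, hE, fun t ht => ?_⟩
  obtain ⟨F0, g, hF0, hE0, hg, hEg, _, hgF⟩ := C.ext1 ht
  have hO := C.dt_open t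
  have hcc : connectedComponentIn (Dt D ψ t) z₀ ⊆ Dt D ψ t := connectedComponentIn_subset _ _
  have hgF' := C.uniq hF hg hE hEg
  refine le_antisymm ?_ ?_
  · have h1 := C.hlow t ht.le ((connectedComponentIn (Dt D ψ t) z₀).indicator F)
      ⟨ind_diff hO (hF.1.mono (dt_sub t)), ?_⟩
    · refine h1.trans (le_of_eq ?_)
      unfold En
      rw [← inter_eq_self_of_subset_left hcc, ← setLIntegral_indicator hO.connectedComponentIn.measurableSet]
      rw [inter_eq_self_of_subset_left hcc]
      refine lintegral_congr fun z => ?_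
      by_cases hz : z ∈ connectedComponentIn (Dt D ψ t) z₀
      · simp only [indicator_of_mem hz]
      · simp [indicator_of_notMem hz]
    · refine C.hI.1 _ _ ?_ hF.2
      filter_upwards [hO.connectedComponentIn.mem_nhds (mem_connectedComponentIn (C.z0_mem t))] with z hz
      rw [indicator_of_mem hz]
  · rw [← hE0]
    refine le_trans (le_of_eq ?_) (En_mono hcc _ _)
    exact En_congr hO.connectedComponentIn fun z hz => by
      rw [← hgF z hz, hgF' z (dt_sub t (hcc hz))]

lemma reach (C : Ctx D ψ Φ q w z₀ f Fz Gm a b) {x : ℂ} (hx : x ∈ D) {t : ℝ} (ht : 0 < t) :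
    ∃ s, 0 < s ∧ s ≤ t ∧ x ∈ connectedComponentIn (Dt D ψ s) z₀ := by
  have hpc := (C.hD.isConnected_iff_isPathConnected.1 C.hc).joinedIn z₀ C.hz0 x hx
  obtain ⟨γ, hγ⟩ := hpc
  have hK : IsCompact (range γ) := isCompact_range γ.continuous
  have hKD : range γ ⊆ D := by rintro _ ⟨u, rfl⟩; exact hγ u
  obtain ⟨M, hM, hM0⟩ := usc_bound hK hKD C.hψ
  have hM0 := hM0 C.hneg
  refine ⟨min t (-M/2), lt_min ht (by linarith), min_le_left _ _, ?_⟩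
  have hsub : range γ ⊆ Dt D ψ (min t (-M/2)) := fun z hz => ⟨hKD hz, (hM z hz).trans_lt (by
    have : min t (-M/2) ≤ -M/2 := min_le_right _ _
    exact_mod_cast (by linarith : M < -(min t (-M/2))))⟩
  exact (isPreconnected_range γ.continuous).subset_connectedComponentIn ⟨0, γ.source⟩ hsub ⟨1, γ.target⟩

lemma conn (C : Ctx D ψ Φ q w z₀ f Fz Gm a b) {F : ℂ → ℂ} (hF : Adm D f Fz F)
    (h : ∀ t, 0 < t → Gm t = En (connectedComponentIn (Dt D ψ t) z₀) w F) {t : ℝ} (ht : 0 < t) :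
    connectedComponentIn (Dt D ψ t) z₀ = Dt D ψ t := by
  refine (connectedComponentIn_subset _ _).antisymm fun x hx => ?_
  by_contra hxn
  obtain ⟨s0, hs0, hst, hxs⟩ := C.reach hx.1 ht
  obtain ⟨r, hr, hrs⟩ := nhds_basis_ball.mem_iff.1 ((C.dt_open t).mem_nhds hx)
  have hpb : IsPreconnected (ball x r) := (convex_ball x r).isPreconnected
  have hκ : En (ball x r) w F ≠ 0 := by
    intro h0
    have hz := (C.hL _ isOpen_ball (hrs.trans (dt_sub t))).eq_zero (hF.1.mono (hrs.trans (dt_sub t))) h0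
    have han : AnalyticOnNhd ℂ F D := fun z hz => hF.1.analyticAt (C.hD.mem_nhds hz)
    have := han.eqOn_zero_of_preconnected_of_eventuallyEq_zero C.hc.isPreconnected hx.1 (by
      filter_upwards [ball_mem_nhds x hr] with z hzb using hz z hzb)
    exact C.nz hF (by filter_upwards [C.hD.mem_nhds C.hz0] with z hz using this hz)
  have step : ∀ s s', s0 ≤ s → s ≤ s' → s' ≤ t → x ∈ connectedComponentIn (Dt D ψ s) z₀ →
      x ∉ connectedComponentIn (Dt D ψ s') z₀ →
      En (ball x r) w F ≤ ENNReal.ofReal (a * (q s0 * (s' - s))) := by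
    intro s s' h1 h2 h3 hP hnP
    have hs : 0 < s := hs0.trans_le h1
    have hs' : 0 < s' := hs.trans_le h2
    have hb1 : ball x r ⊆ connectedComponentIn (Dt D ψ s) z₀ := by
      rw [connectedComponentIn_eq hP]
      exact hpb.subset_connectedComponentIn (mem_ball_self hr) (hrs.trans (dt_mono (h2.trans h3)))
    have hb2 : Disjoint (ball x r) (connectedComponentIn (Dt D ψ s') z₀) := by
      rw [Set.disjoint_left]
      intro y hy hy2
      apply hnP
      rw [connectedComponentIn_eq hy2]
      exact hpb.subset_connectedComponentIn hy (hrs.trans (dt_mono h3)) (mem_ball_self hr)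
    have h4 : En (ball x r) w F + Gm s' ≤ Gm s := by
      rw [h s hs, h s' hs', En, En, ← lintegral_union (C.dt_open s').connectedComponentIn.measurableSet hb2]
      exact lintegral_mono_set (union_subset hb1 (connectedComponentIn_mono _ (dt_mono h2)))
    rw [C.gsplit hs h2, ENNReal.add_le_add_iff_right (C.Gm_fin hs')] at h4
    refine h4.trans (ENNReal.ofReal_le_ofReal (mul_le_mul_of_nonneg_left ?_ C.ha))
    exact C.ioc_le hs.le h2 fun y hy => C.hanti s0 y hs0 (h1.trans hy.le)
  have all : ∀ N : ℕ, En (ball x r) w F ≤ ENNReal.ofReal (a * (q s0 * ((t - s0) / ((N:ℝ)+1)))) := by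
    intro N
    by_contra hlt
    have hd : 0 ≤ (t - s0) / ((N:ℝ)+1) := div_nonneg (by linarith) (by positivity)
    have hdN : ((N:ℝ)+1) * ((t - s0) / ((N:ℝ)+1)) = t - s0 := by field_simp
    have key : ∀ i : ℕ, i ≤ N + 1 → x ∈ connectedComponentIn (Dt D ψ (s0 + i * ((t - s0) / ((N:ℝ)+1)))) z₀ := by
      intro i
      induction i with
      | zero => intro _; simpa using hxs
      | succ i ih =>
        intro hi
        by_contra hn
        refine hlt ((step _ _ ?_ ?_ ?_ (ih (by omega)) hn).trans (le_of_eq ?_))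
        · have : 0 ≤ (i:ℝ) * ((t - s0) / ((N:ℝ)+1)) := by positivity
          linarith
        · push_cast; linarith
        · have h5 : ((i+1:ℕ):ℝ) ≤ (N:ℝ) + 1 := by exact_mod_cast hi
          have := mul_le_mul_of_nonneg_right h5 hd
          linarith
        · congr 3; push_cast; ring
    have := key (N+1) le_rfl
    push_cast at this
    rw [hdN, add_sub_cancel] at this
    exact hxn this
  have hlim : Tendsto (fun N : ℕ => ENNReal.ofReal (a * (q s0 * ((t - s0) / ((N:ℝ)+1))))) atTop (𝓝 0) := by
    have h1 : Tendsto (fun N : ℕ => a * (q s0 * ((t - s0) * (1 / ((N:ℝ)+1))))) atTop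
        (𝓝 (a * (q s0 * ((t - s0) * 0)))) :=
      ((tendsto_one_div_add_atTop_nhds_zero_nat.const_mul _).const_mul _).const_mul _
    have h2 := (ENNReal.continuous_ofReal.tendsto _).comp h1
    simpa [Function.comp_def, div_eq_mul_inv] using h2
  exact hκ (le_antisymm (ge_of_tendsto' hlim all) zero_le)

lemma main2 (C : Ctx D ψ Φ q w z₀ f Fz Gm a b) : ∃ F, Adm D f Fz F ∧
    ∀ t, 0 ≤ t → Gm t = En (Dt D ψ t) w F := by
  obtain ⟨F, hF, h0, h⟩ := C.main1
  refine ⟨F, hF, fun t ht => ?_⟩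
  rcases ht.eq_or_lt with rfl | ht
  · rw [C.dt_zero, h0]
  · rw [h t ht, C.conn hF h ht]

lemma b0 (C : Ctx D ψ Φ q w z₀ f Fz Gm a b) {F : ℂ → ℂ} (hF : Adm D f Fz F)
    (h : ∀ t, 0 ≤ t → Gm t = En (Dt D ψ t) w F) : b = 0 := by
  have hI : ⋂ n : ℕ, Ioi (n:ℝ) = ∅ := by
    ext x
    simp only [mem_iInter, mem_Ioi, mem_empty_iff_false, iff_false, not_forall, not_lt]
    exact exists_nat_ge x
  have h1 := tendsto_setIntegral_of_antitone (f := q) (μ := volume) (s := fun n : ℕ => Ioi (n:ℝ))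
    (fun n => measurableSet_Ioi)
    (fun n m hnm => Ioi_subset_Ioi (by exact_mod_cast hnm)) ⟨0, by simpa using C.hint⟩
  rw [hI, setIntegral_empty] at h1
  have h2 := (h1.const_mul a).add_const b
  rw [mul_zero, zero_add] at h2
  have hb : 0 ≤ b := by
    refine ge_of_tendsto h2 ?_
    filter_upwards [eventually_gt_atTop 0] with n hn
    exact (C.gpos (by exact_mod_cast hn)).le
  set ν := (volume.restrict D).withDensity (fun z => ENNReal.ofReal (‖F z‖ ^ 2 * w z)) with hν
  have hνD : ∀ t, ν (Dt D ψ t) = En (Dt D ψ t) w F := by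
    intro t
    rw [hν, withDensity_apply _ (C.dt_open t).measurableSet, Measure.restrict_restrict (C.dt_open t).measurableSet,
      inter_eq_self_of_subset_left (dt_sub t)]; rfl
  have h3 := tendsto_measure_iInter_atTop (μ := ν) (s := fun n : ℕ => Dt D ψ n)
    (fun n => (C.dt_open _).measurableSet.nullMeasurableSet)
    (fun n m hnm => dt_mono (by exact_mod_cast hnm)) ⟨0, by
      rw [hνD, ← h _ (by positivity)]; simpa using C.G0_fin⟩
  have h4 : ν (⋂ n : ℕ, Dt D ψ n) = 0 := by
    have : (volume.restrict D) (⋂ n : ℕ, Dt D ψ n) = 0 := by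
      refine measure_mono_null ?_ C.hψA.1
      intro z hz hzb
      rw [mem_iInter] at hz
      obtain ⟨n, hn⟩ := exists_nat_ge (-(ψ z).toReal)
      have := toReal_lt_of hzb (hz n).2
      linarith
    exact withDensity_absolutelyContinuous _ _ this
  rw [h4] at h3
  have h5 : Tendsto (fun n : ℕ => Gm n) atTop (𝓝 0) := by
    refine h3.congr fun n => ?_
    simp only [Function.comp]
    rw [hνD, h _ (by positivity)]
  have h6 := (ENNReal.continuous_ofReal.tendsto _).comp h2
  have h7 : Tendsto (fun n : ℕ => Gm n) atTop (𝓝 (ENNReal.ofReal b)) := by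
    refine h6.congr' ?_
    filter_upwards [eventually_gt_atTop 0] with n hn
    exact (C.hlin n (by exact_mod_cast hn)).symm
  have h8 := tendsto_nhds_unique h7 h5
  exact le_antisymm (ENNReal.ofReal_eq_zero.1 h8) hb

lemma main3 (C : Ctx D ψ Φ q w z₀ f Fz Gm a b) {F : ℂ → ℂ} (hF : Adm D f Fz F)
    (h : ∀ t, 0 ≤ t → Gm t = En (Dt D ψ t) w F) {t : ℝ} (ht : 0 ≤ t) :
    Gm t = ENNReal.ofReal (a * ∫ s in Ioi t, q s) := by
  have hb := C.b0 hF h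
  rcases ht.eq_or_lt with rfl | ht
  · obtain ⟨_, _, _, _, _, _, h, _⟩ := C.ext1 one_pos
    rw [h, hb, add_zero]
  · rw [C.hlin t ht, hb, add_zero]

end Ctx

end

section
open MeasureTheory Metric Complex Set Filter
open scoped ContDiff Topology

namespace Ctx
variable {D : Set ℂ} {ψ Φ : ℂ → EReal} {q : ℝ → ℝ} {w : ℂ → ℝ} {z₀ : ℂ} {f : ℂ → ℂ}
    {Fz : (ℂ → ℂ) → Prop} {Gm : ℝ → ENNReal} {a b : ℝ}

lemma distr (C : Ctx D ψ Φ q w z₀ f Fz Gm a b) {F : ℂ → ℂ} (hF : Adm D f Fz F)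
    (h : ∀ t, 0 ≤ t → Gm t = En (Dt D ψ t) w F) {k : ℝ → ENNReal} (hk : Measurable k) :
    ∫⁻ z in D, ENNReal.ofReal (‖F z‖ ^ 2 * w z) * k (-(ψ z).toReal) =
      ∫⁻ t in Ioi 0, ENNReal.ofReal (a * q t) * k t := by
  have hρ : AEMeasurable (fun z => ENNReal.ofReal (‖F z‖ ^ 2 * w z)) (volume.restrict D) :=
    En_meas C.hD C.hwm hF.1
  have hT : AEMeasurable (fun z => -(ψ z).toReal) (volume.restrict D) := (C.hψA.aemD C.hD).neg
  set ν := (volume.restrict D).withDensity (fun z => ENNReal.ofReal (‖F z‖ ^ 2 * w z)) with hν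
  have hac : ν ≪ volume.restrict D := withDensity_absolutelyContinuous _ _
  have hTν : AEMeasurable (fun z => -(ψ z).toReal) ν := hT.mono_ac hac
  have hqm : Measurable fun t => ENNReal.ofReal (a * q t) := (C.hqm.const_mul a).ennreal_ofReal
  set μ1 := ν.map (fun z => -(ψ z).toReal) with hμ1
  set μ2 := (volume.restrict (Ioi (0:ℝ))).withDensity (fun t => ENNReal.ofReal (a * q t)) with hμ2
  have hνD : ∀ t, ν (Dt D ψ t) = En (Dt D ψ t) w F := by
    intro t
    rw [hν, withDensity_apply _ (C.dt_open t).measurableSet, Measure.restrict_restrict (C.dt_open t).measurableSet,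
      inter_eq_self_of_subset_left (dt_sub t)]; rfl
  have i1 : ∀ t, 0 ≤ t → μ1 (Ioi t) = Gm t := by
    intro t ht
    rw [hμ1, Measure.map_apply_of_aemeasurable hTν measurableSet_Ioi, h t ht, ← hνD]
    refine measure_congr ?_
    filter_upwards [hac.ae_le C.hψA.1, hac.ae_le (ae_restrict_mem C.hD.measurableSet)] with z h1 h2
    refine propext ?_
    show t < -(ψ z).toReal ↔ z ∈ D ∧ _
    refine ⟨fun hlt => ⟨h2, ?_⟩, fun hlt => ?_⟩
    · rw [← EReal.coe_toReal (C.hψA.2.1 z h2) h1]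
      exact_mod_cast (by linarith : (ψ z).toReal < -t)
    · have := toReal_lt_of h1 hlt.2
      linarith
  have i2 : ∀ t, 0 ≤ t → μ2 (Ioi t) = Gm t := by
    intro t ht
    rw [hμ2, withDensity_apply _ measurableSet_Ioi, Measure.restrict_restrict measurableSet_Ioi,
      inter_eq_self_of_subset_left (Ioi_subset_Ioi ht), C.main3 hF h ht, ← integral_const_mul,
      ofReal_integral_eq_lintegral_ofReal ((C.hint' ht).const_mul a)]
    filter_upwards [ae_restrict_mem measurableSet_Ioi] with x hx
    exact mul_nonneg C.ha (C.hpos x (ht.trans_lt hx)).le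
  have z1 : μ1 (Iic 0) = 0 := by
    rw [hμ1, Measure.map_apply_of_aemeasurable hTν measurableSet_Iic]
    refine measure_mono_null ?_ (hac C.tpos)
    intro z hz hz2
    have h1 : -(ψ z).toReal ≤ 0 := hz
    have h2 : 0 < -(ψ z).toReal := hz2
    linarith
  have z2 : μ2 (Iic 0) = 0 := by
    rw [hμ2, withDensity_apply _ measurableSet_Iic, Measure.restrict_restrict measurableSet_Iic,
      (Iic_disjoint_Ioi le_rfl).inter_eq, Measure.restrict_empty, lintegral_zero_measure]
  have u : ∀ μ : Measure ℝ, μ (Iic 0) = 0 → μ (Ioi 0) = Gm 0 → μ univ = Gm 0 := by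
    intro μ e1 e2
    rw [← Iic_union_Ioi (a := (0:ℝ)), measure_union (Iic_disjoint_Ioi le_rfl) measurableSet_Ioi, e1, e2, zero_add]
  have u1 := u μ1 z1 (i1 0 le_rfl)
  have u2 := u μ2 z2 (i2 0 le_rfl)
  have : IsFiniteMeasure μ1 := ⟨by rw [u1]; exact C.G0_fin.lt_top⟩
  have : IsFiniteMeasure μ2 := ⟨by rw [u2]; exact C.G0_fin.lt_top⟩
  have heq : μ1 = μ2 := by
    refine Measure.ext_of_Iic μ1 μ2 fun t => ?_
    rcases le_total 0 t with ht | ht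
    · rw [← compl_Ioi, measure_compl measurableSet_Ioi (measure_ne_top _ _),
        measure_compl measurableSet_Ioi (measure_ne_top _ _), u1, u2, i1 t ht, i2 t ht]
    · rw [measure_mono_null (Iic_subset_Iic.2 ht) z1, measure_mono_null (Iic_subset_Iic.2 ht) z2]
  have e1 : ∫⁻ x, k x ∂μ1 = ∫⁻ z in D, ENNReal.ofReal (‖F z‖ ^ 2 * w z) * k (-(ψ z).toReal) := by
    rw [hμ1, lintegral_map' hk.aemeasurable hTν, hν]
    exact lintegral_withDensity_eq_lintegral_mul₀ hρ (hk.comp_aemeasurable hT)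
  have e2 : ∫⁻ x, k x ∂μ2 = ∫⁻ t in Ioi 0, ENNReal.ofReal (a * q t) * k t := by
    rw [hμ2]
    exact lintegral_withDensity_eq_lintegral_mul _ hqm hk
  rw [← e1, ← e2, heq]

end Ctx

end

section
open MeasureTheory Metric Complex Set Filter
open scoped ContDiff Topology

lemma real_parts {x y : EReal} (hy : y ≠ ⊥) (hy' : y ≠ ⊤) (h : x + y ≠ ⊥) (h' : x + y ≠ ⊤) :
    (x + y).toReal = x.toReal + y.toReal := by
  have hx : x ≠ ⊥ := by rintro rfl; simp at h
  have hx' : x ≠ ⊤ := by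
    rintro rfl
    exact h' (EReal.top_add_of_ne_bot hy)
  exact EReal.toReal_add hx' hx hy' hy

lemma wgt_eq {φ ψ : ℂ → EReal} {c : ℝ → ℝ} {D : Set ℂ} (hD : IsOpen D) (hψ : Apx ψ D)
    (hΦ : Apx (fun z => φ z + ψ z) D) :
    ∀ᵐ z ∂(volume.restrict D), wgt1 φ ψ c z =
      Real.exp (-(φ z + ψ z).toReal) * (c (-(ψ z).toReal) * Real.exp (-(-(ψ z).toReal))) := by
  filter_upwards [hψ.1, hΦ.1, ae_restrict_mem hD.measurableSet] with z h1 h2 h3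
  rw [wgt1, EReal.toReal_neg_eq, real_parts h1 (hψ.2.1 z h3) h2 (hΦ.2.1 z h3),
    mul_comm (c _), ← mul_assoc, ← Real.exp_add]
  congr 2; ring

lemma mk_ctx {n : ℕ} {D : Set ℂ} (hD : IsRegularRegion n D) {ψ φ : ℂ → EReal}
    (hψsh : SubharmonicOnE ψ D) (hψneg : ∀ z ∈ D, ψ z < 0)
    (hφψ : SubharmonicOnE (fun z => φ z + ψ z) D)
    {z₀ : ℂ} (hz₀ : z₀ ∈ D) {f : ℂ → ℂ} {Fz : (ℂ → ℂ) → Prop} (hFz : IsIdealAt Fz z₀)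
    (hFzI : ∀ g : ℂ → ℂ, InMultIdeal φ ψ z₀ g → Fz g) {c : ℝ → ℝ} (hc : AdmissibleC' c)
    {Z : Set ℂ} (hZ : DiscreteIn Z D) (hZψ : Z ⊆ {z | ψ z = ⊥})
    (hlb : PosLowerBoundOnCompacts D Z (wgt1 φ ψ c)) {a b : ℝ}
    (hlin : ∀ t : ℝ, 0 < t → minL2F D ψ φ c f Fz t = ENNReal.ofReal (a * hFun c t + b)) (hf : ¬ Fz f) :
    Ctx D ψ (fun z => φ z + ψ z) (fun t => c t * Real.exp (-t)) (wgt1 φ ψ c) z₀ f Fz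
      (minL2F D ψ φ c f Fz) a b := by
  have hDo := hD.1
  have hpre := hD.2.1.isPreconnected
  have hψA := subh_apx hDo hpre hψsh
  have hΦ := subh_apx hDo hpre hφψ
  have hqm : Measurable fun t => c t * Real.exp (-t) :=
    hc.meas.mul (Real.measurable_exp.comp measurable_neg)
  have hpos : ∀ t, 0 < t → 0 < c t * Real.exp (-t) := fun t ht => mul_pos (hc.pos t ht) (Real.exp_pos _)
  have hwq := wgt_eq (c := c) hDo hψA hΦ
  have hTm : AEMeasurable (fun z => -(ψ z).toReal) (volume.restrict D) := (hψA.aemD hDo).neg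
  have hwm : AEMeasurable (wgt1 φ ψ c) (volume.restrict D) := by
    refine AEMeasurable.congr ?_ (EventuallyEq.symm hwq)
    exact (Real.measurable_exp.comp_aemeasurable (hΦ.aemD hDo).neg).mul (hqm.comp_aemeasurable hTm)
  have hzb : ψ z₀ = ⊥ := by
    by_contra hne
    have hnt := hψsh.2.1 z₀ hz₀
    have hr : (ψ z₀).toReal < 0 := toReal_lt_of hne (by simpa using hψneg z₀ hz₀)
    set t' := -(ψ z₀).toReal / 2 with ht'
    have ht0 : 0 < t' := by rw [ht']; linarith
    obtain ⟨g, hg, hgE⟩ := minL2F_approx (D := D) (ψ := ψ) (φ := φ) (c := c) (f := f) (Fz := Fz) (t := t')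
      (by rw [hlin t' ht0]; simp) one_pos
    have hO : IsOpen {z | z ∈ D ∧ ψ z < ((-t' : ℝ) : EReal)} := usc_open hDo hψsh.1 _
    have hzm : z₀ ∈ {z | z ∈ D ∧ ψ z < ((-t' : ℝ) : EReal)} := by
      refine ⟨hz₀, ?_⟩
      rw [← EReal.coe_toReal hnt hne]
      exact_mod_cast (by rw [ht']; linarith : (ψ z₀).toReal < -t')
    obtain ⟨r, hr0, hrs⟩ := nhds_basis_ball.mem_iff.1 (hO.mem_nhds hzm)
    have han : AnalyticAt ℂ g z₀ := hg.1.analyticAt (hO.mem_nhds hzm)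
    have hrD : ball z₀ r ⊆ D := hrs.trans fun z hz => hz.1
    have hE : ∫⁻ z in ball z₀ r, ENNReal.ofReal (‖g z‖ ^ 2 * (Real.exp (-(φ z + ψ z).toReal) *
        (fun t => c t * Real.exp (-t)) (-(ψ z).toReal))) ≠ ⊤ := by
      refine ne_top_of_le_ne_top (b := minL2F D ψ φ c f Fz t' + ENNReal.ofReal 1) ?_ ?_
      · rw [hlin t' ht0]; simp
      · refine le_trans (le_of_eq ?_) ((En_mono hrs _ _).trans hgE)
        refine lintegral_congr_ae ?_
        filter_upwards [ae_restrict_of_ae_restrict_of_subset hrD hwq] with z hz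
        rw [hz]
    have hpat := patho hDo hψsh hψneg hψA.1 hΦ hz₀ hne hpos hc.mono han hr0 hE
    have hFg : Fz g := hFzI g ⟨han, hpat⟩
    exact hf (Fz_congr hFz (Fz_sub hFz hFg hg.2) fun z => by ring)
  refine ⟨hDo, hD.2.1, hψsh, hψA, hψneg, hΦ, hz₀, hzb, hqm, hpos, hc.mono, ?_, hwq, hwm,
    fun Ω hΩ hs => lbd_of hZ hlb hΩ hs, hFz, fun g hg h => hFzI g ⟨hg, h⟩, ?_, hf,
    fun t _ g hg => minL2F_le hg, fun t _ hG ε hε => minL2F_approx hG hε, hlin⟩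
  · refine (lintegral_ofReal_ne_top_iff_integrable hqm.aestronglyMeasurable ?_).1 hc.fin
    filter_upwards [ae_restrict_mem measurableSet_Ioi] with t ht using (hpos t ht).le
  · intro z hz
    by_cases hzZ : z ∈ Z
    · exact Or.inl (hZψ hzZ)
    right
    obtain ⟨r, hr, hrZ⟩ := hZ.2 z hz
    obtain ⟨r', hr', hrD⟩ := nhds_basis_ball.mem_iff.1 (hDo.mem_nhds hz)
    set ρ := min r r' / 2 with hρ
    have hm : 0 < min r r' := lt_min hr hr'
    have hρ0 : 0 < ρ := by rw [hρ]; linarith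
    have h1 : closedBall z ρ ⊆ ball z (min r r') := closedBall_subset_ball (by rw [hρ]; linarith)
    obtain ⟨m, hm0, hmw⟩ := hlb (closedBall z ρ) (fun x hx => ⟨hrD (ball_subset_ball (min_le_right _ _) (h1 hx)),
      fun hxZ => hzZ (by
        have : x ∈ ({z} : Set ℂ) := hrZ ⟨ball_subset_ball (min_le_left _ _) (h1 hx), hxZ⟩
        rw [mem_singleton_iff] at this
        rwa [← this])⟩) (isCompact_closedBall z ρ)
    exact ⟨ρ, hρ0, m, hm0, fun x hx => hrD (ball_subset_ball (min_le_right _ _) (h1 (ball_subset_closedBall hx))),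
      fun x hx => hmw x (ball_subset_closedBall hx)⟩

lemma fml {D : Set ℂ} {ψ φ Φ : ℂ → EReal} {c : ℝ → ℝ} (hc : AdmissibleC' c) {z₀ : ℂ} {f : ℂ → ℂ}
    {Fz : (ℂ → ℂ) → Prop} {Gm : ℝ → ENNReal} {a b : ℝ}
    (C : Ctx D ψ Φ (fun t => c t * Real.exp (-t)) (wgt1 φ ψ c) z₀ f Fz Gm a b) {F : ℂ → ℂ} (hF : Adm D f Fz F)
    (h : ∀ t, 0 ≤ t → Gm t = En (Dt D ψ t) (wgt1 φ ψ c) F) {α : ℝ → ENNReal} (hα : Measurable α)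
    {A : Set ℂ} {S : Set ℝ} (hA : MeasurableSet A) (hAD : A ⊆ D) (hS : MeasurableSet S) (hS0 : S ⊆ Ioi 0)
    (hAS : ∀ z ∈ D, ψ z ≠ ⊥ → (z ∈ A ↔ -(ψ z).toReal ∈ S)) :
    ∫⁻ z in A, ENNReal.ofReal (‖F z‖ ^ 2 * Real.exp (-(φ z).toReal)) * α ((-(ψ z)).toReal) =
      Gm 0 / ENNReal.ofReal (cInt c) * ∫⁻ t in S, α t * ENNReal.ofReal (Real.exp (-t)) := by
  have hci : 0 < cInt c := by
    have h1 := C.le_ioc (s := 0) (t := 1) le_rfl zero_le_one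
    have h2 := C.hsplit (s := 0) (t := 1) le_rfl zero_le_one
    have h3 : 0 ≤ ∫ x in Ioi (1:ℝ), c x * Real.exp (-x) := setIntegral_nonneg measurableSet_Ioi
      fun x hx => (C.hpos x (one_pos.trans hx)).le
    have h4 := C.hpos 1 one_pos
    simp only [sub_zero, mul_one] at h1 h2 h4
    rw [cInt, h2]
    linarith
  have e0 : Gm 0 / ENNReal.ofReal (cInt c) = ENNReal.ofReal a := by
    rw [C.main3 hF h le_rfl, ENNReal.ofReal_mul C.ha]
    exact ENNReal.mul_div_cancel_right (ENNReal.ofReal_pos.2 hci).ne' ENNReal.ofReal_ne_top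
  have hk : Measurable (S.indicator fun t => α t * (ENNReal.ofReal (c t))⁻¹) :=
    (hα.mul hc.meas.ennreal_ofReal.inv).indicator hS
  have key := C.distr hF h hk
  rw [e0, ← lintegral_const_mul' _ _ ENNReal.ofReal_ne_top]
  have e1 : ∫⁻ z in A, ENNReal.ofReal (‖F z‖ ^ 2 * Real.exp (-(φ z).toReal)) * α ((-(ψ z)).toReal) =
      ∫⁻ z in D, ENNReal.ofReal (‖F z‖ ^ 2 * wgt1 φ ψ c z) *
        (S.indicator fun t => α t * (ENNReal.ofReal (c t))⁻¹) (-(ψ z).toReal) := by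
    have := setLIntegral_indicator (μ := volume) hA (t := D) (fun z =>
      ENNReal.ofReal (‖F z‖ ^ 2 * Real.exp (-(φ z).toReal)) * α ((-(ψ z)).toReal))
    rw [inter_eq_self_of_subset_left hAD] at this
    rw [← this]
    refine lintegral_congr_ae ?_
    filter_upwards [C.hψA.1, C.tpos, ae_restrict_mem C.hD.measurableSet] with z h1 h2 h3
    by_cases hz : z ∈ A
    · rw [indicator_of_mem hz, indicator_of_mem ((hAS z h3 h1).1 hz), wgt1, EReal.toReal_neg_eq,
        ← mul_assoc (‖F z‖ ^ 2), ENNReal.ofReal_mul (by positivity) (q := c _)]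
      have hcp := hc.pos _ h2
      have hi := ENNReal.mul_inv_cancel (ENNReal.ofReal_pos.2 hcp).ne' ENNReal.ofReal_ne_top
      calc _ = ENNReal.ofReal (‖F z‖ ^ 2 * Real.exp (-(φ z).toReal)) * α (-(ψ z).toReal) * 1 := by rw [mul_one]
        _ = _ := by rw [← hi]; ring
    · rw [indicator_of_notMem hz, indicator_of_notMem (fun hh => hz ((hAS z h3 h1).2 hh)), mul_zero]
  rw [e1, key]
  have := setLIntegral_indicator (μ := volume) hS (t := Ioi 0) (fun t =>
      ENNReal.ofReal a * (α t * ENNReal.ofReal (Real.exp (-t))))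
  rw [inter_eq_self_of_subset_left hS0] at this
  rw [← this]
  refine setLIntegral_congr_fun measurableSet_Ioi fun t ht => ?_
  by_cases hz : t ∈ S
  · simp only [indicator_of_mem hz]
    have hcp := hc.pos t ht
    rw [ENNReal.ofReal_mul C.ha, ENNReal.ofReal_mul hcp.le]
    have hi := ENNReal.mul_inv_cancel (ENNReal.ofReal_pos.2 hcp).ne' ENNReal.ofReal_ne_top
    calc _ = ENNReal.ofReal a * (α t * ENNReal.ofReal (Real.exp (-t))) *
          (ENNReal.ofReal (c t) * (ENNReal.ofReal (c t))⁻¹) := by ring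
      _ = _ := by rw [hi, mul_one]
  · simp only [indicator_of_notMem hz, mul_zero]

end

open MeasureTheory Metric Complex Set Filter
open scoped ContDiff Topology
/-- if `G(h⁻¹(r))` is linear on `[0, ∫₀^∞ c(s)e^{-s}ds)` (equivalently,
`G(t)` is an affine function of `h(t)` for `t ∈ (0,∞)`), then there is a unique
holomorphic `F` on `D` computing `G(t)` for all `t ≥ 0`, and
`∫_{{-t₁ ≤ ψ < -t₂}} |F|² e^{-φ} a(-ψ) = (G(0)/∫₀^∞ c e^{-s} ds) ∫_{t₂}^{t₁} a(t)e^{-t} dt`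
for every nonnegative measurable `a` and all `+∞ ≥ t₁ > t₂ ≥ 0`. -/
theorem minimal_L2_linearity_consequences
    (n : ℕ) (D : Set ℂ) (hD : IsRegularRegion n D)
    (ψ φ : ℂ → EReal)
    (hψsh : SubharmonicOnE ψ D) (hψneg : ∀ z ∈ D, ψ z < 0)
    (hφmeas : Measurable φ)
    (hφψ : SubharmonicOnE (fun z => φ z + ψ z) D)
    (z₀ : ℂ) (hz₀ : z₀ ∈ D)
    (hmult : MultIdealNontrivial φ ψ z₀)
    (f : ℂ → ℂ) (hf : AnalyticAt ℂ f z₀)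
    (Fz : (ℂ → ℂ) → Prop) (hFz : IsIdealAt Fz z₀)
    (hFzI : ∀ g : ℂ → ℂ, InMultIdeal φ ψ z₀ g → Fz g)
    (c : ℝ → ℝ) (hc : AdmissibleC' c)
    (Z : Set ℂ) (hZ : DiscreteIn Z D) (hZψ : Z ⊆ {z | ψ z = ⊥})
    (hlb : PosLowerBoundOnCompacts D Z (wgt1 φ ψ c))
    -- linearity of G(h⁻¹(r)) on [0, ∫₀^∞ c(s)e^{-s}ds)
    (hlin : ∃ a b : ℝ, ∀ t : ℝ, 0 < t →
      minL2F D ψ φ c f Fz t = ENNReal.ofReal (a * hFun c t + b)) :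
    ∃ F : ℂ → ℂ, DifferentiableOn ℂ F D ∧ Fz (fun z => F z - f z) ∧
      (∀ t : ℝ, 0 ≤ t →
        minL2F D ψ φ c f Fz t =
          ∫⁻ z in {z | z ∈ D ∧ ψ z < ((-t : ℝ) : EReal)},
            ENNReal.ofReal (‖F z‖ ^ 2 * wgt1 φ ψ c z)) ∧
      (∀ F' : ℂ → ℂ, DifferentiableOn ℂ F' D → Fz (fun z => F' z - f z) →
        (∀ t : ℝ, 0 ≤ t →
          minL2F D ψ φ c f Fz t =
            ∫⁻ z in {z | z ∈ D ∧ ψ z < ((-t : ℝ) : EReal)},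
              ENNReal.ofReal (‖F' z‖ ^ 2 * wgt1 φ ψ c z)) →
        ∀ z ∈ D, F' z = F z) ∧
      (∀ a : ℝ → ENNReal, Measurable a →
        (∀ t₁ t₂ : ℝ, 0 ≤ t₂ → t₂ < t₁ →
          (∫⁻ z in {z | z ∈ D ∧ ((-t₁ : ℝ) : EReal) ≤ ψ z ∧ ψ z < ((-t₂ : ℝ) : EReal)},
              ENNReal.ofReal (‖F z‖ ^ 2 * Real.exp (-(φ z).toReal)) * a ((-(ψ z)).toReal)) =
            minL2F D ψ φ c f Fz 0 / ENNReal.ofReal (cInt c) *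
              ∫⁻ t in Set.Ioc t₂ t₁, a t * ENNReal.ofReal (Real.exp (-t))) ∧
        (∀ t₂ : ℝ, 0 ≤ t₂ →
          (∫⁻ z in {z | z ∈ D ∧ ψ z < ((-t₂ : ℝ) : EReal)},
              ENNReal.ofReal (‖F z‖ ^ 2 * Real.exp (-(φ z).toReal)) * a ((-(ψ z)).toReal)) =
            minL2F D ψ φ c f Fz 0 / ENNReal.ofReal (cInt c) *
              ∫⁻ t in Set.Ioi t₂, a t * ENNReal.ofReal (Real.exp (-t)))) := by
  have hDo := hD.1
  have hDt0 : {z | z ∈ D ∧ ψ z < ((-0 : ℝ) : EReal)} = D := by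
    ext z; exact ⟨fun h => h.1, fun h => ⟨h, by simpa using hψneg z h⟩⟩
  by_cases hfF : Fz f
  · have hadm : ∀ Ω, Adm Ω f Fz (fun _ => 0) := fun Ω =>
      ⟨differentiableOn_const 0, Fz_congr hFz (Fz_mulc hFz hfF (-1)) fun z => by ring⟩
    have hG0 : ∀ t, minL2F D ψ φ c f Fz t = 0 := by
      intro t
      refine le_antisymm ((minL2F_le (hadm _)).trans (le_of_eq ?_)) zero_le
      simp [En]
    refine ⟨fun _ => 0, differentiableOn_const 0, (hadm D).2, fun t _ => ?_, fun F' h1 h2 h3 z hz => ?_,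
      fun a _ => ⟨fun t₁ t₂ _ _ => ?_, fun t₂ _ => ?_⟩⟩
    · rw [hG0]; simp
    · have h4 := h3 0 le_rfl
      rw [hG0, hDt0] at h4
      exact (lbd_of hZ hlb hDo subset_rfl).eq_zero h1 h4.symm z hz
    · rw [hG0]; simp
    · rw [hG0]; simp
  · obtain ⟨a, b, hlin⟩ := hlin
    have C := mk_ctx hD hψsh hψneg hφψ hz₀ hFz hFzI hc hZ hZψ hlb hlin hfF
    obtain ⟨F, hF, hE⟩ := C.main2
    refine ⟨F, hF.1, hF.2, hE, fun F' h1 h2 h3 z hz => ?_, fun α hα => ⟨fun t₁ t₂ h0 h12 => ?_, fun t₂ h0 => ?_⟩⟩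
    · have e1 := hE 0 le_rfl
      rw [C.dt_zero] at e1
      have e2 := h3 0 le_rfl
      rw [hDt0] at e2
      exact C.uniq hF ⟨h1, h2⟩ e1.symm e2.symm z hz
    · have hAeq : {z | z ∈ D ∧ ((-t₁ : ℝ) : EReal) ≤ ψ z ∧ ψ z < ((-t₂ : ℝ) : EReal)} =
          Dt D ψ t₂ \ Dt D ψ t₁ := by
        ext z
        refine ⟨fun h => ⟨⟨h.1, h.2.2⟩, fun h' => absurd h'.2 (not_lt.2 h.2.1)⟩,
          fun h => ⟨h.1.1, not_lt.1 fun h' => h.2 ⟨h.1.1, h'⟩, h.1.2⟩⟩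
      refine fml hc C hF hE hα ?_ (fun z hz => hz.1) measurableSet_Ioc
        (fun t ht => h0.trans_lt ht.1) fun z hz hb => ?_
      · rw [hAeq]; exact (C.dt_open _).measurableSet.diff (C.dt_open _).measurableSet
      · have hr := EReal.coe_toReal (hψsh.2.1 z hz) hb
        constructor
        · rintro ⟨_, h1, h2⟩
          rw [← hr] at h1 h2
          have h1' : -t₁ ≤ (ψ z).toReal := by exact_mod_cast h1
          have h2' : (ψ z).toReal < -t₂ := by exact_mod_cast h2
          exact ⟨by linarith, by linarith⟩
        · rintro ⟨h1, h2⟩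
          refine ⟨hz, ?_, ?_⟩
          · rw [← hr]; exact_mod_cast (by linarith : -t₁ ≤ (ψ z).toReal)
          · rw [← hr]; exact_mod_cast (by linarith : (ψ z).toReal < -t₂)
    · refine fml hc C hF hE hα (C.dt_open t₂).measurableSet (fun z hz => hz.1) measurableSet_Ioi
        (fun t ht => h0.trans_lt ht) fun z hz hb => ?_
      have hr := EReal.coe_toReal (hψsh.2.1 z hz) hb
      constructor
      · rintro ⟨_, h2⟩
        rw [← hr] at h2
        have h2' : (ψ z).toReal < -t₂ := by exact_mod_cast h2
        show t₂ < _
        linarith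
      · intro h1
        have h1' : t₂ < -(ψ z).toReal := h1
        refine ⟨hz, ?_⟩
        rw [← hr]; exact_mod_cast (by linarith : (ψ z).toReal < -t₂)
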